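/- Let 0 < R₁ < R₂ < R, let Γ be a nonempty open subset of the unit sphere S^{d−1}, and let ω = { rθ : R₁ < r < R₂, θ ∈ Γ } be the corresponding section of annulus in B_R. Set T* = R₁²/(2d). Then for every β > 1 there exists c_β > 0 such that for every T > T*, every solution y of the Baouendi–Grushin equation on [0,T] satisfies ∫_{B_R × Ω̃} |y(T,·)|² ≤ exp(2 c_β/(T−T*)^{2β}) ∫₀^T ∫_{ω × Ω̃} |y|², i.e., observability holds with cost K_T ≤ exp(c_β/(T−T*)^{2β}). -/

import Mathlib

open MeasureTheory Metric Set Filter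

/-- The Euclidean Laplacian of `f : ℝ^n → ℝ` at `x`. -/
noncomputable def lapl {n : ℕ} (f : EuclideanSpace ℝ (Fin n) → ℝ)
    (x : EuclideanSpace ℝ (Fin n)) : ℝ :=
  ∑ i, fderiv ℝ (fun z => fderiv ℝ f z (EuclideanSpace.single i 1)) x (EuclideanSpace.single i 1)

/-- `y` is a solution of the Baouendi–Grushin equation on `(0,T) × B_R × Ω̃`. -/
structure IsGrushinSolution (d dt : ℕ) (R T : ℝ) (Ωt : Set (EuclideanSpace ℝ (Fin dt)))
    (y : ℝ → EuclideanSpace ℝ (Fin d) → EuclideanSpace ℝ (Fin dt) → ℝ) : Prop where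
  continuousOn : ContinuousOn
    (fun p : ℝ × (EuclideanSpace ℝ (Fin d) × EuclideanSpace ℝ (Fin dt)) => y p.1 p.2.1 p.2.2)
    (Icc 0 T ×ˢ closure (ball (0 : EuclideanSpace ℝ (Fin d)) R ×ˢ Ωt))
  smoothOn : ContDiffOn ℝ (⊤ : ℕ∞)
    (fun p : ℝ × (EuclideanSpace ℝ (Fin d) × EuclideanSpace ℝ (Fin dt)) => y p.1 p.2.1 p.2.2)
    (Ioo 0 T ×ˢ (ball (0 : EuclideanSpace ℝ (Fin d)) R ×ˢ Ωt))
  eqn : ∀ t ∈ Ioo (0:ℝ) T, ∀ x ∈ ball (0 : EuclideanSpace ℝ (Fin d)) R, ∀ z ∈ Ωt,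
    deriv (fun s => y s x z) t - lapl (fun x' => y t x' z) x
      - ‖x‖ ^ 2 * lapl (fun z' => y t x z') z = 0
  boundary : ∀ t ∈ Ioo (0:ℝ) T,
    ∀ p ∈ frontier (ball (0 : EuclideanSpace ℝ (Fin d)) R ×ˢ Ωt), y t p.1 p.2 = 0

set_option linter.unusedSectionVars false

/-! ### Square-integrable limits -/

section L2

variable {α F : Type*} [MeasurableSpace α] {μ : Measure α} [NormedAddCommGroup F]
  [InnerProductSpace ℝ F]

theorem memLp_two_integrable_inner {f g : α → F} (hf : MemLp f 2 μ) (hg : MemLp g 2 μ) :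
    Integrable (fun x => inner ℝ (f x) (g x)) μ := by
  refine (L2.integrable_inner (𝕜 := ℝ) (hf.toLp f) (hg.toLp g)).congr ?_
  filter_upwards [hf.coeFn_toLp, hg.coeFn_toLp] with x h1 h2
  rw [h1, h2]

theorem memLp_two_integrable_mul {f g : α → ℝ} (hf : MemLp f 2 μ) (hg : MemLp g 2 μ) :
    Integrable (fun x => f x * g x) μ := hf.integrable_mul hg

theorem memLp_two_integrable_norm_sq {f : α → F} (hf : MemLp f 2 μ) :
    Integrable (fun x => ‖f x‖ ^ 2) μ := by
  simpa only [real_inner_self_eq_norm_sq] using memLp_two_integrable_inner hf hf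

theorem inner_toLp {f g : α → F} (hf : MemLp f 2 μ) (hg : MemLp g 2 μ) :
    inner ℝ (hf.toLp f) (hg.toLp g) = ∫ x, inner ℝ (f x) (g x) ∂μ := by
  rw [L2.inner_def]
  refine integral_congr_ae ?_
  filter_upwards [hf.coeFn_toLp, hg.coeFn_toLp] with x h1 h2
  rw [h1, h2]

theorem abs_integral_inner_le {f g : α → F} (hf : MemLp f 2 μ) (hg : MemLp g 2 μ) :
    (∫ x, inner ℝ (f x) (g x) ∂μ) ^ 2 ≤ (∫ x, ‖f x‖ ^ 2 ∂μ) * ∫ x, ‖g x‖ ^ 2 ∂μ := by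
  have h := real_inner_mul_inner_self_le (hf.toLp f) (hg.toLp g)
  simp only [inner_toLp] at h
  simpa only [sq, real_inner_self_eq_norm_sq] using h

/-- `f k → f` in `L²`. -/
structure L2Lim (μ : Measure α) (f : ℕ → α → F) (g : α → F) : Prop where
  mem : ∀ k, MemLp (f k) 2 μ
  memLim : MemLp g 2 μ
  lim : Tendsto (fun k => eLpNorm (f k - g) 2 μ) atTop (nhds 0)

theorem L2Lim.tendsto_toLp {f : ℕ → α → F} {g : α → F} (h : L2Lim μ f g) :
    Tendsto (fun k => (h.mem k).toLp (f k)) atTop (nhds (h.memLim.toLp g)) :=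
  (Lp.tendsto_Lp_iff_tendsto_eLpNorm'' f h.mem g h.memLim).2 h.lim

theorem L2Lim.const {g : α → F} (h : MemLp g 2 μ) : L2Lim μ (fun _ => g) g :=
  ⟨fun _ => h, h, by simp⟩

theorem L2Lim.tendsto_inner {f g : ℕ → α → F} {f' g' : α → F} (hf : L2Lim μ f f') (hg : L2Lim μ g g') :
    Tendsto (fun k => ∫ x, inner ℝ (f k x) (g k x) ∂μ) atTop
      (nhds (∫ x, inner ℝ (f' x) (g' x) ∂μ)) := by
  have := Filter.Tendsto.inner (𝕜 := ℝ) hf.tendsto_toLp hg.tendsto_toLp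
  simpa only [inner_toLp] using this

theorem L2Lim.tendsto_mul {f g : ℕ → α → ℝ} {f' g' : α → ℝ} (hf : L2Lim μ f f') (hg : L2Lim μ g g') :
    Tendsto (fun k => ∫ x, f k x * g k x ∂μ) atTop (nhds (∫ x, f' x * g' x ∂μ)) := by
  have := hg.tendsto_inner hf
  simpa only [RCLike.inner_apply, conj_trivial] using this

theorem L2Lim.tendsto_norm_sq {f : ℕ → α → F} {f' : α → F} (hf : L2Lim μ f f') :
    Tendsto (fun k => ∫ x, ‖f k x‖ ^ 2 ∂μ) atTop (nhds (∫ x, ‖f' x‖ ^ 2 ∂μ)) := by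
  simpa only [real_inner_self_eq_norm_sq] using hf.tendsto_inner hf

theorem L2Lim.of_le {G : Type*} [NormedAddCommGroup G] [InnerProductSpace ℝ G]
    {f : ℕ → α → F} {f' : α → F} (hf : L2Lim μ f f') {g : ℕ → α → G} {g' : α → G}
    (hg : ∀ k, MemLp (g k) 2 μ) (hg' : MemLp g' 2 μ) (C : ℝ)
    (h : ∀ k x, ‖g k x - g' x‖ ≤ C * ‖f k x - f' x‖) : L2Lim μ g g' := by
  refine ⟨hg, hg', ?_⟩
  have h1 : ∀ k, eLpNorm (g k - g') 2 μ ≤ ENNReal.ofReal C * eLpNorm (f k - f') 2 μ := fun k =>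
    eLpNorm_le_mul_eLpNorm_of_ae_le_mul (Eventually.of_forall fun x => h k x) 2
  have h2 : Tendsto (fun k => ENNReal.ofReal C * eLpNorm (f k - f') 2 μ) atTop (nhds 0) := by
    simpa using ENNReal.Tendsto.const_mul hf.lim (Or.inr ENNReal.ofReal_ne_top)
  exact tendsto_of_tendsto_of_tendsto_of_le_of_le tendsto_const_nhds h2 (fun _ => bot_le) h1

theorem L2Lim.add {f g : ℕ → α → F} {f' g' : α → F} (hf : L2Lim μ f f') (hg : L2Lim μ g g') :
    L2Lim μ (fun k x => f k x + g k x) (fun x => f' x + g' x) := by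
  refine ⟨fun k => (hf.mem k).add (hg.mem k), hf.memLim.add hg.memLim, ?_⟩
  have h1 : ∀ k, eLpNorm ((fun x => f k x + g k x) - fun x => f' x + g' x) 2 μ ≤
      eLpNorm (f k - f') 2 μ + eLpNorm (g k - g') 2 μ := fun k => by
    have : ((fun x => f k x + g k x) - fun x => f' x + g' x) = (f k - f') + (g k - g') := by
      funext x; simp only [Pi.sub_apply, Pi.add_apply]; abel
    rw [this]
    exact eLpNorm_add_le ((hf.mem k).sub hf.memLim).1 ((hg.mem k).sub hg.memLim).1 (by norm_num)
  have h2 := hf.lim.add hg.lim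
  rw [add_zero] at h2
  exact tendsto_of_tendsto_of_tendsto_of_le_of_le tendsto_const_nhds h2 (fun _ => bot_le) h1

theorem L2Lim.const_smul {f : ℕ → α → F} {f' : α → F} (hf : L2Lim μ f f') (c : ℝ) :
    L2Lim μ (fun k x => c • f k x) (fun x => c • f' x) :=
  hf.of_le (fun k => (hf.mem k).const_smul c) (hf.memLim.const_smul c) |c| fun k x => by
    rw [← smul_sub, norm_smul, Real.norm_eq_abs]

end L2

/-! ### Functions supported in a bounded set, multiplied by continuous weights -/

/-- The Euclidean space of dimension `m`. -/
abbrev Euc (m : ℕ) := EuclideanSpace ℝ (Fin m)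

/-- Square-integrable functions vanishing off `D`. -/
structure Good {m : ℕ} {F : Type*} [NormedAddCommGroup F] (D : Set (Euc m)) (f : Euc m → F) :
    Prop where
  mem : MemLp f 2 volume
  zero : ∀ x ∉ D, f x = 0

section Good

variable {m : ℕ} {D : Set (Euc m)} {F : Type*} [NormedAddCommGroup F] [InnerProductSpace ℝ F]

theorem exists_bound_of_isBounded {G : Type*} [NormedAddCommGroup G] (hD : Bornology.IsBounded D)
    {b : Euc m → G} (hb : Continuous b) : ∃ C, 0 ≤ C ∧ ∀ x ∈ D, ‖b x‖ ≤ C := by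
  obtain ⟨C, hC⟩ := (hD.isCompact_closure).exists_bound_of_continuousOn hb.continuousOn
  exact ⟨max C 0, le_max_right _ _, fun x hx => (hC x (subset_closure hx)).trans (le_max_left _ _)⟩

theorem Good.smul (hD : Bornology.IsBounded D) {f : Euc m → F} (hf : Good D f) {b : Euc m → ℝ}
    (hb : Continuous b) : Good D (fun x => b x • f x) := by
  obtain ⟨C, hC0, hC⟩ := exists_bound_of_isBounded hD hb
  refine ⟨hf.mem.of_le_mul (c := C) (hb.aestronglyMeasurable.smul hf.mem.1)
    (Eventually.of_forall fun x => ?_), fun x hx => by rw [hf.zero x hx, smul_zero]⟩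
  by_cases hx : x ∈ D
  · rw [norm_smul]; exact mul_le_mul_of_nonneg_right (hC x hx) (norm_nonneg _)
  · simp [hf.zero x hx]

theorem Good.mul (hD : Bornology.IsBounded D) {f : Euc m → ℝ} (hf : Good D f) {b : Euc m → ℝ}
    (hb : Continuous b) : Good D (fun x => b x * f x) := hf.smul hD hb

theorem Good.smul_vec (hD : Bornology.IsBounded D) {f : Euc m → ℝ} (hf : Good D f)
    {b : Euc m → F} (hb : Continuous b) : Good D (fun x => f x • b x) := by
  obtain ⟨C, hC0, hC⟩ := exists_bound_of_isBounded hD hb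
  refine ⟨hf.mem.of_le_mul (c := C) (hf.mem.1.smul hb.aestronglyMeasurable)
    (Eventually.of_forall fun x => ?_), fun x hx => by rw [hf.zero x hx, zero_smul]⟩
  by_cases hx : x ∈ D
  · rw [norm_smul, mul_comm]; exact mul_le_mul_of_nonneg_right (hC x hx) (norm_nonneg _)
  · simp [hf.zero x hx]

theorem Good.inner_vec (hD : Bornology.IsBounded D) {f : Euc m → F} (hf : Good D f)
    {b : Euc m → F} (hb : Continuous b) : Good D (fun x => inner ℝ (b x) (f x)) := by
  obtain ⟨C, hC0, hC⟩ := exists_bound_of_isBounded hD hb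
  refine ⟨hf.mem.of_le_mul (c := C) (hb.aestronglyMeasurable.inner hf.mem.1)
    (Eventually.of_forall fun x => ?_), fun x hx => by rw [hf.zero x hx, inner_zero_right]⟩
  by_cases hx : x ∈ D
  · exact (norm_inner_le_norm _ _).trans (mul_le_mul_of_nonneg_right (hC x hx) (norm_nonneg _))
  · simp [hf.zero x hx]

theorem Good.add {f g : Euc m → F} (hf : Good D f) (hg : Good D g) :
    Good D (fun x => f x + g x) :=
  ⟨hf.mem.add hg.mem, fun x hx => by rw [hf.zero x hx, hg.zero x hx, add_zero]⟩

theorem Good.sub {f g : Euc m → F} (hf : Good D f) (hg : Good D g) :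
    Good D (fun x => f x - g x) :=
  ⟨hf.mem.sub hg.mem, fun x hx => by rw [hf.zero x hx, hg.zero x hx, sub_zero]⟩

theorem Good.const_smul {f : Euc m → F} (hf : Good D f) (c : ℝ) : Good D (fun x => c • f x) :=
  ⟨hf.mem.const_smul c, fun x hx => by rw [hf.zero x hx, smul_zero]⟩

theorem Good.zero_fun : Good D (fun _ : Euc m => (0 : F)) := ⟨MemLp.zero, fun _ _ => rfl⟩

theorem Good.sum {ι : Type*} (s : Finset ι) {f : ι → Euc m → F} (hf : ∀ i ∈ s, Good D (f i)) :
    Good D (fun x => ∑ i ∈ s, f i x) :=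
  ⟨memLp_finsetSum s fun i hi => (hf i hi).mem,
    fun x hx => Finset.sum_eq_zero fun i hi => (hf i hi).zero x hx⟩

theorem Good.int_mul {f g : Euc m → ℝ} (hf : Good D f) (hg : Good D g) :
    Integrable (fun x => f x * g x) := memLp_two_integrable_mul hf.mem hg.mem

theorem Good.int_inner {f g : Euc m → F} (hf : Good D f) (hg : Good D g) :
    Integrable (fun x => inner ℝ (f x) (g x)) := memLp_two_integrable_inner hf.mem hg.mem

theorem Good.int_mulw (hD : Bornology.IsBounded D) {f g : Euc m → ℝ} (hf : Good D f)
    (hg : Good D g) {b : Euc m → ℝ} (hb : Continuous b) :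
    Integrable (fun x => f x * g x * b x) := by
  have := (hf.mul hD hb).int_mul hg
  exact this.congr (Eventually.of_forall fun x => by ring)

theorem Good.int_innerw (hD : Bornology.IsBounded D) {f g : Euc m → F} (hf : Good D f)
    (hg : Good D g) {b : Euc m → ℝ} (hb : Continuous b) :
    Integrable (fun x => inner ℝ (f x) (g x) * b x) := by
  have := (hf.smul hD hb).int_inner hg
  refine this.congr (Eventually.of_forall fun x => ?_)
  simp only [real_inner_smul_left]; ring

theorem Good.int_sqw (hD : Bornology.IsBounded D) {f : Euc m → ℝ} (hf : Good D f)
    {b : Euc m → ℝ} (hb : Continuous b) : Integrable (fun x => f x ^ 2 * b x) := by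
  simpa only [sq] using hf.int_mulw hD hf hb

theorem Good.int_nsqw (hD : Bornology.IsBounded D) {f : Euc m → F} (hf : Good D f)
    {b : Euc m → ℝ} (hb : Continuous b) : Integrable (fun x => ‖f x‖ ^ 2 * b x) := by
  simpa only [real_inner_self_eq_norm_sq] using hf.int_innerw hD hf hb

theorem Good.int_sq {f : Euc m → ℝ} (hf : Good D f) : Integrable (fun x => f x ^ 2) := by
  simpa only [sq] using hf.int_mul hf

theorem Good.int_nsq {f : Euc m → F} (hf : Good D f) : Integrable (fun x => ‖f x‖ ^ 2) := by
  simpa only [real_inner_self_eq_norm_sq] using hf.int_inner hf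

theorem L2Lim.smul_cont (hD : Bornology.IsBounded D) {f : ℕ → Euc m → F} {f' : Euc m → F}
    (hf : L2Lim volume f f') (hz : ∀ k, ∀ x ∉ D, f k x = 0) (hz' : ∀ x ∉ D, f' x = 0)
    {b : Euc m → ℝ} (hb : Continuous b) :
    L2Lim volume (fun k x => b x • f k x) (fun x => b x • f' x) := by
  obtain ⟨C, hC0, hC⟩ := exists_bound_of_isBounded hD hb
  refine hf.of_le (fun k => (Good.smul hD ⟨hf.mem k, hz k⟩ hb).mem)
    (Good.smul hD ⟨hf.memLim, hz'⟩ hb).mem C fun k x => ?_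
  by_cases hx : x ∈ D
  · rw [← smul_sub, norm_smul]; exact mul_le_mul_of_nonneg_right (hC x hx) (norm_nonneg _)
  · simp [hz k x hx, hz' x hx]

theorem L2Lim.smul_vec (hD : Bornology.IsBounded D) {f : ℕ → Euc m → ℝ} {f' : Euc m → ℝ}
    (hf : L2Lim volume f f') (hz : ∀ k, ∀ x ∉ D, f k x = 0) (hz' : ∀ x ∉ D, f' x = 0)
    {b : Euc m → F} (hb : Continuous b) :
    L2Lim volume (fun k x => f k x • b x) (fun x => f' x • b x) := by
  obtain ⟨C, hC0, hC⟩ := exists_bound_of_isBounded hD hb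
  refine hf.of_le (fun k => (Good.smul_vec hD ⟨hf.mem k, hz k⟩ hb).mem)
    (Good.smul_vec hD ⟨hf.memLim, hz'⟩ hb).mem C fun k x => ?_
  by_cases hx : x ∈ D
  · rw [← sub_smul, norm_smul, mul_comm]
    exact mul_le_mul_of_nonneg_right (hC x hx) (norm_nonneg _)
  · simp [hz k x hx, hz' x hx]

theorem L2Lim.inner_vec (hD : Bornology.IsBounded D) {f : ℕ → Euc m → F} {f' : Euc m → F}
    (hf : L2Lim volume f f') (hz : ∀ k, ∀ x ∉ D, f k x = 0) (hz' : ∀ x ∉ D, f' x = 0)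
    {b : Euc m → F} (hb : Continuous b) :
    L2Lim volume (fun k x => inner ℝ (b x) (f k x)) (fun x => inner ℝ (b x) (f' x)) := by
  obtain ⟨C, hC0, hC⟩ := exists_bound_of_isBounded hD hb
  refine hf.of_le (fun k => (Good.inner_vec hD ⟨hf.mem k, hz k⟩ hb).mem)
    (Good.inner_vec hD ⟨hf.memLim, hz'⟩ hb).mem C fun k x => ?_
  by_cases hx : x ∈ D
  · rw [← inner_sub_right]
    exact (norm_inner_le_norm _ _).trans (mul_le_mul_of_nonneg_right (hC x hx) (norm_nonneg _))
  · simp [hz k x hx, hz' x hx]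

end Good

/-! ### Test functions and integration by parts -/

/-- Smooth functions compactly supported in `D`. -/
structure IsTest {m : ℕ} (D : Set (Euc m)) (φ : Euc m → ℝ) : Prop where
  contDiff : ContDiff ℝ (⊤ : ℕ∞) φ
  compact : HasCompactSupport φ
  sub : tsupport φ ⊆ D

section Test

variable {m : ℕ} {D : Set (Euc m)}

theorem contDiff_gradient {φ : Euc m → ℝ} (h : ContDiff ℝ (⊤ : ℕ∞) φ) :
    ContDiff ℝ (⊤ : ℕ∞) (gradient φ) := by
  have h1 : ContDiff ℝ (⊤ : ℕ∞) (fderiv ℝ φ) := h.fderiv_right (by simp)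
  exact ((InnerProductSpace.toDual ℝ (Euc m)).symm.toContinuousLinearEquiv.contDiff).comp h1

theorem gradient_apply {φ : Euc m → ℝ} (x v : Euc m) :
    inner ℝ (gradient φ x) v = fderiv ℝ φ x v := by
  simp [gradient]

theorem gradient_eq_zero_of_notMem {φ : Euc m → ℝ} {x : Euc m} (hx : x ∉ tsupport φ) :
    gradient φ x = 0 := by
  have : fderiv ℝ φ x = 0 := by
    by_contra h
    exact hx (support_fderiv_subset ℝ h)
  simp [gradient, this]

theorem hasCompactSupport_gradient {φ : Euc m → ℝ} (h : HasCompactSupport φ) :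
    HasCompactSupport (gradient φ) :=
  HasCompactSupport.intro h fun _ hx => gradient_eq_zero_of_notMem hx

theorem gradient_mul {f g : Euc m → ℝ} {x : Euc m} (hf : DifferentiableAt ℝ f x)
    (hg : DifferentiableAt ℝ g x) :
    gradient (fun x => f x * g x) x = f x • gradient g x + g x • gradient f x := by
  simp only [gradient]
  rw [fderiv_fun_mul hf hg]
  simp

theorem gradient_add {f g : Euc m → ℝ} {x : Euc m} (hf : DifferentiableAt ℝ f x)
    (hg : DifferentiableAt ℝ g x) :
    gradient (fun x => f x + g x) x = gradient f x + gradient g x := by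
  simp only [gradient]
  rw [fderiv_fun_add hf hg]
  simp

theorem gradient_const_smul {f : Euc m → ℝ} {x : Euc m} (hf : DifferentiableAt ℝ f x) (c : ℝ) :
    gradient (fun x => c * f x) x = c • gradient f x := by
  simp only [gradient]
  rw [fderiv_const_mul hf]
  simp

theorem gradient_coord (φ : Euc m → ℝ) (x : Euc m) (i : Fin m) :
    gradient φ x i = fderiv ℝ φ x (EuclideanSpace.single i 1) := by
  rw [← gradient_apply, EuclideanSpace.inner_single_right]; simp

theorem sum_coord_single (w : Euc m) : ∑ i, w i • EuclideanSpace.single i (1 : ℝ) = w := by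
  ext j
  simp [EuclideanSpace.single, Pi.single_apply]

theorem inner_eq_sum (v w : Euc m) : inner ℝ v w = ∑ i, v i * w i := by
  simp [PiLp.inner_apply, mul_comm]

theorem IsTest.good {φ : Euc m → ℝ} (h : IsTest D φ) : Good D φ :=
  ⟨h.contDiff.continuous.memLp_of_hasCompactSupport h.compact,
    fun _ hx => image_eq_zero_of_notMem_tsupport fun hx' => hx (h.sub hx')⟩

theorem IsTest.good_gradient {φ : Euc m → ℝ} (h : IsTest D φ) : Good D (gradient φ) :=
  ⟨(contDiff_gradient h.contDiff).continuous.memLp_of_hasCompactSupport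
    (hasCompactSupport_gradient h.compact),
    fun _ hx => gradient_eq_zero_of_notMem fun hx' => hx (h.sub hx')⟩

theorem IsTest.mul_left {φ η : Euc m → ℝ} (h : IsTest D φ) (hη : ContDiff ℝ (⊤ : ℕ∞) η) :
    IsTest D (fun x => η x * φ x) :=
  ⟨hη.mul h.contDiff, h.compact.mul_left, (tsupport_mul_subset_right).trans h.sub⟩

theorem IsTest.add {φ ψ : Euc m → ℝ} (h : IsTest D φ) (h' : IsTest D ψ) :
    IsTest D (fun x => φ x + ψ x) :=
  ⟨h.contDiff.add h'.contDiff, h.compact.add h'.compact,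
    (tsupport_add φ ψ).trans (union_subset h.sub h'.sub)⟩

theorem IsTest.zero : IsTest D (fun _ => (0 : ℝ)) :=
  ⟨contDiff_const, HasCompactSupport.zero, by
    have : tsupport (fun _ : Euc m => (0 : ℝ)) = ∅ := by
      rw [tsupport_eq_empty_iff]; rfl
    rw [this]; exact empty_subset _⟩

theorem integral_fderiv_eq_zero_of_compact {f : Euc m → ℝ} (hf : ContDiff ℝ 1 f)
    (hc : HasCompactSupport f) (v : Euc m) : ∫ x, fderiv ℝ f x v = 0 := by
  have hi : Integrable (fun x => fderiv ℝ f x v) :=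
    ((hf.continuous_fderiv one_ne_zero).clm_apply continuous_const).integrable_of_hasCompactSupport
      (hc.fderiv_apply ℝ v)
  have := integral_mul_fderiv_eq_neg_fderiv_mul_of_integrable (μ := (volume : Measure (Euc m)))
    (f := fun _ => (1 : ℝ)) (g := f) (v := v) (by simp) (by simpa using hi)
    (by simpa using hf.continuous.integrable_of_hasCompactSupport hc)
    (fun x _ => differentiableAt_const _) (fun x _ => (hf.differentiable one_ne_zero) x)
  simpa using this

theorem integrable_fderiv_of_compact {f : Euc m → ℝ} (hf : ContDiff ℝ 1 f)
    (hc : HasCompactSupport f) (v : Euc m) : Integrable (fun x => fderiv ℝ f x v) :=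
  ((hf.continuous_fderiv one_ne_zero).clm_apply continuous_const).integrable_of_hasCompactSupport
      (hc.fderiv_apply ℝ v)

theorem hasFDerivAt_coord_sub (x0 x : Euc m) (i : Fin m) :
    HasFDerivAt (fun x : Euc m => (x - x0) i) (EuclideanSpace.proj i : Euc m →L[ℝ] ℝ) x := by
  have h := (EuclideanSpace.proj i : Euc m →L[ℝ] ℝ).hasFDerivAt (x := x)
  exact h.sub_const (x0 i)

/-- The radial integration by parts formula for test functions. -/
theorem IsTest.integral_radial {φ η : Euc m → ℝ} (h : IsTest D φ) (hη : ContDiff ℝ (⊤ : ℕ∞) η)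
    (x0 : Euc m) :
    ∫ x, (2 * φ x * inner ℝ (x - x0) (gradient φ x) * η x
      + φ x ^ 2 * (m * η x + inner ℝ (x - x0) (gradient η x))) = 0 := by
  set F : Fin m → Euc m → ℝ := fun i x => φ x * φ x * (η x * (x - x0) i) with hF
  have hc1 : ∀ i : Fin m, ContDiff ℝ (⊤ : ℕ∞) (fun x : Euc m => (x - x0) i) := fun i =>
    ((EuclideanSpace.proj i : Euc m →L[ℝ] ℝ).contDiff).comp (contDiff_id.sub contDiff_const)
  have hFc : ∀ i, ContDiff ℝ 1 (F i) := fun i =>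
    ((h.contDiff.mul h.contDiff).mul (hη.mul (hc1 i))).of_le (by simp)
  have hFs : ∀ i, HasCompactSupport (F i) := fun i =>
    (h.compact.mul_left (f := φ)).mul_right
  have hsum : ∀ x, (2 * φ x * inner ℝ (x - x0) (gradient φ x) * η x
      + φ x ^ 2 * (m * η x + inner ℝ (x - x0) (gradient η x)))
      = ∑ i, fderiv ℝ (F i) x (EuclideanSpace.single i 1) := by
    intro x
    have hφ : HasFDerivAt φ (fderiv ℝ φ x) x :=
      (h.contDiff.differentiable (by simp) x).hasFDerivAt
    have hη' : HasFDerivAt η (fderiv ℝ η x) x := (hη.differentiable (by simp) x).hasFDerivAt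
    have hd : ∀ i, fderiv ℝ (F i) x (EuclideanSpace.single i 1)
        = 2 * φ x * ((x - x0) i * gradient φ x i) * η x
          + φ x ^ 2 * (η x + (x - x0) i * gradient η x i) := by
      intro i
      have := (hφ.mul hφ).mul (hη'.mul (hasFDerivAt_coord_sub x0 x i))
      rw [HasFDerivAt.fderiv (f := F i) this, gradient_coord, gradient_coord]
      simp
      ring
    simp only [hd, inner_eq_sum, Finset.sum_add_distrib, ← Finset.mul_sum, ← Finset.sum_mul]
    simp
  simp_rw [hsum]
  rw [integral_finsetSum _ fun i _ => integrable_fderiv_of_compact (hFc i) (hFs i) _]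
  exact Finset.sum_eq_zero fun i _ => integral_fderiv_eq_zero_of_compact (hFc i) (hFs i) _

theorem contDiff_partial {ζ : Euc m → ℝ} (hζ : ContDiff ℝ (⊤ : ℕ∞) ζ) (v : Euc m) :
    ContDiff ℝ (⊤ : ℕ∞) (fun z => fderiv ℝ ζ z v) :=
  (hζ.fderiv_right (m := ((⊤ : ℕ∞) : WithTop ℕ∞)) (by simp)).clm_apply contDiff_const

theorem continuous_lapl {ζ : Euc m → ℝ} (hζ : ContDiff ℝ (⊤ : ℕ∞) ζ) : Continuous (lapl ζ) := by
  unfold lapl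
  refine continuous_finsetSum _ fun i _ => ?_
  exact (contDiff_partial (contDiff_partial hζ _) _).continuous

theorem IsTest.good_lapl {ζ : Euc m → ℝ} (h : IsTest D ζ) : Good D (lapl ζ) := by
  have hz : ∀ x ∉ tsupport ζ, lapl ζ x = 0 := by
    intro x hx
    refine Finset.sum_eq_zero fun i _ => ?_
    have h1 : x ∉ tsupport fun z => fderiv ℝ ζ z (EuclideanSpace.single i (1 : ℝ)) :=
      fun hx' => hx (tsupport_fderiv_apply_subset ℝ _ hx')
    by_contra hne
    refine h1 (support_fderiv_subset ℝ fun h0 => hne ?_)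
    rw [h0]; rfl
  exact ⟨(continuous_lapl h.contDiff).memLp_of_hasCompactSupport
    (HasCompactSupport.intro h.compact hz), fun x hx => hz x fun hx' => hx (h.sub hx')⟩

/-- Green's formula with a test function. -/
theorem IsTest.integral_green {φ ζ : Euc m → ℝ} (h : IsTest D φ) (hζ : ContDiff ℝ (⊤ : ℕ∞) ζ) :
    ∫ x, (inner ℝ (gradient φ x) (gradient ζ x) + φ x * lapl ζ x) = 0 := by
  set F : Fin m → Euc m → ℝ := fun i x =>
    φ x * fderiv ℝ ζ x (EuclideanSpace.single i 1) with hF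
  have hFc : ∀ i, ContDiff ℝ 1 (F i) := fun i =>
    (h.contDiff.mul (contDiff_partial hζ _)).of_le (by simp)
  have hFs : ∀ i, HasCompactSupport (F i) := fun i => h.compact.mul_right
  have hsum : ∀ x, inner ℝ (gradient φ x) (gradient ζ x) + φ x * lapl ζ x
      = ∑ i, fderiv ℝ (F i) x (EuclideanSpace.single i 1) := by
    intro x
    have hd : ∀ i, fderiv ℝ (F i) x (EuclideanSpace.single i 1)
        = gradient φ x i * gradient ζ x i + φ x *
          fderiv ℝ (fun z => fderiv ℝ ζ z (EuclideanSpace.single i 1)) x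
            (EuclideanSpace.single i 1) := by
      intro i
      simp only [hF]
      rw [fderiv_fun_mul (h.contDiff.differentiable (by simp) x)
        ((contDiff_partial hζ _).differentiable (by simp) x), gradient_coord, gradient_coord]
      simp
      ring
    simp only [hd, inner_eq_sum, Finset.sum_add_distrib, ← Finset.mul_sum, lapl]
  simp_rw [hsum]
  rw [integral_finsetSum _ fun i _ => integrable_fderiv_of_compact (hFc i) (hFs i) _]
  exact Finset.sum_eq_zero fun i _ => integral_fderiv_eq_zero_of_compact (hFc i) (hFs i) _

end Test

/-! ### Functions of class `H¹₀` -/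

/-- `u` is in `H¹₀(D)`, with weak gradient `g`. -/
structure H10 {m : ℕ} (D : Set (Euc m)) (u : Euc m → ℝ) (g : Euc m → Euc m) : Prop where
  zu : ∀ x ∉ D, u x = 0
  zg : ∀ x ∉ D, g x = 0
  approx : ∃ φ : ℕ → Euc m → ℝ, (∀ k, IsTest D (φ k)) ∧ L2Lim volume φ u ∧
    L2Lim volume (fun k => gradient (φ k)) g

/-- `-Δu + c²‖x‖²u = h` weakly in `D`, with `u ∈ H¹₀(D)` of weak gradient `g`. -/
structure IsWeak {m : ℕ} (D : Set (Euc m)) (c : ℝ) (u : Euc m → ℝ) (g : Euc m → Euc m)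
    (h : Euc m → ℝ) : Prop where
  h10 : H10 D u g
  good_h : Good D h
  weak : ∀ φ, IsTest D φ → (∫ x, inner ℝ (g x) (gradient φ x))
    + ∫ x, u x * φ x * (c ^ 2 * ‖x‖ ^ 2) = ∫ x, h x * φ x

section H10

variable {m : ℕ} {D : Set (Euc m)}

theorem H10.good {u : Euc m → ℝ} {g : Euc m → Euc m} (h : H10 D u g) : Good D u :=
  ⟨by obtain ⟨φ, -, h2, -⟩ := h.approx; exact h2.memLim, h.zu⟩

theorem H10.good_grad {u : Euc m → ℝ} {g : Euc m → Euc m} (h : H10 D u g) : Good D g :=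
  ⟨by obtain ⟨φ, -, -, h2⟩ := h.approx; exact h2.memLim, h.zg⟩

theorem IsTest.h10 {φ : Euc m → ℝ} (h : IsTest D φ) : H10 D φ (gradient φ) :=
  ⟨h.good.zero, h.good_gradient.zero, fun _ => φ, fun _ => h, L2Lim.const h.good.mem,
    L2Lim.const h.good_gradient.mem⟩

theorem H10.add {u u' : Euc m → ℝ} {g g' : Euc m → Euc m} (h : H10 D u g) (h' : H10 D u' g') :
    H10 D (fun x => u x + u' x) (fun x => g x + g' x) := by
  obtain ⟨φ, h1, h2, h3⟩ := h.approx
  obtain ⟨φ', h1', h2', h3'⟩ := h'.approx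
  refine ⟨(h.good.add h'.good).zero, (h.good_grad.add h'.good_grad).zero,
    fun k x => φ k x + φ' k x, fun k => (h1 k).add (h1' k), h2.add h2', ?_⟩
  have : (fun k => gradient fun x => φ k x + φ' k x) =
      fun k x => gradient (φ k) x + gradient (φ' k) x := by
    funext k x
    exact gradient_add ((h1 k).contDiff.differentiable (by simp) x)
      ((h1' k).contDiff.differentiable (by simp) x)
  rw [this]; exact h3.add h3'

theorem H10.mul_smooth (hD : Bornology.IsBounded D) {u : Euc m → ℝ} {g : Euc m → Euc m}
    (h : H10 D u g) {η : Euc m → ℝ} (hη : ContDiff ℝ (⊤ : ℕ∞) η) :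
    H10 D (fun x => η x * u x) (fun x => η x • g x + u x • gradient η x) := by
  obtain ⟨φ, h1, h2, h3⟩ := h.approx
  have hg := (contDiff_gradient hη).continuous
  refine ⟨(h.good.mul hD hη.continuous).zero,
    ((h.good_grad.smul hD hη.continuous).add (h.good.smul_vec hD hg)).zero,
    fun k x => η x * φ k x, fun k => (h1 k).mul_left hη,
    h2.smul_cont hD (fun k => (h1 k).good.zero) h.zu hη.continuous, ?_⟩
  have : (fun k => gradient fun x => η x * φ k x) =
      fun k x => η x • gradient (φ k) x + φ k x • gradient η x := by
    funext k x
    exact gradient_mul (hη.differentiable (by simp) x)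
      ((h1 k).contDiff.differentiable (by simp) x)
  rw [this]
  exact (h3.smul_cont hD (fun k => (h1 k).good_gradient.zero) h.zg hη.continuous).add
    (h2.smul_vec hD (fun k => (h1 k).good.zero) h.zu hg)

theorem H10.const_mul {u : Euc m → ℝ} {g : Euc m → Euc m}
    (h : H10 D u g) (a : ℝ) : H10 D (fun x => a * u x) (fun x => a • g x) := by
  obtain ⟨φ, h1, h2, h3⟩ := h.approx
  refine ⟨(h.good.const_smul a).zero, (h.good_grad.const_smul a).zero,
    fun k x => a * φ k x, fun k => (h1 k).mul_left contDiff_const, h2.const_smul a, ?_⟩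
  have : (fun k => gradient fun x => a * φ k x) = fun k x => a • gradient (φ k) x := by
    funext k x
    exact gradient_const_smul ((h1 k).contDiff.differentiable (by simp) x) a
  rw [this]; exact h3.const_smul a

theorem H10.zero : H10 D (fun _ => 0) (fun _ => (0 : Euc m)) := by
  have := (IsTest.zero (D := D)).h10
  have h0 : gradient (fun _ : Euc m => (0 : ℝ)) = fun _ => 0 := by
    funext x; simp [gradient]
  rwa [h0] at this

theorem H10.sum {ι : Type*} (s : Finset ι) {u : ι → Euc m → ℝ} {g : ι → Euc m → Euc m}
    (h : ∀ i ∈ s, H10 D (u i) (g i)) :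
    H10 D (fun x => ∑ i ∈ s, u i x) (fun x => ∑ i ∈ s, g i x) := by
  classical
  induction s using Finset.induction_on with
  | empty => simpa using H10.zero
  | insert a s ha ih =>
    simp only [Finset.sum_insert ha]
    exact (h a (by simp)).add (ih fun i hi => h i (by simp [hi]))

/-- The radial integration by parts formula. -/
theorem H10.integral_radial (hD : Bornology.IsBounded D) {u : Euc m → ℝ} {g : Euc m → Euc m}
    (h : H10 D u g) {η : Euc m → ℝ} (hη : ContDiff ℝ (⊤ : ℕ∞) η) (x0 : Euc m) :
    2 * ∫ x, u x * inner ℝ (x - x0) (g x) * η x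
      = - ∫ x, u x ^ 2 * (m * η x + inner ℝ (x - x0) (gradient η x)) := by
  obtain ⟨φ, h1, h2, h3⟩ := h.approx
  have hX : Continuous fun x : Euc m => x - x0 := by fun_prop
  have hη' := hη.continuous
  have hw : Continuous fun x => m * η x + inner ℝ (x - x0) (gradient η x) :=
    (continuous_const.mul hη').add (hX.inner (contDiff_gradient hη).continuous)
  have key : ∀ k, 2 * ∫ x, φ k x * (η x * inner ℝ (x - x0) (gradient (φ k) x))
      = - ∫ x, φ k x * ((m * η x + inner ℝ (x - x0) (gradient η x)) * φ k x) := by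
    intro k
    have hk := (h1 k).integral_radial hη x0
    have i1 : Integrable fun x => φ k x * (η x * inner ℝ (x - x0) (gradient (φ k) x)) :=
      (h1 k).good.int_mul (((h1 k).good_gradient.inner_vec hD hX).mul hD hη')
    have i2 : Integrable fun x =>
        φ k x * ((m * η x + inner ℝ (x - x0) (gradient η x)) * φ k x) :=
      (h1 k).good.int_mul ((h1 k).good.mul hD hw)
    have e : (fun x => 2 * φ k x * inner ℝ (x - x0) (gradient (φ k) x) * η x
      + φ k x ^ 2 * (m * η x + inner ℝ (x - x0) (gradient η x)))
      = fun x => 2 * (φ k x * (η x * inner ℝ (x - x0) (gradient (φ k) x)))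
        + φ k x * ((m * η x + inner ℝ (x - x0) (gradient η x)) * φ k x) := by
      funext x; ring
    rw [e, integral_add (i1.const_mul 2) i2, integral_const_mul] at hk
    linarith
  have hX3 := h3.inner_vec hD (fun k => (h1 k).good_gradient.zero) h.zg hX
  have L1 := h2.tendsto_mul (hX3.smul_cont hD
    (fun k => ((h1 k).good_gradient.inner_vec hD hX).zero)
    (h.good_grad.inner_vec hD hX).zero hη')
  have L2 := h2.tendsto_mul (h2.smul_cont hD (fun k => (h1 k).good.zero) h.zu hw)
  simp only [smul_eq_mul] at L1 L2
  have := tendsto_nhds_unique ((L1.const_mul 2).congr key) L2.neg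
  convert this using 2
  · congr 1; funext x; ring
  · congr 1; funext x; ring

/-- Green's formula. -/
theorem H10.integral_green {u : Euc m → ℝ} {g : Euc m → Euc m}
    (h : H10 D u g) {ζ : Euc m → ℝ} (hζ : IsTest D ζ) :
    ∫ x, inner ℝ (g x) (gradient ζ x) = - ∫ x, u x * lapl ζ x := by
  obtain ⟨φ, h1, h2, h3⟩ := h.approx
  have key : ∀ k, ∫ x, inner ℝ (gradient (φ k) x) (gradient ζ x)
      = - ∫ x, φ k x * lapl ζ x := by
    intro k
    have hk := (h1 k).integral_green hζ.contDiff
    rw [integral_add ((h1 k).good_gradient.int_inner hζ.good_gradient)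
      ((h1 k).good.int_mul hζ.good_lapl)] at hk
    linarith
  exact tendsto_nhds_unique
    ((h3.tendsto_inner (L2Lim.const hζ.good_gradient.mem)).congr key)
    (h2.tendsto_mul (L2Lim.const hζ.good_lapl.mem)).neg

/-- The weak equation can be tested against `H¹₀` functions. -/
theorem IsWeak.weak_h10 (hD : Bornology.IsBounded D) {c : ℝ} {u h : Euc m → ℝ}
    {g : Euc m → Euc m} (H : IsWeak D c u g h) {w : Euc m → ℝ} {gw : Euc m → Euc m}
    (hw : H10 D w gw) :
    (∫ x, inner ℝ (g x) (gw x)) + ∫ x, u x * w x * (c ^ 2 * ‖x‖ ^ 2) = ∫ x, h x * w x := by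
  obtain ⟨φ, h1, h2, h3⟩ := hw.approx
  have hV : Continuous fun x : Euc m => c ^ 2 * ‖x‖ ^ 2 := by fun_prop
  have L1 := (L2Lim.const H.h10.good_grad.mem).tendsto_inner h3
  have L2 := (L2Lim.const H.h10.good.mem).tendsto_mul
    (h2.smul_cont hD (fun k => (h1 k).good.zero) hw.zu hV)
  have L3 := (L2Lim.const H.good_h.mem).tendsto_mul h2
  have := tendsto_nhds_unique ((L1.add L2).congr fun k => ?_) L3
  · rw [← this]; congr 2; funext x; simp only [smul_eq_mul]; ring
  · rw [← H.weak _ (h1 k)]; congr 2; funext x; simp only [smul_eq_mul]; ring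

theorem IsWeak.const_mul {c : ℝ} {u h : Euc m → ℝ}
    {g : Euc m → Euc m} (H : IsWeak D c u g h) (a : ℝ) :
    IsWeak D c (fun x => a * u x) (fun x => a • g x) (fun x => a * h x) := by
  refine ⟨H.h10.const_mul a, H.good_h.const_smul a, fun φ hφ => ?_⟩
  have := H.weak φ hφ
  simp only [real_inner_smul_left, mul_assoc, integral_const_mul] at this ⊢
  rw [← this, mul_add]

theorem IsWeak.add (hD : Bornology.IsBounded D) {c : ℝ} {u h u' h' : Euc m → ℝ}
    {g g' : Euc m → Euc m} (H : IsWeak D c u g h) (H' : IsWeak D c u' g' h') :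
    IsWeak D c (fun x => u x + u' x) (fun x => g x + g' x) (fun x => h x + h' x) := by
  refine ⟨H.h10.add H'.h10, H.good_h.add H'.good_h, fun φ hφ => ?_⟩
  have e1 := H.weak φ hφ
  have e2 := H'.weak φ hφ
  have hV : Continuous fun x : Euc m => c ^ 2 * ‖x‖ ^ 2 := by fun_prop
  simp only [inner_add_left, add_mul]
  rw [integral_add (H.h10.good_grad.int_inner hφ.good_gradient)
      (H'.h10.good_grad.int_inner hφ.good_gradient),
    integral_add (H.h10.good.int_mulw hD hφ.good hV) (H'.h10.good.int_mulw hD hφ.good hV),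
    integral_add (H.good_h.int_mul hφ.good) (H'.good_h.int_mul hφ.good), ← e1, ← e2]
  ring

theorem IsWeak.zero {c : ℝ} :
    IsWeak D c (fun _ => 0) (fun _ => (0 : Euc m)) (fun _ => 0) :=
  ⟨H10.zero, Good.zero_fun, fun φ _ => by simp⟩

theorem IsWeak.sum (hD : Bornology.IsBounded D) {c : ℝ} {ι : Type*} (s : Finset ι)
    {u h : ι → Euc m → ℝ} {g : ι → Euc m → Euc m}
    (H : ∀ i ∈ s, IsWeak D c (u i) (g i) (h i)) :
    IsWeak D c (fun x => ∑ i ∈ s, u i x) (fun x => ∑ i ∈ s, g i x)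
      (fun x => ∑ i ∈ s, h i x) := by
  classical
  induction s using Finset.induction_on with
  | empty => simpa using IsWeak.zero
  | insert a s ha ih =>
    simp only [Finset.sum_insert ha]
    exact (H a (by simp)).add hD (ih fun i hi => H i (by simp [hi]))

end H10

theorem integral_lin2 {α : Type*} [MeasurableSpace α] {μ : Measure α} {f₁ f₂ : α → ℝ}
    (h₁ : Integrable f₁ μ) (h₂ : Integrable f₂ μ) (a₁ a₂ : ℝ) :
    ∫ x, (a₁ * f₁ x + a₂ * f₂ x) ∂μ = a₁ * (∫ x, f₁ x ∂μ) + a₂ * ∫ x, f₂ x ∂μ := by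
  rw [integral_add (h₁.const_mul _) (h₂.const_mul _), integral_const_mul, integral_const_mul]

theorem integral_lin3 {α : Type*} [MeasurableSpace α] {μ : Measure α} {f₁ f₂ f₃ : α → ℝ}
    (h₁ : Integrable f₁ μ) (h₂ : Integrable f₂ μ) (h₃ : Integrable f₃ μ) (a₁ a₂ a₃ : ℝ) :
    ∫ x, (a₁ * f₁ x + a₂ * f₂ x + a₃ * f₃ x) ∂μ
      = a₁ * (∫ x, f₁ x ∂μ) + a₂ * (∫ x, f₂ x ∂μ) + a₃ * ∫ x, f₃ x ∂μ := by
  have := integral_lin2 ((h₁.const_mul a₁).add (h₂.const_mul a₂)) h₃ 1 a₃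
  simp only [one_mul, Pi.add_apply] at this
  rw [this, integral_lin2 h₁ h₂]

/-! ### Gaussian weights -/

/-- The Gaussian weight `exp(a‖x - x0‖²)`. -/
noncomputable def gwt {m : ℕ} (a : ℝ) (x0 x : Euc m) : ℝ := Real.exp (a * ‖x - x0‖ ^ 2)

section Static

variable {m : ℕ} {D : Set (Euc m)}

theorem gwt_pos (a : ℝ) (x0 x : Euc m) : 0 < gwt a x0 x := Real.exp_pos _

theorem contDiff_gwt (a : ℝ) (x0 : Euc m) : ContDiff ℝ (⊤ : ℕ∞) (gwt a x0) :=
  Real.contDiff_exp.comp (contDiff_const.mul ((contDiff_id.sub contDiff_const).norm_sq ℝ))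

theorem continuous_gwt (a : ℝ) (x0 : Euc m) : Continuous (gwt a x0) :=
  (contDiff_gwt a x0).continuous

theorem hasFDerivAt_normSq (x0 x : Euc m) :
    HasFDerivAt (fun x : Euc m => ‖x - x0‖ ^ 2) (2 • (innerSL ℝ (x - x0))) x := by
  have := ((hasFDerivAt_id x).sub_const x0).norm_sq
  simpa using this

theorem gradient_eq_of_fderiv {f : Euc m → ℝ} {x v : Euc m} {L : Euc m →L[ℝ] ℝ}
    (h : HasFDerivAt f L x) (hL : ∀ w, L w = inner ℝ v w) : gradient f x = v := by
  refine ext_inner_right ℝ fun w => ?_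
  rw [gradient_apply, h.fderiv, hL]

theorem gradient_normSq (x0 x : Euc m) :
    gradient (fun x : Euc m => ‖x - x0‖ ^ 2) x = (2 : ℝ) • (x - x0) := by
  refine gradient_eq_of_fderiv (hasFDerivAt_normSq x0 x) fun w => ?_
  simp only [real_inner_smul_left, inner_sub_left]
  simp

theorem gradient_gwt (a : ℝ) (x0 x : Euc m) :
    gradient (gwt a x0) x = (2 * a * gwt a x0 x) • (x - x0) := by
  have h := ((hasFDerivAt_normSq x0 x).const_mul a).exp
  refine gradient_eq_of_fderiv (f := gwt a x0) h fun w => ?_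
  simp only [gwt, real_inner_smul_left, inner_sub_left]
  simp
  ring

/-- The radial identity with a Gaussian weight. -/
theorem H10.integral_radial_gwt (hD : Bornology.IsBounded D) {u : Euc m → ℝ} {g : Euc m → Euc m}
    (h : H10 D u g) (a : ℝ) (x0 : Euc m) :
    2 * ∫ x, u x * inner ℝ (x - x0) (g x) * gwt a x0 x
      = - (m * ∫ x, u x ^ 2 * gwt a x0 x)
        - 2 * a * ∫ x, u x ^ 2 * (‖x - x0‖ ^ 2 * gwt a x0 x) := by
  rw [h.integral_radial hD (contDiff_gwt a x0) x0]
  have hw := continuous_gwt a x0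
  have hX : Continuous fun x : Euc m => ‖x - x0‖ ^ 2 := by fun_prop
  have := integral_lin2 (h.good.int_sqw hD hw) (h.good.int_sqw hD (hX.mul hw)) (-(m : ℝ)) (-(2 * a))
  refine Eq.trans ?_ (this.trans ?_)
  swap; · simp only [Pi.mul_apply]; ring
  rw [← integral_neg]
  congr 1; funext x
  simp only [Pi.mul_apply]
  rw [gradient_gwt, real_inner_smul_right, real_inner_self_eq_norm_sq]
  ring

/-- The radial identity with weight `‖x‖²` times a Gaussian. -/
theorem H10.integral_radial_sq_gwt (hD : Bornology.IsBounded D) {u : Euc m → ℝ}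
    {g : Euc m → Euc m} (h : H10 D u g) (a : ℝ) (x0 : Euc m) :
    2 * ∫ x, u x * inner ℝ (x - x0) (g x) * (‖x‖ ^ 2 * gwt a x0 x)
      = - (m * ∫ x, u x ^ 2 * (‖x‖ ^ 2 * gwt a x0 x))
        - 2 * (∫ x, u x ^ 2 * (inner ℝ (x - x0) x * gwt a x0 x))
        - 2 * a * ∫ x, u x ^ 2 * (‖x‖ ^ 2 * ‖x - x0‖ ^ 2 * gwt a x0 x) := by
  have hc : ContDiff ℝ (⊤ : ℕ∞) fun x : Euc m => ‖x‖ ^ 2 := contDiff_norm_sq ℝ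
  rw [h.integral_radial hD (hc.mul (contDiff_gwt a x0)) x0]
  have hw := continuous_gwt a x0
  have hX : Continuous fun x : Euc m => ‖x‖ ^ 2 := by fun_prop
  have hX0 : Continuous fun x : Euc m => ‖x‖ ^ 2 * ‖x - x0‖ ^ 2 := by fun_prop
  have hX1 : Continuous fun x : Euc m => inner ℝ (x - x0) x := by fun_prop
  have := integral_lin3 (h.good.int_sqw hD (hX.mul hw)) (h.good.int_sqw hD (hX1.mul hw))
    (h.good.int_sqw hD (hX0.mul hw)) (-(m : ℝ)) (-2) (-(2 * a))
  refine Eq.trans ?_ (this.trans ?_)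
  swap; · simp only [Pi.mul_apply]; ring
  rw [← integral_neg]
  congr 1; funext x
  simp only [Pi.mul_apply]
  rw [gradient_mul (hc.differentiable (by simp) x)
    ((contDiff_gwt a x0).differentiable (by simp) x), gradient_gwt]
  have := gradient_normSq (0 : Euc m) x
  simp only [sub_zero] at this
  rw [this, inner_add_right, real_inner_smul_right, real_inner_smul_right, real_inner_smul_right,
    real_inner_smul_right, real_inner_self_eq_norm_sq]
  ring

/-- The weak equation tested against `η w`. -/
theorem IsWeak.test_mul (hD : Bornology.IsBounded D) {c : ℝ} {u h : Euc m → ℝ}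
    {g : Euc m → Euc m} (H : IsWeak D c u g h) {w : Euc m → ℝ} {gw : Euc m → Euc m}
    (hw : H10 D w gw) (a : ℝ) (x0 : Euc m) :
    ∫ x, h x * w x * gwt a x0 x = (∫ x, inner ℝ (g x) (gw x) * gwt a x0 x)
      + 2 * a * (∫ x, w x * inner ℝ (x - x0) (g x) * gwt a x0 x)
      + c ^ 2 * ∫ x, u x * w x * (‖x‖ ^ 2 * gwt a x0 x) := by
  have e := H.weak_h10 hD (hw.mul_smooth hD (contDiff_gwt a x0))
  have hη := continuous_gwt a x0
  have hX : Continuous fun x : Euc m => x - x0 := by fun_prop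
  have hN : Continuous fun x : Euc m => ‖x‖ ^ 2 := by fun_prop
  have e1 : ∫ x, h x * (gwt a x0 x * w x) = ∫ x, h x * w x * gwt a x0 x := by
    congr 1; funext x; ring
  have e2 : ∫ x, inner ℝ (g x) (gwt a x0 x • gw x + w x • gradient (gwt a x0) x)
      = (∫ x, inner ℝ (g x) (gw x) * gwt a x0 x)
      + 2 * a * (∫ x, w x * inner ℝ (x - x0) (g x) * gwt a x0 x) := by
    rw [← integral_const_mul, ← integral_add (H.h10.good_grad.int_innerw hD hw.good_grad hη)
      ((hw.good.int_mulw hD (H.h10.good_grad.inner_vec hD hX) hη).const_mul _)]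
    congr 1; funext x
    rw [gradient_gwt, inner_add_right, real_inner_smul_right, real_inner_smul_right,
      real_inner_smul_right, real_inner_comm (g x) (x - x0)]
    ring
  have e3 : ∫ x, u x * (gwt a x0 x * w x) * (c ^ 2 * ‖x‖ ^ 2)
      = c ^ 2 * ∫ x, u x * w x * (‖x‖ ^ 2 * gwt a x0 x) := by
    rw [← integral_const_mul]
    congr 1; funext x; ring
  rw [e1, e2, e3] at e
  exact e.symm

theorem gwt_zero (x0 x : Euc m) : gwt 0 x0 x = 1 := by simp [gwt]

theorem IsWeak.energy (hD : Bornology.IsBounded D) {c : ℝ} {u h : Euc m → ℝ}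
    {g : Euc m → Euc m} (H : IsWeak D c u g h) :
    ∫ x, h x * u x = (∫ x, ‖g x‖ ^ 2) + c ^ 2 * ∫ x, u x ^ 2 * ‖x‖ ^ 2 := by
  have := H.test_mul hD H.h10 0 0
  simp only [gwt_zero, mul_one, mul_zero, zero_mul, add_zero, real_inner_self_eq_norm_sq] at this
  rw [this]; simp only [sq]

theorem H10.radial (hD : Bornology.IsBounded D) {u : Euc m → ℝ} {g : Euc m → Euc m}
    (h : H10 D u g) : 2 * ∫ x, u x * inner ℝ x (g x) = - (m * ∫ x, u x ^ 2) := by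
  have := h.integral_radial_gwt hD 0 0
  simpa only [gwt_zero, mul_one, mul_zero, zero_mul, sub_zero] using this

/-- The uncertainty principle. -/
theorem H10.uncertainty (hD : Bornology.IsBounded D) {u : Euc m → ℝ} {g : Euc m → Euc m}
    (h : H10 D u g) (c : ℝ) :
    m * c * ∫ x, u x ^ 2 ≤ (∫ x, ‖g x‖ ^ 2) + c ^ 2 * ∫ x, u x ^ 2 * ‖x‖ ^ 2 := by
  have hN : Continuous fun x : Euc m => ‖x‖ ^ 2 := by fun_prop
  have h0 : 0 ≤ ∫ x, ‖g x + (c * u x) • x‖ ^ 2 := integral_nonneg fun x => by positivity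
  have e : ∫ x, ‖g x + (c * u x) • x‖ ^ 2 = (∫ x, ‖g x‖ ^ 2)
      + 2 * c * (∫ x, u x * inner ℝ x (g x)) + c ^ 2 * ∫ x, u x ^ 2 * ‖x‖ ^ 2 := by
    have i2 : Integrable fun x => u x * inner ℝ x (g x) :=
      h.good.int_mul (h.good_grad.inner_vec hD continuous_id)
    have := integral_lin3 h.good_grad.int_nsq i2 (h.good.int_sqw hD hN) 1 (2 * c) (c ^ 2)
    rw [one_mul] at this
    rw [← this]
    congr 1; funext x
    rw [norm_add_sq_real, norm_smul, real_inner_smul_right, real_inner_comm, mul_pow,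
      Real.norm_eq_abs, sq_abs]
    ring
  have := h.radial hD
  rw [e] at h0
  have h2 : 2 * c * ∫ x, u x * inner ℝ x (g x) = c * (2 * ∫ x, u x * inner ℝ x (g x)) := by ring
  rw [h2, this] at h0
  linarith

theorem H10.poincare {R : ℝ} (hR : 0 < R) (hDR : D ⊆ ball 0 R) {u : Euc m → ℝ}
    {g : Euc m → Euc m} (h : H10 D u g) :
    m ^ 2 / (4 * R ^ 2) * ∫ x, u x ^ 2 ≤ ∫ x, ‖g x‖ ^ 2 := by
  have hD : Bornology.IsBounded D := isBounded_ball.subset hDR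
  have h1 := h.uncertainty hD (m / (2 * R ^ 2))
  have hN : Continuous fun x : Euc m => ‖x‖ ^ 2 := by fun_prop
  have h2 : ∫ x, u x ^ 2 * ‖x‖ ^ 2 ≤ R ^ 2 * ∫ x, u x ^ 2 := by
    rw [← integral_const_mul]
    refine integral_mono (h.good.int_sqw hD hN) (h.good.int_sq.const_mul _) fun x => ?_
    by_cases hx : x ∈ D
    · have : ‖x‖ ≤ R := by simpa using (mem_ball.1 (hDR hx)).le
      have : ‖x‖ ^ 2 ≤ R ^ 2 := by gcongr
      show u x ^ 2 * ‖x‖ ^ 2 ≤ R ^ 2 * u x ^ 2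
      nlinarith [sq_nonneg (u x)]
    · simp [h.zu x hx]
  have h3 : (m / (2 * R ^ 2)) ^ 2 * ∫ x, u x ^ 2 * ‖x‖ ^ 2
      ≤ (m / (2 * R ^ 2)) ^ 2 * (R ^ 2 * ∫ x, u x ^ 2) := by gcongr
  have e1 : (m : ℝ) * (m / (2 * R ^ 2)) - (m / (2 * R ^ 2)) ^ 2 * R ^ 2 = m ^ 2 / (4 * R ^ 2) := by
    field_simp; ring
  rw [← e1, sub_mul]
  linarith

/-- The weighted energy lower bound for growing Gaussian weights. -/
theorem IsWeak.weighted_energy (hD : Bornology.IsBounded D) {c : ℝ} {u h : Euc m → ℝ}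
    {g : Euc m → Euc m} (H : IsWeak D c u g h) (a : ℝ) :
    (c ^ 2 - a ^ 2) * ∫ x, u x ^ 2 * (‖x‖ ^ 2 * gwt a 0 x) ≤ ∫ x, h x * u x * gwt a 0 x := by
  have e := H.test_mul hD H.h10 a 0
  have hη := continuous_gwt (m := m) a 0
  have hN : Continuous fun x : Euc m => ‖x‖ ^ 2 := by fun_prop
  have h0 : 0 ≤ ∫ x, ‖g x + (a * u x) • x‖ ^ 2 * gwt a 0 x :=
    integral_nonneg fun x => mul_nonneg (by positivity) (gwt_pos _ _ _).le
  have e' : ∫ x, ‖g x + (a * u x) • x‖ ^ 2 * gwt a 0 x = (∫ x, ‖g x‖ ^ 2 * gwt a 0 x)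
      + 2 * a * (∫ x, u x * inner ℝ x (g x) * gwt a 0 x)
      + a ^ 2 * ∫ x, u x ^ 2 * (‖x‖ ^ 2 * gwt a 0 x) := by
    have i2 : Integrable fun x => u x * inner ℝ x (g x) * gwt a 0 x :=
      H.h10.good.int_mulw hD (H.h10.good_grad.inner_vec hD continuous_id) hη
    have := integral_lin3 (H.h10.good_grad.int_nsqw hD hη) i2
      (H.h10.good.int_sqw hD (hN.mul hη)) 1 (2 * a) (a ^ 2)
    rw [one_mul] at this
    refine Eq.trans ?_ this
    congr 1; funext x
    rw [norm_add_sq_real, norm_smul, real_inner_smul_right, real_inner_comm, mul_pow,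
      Real.norm_eq_abs, sq_abs]
    simp only [Pi.mul_apply]
    ring
  simp only [sub_zero, real_inner_self_eq_norm_sq, ← sq] at e
  rw [e'] at h0
  linarith

end Static

/-! ### Difference quotients -/

section Diff

variable {m : ℕ} {D : Set (Euc m)}

theorem sq_intervalIntegral_le {f : ℝ → ℝ} (hf : Continuous f) :
    (∫ τ in (0:ℝ)..1, f τ) ^ 2 ≤ ∫ τ in (0:ℝ)..1, f τ ^ 2 := by
  have h0 : 0 ≤ ∫ τ in (0:ℝ)..1, (f τ - ∫ τ in (0:ℝ)..1, f τ) ^ 2 :=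
    intervalIntegral.integral_nonneg zero_le_one fun _ _ => sq_nonneg _
  set A := ∫ τ in (0:ℝ)..1, f τ with hA
  have e : ∫ τ in (0:ℝ)..1, (f τ - A) ^ 2
      = (∫ τ in (0:ℝ)..1, f τ ^ 2) - 2 * A * A + A ^ 2 := by
    have h1 : ∀ τ, (f τ - A) ^ 2 = (f τ ^ 2 - 2 * A * f τ) + A ^ 2 := fun τ => by ring
    simp_rw [h1]
    rw [intervalIntegral.integral_add, intervalIntegral.integral_sub,
      intervalIntegral.integral_const_mul, ← hA]
    · simp
    all_goals apply Continuous.intervalIntegrable; fun_prop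
  rw [e] at h0
  nlinarith

/-- The `L²` size of an increment along a vector field is controlled by the gradient. -/
theorem integral_increment_sq_le {φ : Euc m → ℝ} (hφ : ContDiff ℝ (⊤ : ℕ∞) φ)
    {v : Euc m → Euc m} (hv : Continuous v) {S : Set (Euc m)} (hS : IsCompact S)
    (hz : ∀ x ∉ S, ∀ τ ∈ Icc (0:ℝ) 1, x + τ • v x ∉ tsupport φ) {K : ℝ}
    (hK : ∀ τ ∈ Icc (0:ℝ) 1, ∫ x, (inner ℝ (gradient φ (x + τ • v x)) (v x)) ^ 2 ≤ K) :
    ∫ x, (φ (x + v x) - φ x) ^ 2 ≤ K := by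
  set F : ℝ → Euc m → ℝ := fun τ x => (inner ℝ (gradient φ (x + τ • v x)) (v x)) ^ 2 with hF
  have hg := (contDiff_gradient hφ).continuous
  have hFc : Continuous (Function.uncurry F) := by
    simp only [hF, Function.uncurry_def]
    fun_prop
  have hz0 : ∀ x ∉ S, ∀ τ ∈ Icc (0:ℝ) 1, F τ x = 0 := fun x hx τ hτ => by
    show (inner ℝ (gradient φ (x + τ • v x)) (v x)) ^ 2 = 0
    rw [gradient_eq_zero_of_notMem (hz x hx τ hτ), inner_zero_left]; norm_num
  have hpt : ∀ x, (φ (x + v x) - φ x) ^ 2 ≤ ∫ τ in (0:ℝ)..1, F τ x := by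
    intro x
    have hd : ∀ τ : ℝ, HasDerivAt (fun τ : ℝ => φ (x + τ • v x))
        (inner ℝ (gradient φ (x + τ • v x)) (v x)) τ := by
      intro τ
      have h1 : HasDerivAt (fun τ : ℝ => x + τ • v x) (v x) τ := by
        simpa using ((hasDerivAt_id τ).smul_const (v x)).const_add x
      have h2 := (hφ.differentiable (by simp) (x + τ • v x)).hasFDerivAt.comp_hasDerivAt τ h1
      rwa [gradient_apply]
    have hc : Continuous fun τ : ℝ => inner ℝ (gradient φ (x + τ • v x)) (v x) := by fun_prop
    have h1 := intervalIntegral.integral_eq_sub_of_hasDerivAt (a := 0) (b := 1)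
      (fun τ _ => hd τ) (hc.intervalIntegrable _ _)
    simp only [one_smul, zero_smul, add_zero] at h1
    rw [← h1]
    exact sq_intervalIntegral_le hc
  have hIoc : ∀ τ ∈ Ioc (0:ℝ) 1, τ ∈ Icc (0:ℝ) 1 := fun τ h => Ioc_subset_Icc_self h
  have hint : Integrable (Function.uncurry F) ((volume.restrict (Ioc 0 1)).prod volume) := by
    have h1 : IntegrableOn (Function.uncurry F) (Icc (0:ℝ) 1 ×ˢ S) (volume.prod volume) :=
      hFc.continuousOn.integrableOn_compact (isCompact_Icc.prod hS)
    have h2 : IntegrableOn (Function.uncurry F) (Ioc (0:ℝ) 1 ×ˢ univ) (volume.prod volume) := by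
      refine h1.of_forall_sdiff_eq_zero (measurableSet_Ioc.prod .univ) ?_
      rintro ⟨τ, x⟩ ⟨⟨hτ, -⟩, hn⟩
      exact hz0 x (fun hx => hn ⟨hIoc τ hτ, hx⟩) τ (hIoc τ hτ)
    rwa [IntegrableOn, ← Measure.prod_restrict, Measure.restrict_univ] at h2
  have hswap : ∫ x, ∫ τ in (0:ℝ)..1, F τ x = ∫ τ in (0:ℝ)..1, ∫ x, F τ x := by
    simp_rw [intervalIntegral.integral_of_le (zero_le_one (α := ℝ))]
    exact (integral_integral_swap hint).symm
  have hintx : Integrable fun x => ∫ τ in (0:ℝ)..1, F τ x := by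
    simp_rw [intervalIntegral.integral_of_le (zero_le_one (α := ℝ))]
    exact hint.integral_prod_right
  have hintτ : IntervalIntegrable (fun τ => ∫ x, F τ x) volume 0 1 := by
    rw [intervalIntegrable_iff_integrableOn_Ioc_of_le zero_le_one]
    exact hint.integral_prod_left
  calc ∫ x, (φ (x + v x) - φ x) ^ 2 ≤ ∫ x, ∫ τ in (0:ℝ)..1, F τ x :=
        integral_mono_of_nonneg (Eventually.of_forall fun x => sq_nonneg _) hintx
          (Eventually.of_forall hpt)
    _ = ∫ τ in (0:ℝ)..1, ∫ x, F τ x := hswap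
    _ ≤ ∫ _τ in (0:ℝ)..1, K :=
        intervalIntegral.integral_mono_on zero_le_one hintτ (by simp) fun τ hτ => hK τ hτ
    _ = K := by simp

/-- Translation estimate. -/
theorem IsTest.integral_translate_sq_le {φ : Euc m → ℝ} (h : IsTest D φ) (v : Euc m) :
    ∫ x, (φ (x + v) - φ x) ^ 2 ≤ ‖v‖ ^ 2 * ∫ x, ‖gradient φ x‖ ^ 2 := by
  have hcp : IsCompact ((fun p : ℝ × Euc m => p.2 - p.1 • v) '' (Icc (0:ℝ) 1 ×ˢ tsupport φ)) :=
    (isCompact_Icc.prod h.compact).image (by fun_prop)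
  refine integral_increment_sq_le h.contDiff (v := fun _ => v) continuous_const hcp ?_ ?_
  · intro x hx τ hτ hm
    exact hx ⟨(τ, x + τ • v), ⟨hτ, hm⟩, by simp⟩
  · intro τ _
    have e : ∫ x, ‖gradient φ x‖ ^ 2 = ∫ x, ‖gradient φ (x + τ • v)‖ ^ 2 :=
      (integral_add_right_eq_self (fun x => ‖gradient φ x‖ ^ 2) (τ • v)).symm
    rw [e, ← integral_const_mul]
    have hc := (contDiff_gradient h.contDiff).continuous
    have hi : Integrable fun x => ‖gradient φ (x + τ • v)‖ ^ 2 :=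
      h.good_gradient.int_nsq.comp_add_right (τ • v)
    refine integral_mono_of_nonneg (Eventually.of_forall fun x => sq_nonneg _)
      (hi.const_mul _) (Eventually.of_forall fun x => ?_)
    have := real_inner_mul_inner_self_le (gradient φ (x + τ • v)) v
    simp only [real_inner_self_eq_norm_sq] at this
    show (inner ℝ (gradient φ (x + τ • v)) v) ^ 2 ≤ ‖v‖ ^ 2 * ‖gradient φ (x + τ • v)‖ ^ 2
    nlinarith

/-- The dilation `x ↦ x0 + θ(x - x0)`. -/
def dil {m : ℕ} (x0 : Euc m) (θ : ℝ) (x : Euc m) : Euc m := x0 + θ • (x - x0)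

theorem continuous_dil (x0 : Euc m) (θ : ℝ) : Continuous (dil x0 θ) := by
  unfold dil; fun_prop

theorem dil_eq_add (x0 : Euc m) (θ : ℝ) (x : Euc m) : dil x0 θ x = x + (θ - 1) • (x - x0) := by
  simp only [dil]; module

theorem dil_sub (x0 : Euc m) (θ : ℝ) (x : Euc m) : dil x0 θ x - x0 = θ • (x - x0) := by
  simp [dil]

theorem integral_dil {G : Type*} [NormedAddCommGroup G] [NormedSpace ℝ G] (f : Euc m → G)
    (x0 : Euc m) {θ : ℝ} (hθ : 0 < θ) : ∫ x, f (dil x0 θ x) = (θ ^ m)⁻¹ • ∫ x, f x := by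
  have h1 : ∫ x, f (dil x0 θ x) = ∫ x, f (x0 + θ • x) :=
    integral_sub_right_eq_self (fun x => f (x0 + θ • x)) x0
  rw [h1, Measure.integral_comp_smul volume (fun x => f (x0 + x)) θ,
    integral_add_left_eq_self f x0, finrank_euclideanSpace_fin, abs_of_pos (by positivity)]

theorem map_dil (x0 : Euc m) {θ : ℝ} (hθ : 0 < θ) :
    Measure.map (dil x0 θ) (volume : Measure (Euc m)) = ENNReal.ofReal (θ ^ m)⁻¹ • volume := by
  have e : dil x0 θ = (fun y => (x0 - θ • x0) + y) ∘ fun x => θ • x := by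
    funext x; simp only [dil, Function.comp]; module
  rw [e, ← Measure.map_map (measurable_const_add _) (measurable_const_smul θ),
    Measure.map_addHaar_smul volume hθ.ne', Measure.map_smul, map_add_left_eq_self,
    finrank_euclideanSpace_fin, abs_of_pos (by positivity)]

theorem MemLp.comp_dil {G : Type*} [NormedAddCommGroup G] {f : Euc m → G} (hf : MemLp f 2 volume)
    (x0 : Euc m) {θ : ℝ} (hθ : 0 < θ) : MemLp (fun x => f (dil x0 θ x)) 2 volume := by
  refine MemLp.comp_of_map (f := dil x0 θ) ?_ (continuous_dil x0 θ).measurable.aemeasurable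
  rw [map_dil x0 hθ]
  exact hf.smul_measure ENNReal.ofReal_ne_top

theorem L2Lim.comp_dil {G : Type*} [NormedAddCommGroup G] {f : ℕ → Euc m → G} {f' : Euc m → G}
    (hf : L2Lim volume f f') (x0 : Euc m) {θ : ℝ} (hθ : 0 < θ) :
    L2Lim volume (fun k x => f k (dil x0 θ x)) (fun x => f' (dil x0 θ x)) := by
  refine ⟨fun k => MemLp.comp_dil (hf.mem k) x0 hθ, MemLp.comp_dil hf.memLim x0 hθ, ?_⟩
  have e : ∀ k, eLpNorm ((fun x => f k (dil x0 θ x)) - fun x => f' (dil x0 θ x)) 2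
      volume = (ENNReal.ofReal (θ ^ m)⁻¹) ^ (1 / (2 : ENNReal)).toReal * eLpNorm (f k - f') 2
      volume := by
    intro k
    have h1 : (ENNReal.ofReal (θ ^ m)⁻¹) ≠ 0 := by
      rw [ne_eq, ENNReal.ofReal_eq_zero, not_le]; positivity
    have hm : AEStronglyMeasurable (f k - f') (Measure.map (dil x0 θ) volume) := by
      rw [map_dil x0 hθ]
      exact ((hf.mem k).sub hf.memLim).1.smul_measure _
    have := eLpNorm_map_measure (p := 2) hm (continuous_dil x0 θ).measurable.aemeasurable
    rw [map_dil x0 hθ, eLpNorm_smul_measure_of_ne_top (by norm_num)] at this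
    rw [← smul_eq_mul, this]; rfl
  simp_rw [e]
  have := ENNReal.Tendsto.const_mul (a := (ENNReal.ofReal (θ ^ m)⁻¹) ^ (1 / (2 : ENNReal)).toReal)
    hf.lim (Or.inr (by simp))
  simpa using this

/-- The inverse map of a dilation keeps convex sets stable. -/
theorem notMem_dil (hc : Convex ℝ D) {x0 : Euc m} (hx0 : x0 ∈ D) {θ : ℝ} (hθ : 1 ≤ θ) {x : Euc m}
    (hx : x ∉ D) : dil x0 θ x ∉ D := by
  intro h
  apply hx
  have h0 : 0 < θ := by linarith
  have := hc hx0 h (a := 1 - θ⁻¹) (b := θ⁻¹) (by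
    rw [sub_nonneg]; exact inv_le_one_of_one_le₀ hθ) (by positivity) (by ring)
  convert this using 1
  simp only [dil, smul_add, smul_smul, inv_mul_cancel₀ h0.ne', one_smul]
  module

theorem gradient_dil {φ : Euc m → ℝ} (hφ : ContDiff ℝ (⊤ : ℕ∞) φ) (x0 : Euc m) (θ : ℝ)
    (x : Euc m) : gradient (fun x => φ (dil x0 θ x)) x = θ • gradient φ (dil x0 θ x) := by
  have h1 : HasFDerivAt (dil x0 θ) (θ • ContinuousLinearMap.id ℝ (Euc m)) x :=
    (((hasFDerivAt_id x).sub_const x0).const_smul θ).const_add x0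
  have h2 := (hφ.differentiable (by simp) (dil x0 θ x)).hasFDerivAt.comp x h1
  refine gradient_eq_of_fderiv h2 fun w => ?_
  simp [real_inner_smul_left]

theorem IsTest.comp_dil {φ : Euc m → ℝ} (h : IsTest D φ) (hc : Convex ℝ D) {x0 : Euc m} (hx0 : x0 ∈ D)
    {θ : ℝ} (hθ : 1 ≤ θ) : IsTest D (fun x => φ (dil x0 θ x)) := by
  have h0 : 0 < θ := by linarith
  have hcp : IsCompact (dil x0 θ⁻¹ '' tsupport φ) := h.compact.image (continuous_dil _ _)
  have hz : ∀ x ∉ dil x0 θ⁻¹ '' tsupport φ, φ (dil x0 θ x) = 0 := by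
    intro x hx
    refine image_eq_zero_of_notMem_tsupport fun hm => hx ⟨_, hm, ?_⟩
    simp [dil, smul_smul, inv_mul_cancel₀ h0.ne']
  refine ⟨h.contDiff.comp (contDiff_const.add ((contDiff_id.sub contDiff_const).const_smul θ)),
    HasCompactSupport.intro hcp hz, ?_⟩
  refine Subset.trans (closure_minimal (fun x hx => ?_) hcp.isClosed) (?_ : _ ⊆ D)
  · by_contra hn; exact hx (hz x hn)
  · rintro _ ⟨y, hy, rfl⟩
    by_contra hn
    refine notMem_dil hc hx0 hθ hn ?_
    have : dil x0 θ (dil x0 θ⁻¹ y) = y := by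
      simp [dil, smul_smul, mul_inv_cancel₀ h0.ne']
    rw [this]; exact h.sub hy

theorem H10.comp_dil {u : Euc m → ℝ} {g : Euc m → Euc m} (h : H10 D u g) (hc : Convex ℝ D)
    {x0 : Euc m} (hx0 : x0 ∈ D) {θ : ℝ} (hθ : 1 ≤ θ) :
    H10 D (fun x => u (dil x0 θ x)) (fun x => θ • g (dil x0 θ x)) := by
  obtain ⟨φ, h1, h2, h3⟩ := h.approx
  refine ⟨fun x hx => h.zu _ (notMem_dil hc hx0 hθ hx), fun x hx => by
    rw [h.zg _ (notMem_dil hc hx0 hθ hx), smul_zero], fun k x => φ k (dil x0 θ x),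
    fun k => (h1 k).comp_dil hc hx0 hθ, h2.comp_dil x0 (by linarith), ?_⟩
  have : (fun k => gradient fun x => φ k (dil x0 θ x)) =
      fun k x => θ • gradient (φ k) (dil x0 θ x) := by
    funext k x; exact gradient_dil (h1 k).contDiff x0 θ x
  rw [this]
  exact (h3.comp_dil x0 (by linarith)).const_smul θ

theorem Good.integrable {G : Type*} [NormedAddCommGroup G] (hD : Bornology.IsBounded D)
    {f : Euc m → G} (hf : Good D f) : Integrable f := by
  obtain ⟨r, hr⟩ := hD.subset_ball 0
  have h1 : IntegrableOn f (ball 0 r) := by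
    have h2 : MemLp f 2 (volume.restrict (ball 0 r)) := hf.mem.restrict _
    have : IsFiniteMeasure (volume.restrict (ball (0 : Euc m) r)) :=
      ⟨by rw [Measure.restrict_apply_univ]; exact measure_ball_lt_top⟩
    exact h2.integrable (by norm_num)
  exact (integrableOn_iff_integrable_of_support_subset fun x hx => hr (by
    by_contra hn; exact hx (hf.zero x hn))).1 h1

/-- Dilation increments of test functions. -/
theorem IsTest.integral_dil_sub_sq_le (hD : Bornology.IsBounded D) (hc : Convex ℝ D)
    {x0 : Euc m} (hx0 : x0 ∈ D) {ρ : ℝ} (hρ : ∀ x ∈ D, ‖x - x0‖ ≤ ρ) {θ : ℝ} (hθ : 1 ≤ θ)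
    {φ : Euc m → ℝ} (h : IsTest D φ) :
    ∫ x, (φ (dil x0 θ x) - φ x) ^ 2 ≤ (θ - 1) ^ 2 * ρ ^ 2 * ∫ x, ‖gradient φ x‖ ^ 2 := by
  have key := integral_increment_sq_le h.contDiff (v := fun x => (θ - 1) • (x - x0)) (by fun_prop)
    hD.isCompact_closure (K := (θ - 1) ^ 2 * ρ ^ 2 * ∫ x, ‖gradient φ x‖ ^ 2) ?_ ?_
  · refine le_trans (le_of_eq ?_) key
    simp_rw [dil_eq_add]
  · intro x hx τ hτ hm
    have e : x + τ • (θ - 1) • (x - x0) = dil x0 (1 + τ * (θ - 1)) x := by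
      rw [dil_eq_add, smul_smul]; congr 2; ring
    rw [e] at hm
    exact notMem_dil hc hx0 (by nlinarith [hτ.1]) (fun hxD => hx (subset_closure hxD)) (h.sub hm)
  · intro τ hτ
    have hθ' : 1 ≤ 1 + τ * (θ - 1) := by nlinarith [hτ.1]
    have h0 : (0:ℝ) < 1 + τ * (θ - 1) := by linarith
    have e : ∀ x, x + τ • (θ - 1) • (x - x0) = dil x0 (1 + τ * (θ - 1)) x := fun x => by
      rw [dil_eq_add, smul_smul]; congr 2; ring
    simp only [e]
    have hi : Integrable fun x => ‖gradient φ (dil x0 (1 + τ * (θ - 1)) x)‖ ^ 2 :=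
      memLp_two_integrable_norm_sq (MemLp.comp_dil h.good_gradient.mem x0 h0)
    have h1 : ∫ x, (inner ℝ (gradient φ (dil x0 (1 + τ * (θ - 1)) x)) ((θ - 1) • (x - x0))) ^ 2 ≤
        ∫ x, (θ - 1) ^ 2 * ρ ^ 2 * ‖gradient φ (dil x0 (1 + τ * (θ - 1)) x)‖ ^ 2 := by
      refine integral_mono_of_nonneg (Eventually.of_forall fun x => sq_nonneg _)
        (hi.const_mul _) (Eventually.of_forall fun x => ?_)
      show (inner ℝ (gradient φ (dil x0 (1 + τ * (θ - 1)) x)) ((θ - 1) • (x - x0))) ^ 2 ≤ _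
      by_cases hx : x ∈ D
      · have h2 := real_inner_mul_inner_self_le (gradient φ (dil x0 (1 + τ * (θ - 1)) x))
          ((θ - 1) • (x - x0))
        simp only [real_inner_self_eq_norm_sq, norm_smul, Real.norm_eq_abs, mul_pow, sq_abs] at h2
        have h3 : ‖x - x0‖ ^ 2 ≤ ρ ^ 2 := pow_le_pow_left₀ (norm_nonneg _) (hρ x hx) 2
        calc _ ≤ ‖gradient φ (dil x0 (1 + τ * (θ - 1)) x)‖ ^ 2 * ((θ - 1) ^ 2 * ‖x - x0‖ ^ 2) := by
              rw [sq]; exact h2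
          _ ≤ ‖gradient φ (dil x0 (1 + τ * (θ - 1)) x)‖ ^ 2 * ((θ - 1) ^ 2 * ρ ^ 2) := by gcongr
          _ = _ := by ring
      · rw [gradient_eq_zero_of_notMem (fun hm => notMem_dil hc hx0 hθ' hx (h.sub hm)),
          inner_zero_left, zero_pow two_ne_zero]
        positivity
    refine h1.trans ?_
    rw [integral_const_mul, integral_dil (fun x => ‖gradient φ x‖ ^ 2) x0 h0, smul_eq_mul]
    have h4 : ((1 + τ * (θ - 1)) ^ m)⁻¹ ≤ 1 := inv_le_one_of_one_le₀ (one_le_pow₀ hθ')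
    have h5 : 0 ≤ ∫ x, ‖gradient φ x‖ ^ 2 := integral_nonneg fun x => sq_nonneg _
    exact mul_le_mul_of_nonneg_left (mul_le_of_le_one_left h5 h4) (by positivity)

theorem H10.integral_dil_sub_sq_le (hD : Bornology.IsBounded D) (hc : Convex ℝ D)
    {x0 : Euc m} (hx0 : x0 ∈ D) {ρ : ℝ} (hρ : ∀ x ∈ D, ‖x - x0‖ ≤ ρ) {θ : ℝ} (hθ : 1 ≤ θ)
    {u : Euc m → ℝ} {g : Euc m → Euc m} (h : H10 D u g) :
    ∫ x, (u (dil x0 θ x) - u x) ^ 2 ≤ (θ - 1) ^ 2 * ρ ^ 2 * ∫ x, ‖g x‖ ^ 2 := by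
  obtain ⟨φ, h1, h2, h3⟩ := h.approx
  have h4 := ((h2.comp_dil x0 (by linarith : 0 < θ)).add (h2.const_smul (-1))).tendsto_norm_sq
  have h5 := (h3.tendsto_norm_sq.const_mul ((θ - 1) ^ 2 * ρ ^ 2))
  have h6 := le_of_tendsto_of_tendsto' h4 h5 fun k => by
    have := (h1 k).integral_dil_sub_sq_le hD hc hx0 hρ hθ
    simpa only [Real.norm_eq_abs, sq_abs, smul_eq_mul, neg_one_mul, ← sub_eq_add_neg] using this
  simpa only [Real.norm_eq_abs, sq_abs, smul_eq_mul, neg_one_mul, ← sub_eq_add_neg] using h6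

theorem IsTest.tendsto_dil_quotient (hD : Bornology.IsBounded D)
    {x0 : Euc m} {ρ : ℝ} (hρ : ∀ x ∈ D, ‖x - x0‖ ≤ ρ)
    {φ : Euc m → ℝ} (h : IsTest D φ) {K : Euc m → ℝ} (hK : Good D K) :
    Tendsto (fun θ : ℝ => ∫ x, K x * ((θ - 1)⁻¹ * (φ (dil x0 θ x) - φ x))) (nhdsWithin 1 (Ioi 1))
      (nhds (∫ x, K x * inner ℝ (x - x0) (gradient φ x))) := by
  obtain ⟨M, hM⟩ := (contDiff_gradient h.contDiff).continuous.bounded_above_of_compact_support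
    (hasCompactSupport_gradient h.compact)
  have hL : ∀ x y, ‖φ y - φ x‖ ≤ M * ‖y - x‖ := fun x y =>
    convex_univ.norm_image_sub_le_of_norm_fderiv_le
      (fun z _ => h.contDiff.differentiable (by simp) z)
      (fun z _ => by rw [← (InnerProductSpace.toDual ℝ (Euc m)).symm.norm_map]; exact hM z)
      (mem_univ x) (mem_univ y)
  have hM0 : 0 ≤ M := (norm_nonneg _).trans (hM 0)
  refine tendsto_integral_filter_of_dominated_convergence (fun x => ‖K x‖ * (M * ρ))
    (Eventually.of_forall fun θ => hK.mem.1.mul ?_) ?_ ((hK.integrable hD).norm.mul_const _)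
    (Eventually.of_forall fun x => ?_)
  · have := h.contDiff.continuous
    have h2 := continuous_dil x0 θ
    exact Continuous.aestronglyMeasurable (by fun_prop)
  · filter_upwards [self_mem_nhdsWithin] with θ hθ
    have hθ : (0:ℝ) < θ - 1 := sub_pos.2 hθ
    refine Eventually.of_forall fun x => ?_
    by_cases hx : x ∈ D
    · rw [norm_mul]
      refine mul_le_mul_of_nonneg_left ?_ (norm_nonneg _)
      rw [norm_mul, norm_inv, Real.norm_of_nonneg hθ.le, inv_mul_le_iff₀ hθ]
      refine (hL _ _).trans ?_
      rw [dil_eq_add, add_sub_cancel_left, norm_smul, Real.norm_of_nonneg hθ.le]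
      have := hρ x hx
      have := mul_le_mul_of_nonneg_left this (mul_nonneg hM0 hθ.le)
      linarith
    · simp [hK.zero x hx]
  · refine Tendsto.const_mul _ ?_
    have h1 : HasDerivAt (fun θ : ℝ => dil x0 θ x) (x - x0) 1 := by
      unfold dil
      simpa using ((hasDerivAt_id (1:ℝ)).smul_const (x - x0)).const_add x0
    have e1 : dil x0 1 x = x := by simp [dil]
    have h2 := (h.contDiff.differentiable (by simp) (dil x0 1 x)).hasFDerivAt.comp_hasDerivAt 1 h1
    rw [← gradient_apply, real_inner_comm, e1] at h2
    have h3 := hasDerivAt_iff_tendsto_slope.1 h2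
    have h4 := h3.mono_left (nhdsWithin_mono 1 (fun y (hy : 1 < y) => (ne_of_gt hy : y ≠ 1)))
    refine h4.congr fun θ => ?_
    rw [slope_def_field, div_eq_inv_mul]
    simp [e1]

theorem H10.tendsto_dil_quotient (hD : Bornology.IsBounded D) (hc : Convex ℝ D)
    {x0 : Euc m} (hx0 : x0 ∈ D) {u : Euc m → ℝ} {g : Euc m → Euc m} (h : H10 D u g)
    {K : Euc m → ℝ} (hK : Good D K) :
    Tendsto (fun θ : ℝ => ∫ x, K x * ((θ - 1)⁻¹ * (u (dil x0 θ x) - u x))) (nhdsWithin 1 (Ioi 1))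
      (nhds (∫ x, K x * inner ℝ (x - x0) (g x))) := by
  obtain ⟨ρ, hρ0, hρ⟩ : ∃ ρ : ℝ, 0 ≤ ρ ∧ ∀ x ∈ D, ‖x - x0‖ ≤ ρ :=
    exists_bound_of_isBounded hD (by fun_prop : Continuous fun x => x - x0)
  obtain ⟨φ, h1, h2, h3⟩ := h.approx
  set N := ∫ x, K x ^ 2
  have hN : 0 ≤ N := integral_nonneg fun x => sq_nonneg _
  have hgrad : Tendsto (fun k => ∫ x, ‖gradient (φ k) x - g x‖ ^ 2) atTop (nhds 0) := by
    have := (h3.add (L2Lim.const (h.good_grad.mem.const_smul (-1 : ℝ)))).tendsto_norm_sq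
    simpa [← sub_eq_add_neg] using this
  refine TendstoUniformlyOnFilter.tendsto_of_eventually_tendsto
    (F := fun k θ => ∫ x, K x * ((θ - 1)⁻¹ * (φ k (dil x0 θ x) - φ k x))) (p := atTop)
    (L := fun k => ∫ x, K x * inner ℝ (x - x0) (gradient (φ k) x)) ?_
    (Eventually.of_forall fun k => (h1 k).tendsto_dil_quotient hD hρ hK) ?_
  · rw [Metric.tendstoUniformlyOnFilter_iff]
    intro ε hε
    have h5 : Tendsto (fun k => N * (ρ ^ 2 * ∫ x, ‖gradient (φ k) x - g x‖ ^ 2)) atTop (nhds 0) := by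
      simpa using (hgrad.const_mul (ρ ^ 2)).const_mul N
    have h6 := h5.eventually_lt_const (pow_pos hε 2)
    have h7 : ∀ᶠ θ : ℝ in nhdsWithin 1 (Ioi 1), 1 < θ := self_mem_nhdsWithin
    filter_upwards [h6.prod_mk h7] with ⟨k, θ⟩ ⟨hk, hθ⟩
    have hθ0 : 0 < θ - 1 := sub_pos.2 hθ
    have hθ1 : 0 < θ := by linarith
    have hdu := MemLp.comp_dil h.good.mem x0 hθ1
    have hdφ := MemLp.comp_dil (h1 k).good.mem x0 hθ1
    have i1 : Integrable fun x => K x * ((θ - 1)⁻¹ * (u (dil x0 θ x) - u x)) :=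
      memLp_two_integrable_mul hK.mem ((hdu.sub h.good.mem).const_mul _)
    have i2 : Integrable fun x => K x * ((θ - 1)⁻¹ * (φ k (dil x0 θ x) - φ k x)) :=
      memLp_two_integrable_mul hK.mem ((hdφ.sub (h1 k).good.mem).const_mul _)
    rw [Real.dist_eq, ← integral_sub i1 i2]
    have hw : H10 D (fun x => u x + (-1) * φ k x) (fun x => g x + (-1 : ℝ) • gradient (φ k) x) :=
      h.add ((h1 k).h10.const_mul (-1))
    have hb := hw.integral_dil_sub_sq_le hD hc hx0 hρ hθ.le
    have hml : MemLp (fun x => (θ - 1)⁻¹ * ((u (dil x0 θ x) + (-1) * φ k (dil x0 θ x)) -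
        (u x + (-1) * φ k x))) 2 volume :=
      (((hdu.add (hdφ.const_mul (-1))).sub hw.good.mem)).const_mul _
    have hcs := abs_integral_inner_le hml hK.mem
    simp only [RCLike.inner_apply, conj_trivial, Real.norm_eq_abs, sq_abs, mul_pow] at hcs
    rw [integral_const_mul] at hcs
    have e : (∫ x, (K x * ((θ - 1)⁻¹ * (u (dil x0 θ x) - u x)) -
        K x * ((θ - 1)⁻¹ * (φ k (dil x0 θ x) - φ k x)))) =
        ∫ x, K x * ((θ - 1)⁻¹ * ((u (dil x0 θ x) + (-1) * φ k (dil x0 θ x)) -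
        (u x + (-1) * φ k x))) := by
      congr 1; funext x; ring
    rw [e]
    have e2 : ∫ x, ‖g x + (-1 : ℝ) • gradient (φ k) x‖ ^ 2 = ∫ x, ‖gradient (φ k) x - g x‖ ^ 2 := by
      congr 1; funext x; rw [neg_one_smul, ← sub_eq_add_neg, norm_sub_rev]
    rw [e2] at hb
    refine abs_lt_of_sq_lt_sq' ?_ hε.le |> abs_lt.2
    refine hcs.trans_lt (lt_of_le_of_lt ?_ hk)
    rw [mul_comm N]
    refine mul_le_mul_of_nonneg_right ?_ hN
    rw [inv_pow, inv_mul_le_iff₀ (pow_pos hθ0 2)]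
    linarith
  · have hKv : Good D fun x => K x • (x - x0) := hK.smul_vec hD (by fun_prop)
    have := (L2Lim.const hKv.mem).tendsto_inner h3
    simpa only [real_inner_smul_left] using this

/-- Differentiating a Gaussian-weighted integral in the exponent. -/
theorem hasDerivAt_integral_gwt (hD : Bornology.IsBounded D) {f : Euc m → ℝ} (hf : Integrable f)
    (hz : ∀ x ∉ D, f x = 0) (x0 : Euc m) (a : ℝ) :
    HasDerivAt (fun a => ∫ x, f x * gwt a x0 x) (∫ x, f x * (‖x - x0‖ ^ 2 * gwt a x0 x)) a := by
  obtain ⟨ρ, hρ0, hρ⟩ : ∃ ρ : ℝ, 0 ≤ ρ ∧ ∀ x ∈ D, ‖x - x0‖ ≤ ρ :=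
    exists_bound_of_isBounded hD (by fun_prop : Continuous fun x => x - x0)
  have hsm : ∀ a, AEStronglyMeasurable (fun x => f x * gwt a x0 x) volume := fun a =>
    hf.1.mul (continuous_gwt a x0).aestronglyMeasurable
  have hle : ∀ b ∈ ball a 1, ∀ x ∈ D, gwt b x0 x ≤ Real.exp ((|a| + 1) * ρ ^ 2) := by
    intro b hb x hx
    have h1 : b ≤ |a| + 1 := by
      rw [mem_ball, Real.dist_eq] at hb
      linarith [(abs_lt.1 hb).2, le_abs_self a]
    refine Real.exp_le_exp.2 ?_
    have h2 : ‖x - x0‖ ^ 2 ≤ ρ ^ 2 := pow_le_pow_left₀ (norm_nonneg _) (hρ x hx) 2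
    have := abs_nonneg a
    calc b * ‖x - x0‖ ^ 2 ≤ (|a| + 1) * ‖x - x0‖ ^ 2 := by gcongr
      _ ≤ _ := by gcongr
  refine (hasDerivAt_integral_of_dominated_loc_of_deriv_le (ball_mem_nhds a one_pos)
    (bound := fun x => ‖f x‖ * (ρ ^ 2 * Real.exp ((|a| + 1) * ρ ^ 2)))
    (F' := fun a x => f x * (‖x - x0‖ ^ 2 * gwt a x0 x))
    (Eventually.of_forall hsm) ?_ ?_ ?_ (hf.norm.mul_const _) ?_).2
  · refine (hf.norm.mul_const (Real.exp ((|a| + 1) * ρ ^ 2))).mono' (hsm a)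
      (Eventually.of_forall fun x => ?_)
    by_cases hx : x ∈ D
    · rw [norm_mul, Real.norm_of_nonneg (gwt_pos _ _ _).le]
      exact mul_le_mul_of_nonneg_left (hle a (mem_ball_self one_pos) x hx) (norm_nonneg _)
    · simp [hz x hx]
  · exact hf.1.mul (((by fun_prop : Continuous fun x : Euc m => ‖x - x0‖ ^ 2).mul
      (continuous_gwt a x0)).aestronglyMeasurable)
  · refine Eventually.of_forall fun x b hb => ?_
    by_cases hx : x ∈ D
    · rw [norm_mul, norm_mul, Real.norm_of_nonneg (gwt_pos _ _ _).le, norm_pow, norm_norm]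
      have h2 : ‖x - x0‖ ^ 2 ≤ ρ ^ 2 := pow_le_pow_left₀ (norm_nonneg _) (hρ x hx) 2
      have := hle b hb x hx
      have := (gwt_pos b x0 x).le
      gcongr
    · simp [hz x hx]
  · refine Eventually.of_forall fun x b _ => ?_
    unfold gwt
    have := (((hasDerivAt_id b).mul_const (‖x - x0‖ ^ 2)).exp).const_mul (f x)
    refine this.congr_deriv ?_
    simp only [id_eq]; ring

end Diff

/-! ### Rellich inequality -/

section Rellich

variable {m : ℕ} {D : Set (Euc m)}

/-- Rellich inequality for Gaussian weights: on a convex domain the boundary term has a sign. -/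
theorem IsWeak.rellich (hD : Bornology.IsBounded D) (hc : Convex ℝ D) {x0 : Euc m} (hx0 : x0 ∈ D)
    {c : ℝ} {u h : Euc m → ℝ} {g : Euc m → Euc m} (H : IsWeak D c u g h) (a : ℝ) :
    (∫ x, h x * inner ℝ (x - x0) (g x) * gwt a x0 x)
      - 2 * a * (∫ x, (inner ℝ (x - x0) (g x)) ^ 2 * gwt a x0 x)
      - c ^ 2 * (∫ x, u x * inner ℝ (x - x0) (g x) * (‖x‖ ^ 2 * gwt a x0 x))
    ≤ (1 / 2) * ((2 - m) * (∫ x, ‖g x‖ ^ 2 * gwt a x0 x)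
      - 2 * a * ∫ x, ‖g x‖ ^ 2 * (‖x - x0‖ ^ 2 * gwt a x0 x)) := by
  have hη := continuous_gwt a x0
  have hX : Continuous fun x : Euc m => x - x0 := by fun_prop
  have hN : Continuous fun x : Euc m => ‖x‖ ^ 2 := by fun_prop
  have hgg := H.h10.good_grad
  have T1 := H.h10.tendsto_dil_quotient hD hc hx0 (H.good_h.mul hD hη)
  have T2 := H.h10.tendsto_dil_quotient hD hc hx0 ((hgg.inner_vec hD hX).mul hD hη)
  have T3 := H.h10.tendsto_dil_quotient hD hc hx0
    (H.h10.good.mul hD (b := fun x => ‖x‖ ^ 2 * gwt a x0 x) (hN.mul hη))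
  have T := (T1.sub (T2.const_mul (2 * a))).sub (T3.const_mul (c ^ 2))
  set I : ℝ → ℝ := fun b => ∫ x, ‖g x‖ ^ 2 * gwt b x0 x with hI
  have dI : HasDerivAt I (∫ x, ‖g x‖ ^ 2 * (‖x - x0‖ ^ 2 * gwt a x0 x)) a :=
    hasDerivAt_integral_gwt hD hgg.int_nsq (fun x hx => by simp [hgg.zero x hx]) x0 a
  set Φ : ℝ → ℝ := fun θ => (θ / 2 - 1) * I a + θ / 2 * ((θ ^ m)⁻¹ * I (a * (θ ^ 2)⁻¹)) with hΦ
  have dΦ : HasDerivAt Φ ((1 / 2) * ((2 - m) * I a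
      - 2 * a * ∫ x, ‖g x‖ ^ 2 * (‖x - x0‖ ^ 2 * gwt a x0 x))) 1 := by
    have d1 : HasDerivAt (fun θ : ℝ => (θ ^ m)⁻¹) (-m) 1 := by
      exact ((hasDerivAt_pow m (1:ℝ)).inv (by simp)).congr_deriv (by simp)
    have d2 : HasDerivAt (fun θ : ℝ => a * (θ ^ 2)⁻¹) (-2 * a) 1 := by
      have := ((hasDerivAt_pow 2 (1:ℝ)).inv (by simp)).const_mul a
      refine this.congr_deriv ?_
      simp; ring
    have dI' : HasDerivAt I (∫ x, ‖g x‖ ^ 2 * (‖x - x0‖ ^ 2 * gwt a x0 x)) (a * ((1:ℝ) ^ 2)⁻¹) := by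
      simpa using dI
    have d3 := d1.mul (dI'.comp (1:ℝ) d2)
    have d4 : HasDerivAt (fun θ : ℝ => θ / 2) (1 / 2) 1 := (hasDerivAt_id (1:ℝ)).div_const 2
    have d5 := (((d4.sub_const 1).mul_const (I a))).add (d4.mul d3)
    refine d5.congr_deriv ?_
    simp [Function.comp]; ring
  have hs := (hasDerivAt_iff_tendsto_slope.1 dΦ).mono_left
    (nhdsWithin_mono 1 (fun y (hy : 1 < y) => (ne_of_gt hy : y ≠ 1)))
  have hΦ1 : Φ 1 = 0 := by simp [hΦ]; ring
  have key : ∀ᶠ θ : ℝ in nhdsWithin 1 (Ioi 1),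
      (∫ x, gwt a x0 x * h x * ((θ - 1)⁻¹ * (u (dil x0 θ x) - u x)))
      - 2 * a * (∫ x, gwt a x0 x * inner ℝ (x - x0) (g x) *
          ((θ - 1)⁻¹ * (u (dil x0 θ x) - u x)))
      - c ^ 2 * (∫ x, ‖x‖ ^ 2 * gwt a x0 x * u x * ((θ - 1)⁻¹ * (u (dil x0 θ x) - u x)))
      ≤ slope Φ 1 θ := by
    filter_upwards [self_mem_nhdsWithin] with θ hθ
    have hθ1 : 1 < θ := hθ
    have hθ0 : 0 < θ - 1 := sub_pos.2 hθ1
    have hθp : 0 < θ := by linarith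
    have hW := ((H.h10.comp_dil hc hx0 hθ1.le).add (H.h10.const_mul (-1))).const_mul (θ - 1)⁻¹
    have e := H.test_mul hD hW a x0
    have hgd : Good D fun x => g (dil x0 θ x) :=
      ⟨MemLp.comp_dil hgg.mem x0 hθp, fun x hx => hgg.zero _ (notMem_dil hc hx0 hθ1.le hx)⟩
    have i1 := hgg.int_nsqw hD hη
    have i2 := hgd.int_nsqw hD hη
    have b1 : (∫ x, inner ℝ (g x) ((θ - 1)⁻¹ • (θ • g (dil x0 θ x) + (-1 : ℝ) • g x)) * gwt a x0 x)
        ≤ (θ - 1)⁻¹ * ((θ / 2 - 1) * I a + θ / 2 * ∫ x, ‖g (dil x0 θ x)‖ ^ 2 * gwt a x0 x) := by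
      rw [hI, ← integral_lin2 i1 i2, ← integral_const_mul]
      refine integral_mono (hgg.int_innerw hD hW.good_grad hη)
        (((i1.const_mul _).add (i2.const_mul _)).const_mul _) fun x => ?_
      simp only [real_inner_smul_right, inner_add_right, real_inner_self_eq_norm_sq]
      have h1 : inner ℝ (g x) (g (dil x0 θ x)) ≤ (‖g x‖ ^ 2 + ‖g (dil x0 θ x)‖ ^ 2) / 2 := by
        nlinarith [real_inner_le_norm (g x) (g (dil x0 θ x)),
          sq_nonneg (‖g x‖ - ‖g (dil x0 θ x)‖)]
      have h2 : 0 ≤ (θ - 1)⁻¹ * gwt a x0 x := mul_nonneg (inv_nonneg.2 hθ0.le) (gwt_pos _ _ _).le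
      have h3 := mul_le_mul_of_nonneg_left h1 hθp.le
      have h4 := mul_le_mul_of_nonneg_left h3 h2
      nlinarith
    have b2 : ∫ x, ‖g (dil x0 θ x)‖ ^ 2 * gwt a x0 x = (θ ^ m)⁻¹ * I (a * (θ ^ 2)⁻¹) := by
      have := integral_dil (fun y => ‖g y‖ ^ 2 * gwt (a * (θ ^ 2)⁻¹) x0 y) x0 hθp
      rw [smul_eq_mul] at this
      rw [hI, ← this]
      congr 1; funext x; congr 1
      simp only [gwt, dil_sub, norm_smul, mul_pow, Real.norm_eq_abs, sq_abs]
      congr 1; field_simp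
    have b3 : slope Φ 1 θ = (θ - 1)⁻¹ * Φ θ := by
      rw [slope_def_field, hΦ1, sub_zero, div_eq_inv_mul]
    rw [b3, hΦ]
    rw [b2] at b1
    refine le_trans (le_of_eq ?_) b1
    have f1 : ∀ k : Euc m → ℝ, (fun x => k x * ((θ - 1)⁻¹ * (u (dil x0 θ x) + -1 * u x))) =
        fun x => k x * ((θ - 1)⁻¹ * (u (dil x0 θ x) - u x)) := fun k => by
      funext x; ring
    have f2 : (∫ x, gwt a x0 x * h x * ((θ - 1)⁻¹ * (u (dil x0 θ x) - u x))) =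
        ∫ x, h x * ((θ - 1)⁻¹ * (u (dil x0 θ x) + -1 * u x)) * gwt a x0 x := by
      congr 1; funext x; ring
    have f3 : (∫ x, gwt a x0 x * inner ℝ (x - x0) (g x) *
          ((θ - 1)⁻¹ * (u (dil x0 θ x) - u x))) =
        ∫ x, (θ - 1)⁻¹ * (u (dil x0 θ x) + -1 * u x) * inner ℝ (x - x0) (g x) * gwt a x0 x := by
      congr 1; funext x; ring
    have f4 : (∫ x, ‖x‖ ^ 2 * gwt a x0 x * u x * ((θ - 1)⁻¹ * (u (dil x0 θ x) - u x))) =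
        ∫ x, u x * ((θ - 1)⁻¹ * (u (dil x0 θ x) + -1 * u x)) * (‖x‖ ^ 2 * gwt a x0 x) := by
      congr 1; funext x; ring
    rw [f2, f3, f4, e]; ring
  have fin := le_of_tendsto_of_tendsto T hs key
  have g1 : (∫ x, gwt a x0 x * h x * inner ℝ (x - x0) (g x)) =
      ∫ x, h x * inner ℝ (x - x0) (g x) * gwt a x0 x := by congr 1; funext x; ring
  have g2 : (∫ x, gwt a x0 x * inner ℝ (x - x0) (g x) * inner ℝ (x - x0) (g x)) =
      ∫ x, (inner ℝ (x - x0) (g x)) ^ 2 * gwt a x0 x := by congr 1; funext x; ring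
  have g3 : (∫ x, ‖x‖ ^ 2 * gwt a x0 x * u x * inner ℝ (x - x0) (g x)) =
      ∫ x, u x * inner ℝ (x - x0) (g x) * (‖x‖ ^ 2 * gwt a x0 x) := by congr 1; funext x; ring
  rw [g1, g2, g3] at fin
  exact fin

end Rellich

/-! ### Flows -/

section Flow

variable {m : ℕ} {D : Set (Euc m)}

/-- A solution of `∂ₜv = -h`, `-Δv + c²‖x‖²v = h`, with enough regularity to differentiate the
weighted energies in time. -/
structure HeatFlow (D : Set (Euc m)) (c : ℝ) (v : ℝ → Euc m → ℝ) (g : ℝ → Euc m → Euc m)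
    (h : ℝ → Euc m → ℝ) (gh : ℝ → Euc m → Euc m) : Prop where
  weak : ∀ t, IsWeak D c (v t) (g t) (h t)
  h10h : ∀ t, H10 D (h t) (gh t)
  deriv_v : ∀ (x0 : Euc m) {b : ℝ → ℝ} {b' t : ℝ}, HasDerivAt b b' t →
    HasDerivAt (fun t => ∫ x, v t x ^ 2 * gwt (b t) x0 x)
      (-2 * (∫ x, v t x * h t x * gwt (b t) x0 x)
        + b' * ∫ x, v t x ^ 2 * (‖x - x0‖ ^ 2 * gwt (b t) x0 x)) t
  deriv_g : ∀ (x0 : Euc m) {b : ℝ → ℝ} {b' t : ℝ}, HasDerivAt b b' t →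
    HasDerivAt (fun t => ∫ x, ‖g t x‖ ^ 2 * gwt (b t) x0 x)
      (-2 * (∫ x, inner ℝ (g t x) (gh t x) * gwt (b t) x0 x)
        + b' * ∫ x, ‖g t x‖ ^ 2 * (‖x - x0‖ ^ 2 * gwt (b t) x0 x)) t
  deriv_vx : ∀ (x0 : Euc m) {b : ℝ → ℝ} {b' t : ℝ}, HasDerivAt b b' t →
    HasDerivAt (fun t => ∫ x, v t x ^ 2 * (‖x‖ ^ 2 * gwt (b t) x0 x))
      (-2 * (∫ x, v t x * h t x * (‖x‖ ^ 2 * gwt (b t) x0 x))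
        + b' * ∫ x, v t x ^ 2 * (‖x‖ ^ 2 * (‖x - x0‖ ^ 2 * gwt (b t) x0 x))) t
  deriv_pair : ∀ (ζ : ℝ → Euc m → ℝ) (ζ' : Euc m → ℝ) (t : ℝ),
    (∀ f, Good D f → HasDerivAt (fun t => ∫ x, f x * ζ t x) (∫ x, f x * ζ' x) t) →
    (∀ f, Good D f → Integrable fun x => f x * ζ' x) →
    (∀ s, ∀ f, Good D f → Integrable fun x => f x * ζ s x) →
    HasDerivAt (fun t => ∫ x, v t x * ζ t x) (-(∫ x, h t x * ζ t x) + ∫ x, v t x * ζ' x) t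
  cont_loc : ∀ S : Set (Euc m), Continuous fun t => ∫ x in S, v t x ^ 2

/-- `Σ_j a_j exp(-λ_j t) f_j`. -/
noncomputable def comb {ι F : Type*} [Fintype ι] [AddCommMonoid F] [Module ℝ F]
    (a l : ι → ℝ) (f : ι → Euc m → F) (t : ℝ) (x : Euc m) : F :=
  ∑ j, (a j * Real.exp (-(l j) * t)) • f j x

variable {ι : Type*} [Fintype ι] {F : Type*} [NormedAddCommGroup F] [InnerProductSpace ℝ F]

theorem hasDerivAt_coeff (a l t : ℝ) :
    HasDerivAt (fun t => a * Real.exp (-l * t)) (-(l * a * Real.exp (-l * t))) t := by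
  have := (((hasDerivAt_id t).const_mul (-l)).exp).const_mul a
  refine this.congr_deriv ?_
  simp only [id_eq]; ring

theorem integral_inner_comb (hD : Bornology.IsBounded D) {f : ι → Euc m → F}
    (hf : ∀ j, Good D (f j)) (a a' l : ι → ℝ) (t : ℝ) {w : Euc m → ℝ} (hw : Continuous w) :
    ∫ x, inner ℝ (comb a l f t x) (comb a' l f t x) * w x =
      ∑ i, ∑ j, (a i * Real.exp (-(l i) * t)) * (a' j * Real.exp (-(l j) * t)) *
        ∫ x, inner ℝ (f i x) (f j x) * w x := by
  have hi : ∀ i j, Integrable fun x => inner ℝ (f i x) (f j x) * w x := fun i j =>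
    (hf i).int_innerw hD (hf j) hw
  have e : ∀ x, inner ℝ (comb a l f t x) (comb a' l f t x) * w x =
      ∑ i, ∑ j, (a i * Real.exp (-(l i) * t)) * (a' j * Real.exp (-(l j) * t)) *
        (inner ℝ (f i x) (f j x) * w x) := fun x => by
    simp only [comb]
    rw [sum_inner, Finset.sum_mul]
    refine Finset.sum_congr rfl fun i _ => ?_
    rw [inner_sum, Finset.sum_mul]
    refine Finset.sum_congr rfl fun j _ => ?_
    rw [real_inner_smul_left, real_inner_smul_right]; ring
  simp only [e]
  rw [integral_finsetSum _ fun i _ => integrable_finsetSum _ fun j _ => (hi i j).const_mul _]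
  · refine Finset.sum_congr rfl fun i _ => ?_
    rw [integral_finsetSum _ fun j _ => (hi i j).const_mul _]
    simp only [integral_const_mul]

theorem hasDerivAt_integral_comb (hD : Bornology.IsBounded D) {f : ι → Euc m → F}
    (hf : ∀ j, Good D (f j)) (a l : ι → ℝ) (x0 : Euc m) {b : ℝ → ℝ} {b' t : ℝ}
    (hb : HasDerivAt b b' t) :
    HasDerivAt (fun t => ∫ x, ‖comb a l f t x‖ ^ 2 * gwt (b t) x0 x)
      (-2 * (∫ x, inner ℝ (comb a l f t x) (comb (fun j => l j * a j) l f t x) * gwt (b t) x0 x)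
        + b' * ∫ x, ‖comb a l f t x‖ ^ 2 * (‖x - x0‖ ^ 2 * gwt (b t) x0 x)) t := by
  have hη : ∀ b, Continuous (gwt b x0) := fun b => continuous_gwt b x0
  have hX : Continuous fun x : Euc m => ‖x - x0‖ ^ 2 := by fun_prop
  set P : ι → ι → ℝ → ℝ := fun i j b => ∫ x, inner ℝ (f i x) (f j x) * gwt b x0 x with hP
  have dP : ∀ i j, HasDerivAt (fun t => P i j (b t))
      (b' * ∫ x, inner ℝ (f i x) (f j x) * (‖x - x0‖ ^ 2 * gwt (b t) x0 x)) t := fun i j => by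
    have := (hasDerivAt_integral_gwt hD ((hf i).int_inner (hf j))
      (fun x hx => by simp [(hf i).zero x hx]) x0 (b t)).comp t hb
    exact this.congr_deriv (mul_comm _ _)
  have e : (fun t => ∫ x, ‖comb a l f t x‖ ^ 2 * gwt (b t) x0 x) = fun t =>
      ∑ i, ∑ j, (a i * Real.exp (-(l i) * t)) * (a j * Real.exp (-(l j) * t)) * P i j (b t) := by
    funext t
    simp only [← real_inner_self_eq_norm_sq]
    exact integral_inner_comb hD hf a a l t (hη _)
  have d : HasDerivAt (fun t =>
      ∑ i, ∑ j, (a i * Real.exp (-(l i) * t)) * (a j * Real.exp (-(l j) * t)) * P i j (b t))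
      (∑ i, ∑ j, ((-(l i * a i * Real.exp (-(l i) * t)) * (a j * Real.exp (-(l j) * t)) +
        (a i * Real.exp (-(l i) * t)) * -(l j * a j * Real.exp (-(l j) * t))) * P i j (b t) +
        (a i * Real.exp (-(l i) * t)) * (a j * Real.exp (-(l j) * t)) *
        (b' * ∫ x, inner ℝ (f i x) (f j x) * (‖x - x0‖ ^ 2 * gwt (b t) x0 x)))) t := by
    refine HasDerivAt.fun_sum fun i _ => HasDerivAt.fun_sum fun j _ => ?_
    exact ((hasDerivAt_coeff (a i) (l i) t).mul (hasDerivAt_coeff (a j) (l j) t)).mul (dP i j)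
  rw [e]
  refine d.congr_deriv ?_
  simp only [← real_inner_self_eq_norm_sq (comb a l f t _)]
  rw [integral_inner_comb hD hf a _ l t (hη _),
    integral_inner_comb hD hf a a l t (w := fun x => ‖x - x0‖ ^ 2 * gwt (b t) x0 x)
      (hX.mul (hη _))]
  have sw : ∑ i, ∑ j, (a i * Real.exp (-(l i) * t)) * (l j * a j * Real.exp (-(l j) * t)) *
      P i j (b t) = ∑ i, ∑ j, (l i * a i * Real.exp (-(l i) * t)) * (a j * Real.exp (-(l j) * t)) *
      P i j (b t) := by
    rw [Finset.sum_comm]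
    refine Finset.sum_congr rfl fun i _ => Finset.sum_congr rfl fun j _ => ?_
    have : P j i (b t) = P i j (b t) := by
      simp only [hP]; congr 1; funext x; rw [real_inner_comm]
    rw [this]; ring
  have : ∀ S S' Q : ℝ, S = S' → -2 * S + b' * Q = -S' + -S + b' * Q := by
    intro S S' Q h; rw [h]; ring
  rw [this _ _ _ sw, Finset.mul_sum, ← Finset.sum_neg_distrib, ← Finset.sum_neg_distrib,
    ← Finset.sum_add_distrib, ← Finset.sum_add_distrib]
  refine Finset.sum_congr rfl fun i _ => ?_
  rw [Finset.mul_sum, ← Finset.sum_neg_distrib, ← Finset.sum_neg_distrib,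
    ← Finset.sum_add_distrib, ← Finset.sum_add_distrib]
  refine Finset.sum_congr rfl fun j _ => ?_
  ring

theorem H10.comb {e : ι → Euc m → ℝ} {g : ι → Euc m → Euc m}
    (H : ∀ j, H10 D (e j) (g j)) (a l : ι → ℝ) (t : ℝ) :
    H10 D (_root_.comb a l e t) (_root_.comb a l g t) :=
  H10.sum Finset.univ fun j _ => (H j).const_mul _

/-- Finite combinations of eigenmodes are flows. -/
theorem flow_comb (hD : Bornology.IsBounded D) {c : ℝ} {l : ι → ℝ} {e : ι → Euc m → ℝ}
    {g : ι → Euc m → Euc m} (H : ∀ j, IsWeak D c (e j) (g j) (fun x => l j * e j x))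
    (a : ι → ℝ) :
    HeatFlow D c (comb a l e) (comb a l g) (comb (fun j => l j * a j) l e)
      (comb (fun j => l j * a j) l g) := by
  have he : ∀ j, Good D (e j) := fun j => (H j).h10.good
  have hg : ∀ j, Good D (g j) := fun j => (H j).h10.good_grad
  have hev : ∀ j, Good D (fun x => e j x • x) := fun j => (he j).smul_vec hD continuous_id
  refine ⟨fun t => ?_, fun t => H10.comb (fun j => (H j).h10) _ l t, ?_, ?_, ?_, ?_, ?_⟩
  · have := IsWeak.sum hD Finset.univ fun j (_ : j ∈ Finset.univ) =>
      (H j).const_mul (a j * Real.exp (-(l j) * t))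
    have e' : comb (fun j => l j * a j) l e t =
        fun x => ∑ j, a j * Real.exp (-(l j) * t) * (l j * e j x) := by
      funext x
      refine Finset.sum_congr rfl fun j _ => ?_
      rw [smul_eq_mul]; ring
    rw [e']
    exact this
  · intro x0 b b' t hb
    have := hasDerivAt_integral_comb hD he a l x0 hb
    simp only [Real.norm_eq_abs, sq_abs, RCLike.inner_apply, conj_trivial] at this
    refine this.congr_deriv ?_
    congr 3; funext x; ring
  · intro x0 b b' t hb
    exact hasDerivAt_integral_comb hD hg a l x0 hb
  · intro x0 b b' t hb
    have := hasDerivAt_integral_comb hD hev a l x0 hb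
    have e1 : ∀ a : ι → ℝ, ∀ t x, comb a l (fun j x => e j x • x) t x = comb a l e t x • x := by
      intro a t x
      simp only [comb, Finset.sum_smul, smul_assoc]
    simp only [e1, norm_smul, real_inner_smul_left, real_inner_smul_right, mul_pow,
      Real.norm_eq_abs, sq_abs, real_inner_self_eq_norm_sq, mul_assoc] at this ⊢
    refine this.congr_deriv ?_
    congr 3; funext x; ring
  · intro ζ ζ' t hd hi hi'
    have e1 : ∀ a : ι → ℝ, ∀ t, ∀ ζ : Euc m → ℝ, (∀ f, Good D f → Integrable fun x => f x * ζ x) →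
        ∫ x, comb a l e t x * ζ x = ∑ j, (a j * Real.exp (-(l j) * t)) * ∫ x, e j x * ζ x := by
      intro a t ζ hi
      simp only [comb, Finset.sum_mul, smul_eq_mul, mul_assoc]
      rw [integral_finsetSum _ fun j _ => ?_]
      · simp only [integral_const_mul]
      · exact ((hi _ (he j)).const_mul _).const_mul _
    have e2 : (fun t => ∫ x, comb a l e t x * ζ t x) = fun t =>
        ∑ j, (a j * Real.exp (-(l j) * t)) * ∫ x, e j x * ζ t x := by
      funext t; exact e1 a t (ζ t) (hi' t)
    rw [e2]
    have d := HasDerivAt.fun_sum (u := Finset.univ) fun j (_ : j ∈ Finset.univ) =>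
      (hasDerivAt_coeff (a j) (l j) t).mul (hd (e j) (he j))
    refine d.congr_deriv ?_
    rw [e1 _ t _ (hi' t), e1 _ t _ hi, ← Finset.sum_neg_distrib, ← Finset.sum_add_distrib]
    refine Finset.sum_congr rfl fun j _ => ?_
    ring
  · intro S
    have e1 : (fun t => ∫ x in S, comb a l e t x ^ 2) = fun t => ∑ i, ∑ j,
        (a i * Real.exp (-(l i) * t)) * (a j * Real.exp (-(l j) * t)) *
          ∫ x in S, e i x * e j x := by
      funext t
      have hi : ∀ i j, IntegrableOn (fun x => e i x * e j x) S := fun i j =>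
        ((he i).int_mul (he j)).integrableOn
      have e2 : ∀ x, comb a l e t x ^ 2 = ∑ i, ∑ j,
          (a i * Real.exp (-(l i) * t)) * (a j * Real.exp (-(l j) * t)) * (e i x * e j x) := by
        intro x
        simp only [comb, smul_eq_mul, sq, Finset.sum_mul_sum]
        refine Finset.sum_congr rfl fun i _ => Finset.sum_congr rfl fun j _ => ?_
        ring
      simp only [e2]
      rw [integral_finsetSum _ fun i _ => integrable_finsetSum _ fun j _ => (hi i j).const_mul _]
      refine Finset.sum_congr rfl fun i _ => ?_
      rw [integral_finsetSum _ fun j _ => (hi i j).const_mul _]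
      simp only [integral_const_mul]
    rw [e1]
    fun_prop

end Flow

/-! ### Energy estimates for flows -/

section FlowEst

variable {m : ℕ} {D : Set (Euc m)} {c : ℝ} {v : ℝ → Euc m → ℝ} {g : ℝ → Euc m → Euc m}
  {h : ℝ → Euc m → ℝ} {gh : ℝ → Euc m → Euc m}

theorem HeatFlow.good (F : HeatFlow D c v g h gh) (t : ℝ) : Good D (v t) := (F.weak t).h10.good

theorem HeatFlow.hasDerivAt_mass (F : HeatFlow D c v g h gh) (t : ℝ) :
    HasDerivAt (fun t => ∫ x, v t x ^ 2) (-2 * ∫ x, h t x * v t x) t := by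
  have := F.deriv_v 0 (hasDerivAt_const t (0:ℝ))
  simp only [gwt_zero, mul_one, zero_mul, add_zero] at this
  refine this.congr_deriv ?_
  congr 2; funext x; ring

theorem HeatFlow.mass_decay (F : HeatFlow D c v g h gh) {K : ℝ}
    (hK : ∀ t, K * ∫ x, v t x ^ 2 ≤ ∫ x, h t x * v t x) {s t : ℝ} (hst : s ≤ t) :
    ∫ x, v t x ^ 2 ≤ Real.exp (-(2 * K * (t - s))) * ∫ x, v s x ^ 2 := by
  have d : ∀ t, HasDerivAt (fun t => Real.exp (2 * K * t) * ∫ x, v t x ^ 2)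
      (Real.exp (2 * K * t) * (2 * K) * (∫ x, v t x ^ 2) +
        Real.exp (2 * K * t) * (-2 * ∫ x, h t x * v t x)) t := fun t => by
    have := ((hasDerivAt_id t).const_mul (2 * K)).exp.fun_mul (F.hasDerivAt_mass t)
    refine this.congr_deriv ?_
    simp
  have := antitone_of_hasDerivAt_nonpos d (fun t => by
    have h1 := hK t
    have h2 := Real.exp_pos (2 * K * t)
    simp only [Pi.zero_apply]
    nlinarith) hst
  simp only at this
  have e : Real.exp (-(2 * K * (t - s))) = Real.exp (2 * K * s) / Real.exp (2 * K * t) := by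
    rw [← Real.exp_sub]; congr 1; ring
  rw [e, div_mul_eq_mul_div, le_div_iff₀ (Real.exp_pos _), mul_comm]
  exact this

theorem HeatFlow.decay_uncertainty (hD : Bornology.IsBounded D) (F : HeatFlow D c v g h gh)
    {s t : ℝ} (hst : s ≤ t) :
    ∫ x, v t x ^ 2 ≤ Real.exp (-(2 * (m * c) * (t - s))) * ∫ x, v s x ^ 2 :=
  F.mass_decay (fun t => ((F.weak t).h10.uncertainty hD c).trans ((F.weak t).energy hD).ge) hst

theorem HeatFlow.decay_poincare {R : ℝ} (hR : 0 < R) (hDR : D ⊆ ball 0 R)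
    (F : HeatFlow D c v g h gh) {s t : ℝ} (hst : s ≤ t) :
    ∫ x, v t x ^ 2 ≤ Real.exp (-(2 * (m ^ 2 / (4 * R ^ 2)) * (t - s))) * ∫ x, v s x ^ 2 := by
  refine F.mass_decay (fun t => ((F.weak t).h10.poincare hR hDR).trans ?_) hst
  rw [(F.weak t).energy (isBounded_ball.subset hDR)]
  have : 0 ≤ ∫ x, v t x ^ 2 * ‖x‖ ^ 2 := integral_nonneg fun x => by positivity
  nlinarith [sq_nonneg c]

theorem HeatFlow.mass_antitone (hD : Bornology.IsBounded D) (F : HeatFlow D c v g h gh)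
    {s t : ℝ} (hst : s ≤ t) : ∫ x, v t x ^ 2 ≤ ∫ x, v s x ^ 2 := by
  have := F.mass_decay (K := 0) (fun t => by
    rw [(F.weak t).energy hD]
    have : 0 ≤ ∫ x, v t x ^ 2 * ‖x‖ ^ 2 := integral_nonneg fun x => by positivity
    have : 0 ≤ ∫ x, ‖g t x‖ ^ 2 := integral_nonneg fun x => by positivity
    rw [zero_mul]; positivity) hst
  simpa using this

/-- Gaussian decay of flows at infinity. -/
theorem HeatFlow.gauss_bound (hD : Bornology.IsBounded D) (F : HeatFlow D c v g h gh) (hc : 0 < c)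
    {t0 t : ℝ} (ht : t0 ≤ t) :
    ∫ x, v t x ^ 2 * gwt (2 * c ^ 2 * (t - t0) / (1 + 2 * c * (t - t0))) 0 x
      ≤ ∫ x, v t0 x ^ 2 := by
  set a : ℝ → ℝ := fun t => 2 * c ^ 2 * (t - t0) / (1 + 2 * c * (t - t0)) with ha
  have hpos : ∀ s, t0 ≤ s → 0 < 1 + 2 * c * (s - t0) := fun s hs => by
    have : 0 ≤ s - t0 := by linarith
    positivity
  have da : ∀ s, t0 ≤ s → HasDerivAt a (2 * c ^ 2 / (1 + 2 * c * (s - t0)) ^ 2) s := fun s hs => by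
    have d1 := ((hasDerivAt_id s).sub_const t0).const_mul (2 * c ^ 2)
    have d2 := (((hasDerivAt_id s).sub_const t0).const_mul (2 * c)).const_add 1
    refine (d1.div d2 (hpos s hs).ne').congr_deriv ?_
    simp only [id_eq]; congr 1; ring
  have dI : ∀ s, t0 ≤ s → _ := fun s hs => F.deriv_v 0 (da s hs)
  have key := antitoneOn_of_hasDerivWithinAt_nonpos (convex_Ici t0)
    (fun s hs => (dI s hs).continuousAt.continuousWithinAt)
    (fun s hs => (dI s (interior_subset hs)).hasDerivWithinAt) (fun s hs => by
      have hs' : t0 ≤ s := interior_subset hs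
      have w := (F.weak s).weighted_energy hD (a s)
      have hV : 0 ≤ ∫ x, v s x ^ 2 * (‖x‖ ^ 2 * gwt (a s) 0 x) :=
        integral_nonneg fun x => by have := gwt_pos (a s) 0 x; positivity
      have e : ∫ x, v s x * h s x * gwt (a s) 0 x = ∫ x, h s x * v s x * gwt (a s) 0 x := by
        congr 1; funext x; ring
      simp only [sub_zero]
      rw [e]
      have hab : 2 * c ^ 2 / (1 + 2 * c * (s - t0)) ^ 2 ≤ 2 * (c ^ 2 - a s ^ 2) := by
        have hp := hpos s hs'
        have h0 : 0 ≤ s - t0 := by linarith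
        rw [ha, div_pow, div_le_iff₀ (by positivity)]
        have : 2 * (c ^ 2 - (2 * c ^ 2 * (s - t0)) ^ 2 / (1 + 2 * c * (s - t0)) ^ 2) *
          (1 + 2 * c * (s - t0)) ^ 2 = 2 * c ^ 2 * (1 + 4 * c * (s - t0)) := by
          field_simp; ring
        rw [this]
        have : 0 ≤ c * (s - t0) := by positivity
        nlinarith [sq_nonneg c]
      nlinarith [mul_le_mul_of_nonneg_right hab hV])
  have := key (mem_Ici.2 le_rfl) (mem_Ici.2 ht) ht
  simp only [ha, sub_self, mul_zero, zero_div, gwt_zero, mul_one] at this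
  exact this

end FlowEst

/-! ### Parabolic frequency function -/

section Frequency

variable {m : ℕ} {D : Set (Euc m)} {c : ℝ}

theorem IsWeak.weighted_rate (hD : Bornology.IsBounded D) {u h : Euc m → ℝ} {g : Euc m → Euc m}
    (H : IsWeak D c u g h) (x0 : Euc m) (b : ℝ) :
    -2 * (∫ x, u x * h x * gwt b x0 x) + -(4 * b ^ 2) * ∫ x, u x ^ 2 * (‖x - x0‖ ^ 2 * gwt b x0 x)
      = -2 * ((∫ x, ‖g x‖ ^ 2 * gwt b x0 x) + c ^ 2 * ∫ x, u x ^ 2 * (‖x‖ ^ 2 * gwt b x0 x))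
        + 2 * b * m * ∫ x, u x ^ 2 * gwt b x0 x := by
  have e1 := H.test_mul hD H.h10 b x0
  have e2 := H.h10.integral_radial_gwt hD b x0
  simp only [real_inner_self_eq_norm_sq] at e1
  have s1 : ∫ x, h x * u x * gwt b x0 x = ∫ x, u x * h x * gwt b x0 x := by
    congr 1; funext x; ring
  have s2 : ∫ x, u x * u x * (‖x‖ ^ 2 * gwt b x0 x) = ∫ x, u x ^ 2 * (‖x‖ ^ 2 * gwt b x0 x) := by
    congr 1; funext x; ring
  rw [s1, s2] at e1
  linear_combination -2 * e1 - 2 * b * e2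

theorem IsWeak.energy_rate (hD : Bornology.IsBounded D) (hcv : Convex ℝ D) {R : ℝ} {x0 : Euc m}
    (hx0 : x0 ∈ D) (hR : ‖x0‖ ≤ R) {u h : Euc m → ℝ} {g gh : Euc m → Euc m}
    (H : IsWeak D c u g h) (Hh : H10 D h gh) {b : ℝ} (hb : b ≤ 0) :
    (-2 * (∫ x, inner ℝ (g x) (gh x) * gwt b x0 x)
        + -(4 * b ^ 2) * ∫ x, ‖g x‖ ^ 2 * (‖x - x0‖ ^ 2 * gwt b x0 x))
      + c ^ 2 * (-2 * (∫ x, u x * h x * (‖x‖ ^ 2 * gwt b x0 x))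
        + -(4 * b ^ 2) * ∫ x, u x ^ 2 * (‖x‖ ^ 2 * (‖x - x0‖ ^ 2 * gwt b x0 x)))
    ≤ -2 * (∫ x, (h x + (-2 * b) * inner ℝ (x - x0) (g x)) ^ 2 * gwt b x0 x)
      - 2 * b * (2 - m) * ((∫ x, ‖g x‖ ^ 2 * gwt b x0 x)
        + c ^ 2 * ∫ x, u x ^ 2 * (‖x‖ ^ 2 * gwt b x0 x))
      - b * c ^ 2 * R ^ 2 / 2 * ∫ x, u x ^ 2 * gwt b x0 x := by
  have hη := continuous_gwt b x0
  have hX : Continuous fun x : Euc m => x - x0 := by fun_prop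
  have hN : Continuous fun x : Euc m => ‖x‖ ^ 2 := by fun_prop
  have hNη : Continuous fun x : Euc m => ‖x‖ ^ 2 * gwt b x0 x := hN.mul hη
  have hZ := H.h10.good_grad.inner_vec hD hX
  have e1 := H.test_mul hD Hh b x0
  have e2 := H.rellich hD hcv hx0 b
  have e3 := H.h10.integral_radial_sq_gwt hD b x0
  have e4 : ∫ x, (h x + (-2 * b) * inner ℝ (x - x0) (g x)) ^ 2 * gwt b x0 x
      = (∫ x, h x * h x * gwt b x0 x)
        + -4 * b * (∫ x, h x * inner ℝ (x - x0) (g x) * gwt b x0 x)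
        + 4 * b ^ 2 * ∫ x, (inner ℝ (x - x0) (g x)) ^ 2 * gwt b x0 x := by
    have := integral_lin3 (H.good_h.int_mulw hD H.good_h hη) (H.good_h.int_mulw hD hZ hη)
      (hZ.int_sqw hD hη) 1 (-4 * b) (4 * b ^ 2)
    rw [one_mul] at this
    refine Eq.trans ?_ this
    congr 1; funext x; ring
  have e5 : 0 ≤ (∫ x, u x ^ 2 * (‖x‖ ^ 2 * gwt b x0 x))
      + (∫ x, u x ^ 2 * (inner ℝ (x - x0) x * gwt b x0 x))
      + R ^ 2 / 8 * ∫ x, u x ^ 2 * gwt b x0 x := by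
    have := integral_lin3 (H.h10.good.int_sqw hD hNη) (H.h10.good.int_sqw hD
      (b := fun x => inner ℝ (x - x0) x * gwt b x0 x) (by fun_prop))
      (H.h10.good.int_sqw hD hη) 1 1 (R ^ 2 / 8)
    rw [one_mul, one_mul] at this
    rw [← this]
    refine integral_nonneg fun x => ?_
    have h1 : (inner ℝ (x - x0) x : ℝ) = ‖x‖ ^ 2 - inner ℝ x0 x := by
      rw [inner_sub_left, real_inner_self_eq_norm_sq]
    have h2 : (inner ℝ x0 x : ℝ) ≤ R * ‖x‖ :=
      (real_inner_le_norm _ _).trans (by gcongr)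
    have h3 : 0 ≤ ‖x‖ ^ 2 + inner ℝ (x - x0) x + R ^ 2 / 8 := by
      rw [h1]; nlinarith [sq_nonneg (4 * ‖x‖ - R)]
    have h4 : 0 ≤ u x ^ 2 * gwt b x0 x := mul_nonneg (sq_nonneg _) (gwt_pos _ _ _).le
    show 0 ≤ _
    nlinarith [mul_nonneg h3 h4]
  have s1 : ∫ x, h x * u x * (‖x‖ ^ 2 * gwt b x0 x) = ∫ x, u x * h x * (‖x‖ ^ 2 * gwt b x0 x) := by
    congr 1; funext x; ring
  have s2 : ∫ x, u x ^ 2 * (‖x‖ ^ 2 * (‖x - x0‖ ^ 2 * gwt b x0 x))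
      = ∫ x, u x ^ 2 * (‖x‖ ^ 2 * ‖x - x0‖ ^ 2 * gwt b x0 x) := by
    congr 1; funext x; ring
  rw [s2, e4]
  nlinarith [mul_le_mul_of_nonneg_left e2 (show 0 ≤ -4 * b by linarith),
    mul_nonneg (mul_nonneg (show 0 ≤ -4 * b by linarith) (sq_nonneg c)) e5,
    congrArg (fun z => b * c ^ 2 * z) e3, e1]

theorem IsWeak.energy_sq_le (hD : Bornology.IsBounded D) {x0 : Euc m}
    {u h : Euc m → ℝ} {g : Euc m → Euc m}
    (H : IsWeak D c u g h) (b : ℝ) :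
    ((∫ x, ‖g x‖ ^ 2 * gwt b x0 x) + c ^ 2 * ∫ x, u x ^ 2 * (‖x‖ ^ 2 * gwt b x0 x)) ^ 2
    ≤ (∫ x, (h x + (-2 * b) * inner ℝ (x - x0) (g x)) ^ 2 * gwt b x0 x) *
      ∫ x, u x ^ 2 * gwt b x0 x := by
  have hη := continuous_gwt b x0
  have hX : Continuous fun x : Euc m => x - x0 := by fun_prop
  have hZ := H.h10.good_grad.inner_vec hD hX
  have hk : Good D fun x => h x + (-2 * b) * inner ℝ (x - x0) (g x) :=
    H.good_h.add (hZ.const_smul (-2 * b))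
  have e1 := H.test_mul hD H.h10 b x0
  have e2 : ∫ x, (h x + (-2 * b) * inner ℝ (x - x0) (g x)) * u x * gwt b x0 x =
      (∫ x, h x * u x * gwt b x0 x)
        + (-2 * b) * ∫ x, u x * inner ℝ (x - x0) (g x) * gwt b x0 x := by
    have := integral_lin2 (H.good_h.int_mulw hD H.h10.good hη) (H.h10.good.int_mulw hD hZ hη)
      1 (-2 * b)
    rw [one_mul] at this
    refine Eq.trans ?_ this
    congr 1; funext x; ring
  have hr : Continuous fun x : Euc m => Real.sqrt (gwt b x0 x) := hη.sqrt
  have cs := abs_integral_inner_le (hk.mul hD hr).mem (H.h10.good.mul hD hr).mem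
  have r : ∀ x : Euc m, Real.sqrt (gwt b x0 x) * Real.sqrt (gwt b x0 x) = gwt b x0 x := fun x =>
    Real.mul_self_sqrt (gwt_pos _ _ _).le
  have c1 : ∀ x, (inner ℝ (Real.sqrt (gwt b x0 x) * (h x + (-2 * b) * inner ℝ (x - x0) (g x)))
      (Real.sqrt (gwt b x0 x) * u x) : ℝ) =
      (h x + (-2 * b) * inner ℝ (x - x0) (g x)) * u x * gwt b x0 x := fun x => by
    simp only [RCLike.inner_apply, conj_trivial]
    linear_combination (h x + (-2 * b) * inner ℝ (x - x0) (g x)) * u x * r x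
  have c2 : ∀ (k : Euc m → ℝ) (x : Euc m), ‖Real.sqrt (gwt b x0 x) * k x‖ ^ 2 = k x ^ 2 * gwt b x0 x :=
    fun k x => by
      rw [Real.norm_eq_abs, sq_abs]; linear_combination k x ^ 2 * r x
  have c3 := c2 (fun x => h x + (-2 * b) * inner ℝ (x - x0) (g x))
  simp only [c1, c2 u, c3, e2] at cs
  refine le_trans (le_of_eq ?_) cs
  congr 1
  simp only [real_inner_self_eq_norm_sq] at e1
  have s2 : ∫ x, u x * u x * (‖x‖ ^ 2 * gwt b x0 x) = ∫ x, u x ^ 2 * (‖x‖ ^ 2 * gwt b x0 x) := by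
    congr 1; funext x; ring
  rw [s2] at e1
  linarith

theorem H10.concentration (hD : Bornology.IsBounded D) {u : Euc m → ℝ} {g : Euc m → Euc m}
    (h : H10 D u g) {s : ℝ} (hs : 0 < s) (x0 : Euc m) :
    ∫ x, u x ^ 2 * (‖x - x0‖ ^ 2 * gwt (-(4 * s)⁻¹) x0 x)
      ≤ 4 * s * (m * (∫ x, u x ^ 2 * gwt (-(4 * s)⁻¹) x0 x)
        + 4 * s * ∫ x, ‖g x‖ ^ 2 * gwt (-(4 * s)⁻¹) x0 x) := by
  set b := -(4 * s)⁻¹ with hb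
  have hη := continuous_gwt b x0
  have hX : Continuous fun x : Euc m => x - x0 := by fun_prop
  have hNη : Continuous fun x : Euc m => ‖x - x0‖ ^ 2 * gwt b x0 x := by fun_prop
  have e := h.integral_radial_gwt hD b x0
  have hZ := h.good_grad.inner_vec hD hX
  have := integral_lin3 (h.good.int_sqw hD hNη) (h.good.int_mulw hD hZ hη)
    (h.good_grad.int_nsqw hD hη) 1 (-8 * s) (16 * s ^ 2)
  have h0 : 0 ≤ ∫ x, (1 * (u x ^ 2 * (‖x - x0‖ ^ 2 * gwt b x0 x))
      + -8 * s * (u x * inner ℝ (x - x0) (g x) * gwt b x0 x)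
      + 16 * s ^ 2 * (‖g x‖ ^ 2 * gwt b x0 x)) := by
    refine integral_nonneg fun x => ?_
    have : 0 ≤ ‖u x • (x - x0) - (4 * s) • g x‖ ^ 2 * gwt b x0 x :=
      mul_nonneg (by positivity) (gwt_pos _ _ _).le
    rw [norm_sub_sq_real, norm_smul, norm_smul, real_inner_smul_left, real_inner_smul_right,
      mul_pow, mul_pow, Real.norm_eq_abs, sq_abs, Real.norm_eq_abs, sq_abs] at this
    show 0 ≤ _
    linarith
  rw [this] at h0
  have hbs : s * b = -(1 / 4) := by rw [hb]; field_simp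
  have h2 := congrArg (fun z => s * z) e
  have h3 : s * (-(m * ∫ x, u x ^ 2 * gwt b x0 x) - 2 * b * ∫ x, u x ^ 2 * (‖x - x0‖ ^ 2 * gwt b x0 x))
    = -(s * m * ∫ x, u x ^ 2 * gwt b x0 x) - 2 * (s * b) * ∫ x, u x ^ 2 * (‖x - x0‖ ^ 2 * gwt b x0 x) := by
    ring
  rw [h3, hbs] at h2
  linarith

end Frequency

section FrequencyFlow

variable {m : ℕ} {D : Set (Euc m)} {c : ℝ} {v : ℝ → Euc m → ℝ} {g : ℝ → Euc m → Euc m}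
  {h : ℝ → Euc m → ℝ} {gh : ℝ → Euc m → Euc m}

theorem Good.gauss_lower {R : ℝ} (hDR : D ⊆ ball 0 R) {u : Euc m → ℝ} (hu : Good D u)
    {x0 : Euc m} (hx0 : x0 ∈ D) {s : ℝ} (hs : 0 < s) :
    Real.exp (-(R ^ 2 / s)) * ∫ x, u x ^ 2 ≤ ∫ x, u x ^ 2 * gwt (-(4 * s)⁻¹) x0 x := by
  rw [← integral_const_mul]
  refine integral_mono (hu.int_sq.const_mul _)
    (hu.int_sqw (isBounded_ball.subset hDR) (continuous_gwt _ _)) fun x => ?_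
  by_cases hx : x ∈ D
  · have h1 : ‖x - x0‖ ≤ 2 * R := by
      have a := mem_ball_zero_iff.1 (hDR hx)
      have b := mem_ball_zero_iff.1 (hDR hx0)
      linarith [norm_sub_le x x0]
    have h2 : ‖x - x0‖ ^ 2 ≤ 4 * R ^ 2 := by
      have := pow_le_pow_left₀ (norm_nonneg _) h1 2
      linarith [this]
    show Real.exp (-(R ^ 2 / s)) * u x ^ 2 ≤ u x ^ 2 * gwt _ _ _
    rw [mul_comm]
    refine mul_le_mul_of_nonneg_left (Real.exp_le_exp.2 ?_) (sq_nonneg _)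
    have : R ^ 2 / s = (4 * s)⁻¹ * (4 * R ^ 2) := by field_simp
    rw [this, neg_mul]
    have := mul_le_mul_of_nonneg_left h2 (show 0 ≤ (4 * s)⁻¹ by positivity)
    linarith
  · simp [hu.zero x hx]

theorem Good.gauss_upper {R : ℝ} (hDR : D ⊆ ball 0 R) {u : Euc m → ℝ} (hu : Good D u)
    (x0 : Euc m) {s : ℝ} (hs : 0 < s) :
    ∫ x, u x ^ 2 * gwt (-(4 * s)⁻¹) x0 x ≤ ∫ x, u x ^ 2 := by
  refine integral_mono (hu.int_sqw (isBounded_ball.subset hDR) (continuous_gwt _ _))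
    hu.int_sq fun x => ?_
  refine mul_le_of_le_one_right (sq_nonneg _) (Real.exp_le_one_iff.2 ?_)
  have : 0 ≤ (4 * s)⁻¹ * ‖x - x0‖ ^ 2 := by positivity
  linarith

theorem HeatFlow.frequency_bound {R : ℝ} (hcv : Convex ℝ D) (hDR : D ⊆ ball 0 R)
    (F : HeatFlow D c v g h gh) {x0 : Euc m} (hx0 : x0 ∈ D) {t0 T η : ℝ} (hT : 0 < T) (hη : 0 < η)
    (hηT : η ≤ T) (hM : 0 < ∫ x, v (t0 + T) x ^ 2) :
    2 * η * ((∫ x, ‖g (t0 + T) x‖ ^ 2 * gwt (-(4 * η)⁻¹) x0 x)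
        + c ^ 2 * ∫ x, v (t0 + T) x ^ 2 * (‖x‖ ^ 2 * gwt (-(4 * η)⁻¹) x0 x))
      + m / 2 * ∫ x, v (t0 + T) x ^ 2 * gwt (-(4 * η)⁻¹) x0 x
    ≤ (c ^ 2 * R ^ 2 / 4 * T + 8 * R ^ 2 / T
        + 4 * Real.log ((∫ x, v t0 x ^ 2) / ∫ x, v (t0 + T) x ^ 2))
      * ∫ x, v (t0 + T) x ^ 2 * gwt (-(4 * η)⁻¹) x0 x := by
  have hD : Bornology.IsBounded D := isBounded_ball.subset hDR
  set p := t0 + T + η with hp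
  set b : ℝ → ℝ := fun t => -(4 * (p - t))⁻¹ with hb
  set H : ℝ → ℝ := fun t => ∫ x, v t x ^ 2 * gwt (b t) x0 x with hH
  set E : ℝ → ℝ := fun t => (∫ x, ‖g t x‖ ^ 2 * gwt (b t) x0 x)
        + c ^ 2 * ∫ x, v t x ^ 2 * (‖x‖ ^ 2 * gwt (b t) x0 x) with hE
  have hs : ∀ t ≤ t0 + T, 0 < p - t := fun t ht => by rw [hp]; linarith
  have db : ∀ t ≤ t0 + T, HasDerivAt b (-(4 * b t ^ 2)) t := fun t ht => by
    have d1 := ((((hasDerivAt_id t).const_sub p).const_mul 4).inv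
      (by have := hs t ht; simp only [id_eq]; positivity)).neg
    refine d1.congr_deriv ?_
    have := (hs t ht).ne'
    simp only [hb, id_eq]; field_simp
  have dH : ∀ t ≤ t0 + T, HasDerivAt H (-2 * E t + 2 * b t * m * H t) t := fun t ht =>
    (F.deriv_v x0 (db t ht)).congr_deriv ((F.weak t).weighted_rate hD x0 (b t))
  have dE : ∀ t ≤ t0 + T, HasDerivAt E _ t := fun t ht =>
    (F.deriv_g x0 (db t ht)).add ((F.deriv_vx x0 (db t ht)).const_mul (c ^ 2))
  have Mpos : ∀ t ≤ t0 + T, 0 < ∫ x, v t x ^ 2 := fun t ht =>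
    hM.trans_le (F.mass_antitone hD ht)
  have Hpos : ∀ t ≤ t0 + T, 0 < H t := fun t ht =>
    (mul_pos (Real.exp_pos _) (Mpos t ht)).trans_le ((F.good t).gauss_lower hDR hx0 (hs t ht))
  have hx0R : ‖x0‖ ≤ R := (mem_ball_zero_iff.1 (hDR hx0)).le
  set κ := c ^ 2 * R ^ 2 / 8 with hκ
  -- the frequency function is almost monotone
  have dN : ∀ t ≤ t0 + T, HasDerivAt (fun t => (p - t) * E t / H t - κ * t) _ t := fun t ht =>
    (((((hasDerivAt_id t).const_sub p).fun_mul (dE t ht)).fun_div (dH t ht) (Hpos t ht).ne')).sub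
      ((hasDerivAt_id t).const_mul κ)
  have aN : AntitoneOn (fun t => (p - t) * E t / H t - κ * t) (Iic (t0 + T)) := by
    refine antitoneOn_of_hasDerivWithinAt_nonpos (convex_Iic _)
      (fun t ht => (dN t ht).continuousAt.continuousWithinAt)
      (fun t ht => (dN t (interior_subset (s := Iic (t0 + T)) ht)).hasDerivWithinAt) fun t ht => ?_
    have ht' : t ≤ t0 + T := interior_subset (s := Iic (t0 + T)) ht
    have hbn : b t ≤ 0 := by
      have := hs t ht'
      simp only [hb]; rw [neg_nonpos]; positivity
    have r1 := (F.weak t).energy_rate hD hcv hx0 hx0R (F.h10h t) hbn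
    have r2 := (F.weak t).energy_sq_le hD (x0 := x0) (b t)
    have hp' := Hpos t ht'
    rw [mul_one, sub_nonpos, div_le_iff₀ (by positivity)]
    have hE' := le_refl (E t)
    generalize hA : (-2 * (∫ x, inner ℝ (g t x) (gh t x) * gwt (b t) x0 x)
        + -(4 * b t ^ 2) * ∫ x, ‖g t x‖ ^ 2 * (‖x - x0‖ ^ 2 * gwt (b t) x0 x))
      + c ^ 2 * (-2 * (∫ x, v t x * h t x * (‖x‖ ^ 2 * gwt (b t) x0 x))
        + -(4 * b t ^ 2) * ∫ x, v t x ^ 2 * (‖x‖ ^ 2 * (‖x - x0‖ ^ 2 * gwt (b t) x0 x))) = A at r1 ⊢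
    generalize (∫ x, (h t x + (-2 * b t) * inner ℝ (x - x0) (g t x)) ^ 2 * gwt (b t) x0 x) = K2 at r1 r2
    change A ≤ -2 * K2 - 2 * b t * (2 - m) * E t - b t * c ^ 2 * R ^ 2 / 2 * H t at r1
    change E t ^ 2 ≤ K2 * H t at r2
    have hsb : (p - t) * b t = -(1 / 4) := by
      have := (hs t ht').ne'
      simp only [hb]; field_simp
    simp only [id_eq]
    have r3 := mul_le_mul_of_nonneg_left r1 (hs t ht').le
    have e3 : (p - t) * (-2 * K2 - 2 * b t * (2 - m) * E t - b t * c ^ 2 * R ^ 2 / 2 * H t)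
      = -2 * (p - t) * K2 - 2 * ((p - t) * b t) * (2 - m) * E t
        - ((p - t) * b t) * c ^ 2 * R ^ 2 / 2 * H t := by ring
    rw [e3, hsb] at r3
    have r4 := mul_le_mul_of_nonneg_right r3 hp'.le
    have r5 := mul_le_mul_of_nonneg_left r2 (hs t ht').le
    have e6 : (p - t) * E t * (-2 * E t + 2 * b t * m * H t)
      = -2 * ((p - t) * E t ^ 2) + 2 * ((p - t) * b t) * m * E t * H t := by ring
    rw [e6, hsb, hκ]
    linarith
  set T1 := t0 + T with hT1
  set N1 := (p - T1) * E T1 / H T1 with hN1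
  set A := N1 - κ * T with hA
  have hN : ∀ t, t0 ≤ t → t ≤ T1 → A * H t ≤ (p - t) * E t := fun t h0 h1 => by
    have := aN (mem_Iic.2 h1) (mem_Iic.2 le_rfl) h1
    simp only at this
    rw [← le_div_iff₀ (Hpos t h1), hA]
    have hκ0 : 0 ≤ κ := by positivity
    have : κ * T1 - κ * t ≤ κ * T := by
      rw [← mul_sub]; exact mul_le_mul_of_nonneg_left (by linarith) hκ0
    linarith
  have dΦ : ∀ t ≤ T1, HasDerivAt (fun t => Real.log (H t) - (2 * A + m / 2) * Real.log (p - t)) _ t :=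
    fun t ht => ((dH t ht).log (Hpos t ht).ne').sub
      ((((hasDerivAt_id t).const_sub p).log (hs t ht).ne').const_mul (2 * A + m / 2))
  have aΦ : AntitoneOn (fun t => Real.log (H t) - (2 * A + m / 2) * Real.log (p - t)) (Icc t0 T1) := by
    refine antitoneOn_of_hasDerivWithinAt_nonpos (convex_Icc _ _)
      (fun t ht => (dΦ t ht.2).continuousAt.continuousWithinAt)
      (fun t ht => (dΦ t (interior_subset ht).2).hasDerivWithinAt) fun t ht => ?_
    have ht' : t ∈ Icc t0 T1 := interior_subset ht
    have hs' := hs t ht'.2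
    have hp' := Hpos t ht'.2
    have hsb : b t = -(1 / 4) / (p - t) := by
      simp only [hb]; field_simp
    have : (-2 * E t + 2 * b t * m * H t) / H t - (2 * A + m / 2) * (-1 / (p - t))
      = -2 * ((p - t) * E t - A * H t) / ((p - t) * H t) := by
      rw [hsb]; field_simp; ring
    simp only [id_eq]
    rw [this]
    refine div_nonpos_of_nonpos_of_nonneg ?_ (by positivity)
    linarith [hN t ht'.1 ht'.2]
  have key := aΦ (a := t0) (b := t0 + T / 2) ⟨le_rfl, by linarith⟩ ⟨by linarith, by linarith⟩ (by linarith)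
  simp only at key
  have hMm := F.mass_antitone hD (s := t0 + T / 2) (t := T1) (by linarith)
  have l1 : Real.log (H t0) ≤ Real.log (∫ x, v t0 x ^ 2) :=
    Real.log_le_log (Hpos t0 (by linarith)) ((F.good t0).gauss_upper hDR x0 (hs t0 (by linarith)))
  have l2 : -(2 * R ^ 2 / T) + Real.log (∫ x, v T1 x ^ 2) ≤ Real.log (H (t0 + T / 2)) := by
    have hsm := hs (t0 + T / 2) (by linarith)
    have : Real.log (Real.exp (-(2 * R ^ 2 / T)) * ∫ x, v T1 x ^ 2) ≤ Real.log (H (t0 + T / 2)) := by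
      refine Real.log_le_log (mul_pos (Real.exp_pos _) hM) ?_
      refine le_trans ?_ ((F.good (t0 + T / 2)).gauss_lower hDR hx0 hsm)
      refine mul_le_mul (Real.exp_le_exp.2 (neg_le_neg ?_)) hMm hM.le (Real.exp_pos _).le
      rw [div_le_div_iff₀ hsm hT]
      have : 0 ≤ R ^ 2 * η := by positivity
      have e : p - (t0 + T / 2) = T / 2 + η := by rw [hp]; ring
      rw [e]; nlinarith
    rwa [Real.log_mul (Real.exp_pos _).ne' hM.ne', Real.log_exp] at this
  have l3 : 1 / 4 ≤ Real.log (p - t0) - Real.log (p - (t0 + T / 2)) := by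
    have hsm := hs (t0 + T / 2) (by linarith)
    have hs0 := hs t0 (by linarith)
    rw [← Real.log_div hs0.ne' hsm.ne']
    have := Real.one_sub_inv_le_log_of_pos (div_pos hs0 hsm)
    refine le_trans ?_ this
    rw [inv_div, le_sub_comm, div_le_iff₀ hs0, hp]
    linarith
  rw [Real.log_div (Mpos t0 (by linarith)).ne' hM.ne']
  have l4 : Real.log (∫ x, v T1 x ^ 2) ≤ Real.log (∫ x, v t0 x ^ 2) :=
    Real.log_le_log hM (F.mass_antitone hD (by linarith))
  have fin : 2 * A + m / 2 ≤ 8 * R ^ 2 / T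
      + 4 * (Real.log (∫ x, v t0 x ^ 2) - Real.log (∫ x, v T1 x ^ 2)) := by
    have hRT : 4 * (2 * R ^ 2 / T) = 8 * R ^ 2 / T := by ring
    have : 0 ≤ R ^ 2 / T := by positivity
    rcases le_total (2 * A + m / 2) 0 with h0 | h0
    · have : 0 ≤ 8 * R ^ 2 / T := by positivity
      linarith
    · have := mul_le_mul_of_nonneg_left l3 h0
      linarith
  have hpT : p - T1 = η := by rw [hp]; ring
  have hbT : b T1 = -(4 * η)⁻¹ := by simp only [hb]; rw [hpT]
  have eN : N1 * H T1 = η * E T1 := by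
    rw [hN1, hpT]; field_simp [(Hpos T1 le_rfl).ne']
  have := mul_le_mul_of_nonneg_right fin (Hpos T1 le_rfl).le
  rw [← hbT]
  change 2 * η * E T1 + m / 2 * H T1 ≤ _ * H T1
  have e : (2 * A + m / 2) * H T1 = 2 * (N1 * H T1) - 2 * κ * T * H T1 + m / 2 * H T1 := by
    rw [hA]; ring
  rw [e, eN, hκ] at this
  linarith

end FrequencyFlow

section Crude

variable {m : ℕ} {D : Set (Euc m)} {c : ℝ} {v : ℝ → Euc m → ℝ} {g : ℝ → Euc m → Euc m}
  {h : ℝ → Euc m → ℝ} {gh : ℝ → Euc m → Euc m}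

theorem HeatFlow.interpolation {R : ℝ} (hR : 0 < R) (hcv : Convex ℝ D) (hDR : D ⊆ ball 0 R)
    (F : HeatFlow D c v g h gh) {x0 : Euc m} (hx0 : x0 ∈ D) {r : ℝ} (hr : 0 < r) (t0 : ℝ) {T : ℝ}
    (hT : 0 < T) {ε : ℝ} (hε : 0 < ε) (hε1 : ε < 1) :
    ∫ x, v (t0 + T) x ^ 2 ≤ ε * (∫ x, v t0 x ^ 2)
      + 2 * Real.exp (R ^ 2 / T + 16 * R ^ 2 / r ^ 2 * (c ^ 2 * R ^ 2 / 4 * T + 8 * R ^ 2 / T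
        + 4 * Real.log (1 / ε))) * ∫ x in ball x0 r, v (t0 + T) x ^ 2 := by
  have hD : Bornology.IsBounded D := isBounded_ball.subset hDR
  have hB : 0 ≤ ∫ x in ball x0 r, v (t0 + T) x ^ 2 := integral_nonneg fun x => by positivity
  rcases le_or_gt (∫ x, v (t0 + T) x ^ 2) (ε * ∫ x, v t0 x ^ 2) with hle | hgt
  · refine hle.trans (le_add_of_nonneg_right (by positivity))
  have hM0 : 0 ≤ ∫ x, v t0 x ^ 2 := integral_nonneg fun x => by positivity
  have hM : 0 < ∫ x, v (t0 + T) x ^ 2 := lt_of_le_of_lt (by positivity) hgt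
  set W := c ^ 2 * R ^ 2 / 4 * T + 8 * R ^ 2 / T + 4 * Real.log (1 / ε) with hW
  have hlog : 0 < Real.log (1 / ε) := Real.log_pos (by rw [lt_div_iff₀ hε]; linarith)
  have hWp : 0 < W := by positivity
  set η := min T (r ^ 2 / (16 * W)) with hη
  have hη0 : 0 < η := lt_min hT (by positivity)
  have fb := F.frequency_bound hcv hDR hx0 hT hη0 (min_le_left _ _) hM
  have hlog2 : Real.log ((∫ x, v t0 x ^ 2) / ∫ x, v (t0 + T) x ^ 2) ≤ Real.log (1 / ε) := by
    have : 0 < ∫ x, v t0 x ^ 2 := hM.trans_le (F.mass_antitone hD (by linarith))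
    refine Real.log_le_log (by positivity) ?_
    rw [div_le_div_iff₀ hM hε]
    linarith
  have Hw := (F.weak (t0 + T)).h10
  set H := ∫ x, v (t0 + T) x ^ 2 * gwt (-(4 * η)⁻¹) x0 x with hH
  set G := ∫ x, ‖g (t0 + T) x‖ ^ 2 * gwt (-(4 * η)⁻¹) x0 x with hG
  set H2 := ∫ x, v (t0 + T) x ^ 2 * (‖x - x0‖ ^ 2 * gwt (-(4 * η)⁻¹) x0 x) with hH2
  set V := ∫ x, v (t0 + T) x ^ 2 * (‖x‖ ^ 2 * gwt (-(4 * η)⁻¹) x0 x) with hV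
  have hV0 : 0 ≤ V := integral_nonneg fun x => by
    have := gwt_pos (-(4 * η)⁻¹) x0 x; positivity
  have hH0 : 0 ≤ H := integral_nonneg fun x => by
    have := gwt_pos (-(4 * η)⁻¹) x0 x; positivity
  have conc : H2 ≤ 4 * η * (m * H + 4 * η * G) := Hw.concentration hD hη0 x0
  have hWH : 2 * η * G + m / 2 * H ≤ W * H := by
    have h1 : 0 ≤ 2 * η * (c ^ 2 * V) := by positivity
    have h2 := mul_le_mul_of_nonneg_right hlog2 hH0
    rw [hW]
    linarith
  have hηW : η * W ≤ r ^ 2 / 16 := by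
    calc η * W ≤ r ^ 2 / (16 * W) * W := by gcongr; exact min_le_right _ _
      _ = r ^ 2 / 16 := by field_simp
  have hH2b : H2 ≤ r ^ 2 / 2 * H := by
    have h1 := mul_le_mul_of_nonneg_left hWH (show 0 ≤ 8 * η by positivity)
    have h2 := mul_le_mul_of_nonneg_right hηW hH0
    linarith
  have hη2 := continuous_gwt (-(4 * η)⁻¹) x0
  have hNη : Continuous fun x : Euc m => ‖x - x0‖ ^ 2 * gwt (-(4 * η)⁻¹) x0 x := by fun_prop
  have split : H ≤ (∫ x in ball x0 r, v (t0 + T) x ^ 2) + (r ^ 2)⁻¹ * H2 := by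
    rw [← integral_indicator measurableSet_ball, ← integral_const_mul, ← integral_add
      (Hw.good.int_sq.indicator measurableSet_ball)
      ((Hw.good.int_sqw hD hNη).const_mul _)]
    refine integral_mono (Hw.good.int_sqw hD hη2) ((Hw.good.int_sq.indicator measurableSet_ball).add
      ((Hw.good.int_sqw hD hNη).const_mul _)) fun x => ?_
    have hw := gwt_pos (-(4 * η)⁻¹) x0 x
    have hw1 : gwt (-(4 * η)⁻¹) x0 x ≤ 1 := Real.exp_le_one_iff.2 (by
      have : 0 ≤ (4 * η)⁻¹ * ‖x - x0‖ ^ 2 := by positivity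
      linarith)
    by_cases hx : x ∈ ball x0 r
    · simp only [indicator_of_mem hx]
      have : 0 ≤ (r ^ 2)⁻¹ * (v (t0 + T) x ^ 2 * (‖x - x0‖ ^ 2 * gwt (-(4 * η)⁻¹) x0 x)) := by
        positivity
      have := mul_le_of_le_one_right (sq_nonneg (v (t0 + T) x)) hw1
      linarith
    · simp only [indicator_of_notMem hx, zero_add]
      have hxr : r ≤ ‖x - x0‖ := by simpa [dist_eq_norm] using hx
      have h1 : 1 ≤ (r ^ 2)⁻¹ * ‖x - x0‖ ^ 2 := by
        rw [inv_mul_eq_div, one_le_div (by positivity)]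
        gcongr
      have := mul_le_mul_of_nonneg_right h1 (show 0 ≤ v (t0 + T) x ^ 2 * gwt (-(4 * η)⁻¹) x0 x by
        positivity)
      linarith
  have hHle : H ≤ 2 * ∫ x in ball x0 r, v (t0 + T) x ^ 2 := by
    have h1 := mul_le_mul_of_nonneg_left hH2b (show 0 ≤ (r ^ 2)⁻¹ by positivity)
    have : (r ^ 2)⁻¹ * (r ^ 2 / 2 * H) = H / 2 := by field_simp
    linarith
  have low := Hw.good.gauss_lower hDR hx0 hη0
  have hinv : R ^ 2 / η ≤ R ^ 2 / T + 16 * R ^ 2 / r ^ 2 * W := by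
    rcases min_choice T (r ^ 2 / (16 * W)) with e | e
    · rw [hη, e]
      exact le_add_of_nonneg_right (by positivity)
    · rw [hη, e]
      have : R ^ 2 / (r ^ 2 / (16 * W)) = 16 * R ^ 2 / r ^ 2 * W := by field_simp
      rw [this]
      exact le_add_of_nonneg_left (by positivity)
  have h1 : ∫ x, v (t0 + T) x ^ 2 ≤ Real.exp (R ^ 2 / η) * H := by
    rw [Real.exp_neg, inv_mul_le_iff₀ (Real.exp_pos _)] at low
    exact low
  have h2 : Real.exp (R ^ 2 / η) * H ≤ Real.exp (R ^ 2 / T + 16 * R ^ 2 / r ^ 2 * W) *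
      (2 * ∫ x in ball x0 r, v (t0 + T) x ^ 2) :=
    mul_le_mul (Real.exp_le_exp.2 hinv) hHle hH0 (Real.exp_pos _).le
  have h3 : 0 ≤ ε * ∫ x, v t0 x ^ 2 := by positivity
  linarith

theorem HeatFlow.interpolation_short {R : ℝ} (hR : 0 < R) (hcv : Convex ℝ D) (hDR : D ⊆ ball 0 R)
    (F : HeatFlow D c v g h gh) (hc : 0 ≤ c) {x0 : Euc m} (hx0 : x0 ∈ D) {r : ℝ} (hr : 0 < r)
    (t0 : ℝ) {T : ℝ} (hT : 0 < T) (hcT : c * T ≤ 1) {ε : ℝ} (hε : 0 < ε) (hε1 : ε < 1) :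
    ∫ x, v (t0 + T) x ^ 2 ≤ ε * (∫ x, v t0 x ^ 2)
      + 2 * Real.exp ((R ^ 2 + 144 * R ^ 4 / r ^ 2 + 64 * R ^ 2 / r ^ 2) *
        (1 / T + Real.log (1 / ε))) * ∫ x in ball x0 r, v (t0 + T) x ^ 2 := by
  refine (F.interpolation hR hcv hDR hx0 hr t0 hT hε hε1).trans ?_
  have hB : 0 ≤ ∫ x in ball x0 r, v (t0 + T) x ^ 2 := integral_nonneg fun x => by positivity
  have hlog : 0 < Real.log (1 / ε) := Real.log_pos (by rw [lt_div_iff₀ hε]; linarith)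
  gcongr
  have h1 : c ^ 2 * R ^ 2 / 4 * T ≤ R ^ 2 / T := by
    rw [le_div_iff₀ hT]
    have : (c * T) ^ 2 ≤ 1 := by
      have : 0 ≤ c * T := by positivity
      nlinarith
    nlinarith [sq_nonneg R]
  have h2 : 16 * R ^ 2 / r ^ 2 * (c ^ 2 * R ^ 2 / 4 * T + 8 * R ^ 2 / T + 4 * Real.log (1 / ε))
      ≤ 16 * R ^ 2 / r ^ 2 * (R ^ 2 / T + 8 * R ^ 2 / T + 4 * Real.log (1 / ε)) := by
    gcongr
  refine (add_le_add_right h2 _).trans ?_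
  have e : (R ^ 2 + 144 * R ^ 4 / r ^ 2 + 64 * R ^ 2 / r ^ 2) * (1 / T + Real.log (1 / ε))
    - (R ^ 2 / T + 16 * R ^ 2 / r ^ 2 * (R ^ 2 / T + 8 * R ^ 2 / T + 4 * Real.log (1 / ε)))
    = R ^ 2 * Real.log (1 / ε) + 144 * R ^ 4 / r ^ 2 * Real.log (1 / ε)
      + 64 * R ^ 2 / r ^ 2 * (1 / T) := by
    field_simp; ring
  have : 0 ≤ R ^ 2 * Real.log (1 / ε) + 144 * R ^ 4 / r ^ 2 * Real.log (1 / ε)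
      + 64 * R ^ 2 / r ^ 2 * (1 / T) := by positivity
  linarith

/-- Telescoping: interpolation at one time gives observability over an interval. -/
theorem exp_observability_of_interpolation {M f : ℝ → ℝ} {C c : ℝ} (hC : 0 < C) (hc : 0 ≤ c)
    (hMa : Antitone M) (hf : Continuous f) (hf0 : ∀ t, 0 ≤ f t)
    (hI : ∀ t0 T ε : ℝ, 0 < T → c * T ≤ 1 → 0 < ε → ε < 1 →
      M (t0 + T) ≤ ε * M t0 + 2 * Real.exp (C * (1 / T + Real.log (1 / ε))) * f (t0 + T))
    (t0 : ℝ) {t : ℝ} (ht : 0 < t) (ht1 : t ≤ 1) :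
    M (t0 + t) ≤ Real.exp (4 * (C + 2) * (2 * C + 1) * (c + 1 / t)) * ∫ s in t0..(t0 + t), f s := by
  set B := 4 * (C + 2) * (2 * C + 1) with hB
  set τ := t / (1 + c * t) with hτ
  have hct : 0 < 1 + c * t := by positivity
  have hτ0 : 0 < τ := by positivity
  have hτt : τ ≤ t := div_le_self ht.le (by nlinarith)
  have hcτ : c * τ ≤ 1 := by
    rw [hτ, ← mul_div_assoc, div_le_one hct]; linarith
  have hτi : 1 / τ = c + 1 / t := by rw [hτ]; field_simp; ring
  set q := 2 * C / (2 * C + 1) with hq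
  have hq0 : 0 < q := by positivity
  have hq1 : q < 1 := by rw [hq, div_lt_one (by positivity)]; linarith
  have hqi : q⁻¹ - 1 = 1 / (2 * C) := by rw [hq]; field_simp; ring
  have h1q : 1 - q = (2 * C + 1)⁻¹ := by rw [hq]; field_simp; ring
  set σ := t0 + t - τ with hσ
  set a : ℕ → ℝ := fun k => σ + τ * q ^ k with ha
  have hii : ∀ x y, IntervalIntegrable f volume x y := fun x y => hf.intervalIntegrable _ _
  have step : ∀ k, M (a k) ≤ Real.exp (-(B * (q⁻¹ - 1) * (q ^ k)⁻¹ / τ)) * M (a (k + 1))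
      + Real.exp (B * (q ^ k)⁻¹ / τ) * ∫ s in (a (k + 1))..(a k), f s := by
    intro k
    have hqk : 0 < q ^ k := by positivity
    have hqk1 : q ^ k ≤ 1 := pow_le_one₀ hq0.le hq1.le
    set ε := Real.exp (-(B * (q⁻¹ - 1) * (q ^ k)⁻¹ / τ)) with hε
    have hBp : 0 < B := by positivity
    have hqi' : 0 < q⁻¹ - 1 := by rw [hqi]; positivity
    have hε1 : ε < 1 := Real.exp_lt_one_iff.2 (by
      have : 0 < B * (q⁻¹ - 1) * (q ^ k)⁻¹ / τ := by positivity
      linarith)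
    have hlogε : Real.log (1 / ε) = B * (q⁻¹ - 1) * (q ^ k)⁻¹ / τ := by
      rw [one_div, Real.log_inv, hε, Real.log_exp, neg_neg]
    set l := τ * q ^ k * (1 - q) / 2 with hl
    have hl0 : 0 < l := by have : 0 < 1 - q := by linarith
                           positivity
    have hl1 : l ≤ 1 := by
      have h1 : τ * q ^ k ≤ 1 := mul_le_one₀ (hτt.trans ht1) hqk.le hqk1
      have : τ * q ^ k * (1 - q) ≤ 1 := mul_le_one₀ h1 (by linarith) (by linarith)
      linarith
    have hak : a k = a (k + 1) + 2 * l := by simp only [ha, hl, pow_succ]; ring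
    have pt : ∀ s ∈ Icc (a (k + 1) + l) (a k), M (a k) ≤ ε * M (a (k + 1))
        + 2 * Real.exp (C * (1 / l + Real.log (1 / ε))) * f s := by
      intro s hs
      have hs0 : 0 < s - a (k + 1) := by linarith [hs.1]
      have hsτ : s - a (k + 1) ≤ τ := by
        have e1 : a k ≤ σ + τ := by
          simp only [ha]; have := mul_le_mul_of_nonneg_left hqk1 hτ0.le; linarith
        have e2 : σ ≤ a (k + 1) := by simp only [ha]; have : 0 ≤ τ * q ^ (k + 1) := by positivity
                                      linarith
        linarith [hs.2]
      have := hI (a (k + 1)) (s - a (k + 1)) ε hs0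
        ((mul_le_mul_of_nonneg_left hsτ hc).trans hcτ) (Real.exp_pos _) hε1
      rw [add_sub_cancel] at this
      refine (hMa hs.2).trans (this.trans ?_)
      have := hf0 s
      gcongr
      linarith [hs.1]
    have av : ∫ s in (a (k + 1) + l)..(a k), M (a k) ≤ ∫ s in (a (k + 1) + l)..(a k),
        (ε * M (a (k + 1)) + 2 * Real.exp (C * (1 / l + Real.log (1 / ε))) * f s) :=
      intervalIntegral.integral_mono_on (by linarith) (by simp)
        ((by fun_prop : Continuous _).intervalIntegrable _ _) pt
    rw [intervalIntegral.integral_add (by simp) ((hii _ _).const_mul _)] at av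
    simp only [intervalIntegral.integral_const_mul, intervalIntegral.integral_const,
      smul_eq_mul] at av
    have hlen : a k - (a (k + 1) + l) = l := by rw [hak]; ring
    rw [hlen] at av
    have hsub : ∫ s in (a (k + 1) + l)..(a k), f s ≤ ∫ s in (a (k + 1))..(a k), f s :=
      intervalIntegral.integral_mono_interval (by linarith) (by linarith) le_rfl
        (Filter.Eventually.of_forall hf0) (hii _ _)
    have hI0 : 0 ≤ ∫ s in (a (k + 1))..(a k), f s :=
      intervalIntegral.integral_nonneg (by linarith) fun s _ => hf0 s
    have hexp : 2 * Real.exp (C * (1 / l + Real.log (1 / ε))) ≤ l * Real.exp (B * (q ^ k)⁻¹ / τ) := by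
      have e1 : (2:ℝ) ≤ Real.exp (1 / l) := by
        have : 1 ≤ 1 / l := by rw [le_div_iff₀ hl0]; linarith
        have := Real.add_one_le_exp (1 / l)
        linarith
      have e2 : 1 ≤ l * Real.exp (1 / l) := by
        have := Real.add_one_le_exp (1 / l)
        calc (1:ℝ) = l * (1 / l) := by field_simp
          _ ≤ l * Real.exp (1 / l) := by gcongr; linarith
      have e3 : (C + 2) * (1 / l) + C * Real.log (1 / ε) = B * (q ^ k)⁻¹ / τ := by
        rw [hlogε, hqi, hl, h1q, hB]
        field_simp; ring
      rw [← e3]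
      have e4 : Real.exp ((C + 2) * (1 / l) + C * Real.log (1 / ε)) =
          Real.exp (1 / l) * (Real.exp (1 / l) * Real.exp (C * (1 / l + Real.log (1 / ε)))) := by
        rw [← Real.exp_add, ← Real.exp_add]; congr 1; ring
      rw [e4]
      have hX := Real.exp_pos (C * (1 / l + Real.log (1 / ε)))
      calc 2 * Real.exp (C * (1 / l + Real.log (1 / ε)))
          ≤ Real.exp (1 / l) * Real.exp (C * (1 / l + Real.log (1 / ε))) := by gcongr
        _ ≤ l * Real.exp (1 / l) * (Real.exp (1 / l) * Real.exp (C * (1 / l + Real.log (1 / ε)))) :=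
          le_mul_of_one_le_left (by positivity) e2
        _ = _ := by ring
    have f1 : 2 * Real.exp (C * (1 / l + Real.log (1 / ε))) * (∫ s in (a (k + 1) + l)..(a k), f s)
        ≤ l * Real.exp (B * (q ^ k)⁻¹ / τ) * ∫ s in (a (k + 1))..(a k), f s :=
      mul_le_mul hexp hsub (intervalIntegral.integral_nonneg (by linarith) fun s _ => hf0 s)
        (by positivity)
    refine le_of_mul_le_mul_left ?_ hl0
    linarith
  have tele : ∀ n, Real.exp (-(B / τ)) * M (a 0) ≤ Real.exp (-(B * (q ^ n)⁻¹ / τ)) * M (a n)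
      + ∫ s in (a n)..(a 0), f s := by
    intro n
    induction n with
    | zero => simp
    | succ k ih =>
      have s := mul_le_mul_of_nonneg_left (step k) (Real.exp_pos (-(B * (q ^ k)⁻¹ / τ))).le
      rw [mul_add, ← mul_assoc, ← mul_assoc, ← Real.exp_add, ← Real.exp_add, neg_add_cancel,
        Real.exp_zero, one_mul] at s
      have e : -(B * (q ^ k)⁻¹ / τ) + -(B * (q⁻¹ - 1) * (q ^ k)⁻¹ / τ) =
          -(B * (q ^ (k + 1))⁻¹ / τ) := by
        rw [pow_succ, mul_inv]; ring
      rw [e] at s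
      rw [← intervalIntegral.integral_add_adjacent_intervals (hii (a (k + 1)) (a k)) (hii _ _)]
      linarith
  have hBp : 0 < B := by positivity
  have lim : Tendsto (fun n : ℕ => Real.exp (-(B * (q ^ n)⁻¹ / τ)) * M σ
      + ∫ s in t0..(t0 + t), f s) atTop (nhds (0 * M σ + ∫ s in t0..(t0 + t), f s)) := by
    refine Tendsto.add_const _ (Tendsto.mul_const _ ?_)
    refine Real.tendsto_exp_neg_atTop_nhds_zero.comp ?_
    have : Tendsto (fun n : ℕ => (q ^ n)⁻¹) atTop atTop := by
      simp only [← inv_pow]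
      exact tendsto_pow_atTop_atTop_of_one_lt ((one_lt_inv₀ hq0).2 hq1)
    exact (this.const_mul_atTop hBp).atTop_div_const hτ0
  have fin : Real.exp (-(B / τ)) * M (t0 + t) ≤ 0 * M σ + ∫ s in t0..(t0 + t), f s := by
    refine ge_of_tendsto' lim fun n => ?_
    have e0 : a 0 = t0 + t := by simp [ha, hσ]
    have hσn : σ ≤ a n := by simp only [ha]; have : 0 ≤ τ * q ^ n := by positivity
                             linarith
    have hn0 : a n ≤ a 0 := by
      simp only [ha, pow_zero]
      have := mul_le_mul_of_nonneg_left (pow_le_one₀ hq0.le hq1.le : q ^ n ≤ 1) hτ0.le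
      linarith
    have := tele n
    rw [e0] at this
    have h1 := mul_le_mul_of_nonneg_left (hMa hσn) (Real.exp_pos (-(B * (q ^ n)⁻¹ / τ))).le
    have h2 : ∫ s in (a n)..(t0 + t), f s ≤ ∫ s in t0..(t0 + t), f s :=
      intervalIntegral.integral_mono_interval (by rw [hσ] at hσn; linarith) (by linarith) le_rfl
        (Filter.Eventually.of_forall hf0) (hii _ _)
    linarith
  rw [zero_mul, zero_add, Real.exp_neg, inv_mul_le_iff₀ (Real.exp_pos _), div_eq_mul_one_div,
    hτi] at fin
  exact fin

/-- Observability of a flow with cost `exp (B (c + 1/t))`. -/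
theorem HeatFlow.crude_observability {R : ℝ} (hR : 0 < R) (hcv : Convex ℝ D) (hDR : D ⊆ ball 0 R)
    (F : HeatFlow D c v g h gh) (hc : 0 ≤ c) {x0 : Euc m} (hx0 : x0 ∈ D) {r : ℝ} (hr : 0 < r)
    {C : ℝ} (hC : C = R ^ 2 + 144 * R ^ 4 / r ^ 2 + 64 * R ^ 2 / r ^ 2)
    (t0 : ℝ) {t : ℝ} (ht : 0 < t) (ht1 : t ≤ 1) :
    ∫ x, v (t0 + t) x ^ 2 ≤ Real.exp (4 * (C + 2) * (2 * C + 1) * (c + 1 / t)) *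
      ∫ s in t0..(t0 + t), ∫ x in ball x0 r, v s x ^ 2 := by
  refine exp_observability_of_interpolation (M := fun t => ∫ x, v t x ^ 2)
    (f := fun s => ∫ x in ball x0 r, v s x ^ 2) (c := c) (by rw [hC]; positivity) hc
    (fun s t hst => F.mass_antitone (isBounded_ball.subset hDR) hst) (F.cont_loc _)
    (fun t => integral_nonneg fun x => by positivity) (fun t0 T ε hT hcT hε hε1 => ?_) t0 ht ht1
  rw [hC]
  exact F.interpolation_short hR hcv hDR hc hx0 hr t0 hT hcT hε hε1

end Crude

/-! ### Gaussian test functions -/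

section Gaussian

variable {m : ℕ} {D : Set (Euc m)}

/-- `exp (α‖y‖² + ⟪β, y⟫ + γ)`. -/
noncomputable def gker (α : ℝ) (β : Euc m) (γ : ℝ) (y : Euc m) : ℝ :=
  Real.exp (α * ‖y‖ ^ 2 + inner ℝ β y + γ)

theorem contDiff_gker (α : ℝ) (β : Euc m) (γ : ℝ) : ContDiff ℝ (⊤ : ℕ∞) (gker α β γ) :=
  (((contDiff_const.mul (contDiff_norm_sq ℝ)).add
    (contDiff_const.inner ℝ contDiff_id)).add contDiff_const).exp

theorem hasFDerivAt_gker (α : ℝ) (β : Euc m) (γ : ℝ) (y : Euc m) :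
    HasFDerivAt (gker α β γ) (gker α β γ y • innerSL ℝ ((2 * α) • y + β)) y := by
  have h1 := (((hasFDerivAt_normSq (0 : Euc m) y).const_mul α).fun_add
    ((innerSL ℝ β).hasFDerivAt (x := y))).add_const γ
  have h2 := h1.exp
  have e : gker α β γ = fun y => Real.exp (α * ‖y - 0‖ ^ 2 + innerSL ℝ β y + γ) := by
    funext y; simp [gker]
  rw [e]
  refine h2.congr_fderiv ?_
  ext w
  simp
  ring

theorem gradient_gker (α : ℝ) (β : Euc m) (γ : ℝ) (y : Euc m) :
    gradient (gker α β γ) y = gker α β γ y • ((2 * α) • y + β) := by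
  refine gradient_eq_of_fderiv (hasFDerivAt_gker α β γ y) ?_
  intro w
  simp only [smul_apply, smul_eq_mul, innerSL_apply_apply, real_inner_smul_left]

theorem lapl_gker (α : ℝ) (β : Euc m) (γ : ℝ) (y : Euc m) :
    lapl (gker α β γ) y = (‖(2 * α) • y + β‖ ^ 2 + 2 * α * m) * gker α β γ y := by
  have e : ∀ i : Fin m, (fun z => fderiv ℝ (gker α β γ) z (EuclideanSpace.single i 1))
      = fun z => gker α β γ z * ((2 * α) * z i + β i) := fun i => by
    funext z
    rw [(hasFDerivAt_gker α β γ z).fderiv]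
    simp [EuclideanSpace.inner_single_right]
    ring
  have d : ∀ i : Fin m, fderiv ℝ (fun z => gker α β γ z * ((2 * α) * z i + β i)) y
      (EuclideanSpace.single i 1) = gker α β γ y * ((2 * α) * y i + β i) ^ 2
        + 2 * α * gker α β γ y := fun i => by
    have h1 := hasFDerivAt_gker α β γ y
    have h2 : HasFDerivAt (fun z : Euc m => (2 * α) * z i + β i)
        ((2 * α) • (EuclideanSpace.proj i : Euc m →L[ℝ] ℝ)) y :=
      (((EuclideanSpace.proj i : Euc m →L[ℝ] ℝ).hasFDerivAt).const_mul (2 * α)).add_const _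
    rw [(h1.fun_mul h2).fderiv]
    simp [EuclideanSpace.inner_single_right]
    ring
  unfold lapl
  simp only [e, d]
  rw [Finset.sum_add_distrib, ← Finset.mul_sum, EuclideanSpace.norm_sq_eq]
  simp
  ring

theorem lapl_mul {f g : Euc m → ℝ} (hf : ContDiff ℝ (⊤ : ℕ∞) f) (hg : ContDiff ℝ (⊤ : ℕ∞) g)
    (y : Euc m) : lapl (fun z => f z * g z) y =
      f y * lapl g y + 2 * inner ℝ (gradient f y) (gradient g y) + g y * lapl f y := by
  have hfd : Differentiable ℝ f := hf.differentiable (by simp)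
  have hgd : Differentiable ℝ g := hg.differentiable (by simp)
  have e : ∀ i : Fin m, (fun z => fderiv ℝ (fun z => f z * g z) z (EuclideanSpace.single i 1))
      = fun z => f z * fderiv ℝ g z (EuclideanSpace.single i 1)
        + g z * fderiv ℝ f z (EuclideanSpace.single i 1) := fun i => by
    funext z
    rw [((hfd z).hasFDerivAt.fun_mul (hgd z).hasFDerivAt).fderiv]
    simp
  have d : ∀ i : Fin m, fderiv ℝ (fun z => f z * fderiv ℝ g z (EuclideanSpace.single i 1)
        + g z * fderiv ℝ f z (EuclideanSpace.single i 1)) y (EuclideanSpace.single i 1)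
      = f y * fderiv ℝ (fun z => fderiv ℝ g z (EuclideanSpace.single i 1)) y
          (EuclideanSpace.single i 1)
        + 2 * (gradient f y i * gradient g y i)
        + g y * fderiv ℝ (fun z => fderiv ℝ f z (EuclideanSpace.single i 1)) y
          (EuclideanSpace.single i 1) := fun i => by
    have h1 := ((contDiff_partial hg (EuclideanSpace.single i 1)).differentiable
      (by simp) y).hasFDerivAt
    have h2 := ((contDiff_partial hf (EuclideanSpace.single i 1)).differentiable
      (by simp) y).hasFDerivAt
    rw [(((hfd y).hasFDerivAt.fun_mul h1).fun_add ((hgd y).hasFDerivAt.fun_mul h2)).fderiv,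
      gradient_coord, gradient_coord]
    simp
    ring
  unfold lapl
  simp only [e, d]
  rw [Finset.sum_add_distrib, Finset.sum_add_distrib, ← Finset.mul_sum, ← Finset.mul_sum,
    ← Finset.mul_sum, inner_eq_sum]

/-- Differentiation under the integral against a `Good` function. -/
theorem Good.hasDerivAt_integral (hD : Bornology.IsBounded D) {ζ ζ' : ℝ → Euc m → ℝ} {I : Set ℝ}
    (hI : IsOpen I) (hζ : ∀ t ∈ I, Continuous (ζ t))
    (hζ' : ContinuousOn (fun p : ℝ × Euc m => ζ' p.1 p.2) (I ×ˢ univ))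
    (hd : ∀ t ∈ I, ∀ y, HasDerivAt (fun t => ζ t y) (ζ' t y) t) {f : Euc m → ℝ} (hf : Good D f)
    {t : ℝ} (ht : t ∈ I) :
    HasDerivAt (fun t => ∫ y, f y * ζ t y) (∫ y, f y * ζ' t y) t := by
  obtain ⟨ε, hε, hεI⟩ := Metric.nhds_basis_closedBall.mem_iff.1 (hI.mem_nhds ht)
  have hcomp : IsCompact (closedBall t ε ×ˢ closure D) :=
    (isCompact_closedBall t ε).prod hD.isCompact_closure
  obtain ⟨C, hC⟩ := hcomp.exists_bound_of_continuousOn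
    (hζ'.mono (prod_mono hεI (subset_univ _)))
  have hζ't : Continuous (ζ' t) := continuousOn_univ.1
    (hζ'.comp (f := fun y => (t, y)) (by fun_prop) fun y _ => ⟨ht, mem_univ _⟩)
  refine (hasDerivAt_integral_of_dominated_loc_of_deriv_le (bound := fun y => C * ‖f y‖)
    (F := fun t y => f y * ζ t y) (F' := fun t y => f y * ζ' t y) (s := closedBall t ε)
    (closedBall_mem_nhds t hε) ?_ ?_ ?_ ?_ ?_ ?_).2
  · filter_upwards [hI.mem_nhds ht] with s hs
    exact hf.mem.1.mul (hζ s hs).aestronglyMeasurable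
  · have := (hf.mul hD (hζ t ht)).integrable hD
    simpa only [mul_comm] using this
  · exact hf.mem.1.mul hζ't.aestronglyMeasurable
  · refine Filter.Eventually.of_forall fun y s hs => ?_
    by_cases hy : y ∈ D
    · rw [norm_mul, mul_comm]
      exact mul_le_mul_of_nonneg_right (hC (s, y) ⟨hs, subset_closure hy⟩) (norm_nonneg _)
    · simp [hf.zero y hy]
  · exact (hf.integrable hD).norm.const_mul C
  · exact Filter.Eventually.of_forall fun y s hs => (hd s (hεI hs) y).const_mul _

end Gaussian

section GaussianFlow

variable {m : ℕ} {D : Set (Euc m)} {c : ℝ} {v : ℝ → Euc m → ℝ} {g : ℝ → Euc m → Euc m}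
  {h : ℝ → Euc m → ℝ} {gh : ℝ → Euc m → Euc m}

theorem IsTest.mul_right {φ η : Euc m → ℝ} (h : IsTest D φ) (hη : ContDiff ℝ (⊤ : ℕ∞) η) :
    IsTest D (fun x => φ x * η x) := by
  simpa only [mul_comm] using h.mul_left hη

/-- The commutator of the cut-off `χ` with the Laplacian, on a Gaussian. -/
noncomputable def cutErr (χ : Euc m → ℝ) (α : ℝ) (β : Euc m) (γ : ℝ) (y : Euc m) : ℝ :=
  gker α β γ y * (2 * inner ℝ (gradient χ y) ((2 * α) • y + β) + lapl χ y)

theorem lapl_cut {χ : Euc m → ℝ} (hχ : ContDiff ℝ (⊤ : ℕ∞) χ) (α : ℝ) (β : Euc m) (γ : ℝ)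
    (y : Euc m) : lapl (fun y => χ y * gker α β γ y) y =
      cutErr χ α β γ y + χ y * ((‖(2 * α) • y + β‖ ^ 2 + 2 * α * m) * gker α β γ y) := by
  rw [lapl_mul hχ (contDiff_gker α β γ), lapl_gker, gradient_gker, real_inner_smul_right, cutErr]
  ring

theorem good_cutErr {χ : Euc m → ℝ} (hχ : IsTest D χ) (hD : Bornology.IsBounded D) (α : ℝ)
    (β : Euc m) (γ : ℝ) : Good D (cutErr χ α β γ) := by
  have h1 := hχ.good_gradient.inner_vec hD (b := fun y => (2 * α) • y + β) (by fun_prop)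
  have h2 := ((h1.const_smul 2).add hχ.good_lapl).mul hD (contDiff_gker α β γ).continuous
  have e : cutErr χ α β γ = fun y => gker α β γ y *
      (2 • inner ℝ ((2 * α) • y + β) (gradient χ y) + lapl χ y) := by
    funext y; rw [cutErr, real_inner_comm, two_smul, two_mul]
  rw [e]
  simpa only [smul_eq_mul, two_smul, two_mul] using h2

/-- Pairing a flow with a truncated solution of the backward equation. -/
theorem HeatFlow.hasDerivAt_gker (hD : Bornology.IsBounded D) (F : HeatFlow D c v g h gh)
    {χ : Euc m → ℝ} (hχ : IsTest D χ) {α γ : ℝ → ℝ} {β : ℝ → Euc m}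
    (hα : ∀ σ, 0 < σ → HasDerivAt α (4 * α σ ^ 2 - c ^ 2) σ)
    (hβ : ∀ σ, 0 < σ → HasDerivAt β ((4 * α σ) • β σ) σ)
    (hγ : ∀ σ, 0 < σ → HasDerivAt γ (‖β σ‖ ^ 2 + 2 * α σ * m) σ) {t1 τ : ℝ} (hτ : τ < t1) :
    HasDerivAt (fun τ => ∫ y, v τ y * (χ y * gker (α (t1 - τ)) (β (t1 - τ)) (γ (t1 - τ)) y))
      (∫ y, v τ y * cutErr χ (α (t1 - τ)) (β (t1 - τ)) (γ (t1 - τ)) y) τ := by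
  have hsub : ∀ s : ℝ, HasDerivAt (fun s => t1 - s) (-1) s := fun s => by
    simpa using (hasDerivAt_id s).const_sub t1
  have cα : ContinuousOn (fun s => α (t1 - s)) (Iio t1) := fun s hs =>
    (HasDerivAt.comp s (hα (t1 - s) (sub_pos.2 hs)) (hsub s)).continuousAt.continuousWithinAt
  have dβ : ∀ s ∈ Iio t1, HasDerivAt (fun s => β (t1 - s))
      (-((4 * α (t1 - s)) • β (t1 - s))) s := fun s hs => by
    exact (HasDerivAt.scomp s (hβ (t1 - s) (sub_pos.2 hs)) (hsub s)).congr_deriv (by simp)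
  have cβ : ContinuousOn (fun s => β (t1 - s)) (Iio t1) := fun s hs =>
    (dβ s hs).continuousAt.continuousWithinAt
  have cγ : ContinuousOn (fun s => γ (t1 - s)) (Iio t1) := fun s hs =>
    (HasDerivAt.comp s (hγ (t1 - s) (sub_pos.2 hs)) (hsub s)).continuousAt.continuousWithinAt
  set ζ : ℝ → Euc m → ℝ := fun s y => χ y * gker (α (t1 - s)) (β (t1 - s)) (γ (t1 - s)) y with hζ
  set ζ' : ℝ → Euc m → ℝ := fun s y => -(χ y * (((4 * α (t1 - s) ^ 2 - c ^ 2) * ‖y‖ ^ 2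
    + inner ℝ ((4 * α (t1 - s)) • β (t1 - s)) y + (‖β (t1 - s)‖ ^ 2 + 2 * α (t1 - s) * m))
    * gker (α (t1 - s)) (β (t1 - s)) (γ (t1 - s)) y)) with hζ'
  have test : ∀ s, IsTest D (ζ s) := fun s => hχ.mul_right (contDiff_gker _ _ _)
  have cχ : Continuous χ := hχ.contDiff.continuous
  have cζ' : ContinuousOn (fun p : ℝ × Euc m => ζ' p.1 p.2) (Iio t1 ×ˢ univ) := by
    have m1 : MapsTo (Prod.fst : ℝ × Euc m → ℝ) (Iio t1 ×ˢ univ) (Iio t1) := fun p hp => hp.1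
    have c1 := cα.comp (f := (Prod.fst : ℝ × Euc m → ℝ)) continuous_fst.continuousOn m1
    have c2 := cβ.comp (f := (Prod.fst : ℝ × Euc m → ℝ)) continuous_fst.continuousOn m1
    have c3 := cγ.comp (f := (Prod.fst : ℝ × Euc m → ℝ)) continuous_fst.continuousOn m1
    simp only [Function.comp_def] at c1 c2 c3
    have c4 : Continuous fun q : ℝ × Euc m × ℝ × Euc m => -(χ q.2.2.2 *
        (((4 * q.1 ^ 2 - c ^ 2) * ‖q.2.2.2‖ ^ 2 + inner ℝ ((4 * q.1) • q.2.1) q.2.2.2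
          + (‖q.2.1‖ ^ 2 + 2 * q.1 * m)) *
          Real.exp (q.1 * ‖q.2.2.2‖ ^ 2 + inner ℝ q.2.1 q.2.2.2 + q.2.2.1))) := by fun_prop
    exact c4.comp_continuousOn (c1.prodMk (c2.prodMk (c3.prodMk continuousOn_snd)))
  have gζ' : Continuous (ζ' τ) := by
    have := (contDiff_gker (α (t1 - τ)) (β (t1 - τ)) (γ (t1 - τ))).continuous
    simp only [hζ']
    fun_prop
  have dζ : ∀ s ∈ Iio t1, ∀ y, HasDerivAt (fun s => ζ s y) (ζ' s y) s := fun s hs y => by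
    have hs' := sub_pos.2 (mem_Iio.1 hs)
    have d1 := (HasDerivAt.comp s (hα (t1 - s) hs') (hsub s)).mul_const (‖y‖ ^ 2)
    have d2 := (dβ s hs).inner ℝ (hasDerivAt_const s y)
    have d3 := HasDerivAt.comp s (hγ (t1 - s) hs') (hsub s)
    have := (((d1.fun_add d2).fun_add d3).exp).const_mul (χ y)
    refine this.congr_deriv ?_
    simp only [hζ', gker, Function.comp_apply, inner_zero_right, inner_neg_left]
    ring
  have key := F.deriv_pair ζ (ζ' τ) τ
    (fun f hf => hf.hasDerivAt_integral hD isOpen_Iio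
      (fun s _ => (test s).contDiff.continuous) cζ' dζ hτ)
    (fun f hf => by
      simpa only [mul_comm] using (hf.mul hD gζ').integrable hD)
    (fun s f hf => hf.int_mul (test s).good)
  refine key.congr_deriv ?_
  have W := (F.weak τ).weak _ (test τ)
  rw [(F.weak τ).h10.integral_green (test τ)] at W
  have gv := F.good τ
  have i1 : Integrable fun y => v τ y * lapl (ζ τ) y := gv.int_mul (test τ).good_lapl
  have i2 : Integrable fun y => v τ y * ζ τ y * (c ^ 2 * ‖y‖ ^ 2) :=
    gv.int_mulw hD (test τ).good (by fun_prop)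
  have i3 : Integrable fun y => v τ y * ζ' τ y := by
    simpa only [mul_comm] using (gv.mul hD gζ').integrable hD
  rw [← W]
  have := integral_lin3 i1 i2 i3 1 (-1) 1
  have e : (-(-(∫ y, v τ y * lapl (ζ τ) y) + ∫ y, v τ y * ζ τ y * (c ^ 2 * ‖y‖ ^ 2))
      + ∫ y, v τ y * ζ' τ y) = 1 * (∫ y, v τ y * lapl (ζ τ) y)
        + -1 * (∫ y, v τ y * ζ τ y * (c ^ 2 * ‖y‖ ^ 2)) + 1 * ∫ y, v τ y * ζ' τ y := by ring
  rw [e, ← this]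
  congr 1; funext y
  have hl := lapl_cut hχ.contDiff (α (t1 - τ)) (β (t1 - τ)) (γ (t1 - τ)) y
  have hn : ‖(2 * α (t1 - τ)) • y + β (t1 - τ)‖ ^ 2 = 4 * α (t1 - τ) ^ 2 * ‖y‖ ^ 2
      + 4 * α (t1 - τ) * inner ℝ (β (t1 - τ)) y + ‖β (t1 - τ)‖ ^ 2 := by
    rw [norm_add_sq_real, norm_smul, real_inner_smul_left, mul_pow, Real.norm_eq_abs, sq_abs,
      real_inner_comm]
    ring
  simp only [hζ, hζ']
  rw [hl, hn, real_inner_smul_left]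
  ring

end GaussianFlow

/-! ### The Mehler kernel -/

section Mehler

variable {m : ℕ} {D : Set (Euc m)} {c : ℝ} {v : ℝ → Euc m → ℝ} {g : ℝ → Euc m → Euc m}
  {h : ℝ → Euc m → ℝ} {gh : ℝ → Euc m → Euc m}

/-- The contraction factor of the Mehler semigroup. -/
noncomputable def mq (c σ : ℝ) : ℝ := Real.exp (-(2 * c * σ))

/-- Quadratic coefficient of the Mehler kernel. -/
noncomputable def mα (c σ : ℝ) : ℝ := -(c / 2) * ((1 + mq c σ ^ 2) / (1 - mq c σ ^ 2))

/-- Linear coefficient of the Mehler kernel. -/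
noncomputable def mb (c σ : ℝ) : ℝ := 2 * c * (mq c σ / (1 - mq c σ ^ 2))

/-- Constant coefficient of the Mehler kernel. -/
noncomputable def mγ (c : ℝ) (x : Euc m) (σ : ℝ) : ℝ :=
  -(c * ‖x‖ ^ 2) * (mq c σ ^ 2 / (1 - mq c σ ^ 2))
    + m / 2 * Real.log (c / Real.pi * (mq c σ / (1 - mq c σ ^ 2)))

/-- The Mehler kernel (multiplied by `exp (c‖x‖²/2)`). -/
noncomputable def mker (c : ℝ) (x : Euc m) (σ : ℝ) (y : Euc m) : ℝ :=
  gker (mα c σ) (mb c σ • x) (mγ c x σ) y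

theorem mq_pos (c σ : ℝ) : 0 < mq c σ := Real.exp_pos _

theorem mq_lt_one {c σ : ℝ} (hc : 0 < c) (hσ : 0 < σ) : mq c σ < 1 :=
  Real.exp_lt_one_iff.2 (by have := mul_pos hc hσ; linarith)

theorem one_sub_mq_sq_pos {c σ : ℝ} (hc : 0 < c) (hσ : 0 < σ) : 0 < 1 - mq c σ ^ 2 := by
  nlinarith [mq_pos c σ, mq_lt_one hc hσ]

theorem hasDerivAt_mq (c σ : ℝ) : HasDerivAt (mq c) (-(2 * c) * mq c σ) σ := by
  have := (((hasDerivAt_id σ).const_mul (2 * c)).neg).exp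
  refine this.congr_deriv ?_
  simp only [mq, id_eq, Pi.neg_apply, mul_one]; ring

theorem hasDerivAt_mα {c σ : ℝ} (hc : 0 < c) (hσ : 0 < σ) :
    HasDerivAt (mα c) (4 * mα c σ ^ 2 - c ^ 2) σ := by
  have h0 := (one_sub_mq_sq_pos hc hσ).ne'
  have d := hasDerivAt_mq c σ
  have := ((((d.fun_pow 2).const_add 1).fun_div ((d.fun_pow 2).const_sub 1) h0)).const_mul (-(c / 2))
  refine this.congr_deriv ?_
  simp only [mα]; field_simp; push_cast; ring

theorem hasDerivAt_mb {c σ : ℝ} (hc : 0 < c) (hσ : 0 < σ) :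
    HasDerivAt (mb c) (4 * mα c σ * mb c σ) σ := by
  have h0 := (one_sub_mq_sq_pos hc hσ).ne'
  have d := hasDerivAt_mq c σ
  have := (d.fun_div ((d.fun_pow 2).const_sub 1) h0).const_mul (2 * c)
  refine this.congr_deriv ?_
  simp only [mα, mb]; field_simp; push_cast; ring

theorem hasDerivAt_mγ {c σ : ℝ} (hc : 0 < c) (hσ : 0 < σ) (x : Euc m) :
    HasDerivAt (mγ c x) (‖mb c σ • x‖ ^ 2 + 2 * mα c σ * m) σ := by
  have h0 := (one_sub_mq_sq_pos hc hσ).ne'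
  have hq := (mq_pos c σ).ne'
  have hpi := Real.pi_pos.ne'
  have hc' := hc.ne'
  have d := hasDerivAt_mq c σ
  have h1 : c / Real.pi * (mq c σ / (1 - mq c σ ^ 2)) ≠ 0 := by positivity
  have d1 := ((d.fun_pow 2).fun_div ((d.fun_pow 2).const_sub 1) h0).const_mul (-(c * ‖x‖ ^ 2))
  have d2 := (((d.fun_div ((d.fun_pow 2).const_sub 1) h0).const_mul (c / Real.pi)).log
    h1).const_mul ((m : ℝ) / 2)
  refine (d1.fun_add d2).congr_deriv ?_
  rw [norm_smul, mul_pow, Real.norm_eq_abs, sq_abs]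
  simp only [mα, mb]; field_simp; push_cast; ring

theorem mker_eq {c σ : ℝ} (hc : 0 < c) (hσ : 0 < σ) (x y : Euc m) :
    mker c x σ y = Real.exp (m / 2 * Real.log (c / Real.pi * (mq c σ / (1 - mq c σ ^ 2))))
      * Real.exp (c / 2 * ‖y‖ ^ 2) * Real.exp (-(c / (1 - mq c σ ^ 2)) * ‖y - mq c σ • x‖ ^ 2) := by
  have h0 := (one_sub_mq_sq_pos hc hσ).ne'
  rw [mker, gker, ← Real.exp_add, ← Real.exp_add]
  congr 1
  rw [norm_sub_sq_real, norm_smul, real_inner_smul_left, real_inner_smul_right, mul_pow,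
    Real.norm_eq_abs, sq_abs, real_inner_comm x y, mα, mb, mγ]
  field_simp
  ring

theorem mα_bound {c σ : ℝ} (hc : 0 < c) (hσ : 0 < σ) : |2 * mα c σ| ≤ 2 * (c / (1 - mq c σ ^ 2)) := by
  have h0 := one_sub_mq_sq_pos hc hσ
  have hq : mq c σ ^ 2 ≤ 1 := by linarith
  rw [mα, show 2 * (-(c / 2) * ((1 + mq c σ ^ 2) / (1 - mq c σ ^ 2)))
    = -(c * ((1 + mq c σ ^ 2)) / (1 - mq c σ ^ 2)) by ring, abs_neg, abs_of_pos (by positivity),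
    ← mul_div_assoc]
  refine div_le_div_of_nonneg_right ?_ h0.le
  nlinarith

theorem mb_bound {c σ : ℝ} (hc : 0 < c) (hσ : 0 < σ) :
    0 ≤ mb c σ ∧ mb c σ ≤ 2 * (c / (1 - mq c σ ^ 2)) := by
  have h0 := one_sub_mq_sq_pos hc hσ
  have hq := mq_lt_one hc hσ
  have hq0 := mq_pos c σ
  refine ⟨by rw [mb]; positivity, ?_⟩
  rw [mb, ← mul_div_assoc, ← mul_div_assoc]
  refine div_le_div_of_nonneg_right ?_ h0.le
  nlinarith

theorem le_mk {c σ : ℝ} (hc : 0 < c) (hσ : 0 < σ) : c ≤ c / (1 - mq c σ ^ 2) := by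
  have h0 := one_sub_mq_sq_pos hc hσ
  rw [le_div_iff₀ h0]
  nlinarith [mq_pos c σ]

theorem norm_factor_le {c σ : ℝ} (hc : 1 ≤ c) (hσ : 0 < σ) :
    Real.exp ((m : ℝ) / 2 * Real.log (c / Real.pi * (mq c σ / (1 - mq c σ ^ 2))))
      ≤ (c / (1 - mq c σ ^ 2)) ^ m := by
  have hc0 : 0 < c := by linarith
  have h0 := one_sub_mq_sq_pos hc0 hσ
  have hq := mq_lt_one hc0 hσ
  have hq0 := mq_pos c σ
  set k := c / (1 - mq c σ ^ 2) with hk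
  have hk1 : 1 ≤ k := hc.trans (le_mk hc0 hσ)
  have hlog : 0 ≤ Real.log k := Real.log_nonneg hk1
  have h1 : c / Real.pi * (mq c σ / (1 - mq c σ ^ 2)) ≤ k := by
    rw [show c / Real.pi * (mq c σ / (1 - mq c σ ^ 2)) = k * (mq c σ / Real.pi) by rw [hk]; ring]
    have : mq c σ / Real.pi ≤ 1 := by
      rw [div_le_one Real.pi_pos]; linarith [Real.pi_gt_three]
    nlinarith
  have h2 := Real.log_le_log (by have := Real.pi_pos; positivity) h1
  calc _ ≤ Real.exp (m * Real.log k) := by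
        apply Real.exp_le_exp.2
        have : (m : ℝ) / 2 * Real.log (c / Real.pi * (mq c σ / (1 - mq c σ ^ 2)))
          ≤ m / 2 * Real.log k := by gcongr
        have hm : (0 : ℝ) ≤ m := by positivity
        nlinarith
    _ = k ^ m := by rw [mul_comm, Real.exp_mul, Real.exp_log (by linarith), Real.rpow_natCast]

theorem pow_mul_exp_le (n : ℕ) {a k : ℝ} (ha : 0 < a) (hk : 0 ≤ k) :
    k ^ n * Real.exp (-a * k) ≤ n.factorial / a ^ n := by
  have h1 := Real.pow_div_factorial_le_exp (a * k) (by positivity) n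
  rw [neg_mul, Real.exp_neg, ← div_eq_mul_inv, div_le_div_iff₀ (Real.exp_pos _) (by positivity)]
  rw [div_le_iff₀ (by positivity), mul_pow] at h1
  linarith

/-- The commutator term is exponentially small in `c`. -/
theorem cutErr_mehler_bound {R ρ ρ' : ℝ} (hρ : 0 ≤ ρ) (hρ' : ρ < ρ') {χ : Euc m → ℝ}
    (hχ : IsTest (ball 0 R) χ) (hχ1 : ∀ y, ‖y‖ < ρ' → χ y = 1) :
    ∃ C, 0 ≤ C ∧ ∀ c, 1 ≤ c → ∀ σ, 0 < σ → ∀ x : Euc m, ‖x‖ ≤ ρ → ∀ y,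
      |cutErr χ (mα c σ) (mb c σ • x) (mγ c x σ) y| ≤
        C * Real.exp (-c * ((ρ' - ρ) ^ 2 / 2)) * Real.exp (c / 2 * ‖y‖ ^ 2) := by
  obtain ⟨G, hG0, hG⟩ := exists_bound_of_isBounded (D := ball (0 : Euc m) R) isBounded_ball
    (contDiff_gradient hχ.contDiff).continuous
  obtain ⟨L, hL0, hL⟩ := exists_bound_of_isBounded (D := ball (0 : Euc m) R) isBounded_ball
    (continuous_lapl hχ.contDiff)
  have hgap : 0 < (ρ' - ρ) ^ 2 / 2 := by have := sub_pos.2 hρ'; positivity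
  set B := 2 * G * (2 * |R| + 2 * ρ) + L with hB
  have hB0 : 0 ≤ B := by positivity
  refine ⟨B * ((m + 1).factorial / ((ρ' - ρ) ^ 2 / 2) ^ (m + 1)), by positivity, ?_⟩
  intro c hc σ hσ x hx y
  have hc0 : 0 < c := by linarith
  by_cases hyR : y ∈ ball (0 : Euc m) R
  swap
  · rw [(good_cutErr hχ isBounded_ball _ _ _).zero y hyR, abs_zero]; positivity
  by_cases hy : ‖y‖ < ρ'
  · have hloc : χ =ᶠ[nhds y] fun _ => 1 := by
      filter_upwards [(isOpen_lt continuous_norm continuous_const).mem_nhds hy] with z hz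
      exact hχ1 z hz
    have h1 : gradient χ y = 0 := by
      simp only [gradient, hloc.fderiv_eq]; simp
    have h2 : lapl χ y = 0 := by
      unfold lapl
      refine Finset.sum_eq_zero fun i _ => ?_
      have : (fun z => fderiv ℝ χ z (EuclideanSpace.single i 1)) =ᶠ[nhds y] fun _ => 0 := by
        filter_upwards [hloc.eventually_nhds] with z hz
        rw [Filter.EventuallyEq.fderiv_eq hz]; simp
      rw [this.fderiv_eq]; simp
    rw [cutErr, h1, h2]; simp; positivity
  push Not at hy
  have h0 := one_sub_mq_sq_pos hc0 hσ
  have hq := mq_lt_one hc0 hσ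
  have hq0 := mq_pos c σ
  set k := c / (1 - mq c σ ^ 2) with hk
  have hck : c ≤ k := le_mk hc0 hσ
  have hk1 : 1 ≤ k := hc.trans hck
  have hyR' : ‖y‖ ≤ |R| := by
    have := mem_ball_zero_iff.1 hyR
    exact this.le.trans (le_abs_self R)
  have hfac : |2 * inner ℝ (gradient χ y) ((2 * mα c σ) • y + mb c σ • x) + lapl χ y| ≤ k * B := by
    have e1 : ‖(2 * mα c σ) • y + mb c σ • x‖ ≤ 2 * k * |R| + 2 * k * ρ := by
      refine (norm_add_le _ _).trans (add_le_add ?_ ?_)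
      · rw [norm_smul, Real.norm_eq_abs]
        exact mul_le_mul (mα_bound hc0 hσ) hyR' (norm_nonneg _) (by positivity)
      · rw [norm_smul, Real.norm_eq_abs, abs_of_nonneg (mb_bound hc0 hσ).1]
        exact mul_le_mul (mb_bound hc0 hσ).2 hx (norm_nonneg _) (by positivity)
    have e2 := (abs_real_inner_le_norm (gradient χ y) ((2 * mα c σ) • y + mb c σ • x)).trans
      (mul_le_mul (hG y hyR) e1 (norm_nonneg _) hG0)
    have e3 := hL y hyR
    rw [Real.norm_eq_abs] at e3
    refine (abs_add_le _ _).trans ?_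
    rw [abs_mul, abs_of_pos (by norm_num : (0 : ℝ) < 2), hB]
    nlinarith
  have hdist : ρ' - ρ ≤ ‖y - mq c σ • x‖ := by
    have e1 := norm_sub_norm_le y (mq c σ • x)
    rw [norm_smul, Real.norm_eq_abs, abs_of_pos hq0] at e1
    have : mq c σ * ‖x‖ ≤ ρ := by
      have := mul_le_mul hq.le hx (norm_nonneg _) zero_le_one
      linarith
    linarith
  have hE : Real.exp (-k * ‖y - mq c σ • x‖ ^ 2) ≤ Real.exp (-c * ((ρ' - ρ) ^ 2 / 2))
      * Real.exp (-((ρ' - ρ) ^ 2 / 2) * k) := by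
    rw [← Real.exp_add]
    apply Real.exp_le_exp.2
    have : (ρ' - ρ) ^ 2 ≤ ‖y - mq c σ • x‖ ^ 2 := pow_le_pow_left₀ (by linarith) hdist 2
    have e1 : k * (ρ' - ρ) ^ 2 ≤ k * ‖y - mq c σ • x‖ ^ 2 := by gcongr
    have e2 : c * ((ρ' - ρ) ^ 2 / 2) ≤ k * ((ρ' - ρ) ^ 2 / 2) := by gcongr
    nlinarith
  have hker : gker (mα c σ) (mb c σ • x) (mγ c x σ) y ≤ k ^ m * Real.exp (c / 2 * ‖y‖ ^ 2) *
      (Real.exp (-c * ((ρ' - ρ) ^ 2 / 2)) * Real.exp (-((ρ' - ρ) ^ 2 / 2) * k)) := by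
    have := mker_eq hc0 hσ x y
    rw [mker] at this
    rw [this]
    gcongr
    exact norm_factor_le hc hσ
  have hpow := pow_mul_exp_le (m + 1) hgap (by linarith : (0 : ℝ) ≤ k)
  rw [cutErr, abs_mul, abs_of_pos (show 0 < gker _ _ _ y from Real.exp_pos _)]
  calc _ ≤ (k ^ m * Real.exp (c / 2 * ‖y‖ ^ 2) * (Real.exp (-c * ((ρ' - ρ) ^ 2 / 2))
          * Real.exp (-((ρ' - ρ) ^ 2 / 2) * k))) * (k * B) :=
        mul_le_mul hker hfac (abs_nonneg _) (by positivity)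
    _ = B * (k ^ (m + 1) * Real.exp (-((ρ' - ρ) ^ 2 / 2) * k)) *
          Real.exp (-c * ((ρ' - ρ) ^ 2 / 2)) * Real.exp (c / 2 * ‖y‖ ^ 2) := by ring
    _ ≤ _ := by gcongr

end Mehler

section MehlerFlow

variable {m : ℕ} {D : Set (Euc m)} {c : ℝ} {v : ℝ → Euc m → ℝ} {g : ℝ → Euc m → Euc m}
  {h : ℝ → Euc m → ℝ} {gh : ℝ → Euc m → Euc m}

theorem HeatFlow.gauss_exp {R : ℝ} (F : HeatFlow (ball 0 R) c v g h gh) (hc : 0 < c)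
    {S t' t : ℝ} (hS : 0 < S) (hSt : S ≤ t - t') :
    ∫ x, v t x ^ 2 * Real.exp (c * ‖x‖ ^ 2)
      ≤ Real.exp (R ^ 2 / (2 * S)) * ∫ x, v t' x ^ 2 := by
  have hD : Bornology.IsBounded (ball (0 : Euc m) R) := isBounded_ball
  have key := F.gauss_bound hD hc (t0 := t') (t := t) (by linarith)
  have hp : 0 < 1 + 2 * c * (t - t') := by
    have : 0 < t - t' := by linarith
    positivity
  refine le_trans ?_ (mul_le_mul_of_nonneg_left key (Real.exp_pos _).le)
  rw [← integral_const_mul]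
  refine integral_mono ((F.good t).int_sqw hD (by fun_prop))
    (((F.good t).int_sqw hD (continuous_gwt _ _)).const_mul _) fun x => ?_
  by_cases hx : x ∈ ball (0 : Euc m) R
  swap
  · simp [(F.good t).zero x hx]
  have hx2 : ‖x‖ ^ 2 ≤ R ^ 2 := by
    have := mem_ball_zero_iff.1 hx
    exact pow_le_pow_left₀ (norm_nonneg _) this.le 2
  have : Real.exp (c * ‖x‖ ^ 2) ≤ Real.exp (R ^ 2 / (2 * S)) *
      gwt (2 * c ^ 2 * (t - t') / (1 + 2 * c * (t - t'))) 0 x := by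
    rw [gwt, ← Real.exp_add, sub_zero]
    apply Real.exp_le_exp.2
    have e1 : 2 * c ^ 2 * (t - t') / (1 + 2 * c * (t - t')) = c - c / (1 + 2 * c * (t - t')) := by
      field_simp; ring
    have e2 : c / (1 + 2 * c * (t - t')) ≤ 1 / (2 * S) := by
      rw [div_le_div_iff₀ hp (by positivity)]
      nlinarith [mul_le_mul_of_nonneg_left hSt hc.le]
    have e3 : c / (1 + 2 * c * (t - t')) * ‖x‖ ^ 2 ≤ 1 / (2 * S) * R ^ 2 := by gcongr
    rw [e1]
    have e4 : R ^ 2 / (2 * S) = 1 / (2 * S) * R ^ 2 := by ring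
    rw [e4]; linarith
  calc v t x ^ 2 * Real.exp (c * ‖x‖ ^ 2) ≤ v t x ^ 2 * _ :=
        mul_le_mul_of_nonneg_left this (sq_nonneg _)
    _ = _ := by ring

/-- Moving the time at which a flow is paired with the Mehler kernel. -/
theorem mehler_error {R ρ ρ' : ℝ} (hρ : 0 ≤ ρ) (hρ' : ρ < ρ') {χ : Euc m → ℝ}
    (hχ : IsTest (ball 0 R) χ) (hχ1 : ∀ y, ‖y‖ < ρ' → χ y = 1) :
    ∃ C, 0 ≤ C ∧ ∀ {c : ℝ} {v : ℝ → Euc m → ℝ} {g : ℝ → Euc m → Euc m}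
      {h : ℝ → Euc m → ℝ} {gh : ℝ → Euc m → Euc m}, HeatFlow (ball 0 R) c v g h gh → 1 ≤ c →
      ∀ {S t0 t1 τ : ℝ}, 0 < S → t0 ≤ τ → τ < t1 → t1 ≤ t0 + 1 → ∀ x : Euc m, ‖x‖ ≤ ρ →
      |(∫ y, v τ y * (χ y * mker c x (t1 - τ) y)) - ∫ y, v t0 y * (χ y * mker c x (t1 - t0) y)|
        ≤ C * Real.exp (-c * ((ρ' - ρ) ^ 2 / 2)) * Real.exp (R ^ 2 / (4 * S)) *
          √(∫ y, v (t0 - S) y ^ 2) := by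
  obtain ⟨C, hC0, hC⟩ := cutErr_mehler_bound hρ hρ' hχ hχ1
  have hD : Bornology.IsBounded (ball (0 : Euc m) R) := isBounded_ball
  set V : ℝ := volume.real (ball (0 : Euc m) R) with hV
  refine ⟨C * √V, by positivity, ?_⟩
  intro c v g h gh F hc S t0 t1 τ hS h1 h2 h3 x hx
  have hc0 : 0 < c := by linarith
  set M := ∫ y, v (t0 - S) y ^ 2 with hM
  have hM0 : 0 ≤ M := integral_nonneg fun _ => sq_nonneg _
  set B := C * Real.exp (-c * ((ρ' - ρ) ^ 2 / 2)) with hB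
  have hder : ∀ s ∈ Ico t0 t1, |∫ y, v s y * cutErr χ (mα c (t1 - s)) (mb c (t1 - s) • x)
      (mγ c x (t1 - s)) y| ≤ B * √V * Real.exp (R ^ 2 / (4 * S)) * √M := by
    intro s hs
    have hσ : 0 < t1 - s := sub_pos.2 hs.2
    set Z := cutErr χ (mα c (t1 - s)) (mb c (t1 - s) • x) (mγ c x (t1 - s)) with hZ
    have gZ : Good (ball (0 : Euc m) R) Z := good_cutErr hχ hD _ _ _
    have g1 : Good (ball (0 : Euc m) R) (fun y => Real.exp (c / 2 * ‖y‖ ^ 2) * v s y) :=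
      (F.good s).mul hD (by fun_prop)
    have g2 : Good (ball (0 : Euc m) R) (fun y => Real.exp (-(c / 2 * ‖y‖ ^ 2)) * Z y) :=
      gZ.mul hD (by fun_prop)
    have CS := abs_integral_inner_le g1.mem g2.mem
    have e1 : ∫ y, inner ℝ (Real.exp (c / 2 * ‖y‖ ^ 2) * v s y)
        (Real.exp (-(c / 2 * ‖y‖ ^ 2)) * Z y) = ∫ y, v s y * Z y := by
      congr 1; funext y
      have : Real.exp (c / 2 * ‖y‖ ^ 2) * Real.exp (-(c / 2 * ‖y‖ ^ 2)) = 1 := by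
        rw [← Real.exp_add]; simp
      simp only [RCLike.inner_apply, conj_trivial]
      linear_combination (v s y * Z y) * this
    have e2 : ∫ y, ‖Real.exp (c / 2 * ‖y‖ ^ 2) * v s y‖ ^ 2 ≤ Real.exp (R ^ 2 / (2 * S)) * M := by
      have := F.gauss_exp hc0 (t' := t0 - S) (t := s) hS (by linarith [hs.1])
      refine le_trans (le_of_eq ?_) this
      congr 1; funext y
      have : Real.exp (c * ‖y‖ ^ 2) = Real.exp (c / 2 * ‖y‖ ^ 2) ^ 2 := by
        rw [← Real.exp_nat_mul]; congr 1; push_cast; ring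
      rw [this, Real.norm_eq_abs, sq_abs]; ring
    have e3 : ∫ y, ‖Real.exp (-(c / 2 * ‖y‖ ^ 2)) * Z y‖ ^ 2 ≤ B ^ 2 * V := by
      have : ∀ y, ‖Real.exp (-(c / 2 * ‖y‖ ^ 2)) * Z y‖ ^ 2 ≤
          (ball (0 : Euc m) R).indicator (fun _ => B ^ 2) y := fun y => by
        by_cases hy : y ∈ ball (0 : Euc m) R
        · rw [indicator_of_mem hy]
          refine pow_le_pow_left₀ (norm_nonneg _) ?_ 2
          rw [norm_mul, Real.norm_eq_abs, Real.norm_eq_abs, Real.abs_exp]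
          have := mul_le_mul_of_nonneg_left (hC c hc _ hσ x hx y)
            (Real.exp_pos (-(c / 2 * ‖y‖ ^ 2))).le
          refine this.trans (le_of_eq ?_)
          have : Real.exp (c / 2 * ‖y‖ ^ 2) * Real.exp (-(c / 2 * ‖y‖ ^ 2)) = 1 := by
            rw [← Real.exp_add]; simp
          linear_combination B * this
        · rw [indicator_of_notMem hy, gZ.zero y hy]; simp
      have hint : Integrable ((ball (0 : Euc m) R).indicator (fun _ => B ^ 2)) :=
        (integrable_indicator_iff measurableSet_ball).2
          (integrableOn_const measure_ball_lt_top.ne)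
      refine (integral_mono g2.int_nsq hint this).trans (le_of_eq ?_)
      rw [integral_indicator measurableSet_ball, setIntegral_const, smul_eq_mul, mul_comm]
    rw [e1] at CS
    have CS2 : (∫ y, v s y * Z y) ^ 2 ≤ (B * √V * Real.exp (R ^ 2 / (4 * S)) * √M) ^ 2 := by
      refine CS.trans ((mul_le_mul e2 e3 (integral_nonneg fun _ => by positivity)
        (by positivity)).trans (le_of_eq ?_))
      have : Real.exp (R ^ 2 / (2 * S)) = Real.exp (R ^ 2 / (4 * S)) ^ 2 := by
        rw [← Real.exp_nat_mul]; congr 1; push_cast; field_simp; norm_num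
      have e5 : (B * √V * Real.exp (R ^ 2 / (4 * S)) * √M) ^ 2
          = B ^ 2 * √V ^ 2 * Real.exp (R ^ 2 / (4 * S)) ^ 2 * √M ^ 2 := by ring
      rw [this, e5, Real.sq_sqrt hM0, Real.sq_sqrt (show 0 ≤ V from measureReal_nonneg)]
      ring
    exact abs_le_of_sq_le_sq CS2 (by positivity)
  have hd : ∀ s ∈ Icc t0 τ, HasDerivWithinAt
      (fun s => ∫ y, v s y * (χ y * mker c x (t1 - s) y))
      (∫ y, v s y * cutErr χ (mα c (t1 - s)) (mb c (t1 - s) • x) (mγ c x (t1 - s)) y)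
      (Icc t0 τ) s := fun s hs =>
    (F.hasDerivAt_gker hD hχ (α := mα c) (β := fun σ => mb c σ • x) (γ := mγ c x)
      (fun σ hσ => hasDerivAt_mα hc0 hσ)
      (fun σ hσ => ((hasDerivAt_mb hc0 hσ).smul_const x).congr_deriv (by rw [mul_smul]))
      (fun σ hσ => hasDerivAt_mγ hc0 hσ x) (lt_of_le_of_lt hs.2 h2)).hasDerivWithinAt
  have := norm_image_sub_le_of_norm_deriv_le_segment' hd
    (fun s hs => hder s ⟨hs.1, hs.2.trans h2⟩) τ ⟨h1, le_rfl⟩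
  rw [Real.norm_eq_abs] at this
  refine this.trans ?_
  have h4 : τ - t0 ≤ 1 := by linarith
  calc _ ≤ (B * √V * Real.exp (R ^ 2 / (4 * S)) * √M) * 1 := by gcongr
    _ = _ := by rw [hB]; ring

end MehlerFlow

section MehlerLimit

variable {m : ℕ} {D : Set (Euc m)} {c : ℝ} {v : ℝ → Euc m → ℝ} {g : ℝ → Euc m → Euc m}
  {h : ℝ → Euc m → ℝ} {gh : ℝ → Euc m → Euc m}

theorem continuous_mker (c σ : ℝ) : Continuous fun p : Euc m × Euc m => mker c p.1 σ p.2 := by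
  simp only [mker, gker, mγ]
  fun_prop

theorem integral_gauss : ∫ u : Euc m, Real.exp (-1 * ‖u‖ ^ 2) = Real.pi ^ ((m : ℝ) / 2) := by
  rw [GaussianFourier.integral_rexp_neg_mul_sq_norm one_pos, finrank_euclideanSpace_fin, div_one]

theorem integrable_gauss : Integrable fun u : Euc m => Real.exp (-1 * ‖u‖ ^ 2) := by
  by_contra hn
  have := integral_gauss (m := m)
  rw [integral_undef hn] at this
  exact (Real.rpow_pos_of_pos Real.pi_pos _).ne this

/-- The Mehler kernel integrated in its first variable, as a Gaussian average. -/
theorem integral_mker {σ : ℝ} (hc : 0 < c) (hσ : 0 < σ) (ψ : Euc m → ℝ) (y : Euc m) :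
    ∫ x, ψ x * mker c x σ y = Real.exp (-(m / 2 * Real.log (Real.pi * mq c σ))) *
      Real.exp (c / 2 * ‖y‖ ^ 2) * ∫ u, ψ ((mq c σ)⁻¹ • y +
        (√(c / (1 - mq c σ ^ 2)) * mq c σ)⁻¹ • u) * Real.exp (-1 * ‖u‖ ^ 2) := by
  have h0 := one_sub_mq_sq_pos hc hσ
  have hq := mq_pos c σ
  set q := mq c σ with hqdef
  set k := c / (1 - q ^ 2) with hk
  have hk0 : 0 < k := div_pos hc h0
  have hs : 0 < √k := Real.sqrt_pos.2 hk0
  set b := √k * q with hb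
  have hb0 : 0 < b := mul_pos hs hq
  set G : Euc m → ℝ := fun x => ψ x * Real.exp (-k * ‖y - q • x‖ ^ 2) with hG
  have e1 : ∀ u, ψ (q⁻¹ • y + b⁻¹ • u) * Real.exp (-1 * ‖u‖ ^ 2) = G (q⁻¹ • y + b⁻¹ • u) := by
    intro u
    simp only [hG]
    have : y - q • (q⁻¹ • y + b⁻¹ • u) = -((√k)⁻¹ • u) := by
      rw [smul_add, smul_smul, smul_smul, mul_inv_cancel₀ hq.ne', one_smul, hb, mul_inv,
        mul_comm, mul_assoc, inv_mul_cancel₀ hq.ne', mul_one]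
      abel
    rw [this, norm_neg, norm_smul, mul_pow, norm_inv, Real.norm_eq_abs, inv_pow, sq_abs,
      Real.sq_sqrt hk0.le]
    congr 2; field_simp
  simp_rw [e1]
  rw [Measure.integral_comp_smul volume (fun u => G (q⁻¹ • y + u)) b⁻¹,
    integral_add_left_eq_self G, finrank_euclideanSpace_fin, abs_of_pos (by positivity),
    inv_pow, inv_inv, smul_eq_mul, ← integral_const_mul, ← integral_const_mul]
  congr 1; funext x
  rw [mker_eq hc hσ, ← hqdef, ← hk]
  simp only [hG]
  have e2 : Real.exp (m / 2 * Real.log (c / Real.pi * (q / (1 - q ^ 2)))) =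
      Real.exp (-(m / 2 * Real.log (Real.pi * q))) * b ^ m := by
    have hpi := Real.pi_pos
    have : b ^ m = Real.exp (m / 2 * Real.log (k * q ^ 2)) := by
      have e3 : k * q ^ 2 = b ^ 2 := by rw [hb, mul_pow, Real.sq_sqrt hk0.le]
      rw [e3, Real.log_pow, ← mul_assoc]
      have e4 : (m : ℝ) / 2 * ((2 : ℕ) : ℝ) = m := by push_cast; ring
      rw [e4, mul_comm, Real.exp_mul, Real.exp_log hb0, Real.rpow_natCast]
    rw [this, ← Real.exp_add]
    congr 1
    have e5 : c / Real.pi * (q / (1 - q ^ 2)) = (k * q ^ 2) / (Real.pi * q) := by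
      rw [hk]; field_simp
    rw [e5, Real.log_div (by positivity) (by positivity)]
    ring
  rw [e2]
  ring

theorem tendsto_mq (c : ℝ) : Tendsto (mq c) (nhdsWithin 0 (Ioi 0)) (nhds 1) := by
  have : Continuous (mq c) := by unfold mq; fun_prop
  have := this.tendsto 0
  simp only [mq, mul_zero, neg_zero, Real.exp_zero] at this
  exact this.mono_left nhdsWithin_le_nhds

theorem integral_mker_bound {σ : ℝ} (hc : 0 < c) (hσ : 0 < σ) (hq : 1 / 2 ≤ mq c σ)
    {ψ : Euc m → ℝ} {B : ℝ} (hB : ∀ x, |ψ x| ≤ B) (y : Euc m) :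
    |∫ x, ψ x * mker c x σ y| ≤
      Real.exp (c / 2 * ‖y‖ ^ 2) * (B * Real.pi ^ ((m : ℝ) / 2)) := by
  rw [integral_mker hc hσ, abs_mul, abs_mul, Real.abs_exp, Real.abs_exp]
  have h1 : Real.exp (-(m / 2 * Real.log (Real.pi * mq c σ))) ≤ 1 := by
    apply Real.exp_le_one_iff.2
    have : 0 ≤ Real.log (Real.pi * mq c σ) := Real.log_nonneg (by
      nlinarith [Real.pi_gt_three])
    have : 0 ≤ (m : ℝ) / 2 * Real.log (Real.pi * mq c σ) := by positivity
    linarith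
  have h2 : |∫ u, ψ ((mq c σ)⁻¹ • y + (√(c / (1 - mq c σ ^ 2)) * mq c σ)⁻¹ • u)
      * Real.exp (-1 * ‖u‖ ^ 2)| ≤ B * Real.pi ^ ((m : ℝ) / 2) := by
    rw [← integral_gauss, ← integral_const_mul, ← Real.norm_eq_abs]
    refine norm_integral_le_of_norm_le (integrable_gauss.const_mul B)
      (Eventually.of_forall fun (u : Euc m) => ?_)
    rw [norm_mul, Real.norm_eq_abs, Real.norm_eq_abs, Real.abs_exp]
    exact mul_le_mul_of_nonneg_right (hB _) (Real.exp_pos _).le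
  have hB0 : 0 ≤ B := (abs_nonneg _).trans (hB 0)
  calc _ ≤ 1 * Real.exp (c / 2 * ‖y‖ ^ 2) * (B * Real.pi ^ ((m : ℝ) / 2)) := by gcongr
    _ = _ := by ring

theorem tendsto_integral_mker (hc : 0 < c) {ψ : Euc m → ℝ} (hψ : Continuous ψ) {B : ℝ}
    (hB : ∀ x, |ψ x| ≤ B) (y : Euc m) :
    Tendsto (fun σ => ∫ x, ψ x * mker c x σ y) (nhdsWithin 0 (Ioi 0))
      (nhds (Real.exp (c / 2 * ‖y‖ ^ 2) * ψ y)) := by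
  have tq := tendsto_mq c
  have hpi := Real.pi_pos
  have t1 : Tendsto (fun σ => Real.exp (-(m / 2 * Real.log (Real.pi * mq c σ))))
      (nhdsWithin 0 (Ioi 0)) (nhds (Real.exp (-(m / 2 * Real.log (Real.pi * 1))))) :=
    (Real.continuous_exp.tendsto _).comp
      (((((Real.continuousAt_log (by positivity)).tendsto).comp
        (tq.const_mul Real.pi)).const_mul ((m : ℝ) / 2)).neg)
  have tb : Tendsto (fun σ => (√(c / (1 - mq c σ ^ 2)) * mq c σ)⁻¹) (nhdsWithin 0 (Ioi 0))
      (nhds 0) := by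
    have e : ∀ σ ∈ Ioi (0 : ℝ), √((1 - mq c σ ^ 2) / c) * (mq c σ)⁻¹ =
        (√(c / (1 - mq c σ ^ 2)) * mq c σ)⁻¹ := fun σ _ => by
      rw [mul_inv, ← Real.sqrt_inv, inv_div]
    have : Tendsto (fun σ => √((1 - mq c σ ^ 2) / c) * (mq c σ)⁻¹) (nhdsWithin 0 (Ioi 0))
        (nhds (√((1 - 1 ^ 2) / c) * 1⁻¹)) :=
      ((Real.continuous_sqrt.tendsto _).comp (((tq.pow 2).const_sub 1).div_const c)).mul
        (tq.inv₀ one_ne_zero)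
    simp only [one_pow, sub_self, zero_div, Real.sqrt_zero, zero_mul] at this
    exact this.congr' (eventually_nhdsWithin_of_forall e)
  have t2 : Tendsto (fun σ => ∫ u : Euc m, ψ ((mq c σ)⁻¹ • y +
      (√(c / (1 - mq c σ ^ 2)) * mq c σ)⁻¹ • u) * Real.exp (-1 * ‖u‖ ^ 2))
      (nhdsWithin 0 (Ioi 0)) (nhds (∫ u : Euc m, ψ y * Real.exp (-1 * ‖u‖ ^ 2))) := by
    refine tendsto_integral_filter_of_dominated_convergence
      (fun u : Euc m => B * Real.exp (-1 * ‖u‖ ^ 2)) ?_ ?_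
      (integrable_gauss.const_mul B) ?_
    · refine Eventually.of_forall fun σ => Continuous.aestronglyMeasurable ?_
      fun_prop
    · refine Eventually.of_forall fun σ => Eventually.of_forall fun (u : Euc m) => ?_
      rw [norm_mul, Real.norm_eq_abs, Real.norm_eq_abs, Real.abs_exp]
      exact mul_le_mul_of_nonneg_right (hB _) (Real.exp_pos _).le
    · refine Eventually.of_forall fun (u : Euc m) => Tendsto.mul_const _ ?_
      have : Tendsto (fun σ => (mq c σ)⁻¹ • y + (√(c / (1 - mq c σ ^ 2)) * mq c σ)⁻¹ • u)
          (nhdsWithin 0 (Ioi 0)) (nhds ((1 : ℝ)⁻¹ • y + (0 : ℝ) • u)) :=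
        ((tq.inv₀ one_ne_zero).smul_const y).add (tb.smul_const u)
      rw [inv_one, one_smul, zero_smul, add_zero] at this
      exact (hψ.tendsto y).comp this
  have t3 := (t1.mul_const (Real.exp (c / 2 * ‖y‖ ^ 2))).mul t2
  have e : Real.exp (-(m / 2 * Real.log (Real.pi * 1))) * Real.exp (c / 2 * ‖y‖ ^ 2) *
      ∫ u : Euc m, ψ y * Real.exp (-1 * ‖u‖ ^ 2) = Real.exp (c / 2 * ‖y‖ ^ 2) * ψ y := by
    rw [integral_const_mul, integral_gauss, Real.rpow_def_of_pos hpi, mul_one]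
    have : Real.exp (-(m / 2 * Real.log Real.pi)) * Real.exp (Real.log Real.pi * (m / 2)) = 1 := by
      rw [← Real.exp_add]; rw [Real.exp_eq_one_iff]; ring
    linear_combination Real.exp (c / 2 * ‖y‖ ^ 2) * ψ y * this
  rw [e] at t3
  exact t3.congr' (eventually_nhdsWithin_of_forall fun σ hσ => (integral_mker hc hσ ψ y).symm)

end MehlerLimit

section MehlerClose

variable {m : ℕ} {D : Set (Euc m)} {c : ℝ} {v : ℝ → Euc m → ℝ} {g : ℝ → Euc m → Euc m}
  {h : ℝ → Euc m → ℝ} {gh : ℝ → Euc m → Euc m}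

theorem exists_bound_prod {s t : Set (Euc m)} (hs : Bornology.IsBounded s)
    (ht : Bornology.IsBounded t) {K : Euc m → Euc m → ℝ}
    (hK : Continuous fun p : Euc m × Euc m => K p.1 p.2) :
    ∃ C, 0 ≤ C ∧ ∀ x ∈ s, ∀ y ∈ t, |K x y| ≤ C := by
  obtain ⟨C, hC⟩ := (hs.isCompact_closure.prod ht.isCompact_closure).exists_bound_of_continuousOn
    hK.continuousOn
  exact ⟨|C|, abs_nonneg _, fun x hx y hy =>
    (hC (x, y) ⟨subset_closure hx, subset_closure hy⟩).trans (le_abs_self C)⟩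

theorem Good.continuous_integral (hD : Bornology.IsBounded D) {f : Euc m → ℝ} (hf : Good D f)
    {K : Euc m → Euc m → ℝ} (hK : Continuous fun p : Euc m × Euc m => K p.1 p.2) :
    Continuous fun x => ∫ y, f y * K x y := by
  rw [continuous_iff_continuousAt]
  intro x
  obtain ⟨C, hC0, hC⟩ := exists_bound_prod (isBounded_closedBall (x := x) (r := 1)) hD hK
  have hKx : ∀ x, Continuous (K x) := fun x => hK.comp (by fun_prop : Continuous fun y => (x, y))
  refine continuousAt_of_dominated (bound := fun y => C * ‖f y‖) ?_ ?_
    ((hf.integrable hD).norm.const_mul C) ?_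
  · exact Eventually.of_forall fun z => hf.mem.1.mul (hKx z).aestronglyMeasurable
  · filter_upwards [closedBall_mem_nhds x one_pos] with z hz
    refine Eventually.of_forall fun y => ?_
    by_cases hy : y ∈ D
    · rw [norm_mul, mul_comm, Real.norm_eq_abs (K z y)]
      exact mul_le_mul_of_nonneg_right (hC z hz y hy) (norm_nonneg _)
    · simp [hf.zero y hy]
  · refine Eventually.of_forall fun y => ContinuousAt.mul continuousAt_const ?_
    exact (hK.comp (by fun_prop : Continuous fun x => (x, y))).continuousAt

theorem Good.integrable_prod (hD : Bornology.IsBounded D) {f : Euc m → ℝ} (hf : Good D f)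
    {D' : Set (Euc m)} (hD' : Bornology.IsBounded D') {ψ : Euc m → ℝ} (hψ : Good D' ψ)
    {K : Euc m → Euc m → ℝ} (hK : Continuous fun p : Euc m × Euc m => K p.1 p.2) :
    Integrable (fun p : Euc m × Euc m => ψ p.1 * (f p.2 * K p.1 p.2)) (volume.prod volume) := by
  obtain ⟨C, hC0, hC⟩ := exists_bound_prod hD' hD hK
  refine (((hψ.integrable hD').norm.mul_prod (hf.integrable hD).norm).const_mul C).mono'
    (hψ.mem.1.comp_fst.mul (hf.mem.1.comp_snd.mul hK.aestronglyMeasurable))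
    (Eventually.of_forall fun p => ?_)
  by_cases h1 : p.1 ∈ D'
  swap
  · simp [hψ.zero _ h1]
  by_cases h2 : p.2 ∈ D
  swap
  · simp [hf.zero _ h2]
  rw [norm_mul, norm_mul, Real.norm_eq_abs (K _ _)]
  have := mul_le_mul_of_nonneg_left (hC _ h1 _ h2)
    (mul_nonneg (norm_nonneg (ψ p.1)) (norm_nonneg (f p.2)))
  linarith

theorem Good.integral_swap (hD : Bornology.IsBounded D) {f : Euc m → ℝ} (hf : Good D f)
    {D' : Set (Euc m)} (hD' : Bornology.IsBounded D') {ψ : Euc m → ℝ} (hψ : Good D' ψ)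
    {K : Euc m → Euc m → ℝ} (hK : Continuous fun p : Euc m × Euc m => K p.1 p.2) :
    ∫ x, ψ x * ∫ y, f y * K x y = ∫ y, f y * ∫ x, ψ x * K x y := by
  have := integral_integral_swap (f := fun x y => ψ x * (f y * K x y))
    (hf.integrable_prod hD hD' hψ hK)
  simp only [integral_const_mul] at this
  rw [this]
  congr 1; funext y
  rw [← integral_const_mul]
  congr 1; funext x; ring

theorem Good.integral_sq_le {f : Euc m → ℝ} {x0 : Euc m} {r B : ℝ} (hf : Good (ball x0 r) f)
    (hB : ∀ y ∈ ball x0 r, |f y| ≤ B) :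
    ∫ y, f y ^ 2 ≤ B ^ 2 * volume.real (ball x0 r) := by
  have hint : Integrable ((ball x0 r).indicator (fun _ => B ^ 2)) :=
    (integrable_indicator_iff measurableSet_ball).2 (integrableOn_const measure_ball_lt_top.ne)
  refine (integral_mono hf.int_sq hint fun y => ?_).trans (le_of_eq ?_)
  · by_cases hy : y ∈ ball x0 r
    · rw [indicator_of_mem hy, ← sq_abs]
      exact pow_le_pow_left₀ (abs_nonneg _) (hB y hy) 2
    · rw [indicator_of_notMem hy, hf.zero y hy]; simp
  · rw [integral_indicator measurableSet_ball, setIntegral_const, smul_eq_mul, mul_comm]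

theorem HeatFlow.tendsto_sub_sq (F : HeatFlow D c v g h gh) (t : ℝ) :
    Tendsto (fun s => ∫ x, (v s x - v t x) ^ 2) (nhds t) (nhds 0) := by
  have h1 : Tendsto (fun s => ∫ x, v s x ^ 2) (nhds t) (nhds (∫ x, v t x ^ 2)) := by
    have := (F.cont_loc univ).tendsto t
    simpa only [setIntegral_univ] using this
  have h2 := F.deriv_pair (fun _ => v t) (fun _ => 0) t
    (fun f _ => by simpa using hasDerivAt_const t (∫ x, f x * v t x))
    (fun f _ => by simp) (fun s f hf => hf.int_mul (F.good t))
  have h3 := h2.continuousAt.tendsto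
  have e : ∀ s, (∫ x, v s x ^ 2) + (-2) * (∫ x, v s x * v t x) + (∫ x, v t x ^ 2)
      = ∫ x, (v s x - v t x) ^ 2 := fun s => by
    have := integral_lin3 (F.good s).int_sq ((F.good s).int_mul (F.good t)) (F.good t).int_sq
      1 (-2) 1
    rw [one_mul, one_mul] at this
    rw [← this]; congr 1; funext x; ring
  have h4 := (h1.add (h3.const_mul (-2))).add_const (∫ x, v t x ^ 2)
  refine (h4.congr e).trans (le_of_eq ?_)
  congr 1
  have : ∫ x, v t x ^ 2 = ∫ x, v t x * v t x := by congr 1; funext x; ring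
  rw [this]; ring

/-- The Mehler kernel is an approximation of the identity. -/
theorem HeatFlow.tendsto_mehler {R ρ ρ' : ℝ} (hρ' : ρ < ρ') {χ : Euc m → ℝ}
    (hχ : IsTest (ball 0 R) χ) (hχ1 : ∀ y, ‖y‖ < ρ' → χ y = 1)
    (F : HeatFlow (ball 0 R) c v g h gh) (hc : 0 < c) {ψ : Euc m → ℝ} (hψ : Continuous ψ)
    (hψ0 : ∀ x ∉ closedBall (0 : Euc m) ρ, ψ x = 0) (hψg : Good (closedBall 0 ρ) ψ) (t : ℝ) :
    Tendsto (fun σ => ∫ x, ψ x * ∫ y, v (t - σ) y * (χ y * mker c x σ y)) (nhdsWithin 0 (Ioi 0))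
      (nhds (∫ x, ψ x * (Real.exp (c / 2 * ‖x‖ ^ 2) * v t x))) := by
  have hD : Bornology.IsBounded (ball (0 : Euc m) R) := isBounded_ball
  have hD' : Bornology.IsBounded (closedBall (0 : Euc m) ρ) := isBounded_closedBall
  obtain ⟨B, hB0, hB⟩ := exists_bound_of_isBounded hD' hψ
  have hB' : ∀ x, |ψ x| ≤ B := fun x => by
    by_cases hx : x ∈ closedBall (0 : Euc m) ρ
    · exact hB x hx
    · rw [hψ0 x hx, abs_zero]; exact hB0
  have hcχ : Continuous χ := hχ.contDiff.continuous
  obtain ⟨X, hX0, hX⟩ := exists_bound_of_isBounded hD hcχ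
  have hK : ∀ σ, Continuous fun p : Euc m × Euc m => χ p.2 * mker c p.1 σ p.2 := fun σ =>
    (hcχ.comp continuous_snd).mul (continuous_mker c σ)
  have hP : ∀ σ, Continuous fun y => ∫ x, ψ x * mker c x σ y := fun σ =>
by
    have hs : Continuous fun p : Euc m × Euc m => mker c p.2 σ p.1 := by
      simp only [mker, gker, mγ]
      fun_prop
    exact hψg.continuous_integral hD' (K := fun y x => mker c x σ y) hs
  have e1 : ∀ σ, ∫ x, ψ x * ∫ y, v (t - σ) y * (χ y * mker c x σ y)
      = ∫ y, v (t - σ) y * (χ y * ∫ x, ψ x * mker c x σ y) := fun σ => by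
    rw [(F.good (t - σ)).integral_swap hD hD' hψg (K := fun x y => χ y * mker c x σ y) (hK σ)]
    congr 1; funext y; congr 1; rw [← integral_const_mul]; congr 1; funext x; ring
  set Q := X * (Real.exp (c / 2 * R ^ 2) * (B * Real.pi ^ ((m : ℝ) / 2))) with hQ
  have hQ0 : 0 ≤ Q := by have := Real.pi_pos; positivity
  have hev : ∀ᶠ σ in nhdsWithin (0 : ℝ) (Ioi 0), ∀ y ∈ ball (0 : Euc m) R,
      |χ y * ∫ x, ψ x * mker c x σ y| ≤ Q := by
    filter_upwards [self_mem_nhdsWithin, (tendsto_mq c).eventually_const_le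
      (show (1 / 2 : ℝ) < 1 by norm_num)] with σ hσ hq y hy
    rw [abs_mul]
    have h1 := integral_mker_bound hc hσ hq hB' y
    have h2 : Real.exp (c / 2 * ‖y‖ ^ 2) ≤ Real.exp (c / 2 * R ^ 2) := by
      apply Real.exp_le_exp.2
      have := pow_le_pow_left₀ (norm_nonneg y) (mem_ball_zero_iff.1 hy).le 2
      gcongr
    have hpi := Real.pi_pos
    exact mul_le_mul (hX y hy) (h1.trans (by gcongr)) (abs_nonneg _) hX0
  have gP : ∀ σ, Good (ball (0 : Euc m) R) fun y => χ y * ∫ x, ψ x * mker c x σ y := fun σ => by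
    have := hχ.good.mul hD (hP σ)
    simpa only [mul_comm] using this
  have t1 : Tendsto (fun σ => ∫ y, (v (t - σ) y - v t y) * (χ y * ∫ x, ψ x * mker c x σ y))
      (nhdsWithin 0 (Ioi 0)) (nhds 0) := by
    have hs : Tendsto (fun σ : ℝ => t - σ) (nhdsWithin 0 (Ioi 0)) (nhds t) := by
      have : Tendsto (fun σ : ℝ => t - σ) (nhds 0) (nhds (t - 0)) :=
        (continuous_const.sub continuous_id).tendsto 0
      rw [sub_zero] at this
      exact this.mono_left nhdsWithin_le_nhds
    have hz := ((F.tendsto_sub_sq t).comp hs).mul_const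
      (Q ^ 2 * volume.real (ball (0 : Euc m) R))
    rw [zero_mul] at hz
    have hsq : Tendsto (fun σ => (∫ y, (v (t - σ) y - v t y) *
        (χ y * ∫ x, ψ x * mker c x σ y)) ^ 2) (nhdsWithin 0 (Ioi 0)) (nhds 0) := by
      refine tendsto_of_tendsto_of_tendsto_of_le_of_le' tendsto_const_nhds hz
        (Eventually.of_forall fun _ => sq_nonneg _) ?_
      filter_upwards [hev] with σ hσ
      have CS := abs_integral_inner_le ((F.good (t - σ)).sub (F.good t)).mem (gP σ).mem
      simp only [RCLike.inner_apply, conj_trivial, Real.norm_eq_abs, sq_abs] at CS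
      simp only [mul_comm (v (t - σ) _ - v t _)]
      refine CS.trans (mul_le_mul_of_nonneg_left ((gP σ).integral_sq_le hσ)
        (integral_nonneg fun _ => sq_nonneg _))
    have := hsq.sqrt
    simp only [Real.sqrt_sq_eq_abs, Real.sqrt_zero] at this
    exact tendsto_zero_iff_abs_tendsto_zero _ |>.2 this
  have t2 : Tendsto (fun σ => ∫ y, v t y * (χ y * ∫ x, ψ x * mker c x σ y))
      (nhdsWithin 0 (Ioi 0)) (nhds (∫ x, ψ x * (Real.exp (c / 2 * ‖x‖ ^ 2) * v t x))) := by
    refine tendsto_integral_filter_of_dominated_convergence (fun y => Q * ‖v t y‖) ?_ ?_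
      (((F.good t).integrable hD).norm.const_mul Q) ?_
    · exact Eventually.of_forall fun σ => (F.good t).mem.1.mul (gP σ).mem.1
    · filter_upwards [hev] with σ hσ
      refine Eventually.of_forall fun y => ?_
      by_cases hy : y ∈ ball (0 : Euc m) R
      · rw [norm_mul, mul_comm, Real.norm_eq_abs (χ y * _)]
        exact mul_le_mul_of_nonneg_right (hσ y hy) (norm_nonneg _)
      · simp [(F.good t).zero y hy]
    · refine Eventually.of_forall fun y => ?_
      have := ((tendsto_integral_mker hc hψ hB' y).const_mul (χ y)).const_mul (v t y)
      refine this.trans (le_of_eq ?_)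
      congr 1
      by_cases hy : y ∈ closedBall (0 : Euc m) ρ
      · rw [hχ1 y (lt_of_le_of_lt (mem_closedBall_zero_iff.1 hy) hρ')]; ring
      · rw [hψ0 y hy]; ring
  have t3 := t1.add t2
  rw [zero_add] at t3
  refine t3.congr fun σ => ?_
  rw [e1, ← integral_add (((F.good (t - σ)).sub (F.good t)).int_mul (gP σ))
    ((F.good t).int_mul (gP σ))]
  congr 1; funext y; ring

end MehlerClose

section MehlerClose

variable {m : ℕ} {D : Set (Euc m)} {c : ℝ} {v : ℝ → Euc m → ℝ} {g : ℝ → Euc m → Euc m}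
  {h : ℝ → Euc m → ℝ} {gh : ℝ → Euc m → Euc m}

theorem Good.of_continuous {ψ : Euc m → ℝ} (hψ : Continuous ψ) {ρ : ℝ}
    (hz : ∀ x ∉ closedBall (0 : Euc m) ρ, ψ x = 0) : Good (closedBall 0 ρ) ψ :=
  ⟨hψ.memLp_of_hasCompactSupport (HasCompactSupport.intro (isCompact_closedBall 0 ρ) fun {x} hx => hz x hx),
    hz⟩

theorem Good.mono {D' : Set (Euc m)} (hDD : D ⊆ D') {f : Euc m → ℝ} (hf : Good D f) : Good D' f :=
  ⟨hf.mem, fun x hx => hf.zero x fun h => hx (hDD h)⟩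

/-- The Mehler approximation of `exp (c‖x‖²/2) v (t0 + s) x`. -/
noncomputable def mapx (χ : Euc m → ℝ) (c s : ℝ) (f : Euc m → ℝ) (x : Euc m) : ℝ :=
  ∫ y, f y * (χ y * mker c x s y)

theorem continuous_mapx {χ : Euc m → ℝ} (hχ : Continuous χ) (hD : Bornology.IsBounded D)
    {f : Euc m → ℝ} (hf : Good D f) (c s : ℝ) : Continuous (mapx χ c s f) := by
  refine hf.continuous_integral hD (K := fun x y => χ y * mker c x s y) ?_
  exact (hχ.comp continuous_snd).mul (continuous_mker c s)

theorem mehler_weak_error {R ρ ρ' : ℝ} (hρ : 0 ≤ ρ) (hρ' : ρ < ρ') {χ : Euc m → ℝ}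
    (hχ : IsTest (ball 0 R) χ) (hχ1 : ∀ y, ‖y‖ < ρ' → χ y = 1) :
    ∃ C, 0 ≤ C ∧ ∀ {c : ℝ} {v : ℝ → Euc m → ℝ} {g : ℝ → Euc m → Euc m}
      {h : ℝ → Euc m → ℝ} {gh : ℝ → Euc m → Euc m}, HeatFlow (ball 0 R) c v g h gh → 1 ≤ c →
      ∀ {S s t : ℝ}, 0 < S → 0 < s → s ≤ 1 → ∀ ψ : Euc m → ℝ, Continuous ψ →
      (∀ x ∉ closedBall (0 : Euc m) ρ, ψ x = 0) →
      |(∫ x, ψ x * (Real.exp (c / 2 * ‖x‖ ^ 2) * v t x)) - ∫ x, ψ x * mapx χ c s (v (t - s)) x|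
        ≤ C * Real.exp (-c * ((ρ' - ρ) ^ 2 / 2)) * Real.exp (R ^ 2 / (4 * S)) *
          √(∫ y, v (t - s - S) y ^ 2) * √(∫ x, ψ x ^ 2) := by
  obtain ⟨C, hC0, hC⟩ := mehler_error hρ hρ' hχ hχ1
  set V : ℝ := volume.real (closedBall (0 : Euc m) ρ) with hV
  have hV0 : 0 ≤ V := measureReal_nonneg
  refine ⟨C * √V, by positivity, ?_⟩
  intro c v g h gh F hc S s t hS hs hs1 ψ hψ hψ0
  have hg := Good.of_continuous hψ hψ0
  have hb : Bornology.IsBounded (closedBall (0 : Euc m) ρ) := isBounded_closedBall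
  set E := C * Real.exp (-c * ((ρ' - ρ) ^ 2 / 2)) * Real.exp (R ^ 2 / (4 * S)) *
          √(∫ y, v (t - s - S) y ^ 2) with hE
  have hE0 : 0 ≤ E := by positivity
  have hcont : ∀ (σ r : ℝ), Continuous (mapx χ c σ (v r)) := fun σ r =>
    continuous_mapx hχ.contDiff.continuous isBounded_ball (F.good r) c σ
  have hint : ∀ (σ r : ℝ), Integrable fun x => ψ x * mapx χ c σ (v r) x := fun σ r => by
    simpa only [mul_comm] using (hg.mul hb (hcont σ r)).integrable hb
  have h1 : |(∫ x, ψ x * (Real.exp (c / 2 * ‖x‖ ^ 2) * v t x)) -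
      ∫ x, ψ x * mapx χ c s (v (t - s)) x| ≤ E * ∫ x, |ψ x| := by
    have lim := ((F.tendsto_mehler hρ' hχ hχ1 (by linarith) hψ hψ0 hg t).sub_const
      (∫ x, ψ x * mapx χ c s (v (t - s)) x)).abs
    refine le_of_tendsto lim ?_
    filter_upwards [Ioo_mem_nhdsGT hs] with σ hσ
    have e : (∫ x, ψ x * ∫ y, v (t - σ) y * (χ y * mker c x σ y)) -
        ∫ x, ψ x * mapx χ c s (v (t - s)) x =
        ∫ x, ψ x * (mapx χ c σ (v (t - σ)) x - mapx χ c s (v (t - s)) x) := by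
      refine Eq.trans (integral_sub (hint σ (t - σ)) (hint s (t - s))).symm ?_
      congr 1; funext x; ring
    rw [e, ← integral_const_mul, ← Real.norm_eq_abs]
    refine norm_integral_le_of_norm_le ((hg.integrable hb).abs.const_mul E)
      (Eventually.of_forall fun x => ?_)
    by_cases hx : x ∈ closedBall (0 : Euc m) ρ
    · rw [norm_mul, mul_comm, Real.norm_eq_abs, Real.norm_eq_abs]
      have := hC F hc (t0 := t - s) (τ := t - σ) (t1 := t) hS (by linarith [hσ.2])
        (by linarith [hσ.1]) (by linarith) x (mem_closedBall_zero_iff.1 hx)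
      rw [sub_sub_cancel, sub_sub_cancel] at this
      exact mul_le_mul_of_nonneg_right this (abs_nonneg _)
    · rw [hψ0 x hx]; simp
  have h2 : ∫ x, |ψ x| ≤ √V * √(∫ x, ψ x ^ 2) := by
    rw [← Real.sqrt_mul hV0]
    refine Real.le_sqrt_of_sq_le ?_
    have gi : MemLp ((closedBall (0 : Euc m) ρ).indicator fun _ => (1 : ℝ)) 2 volume :=
      memLp_indicator_const 2 measurableSet_closedBall 1 (Or.inr measure_closedBall_lt_top.ne)
    have := abs_integral_inner_le gi hg.mem.norm
    simp only [RCLike.inner_apply, conj_trivial, Real.norm_eq_abs, sq_abs] at this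
    have e1 : ∀ x, |ψ x| * (closedBall (0 : Euc m) ρ).indicator (fun _ => (1 : ℝ)) x = |ψ x| := by
      intro x
      by_cases hx : x ∈ closedBall (0 : Euc m) ρ
      · rw [indicator_of_mem hx, mul_one]
      · rw [hψ0 x hx]; simp
    have e2 : ∫ x, (closedBall (0 : Euc m) ρ).indicator (fun _ => (1 : ℝ)) x ^ 2 = V := by
      have : ∀ x, (closedBall (0 : Euc m) ρ).indicator (fun _ => (1 : ℝ)) x ^ 2 =
        (closedBall (0 : Euc m) ρ).indicator (fun _ => (1 : ℝ)) x := fun x => by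
          by_cases hx : x ∈ closedBall (0 : Euc m) ρ <;> simp [hx]
      simp only [this]
      rw [integral_indicator measurableSet_closedBall, setIntegral_const, smul_eq_mul, mul_one]
    simpa only [e1, e2] using this
  calc _ ≤ E * ∫ x, |ψ x| := h1
    _ ≤ E * (√V * √(∫ x, ψ x ^ 2)) := by gcongr
    _ = _ := by rw [hE]; ring

/-- Local `L²` closeness of the flow to its Mehler approximation. -/
theorem mehler_close {R ρ ρ₁ ρ' : ℝ} (hρ₁ : 0 < ρ₁) (hρ : ρ₁ < ρ) (hρ' : ρ < ρ') {χ : Euc m → ℝ}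
    (hχ : IsTest (ball 0 R) χ) (hχ1 : ∀ y, ‖y‖ < ρ' → χ y = 1) :
    ∃ C, 0 ≤ C ∧ ∀ {c : ℝ} {v : ℝ → Euc m → ℝ} {g : ℝ → Euc m → Euc m}
      {h : ℝ → Euc m → ℝ} {gh : ℝ → Euc m → Euc m}, HeatFlow (ball 0 R) c v g h gh → 1 ≤ c →
      ∀ {S s t : ℝ}, 0 < S → 0 < s → s ≤ 1 →
      ∫ x in ball 0 ρ₁, (Real.exp (c / 2 * ‖x‖ ^ 2) * v t x - mapx χ c s (v (t - s)) x) ^ 2 ≤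
        C * Real.exp (-c * (ρ' - ρ) ^ 2) * Real.exp (R ^ 2 / (2 * S)) *
          ∫ y, v (t - s - S) y ^ 2 := by
  obtain ⟨C, hC0, hC⟩ := mehler_weak_error (hρ₁.le.trans hρ.le) hρ' hχ hχ1
  refine ⟨C ^ 2, by positivity, ?_⟩
  intro c v g h gh F hc S s t hS hs hs1
  set M := ∫ y, v (t - s - S) y ^ 2 with hM
  have hM0 : 0 ≤ M := integral_nonneg fun _ => sq_nonneg _
  set E := C * Real.exp (-c * ((ρ' - ρ) ^ 2 / 2)) * Real.exp (R ^ 2 / (4 * S)) * √M with hE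
  have hE0 : 0 ≤ E := by positivity
  set b : ContDiffBump (0 : Euc m) := ⟨ρ₁, ρ, hρ₁, hρ⟩ with hb
  set A := mapx χ c s (v (t - s)) with hA
  have hAc : Continuous A :=
    continuous_mapx hχ.contDiff.continuous isBounded_ball (F.good (t - s)) c s
  have hbc : Continuous fun x => b x := b.continuous
  have hb0 : ∀ x ∉ closedBall (0 : Euc m) ρ, b x = 0 := fun x hx =>
    b.zero_of_le_dist (by rw [mem_closedBall, not_le] at hx; exact hx.le)
  have hD : Bornology.IsBounded (ball (0 : Euc m) R) := isBounded_ball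
  have hb' : Bornology.IsBounded (closedBall (0 : Euc m) ρ) := isBounded_closedBall
  have hgb := Good.of_continuous hbc hb0
  have hec : Continuous fun x : Euc m => b x * Real.exp (c / 2 * ‖x‖ ^ 2) := by fun_prop
  obtain ⟨φ, hφ, hφv, -⟩ := (F.weak t).h10.approx
  have L1 : L2Lim volume (fun k x => b x * Real.exp (c / 2 * ‖x‖ ^ 2) * φ k x)
      (fun x => b x * Real.exp (c / 2 * ‖x‖ ^ 2) * v t x) :=
    hφv.smul_cont hD (fun k x hx => (hφ k).good.zero x hx) (F.good t).zero hec
  have gA : Good (closedBall (0 : Euc m) ρ) fun x => A x * b x := hgb.mul hb' hAc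
  have L2 := L1.add (L2Lim.const (gA.const_smul (-1)).mem)
  set u : ℕ → Euc m → ℝ := fun k x => b x * (Real.exp (c / 2 * ‖x‖ ^ 2) * φ k x - A x) with hu
  set w : Euc m → ℝ := fun x => b x * (Real.exp (c / 2 * ‖x‖ ^ 2) * v t x - A x) with hw
  have L : L2Lim volume u w := by
    convert L2 using 1
    · funext k x; simp only [hu, smul_eq_mul]; ring
    · funext x; simp only [hw, smul_eq_mul]; ring
  have huc : ∀ k, Continuous (u k) := fun k => by
    have := (hφ k).contDiff.continuous
    simp only [hu]; fun_prop
  have hu0 : ∀ k, ∀ x ∉ closedBall (0 : Euc m) ρ, u k x = 0 := fun k x hx => by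
    simp only [hu]; rw [hb0 x hx, zero_mul]
  have hle1 : ∀ k, ∫ x, (b x * u k x) ^ 2 ≤ ∫ x, u k x ^ 2 := fun k => by
    have gu := Good.of_continuous (huc k) (hu0 k)
    refine integral_mono (gu.mul hb' hbc).int_sq gu.int_sq fun x => ?_
    rw [mul_pow]
    exact mul_le_of_le_one_left (sq_nonneg _) (pow_le_one₀ b.nonneg b.le_one)
  have key : ∀ k, ∫ x, u k x * w x ≤ E * √(∫ x, u k x ^ 2) := fun k => by
    have h1 := hC F hc (t := t) hS hs hs1 (fun x => b x * u k x) (hbc.mul (huc k))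
      (fun x hx => by rw [hb0 x hx, zero_mul])
    have gu : Good (closedBall (0 : Euc m) ρ) (fun x => b x * u k x) :=
      (Good.of_continuous (huc k) (hu0 k)).mul hb' hbc
    have e : (∫ x, b x * u k x * (Real.exp (c / 2 * ‖x‖ ^ 2) * v t x)) -
        ∫ x, b x * u k x * A x = ∫ x, u k x * w x := by
      have i1 : Integrable fun x => b x * u k x * (Real.exp (c / 2 * ‖x‖ ^ 2) * v t x) :=
        memLp_two_integrable_mul gu.mem ((F.good t).mul hD
          (b := fun x => Real.exp (c / 2 * ‖x‖ ^ 2)) (by fun_prop)).mem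
      have i2 : Integrable fun x => b x * u k x * A x := by
        simpa only [mul_comm] using (gu.mul hb' hAc).integrable hb'
      rw [← integral_sub i1 i2]
      congr 1; funext x; simp only [hw]; ring
    rw [e] at h1
    calc _ ≤ _ := (le_abs_self _).trans h1
      _ ≤ _ := mul_le_mul_of_nonneg_left (Real.sqrt_le_sqrt (hle1 k)) hE0
  have t1 := L.tendsto_mul (L2Lim.const L.memLim)
  have t2 := (L.tendsto_norm_sq.sqrt).const_mul E
  simp only [Real.norm_eq_abs, sq_abs] at t2
  have h1 := le_of_tendsto_of_tendsto' t1 t2 key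
  set W := ∫ x, w x ^ 2 with hW
  have hW0 : 0 ≤ W := integral_nonneg fun _ => sq_nonneg _
  have h2 : W ≤ E * √W := by
    refine le_trans (le_of_eq ?_) h1
    rw [hW]; congr 1; funext x; ring
  have h3 : W ≤ E ^ 2 := by
    have hs := Real.sq_sqrt hW0
    have h0 := Real.sqrt_nonneg W
    rcases h0.eq_or_lt with h0 | h0
    · rw [← h0] at hs; nlinarith [sq_nonneg E]
    · have : √W ≤ E := by
        refine le_of_mul_le_mul_right ?_ h0
        nlinarith
      nlinarith
  have h4 : ∫ x in ball 0 ρ₁, (Real.exp (c / 2 * ‖x‖ ^ 2) * v t x - A x) ^ 2 ≤ W := by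
    rw [hW, ← integral_indicator measurableSet_ball]
    have hwi : Integrable fun x => w x ^ 2 := by
      have := memLp_two_integrable_mul L.memLim L.memLim
      exact this.congr (Eventually.of_forall fun x => by simp only [sq])
    refine integral_mono_of_nonneg (Eventually.of_forall fun x =>
      indicator_nonneg (fun x _ => sq_nonneg _) x) hwi (Eventually.of_forall fun x => ?_)
    by_cases hx : x ∈ ball (0 : Euc m) ρ₁
    · simp only [indicator_of_mem hx, hw]
      rw [b.one_of_mem_closedBall (ball_subset_closedBall hx), one_mul]
    · simp only [indicator_of_notMem hx]; positivity
  refine (h4.trans h3).trans (le_of_eq ?_)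
  rw [hE, mul_pow, mul_pow, mul_pow, Real.sq_sqrt hM0, ← Real.exp_nat_mul, ← Real.exp_nat_mul]
  have e1 : ((2 : ℕ) : ℝ) * (-c * ((ρ' - ρ) ^ 2 / 2)) = -c * (ρ' - ρ) ^ 2 := by push_cast; ring
  have e2 : ((2 : ℕ) : ℝ) * (R ^ 2 / (4 * S)) = R ^ 2 / (2 * S) := by push_cast; field_simp; ring
  rw [e1, e2]

end MehlerClose

/-! ### Extrapolation of the Mehler approximation along rays -/

section Extrapolation

variable {m : ℕ}

theorem exp_taylor_bound {z η : ℝ} (hz : |z| ≤ η) (hη : η ≤ 1) {n : ℕ} (hn : 0 < n) :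
    |Real.exp z - ∑ j ∈ Finset.range n, z ^ j / j.factorial| ≤ 2 * η ^ n := by
  refine (Real.exp_bound (hz.trans hη) hn).trans ?_
  have hn' : (1 : ℝ) ≤ n := by exact_mod_cast hn
  have hf : (1 : ℝ) ≤ n.factorial := by exact_mod_cast Nat.one_le_of_lt n.factorial_pos
  have h1 : ((n.succ : ℕ) : ℝ) / (n.factorial * n) ≤ 2 := by
    rw [div_le_iff₀ (by positivity)]; push_cast; nlinarith
  have h2 : |z| ^ n ≤ η ^ n := pow_le_pow_left₀ (abs_nonneg _) hz n
  calc |z| ^ n * (((n.succ : ℕ) : ℝ) / (n.factorial * n)) ≤ η ^ n * 2 :=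
      mul_le_mul h2 h1 (by positivity) ((pow_nonneg (abs_nonneg z) n).trans h2)
    _ = _ := mul_comm _ _

/-- Equidistant nodes in `(0, θ]`. -/
noncomputable def lnode (θ : ℝ) (N k : ℕ) : ℝ := θ * (k + 1) / N

/-- Lagrange extrapolation from equidistant nodes in `(0, θ]` to `1`. -/
theorem exists_lagrange {θ : ℝ} (hθ : 0 < θ) (hθ1 : θ ≤ 1) {N : ℕ} (hN : 0 < N) :
    ∃ l : Fin N → ℝ, (∀ k, |l k| ≤ (N / θ) ^ N) ∧
      ∀ p : Polynomial ℝ, p.degree < N →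
        p.eval 1 = ∑ k, l k * p.eval (lnode θ N k) := by
  have hN' : (1 : ℝ) ≤ N := by exact_mod_cast hN
  set t : Fin N → ℝ := fun k => lnode θ N k with ht
  have hinj : Set.InjOn t (Finset.univ : Finset (Fin N)) := by
    intro a _ b _ hab
    simp only [ht, lnode] at hab
    have : ((a : ℕ) : ℝ) = (b : ℕ) := by
      field_simp at hab
      linarith
    exact Fin.ext (by exact_mod_cast this)
  refine ⟨fun k => (Lagrange.basis Finset.univ t k).eval 1, fun k => ?_, fun p hp => ?_⟩
  · have hNθ : 1 ≤ N / θ := by rw [le_div_iff₀ hθ]; linarith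
    simp only [Lagrange.basis, Polynomial.eval_prod, Finset.abs_prod]
    have hc : (Finset.univ.erase k).card ≤ N := by
      rw [Finset.card_erase_of_mem (Finset.mem_univ k), Finset.card_univ, Fintype.card_fin]; omega
    refine (Finset.prod_le_prod (g := fun _ => (N / θ : ℝ)) (fun _ _ => abs_nonneg _)
      fun j hj => ?_).trans ((le_of_eq (Finset.prod_const _)).trans (pow_le_pow_right₀ hNθ hc))
    have hkj : (k : ℕ) ≠ j := fun h => (Finset.ne_of_mem_erase hj) (Fin.ext h.symm)
    simp only [Lagrange.basisDivisor, Polynomial.eval_mul, Polynomial.eval_C, Polynomial.eval_sub,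
      Polynomial.eval_X, abs_mul, abs_inv]
    have hj1 : t j ≤ 1 := by
      have : (((j : ℕ) : ℝ) + 1) ≤ N := by exact_mod_cast j.2
      simp only [ht, lnode]
      rw [div_le_one (by linarith)]
      nlinarith
    have hj0 : 0 ≤ t j := by simp only [ht, lnode]; positivity
    have h1 : |1 - t j| ≤ 1 := by rw [abs_le]; constructor <;> linarith
    have h2 : θ / N ≤ |t k - t j| := by
      have e : t k - t j = θ / N * (((k : ℕ) : ℝ) - (j : ℕ)) := by simp only [ht, lnode]; field_simp; ring
      rw [e, abs_mul, abs_of_pos (by positivity : 0 < θ / N)]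
      have : (1 : ℝ) ≤ |((k : ℕ) : ℝ) - (j : ℕ)| := by
        have : (1 : ℤ) ≤ |((k : ℕ) : ℤ) - (j : ℕ)| :=
          Int.one_le_abs (sub_ne_zero.2 (by exact_mod_cast hkj))
        exact_mod_cast this
      exact le_mul_of_one_le_right (by positivity) this
    have h3 : |t k - t j|⁻¹ ≤ N / θ := by
      rw [← inv_div]
      exact inv_anti₀ (by positivity) h2
    calc _ ≤ N / θ * 1 := mul_le_mul h3 h1 (abs_nonneg _) (by positivity)
      _ = _ := mul_one _
  · have hp' : p.degree < (Finset.univ : Finset (Fin N)).card := by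
      rwa [Finset.card_univ, Fintype.card_fin]
    have := Lagrange.eq_interpolate_of_eval_eq (r := fun k => p.eval (t k)) hinj hp'
      fun _ _ => rfl
    conv_lhs => rw [this]
    rw [Lagrange.interpolate_apply, Polynomial.eval_finsetSum]
    refine Finset.sum_congr rfl fun k _ => ?_
    rw [Polynomial.eval_mul, Polynomial.eval_C, mul_comm]

theorem exp_quad_lagrange {θ : ℝ} (hθ : 0 < θ) {n N : ℕ} (hn : 0 < n) (hN : 2 * n ≤ N)
    {l : Fin N → ℝ} (hl : ∀ k, |l k| ≤ (N / θ) ^ N)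
    (hl' : ∀ p : Polynomial ℝ, p.degree < N →
        p.eval 1 = ∑ k, l k * p.eval (lnode θ N k)) {a b e η : ℝ}
    (hη : η ≤ 1) (h1 : |a + b + e| ≤ η)
    (h2 : ∀ k : Fin N, |a + b * (lnode θ N k) +
      e * (lnode θ N k) ^ 2| ≤ η) :
    |Real.exp (a + b + e) - ∑ k : Fin N, l k *
      Real.exp (a + b * (lnode θ N k) +
        e * (lnode θ N k) ^ 2)| ≤
      (1 + N * (N / θ) ^ N) * (2 * η ^ n) := by
  set t : Fin N → ℝ := fun k => lnode θ N k with ht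
  set T : ℝ → ℝ := fun z => ∑ j ∈ Finset.range n, z ^ j / j.factorial with hT
  set q : Polynomial ℝ := Polynomial.C a + Polynomial.C b * Polynomial.X +
    Polynomial.C e * Polynomial.X ^ 2 with hq
  set p : Polynomial ℝ := ∑ j ∈ Finset.range n, Polynomial.C ((j.factorial : ℝ)⁻¹) * q ^ j with hp
  have hqd : q.natDegree ≤ 2 := by rw [hq]; compute_degree
  have hpd : p.degree < N := by
    refine lt_of_le_of_lt (Polynomial.degree_sum_le _ _) ?_
    rw [Finset.sup_lt_iff (by exact WithBot.bot_lt_coe N)]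
    intro j hj
    have hj' := Finset.mem_range.1 hj
    have hnd : (Polynomial.C ((j.factorial : ℝ)⁻¹) * q ^ j).natDegree ≤ j * 2 :=
      (Polynomial.natDegree_C_mul_le _ _).trans
        ((Polynomial.natDegree_pow_le).trans (Nat.mul_le_mul_left j hqd))
    refine lt_of_le_of_lt Polynomial.degree_le_natDegree ?_
    exact_mod_cast lt_of_le_of_lt hnd (by omega)
  have hev : ∀ s, p.eval s = T (a + b * s + e * s ^ 2) := fun s => by
    rw [hp, Polynomial.eval_finsetSum, hT]
    refine Finset.sum_congr rfl fun j _ => ?_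
    rw [hq]
    simp only [Polynomial.eval_mul, Polynomial.eval_C, Polynomial.eval_pow, Polynomial.eval_add,
      Polynomial.eval_X]
    rw [div_eq_inv_mul]
  have hL := hl' p hpd
  simp only [hev, one_pow, mul_one] at hL
  have hB : (0 : ℝ) ≤ (N / θ) ^ N := by positivity
  have hη0 : 0 ≤ η := (abs_nonneg _).trans h1
  have e1 : Real.exp (a + b + e) - ∑ k, l k * Real.exp (a + b * t k + e * t k ^ 2) =
      (Real.exp (a + b + e) - T (a + b + e)) -
        ∑ k, l k * (Real.exp (a + b * t k + e * t k ^ 2) - T (a + b * t k + e * t k ^ 2)) := by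
    simp only [mul_sub, Finset.sum_sub_distrib]
    linear_combination hL
  rw [e1]
  refine (abs_sub _ _).trans ?_
  have e2 : |∑ k, l k * (Real.exp (a + b * t k + e * t k ^ 2) - T (a + b * t k + e * t k ^ 2))|
      ≤ N * ((N / θ) ^ N * (2 * η ^ n)) := by
    refine (Finset.abs_sum_le_sum_abs _ _).trans ?_
    refine (Finset.sum_le_card_nsmul _ _ ((N / θ) ^ N * (2 * η ^ n)) fun k _ => ?_).trans
      (le_of_eq ?_)
    · rw [abs_mul]
      exact mul_le_mul (hl k) (exp_taylor_bound (h2 k) hη hn) (abs_nonneg _) hB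
    · rw [Finset.card_univ, Fintype.card_fin, nsmul_eq_mul]
  have e3 := exp_taylor_bound h1 hη hn
  calc _ ≤ 2 * η ^ n + N * ((N / θ) ^ N * (2 * η ^ n)) := add_le_add e3 e2
    _ = _ := by ring

theorem mker_factor (c s : ℝ) (x y : Euc m) (hq : 1 - mq c s ^ 2 ≠ 0) :
    mker c x s y = Real.exp (mα c s * ‖y‖ ^ 2 +
        m / 2 * Real.log (c / Real.pi * (mq c s / (1 - mq c s ^ 2)))) *
      Real.exp (c * mq c s / (1 - mq c s ^ 2) * (2 * inner ℝ x y - mq c s * ‖x‖ ^ 2)) := by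
  rw [mker, gker, mγ, mb, ← Real.exp_add, real_inner_smul_left]
  congr 1
  field_simp
  ring

theorem mker_lagrange {c s R : ℝ} (hc : 0 < c) (hs : 0 < s) {θ : ℝ} (hθ : 0 < θ) (hθ1 : θ ≤ 1)
    {n N : ℕ} (hn : 0 < n) (hN : 2 * n ≤ N)
    {l : Fin N → ℝ} (hl : ∀ k, |l k| ≤ (N / θ) ^ N)
    (hl' : ∀ p : Polynomial ℝ, p.degree < N →
        p.eval 1 = ∑ k, l k * p.eval (lnode θ N k))
    {η : ℝ} (hη : η ≤ 1) (hR : c * mq c s / (1 - mq c s ^ 2) * (3 * R ^ 2) ≤ η)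
    (hpi : c * mq c s / (1 - mq c s ^ 2) ≤ 1) {x0 x y : Euc m} (hx0 : x0 ∈ ball (0 : Euc m) R)
    (hx : x ∈ ball (0 : Euc m) R) (hy : y ∈ ball (0 : Euc m) R) :
    |mker c x s y - ∑ k : Fin N,
      l k * mker c (dil x0 (lnode θ N k) x) s y| ≤
      (1 + N * (N / θ) ^ N) * (2 * η ^ n) := by
  have hq0 := one_sub_mq_sq_pos hc hs
  have hqp := mq_pos c s
  have hq1 := mq_lt_one hc hs
  set κ := c * mq c s / (1 - mq c s ^ 2) with hκ
  have hκ0 : 0 < κ := by positivity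
  set P := Real.exp (mα c s * ‖y‖ ^ 2 +
        m / 2 * Real.log (c / Real.pi * (mq c s / (1 - mq c s ^ 2)))) with hP
  have hP1 : P ≤ 1 := by
    rw [hP]
    apply Real.exp_le_one_iff.2
    have h1 : mα c s ≤ 0 := by
      rw [mα]
      have : 0 ≤ c / 2 * ((1 + mq c s ^ 2) / (1 - mq c s ^ 2)) := by positivity
      linarith
    have h2 : Real.log (c / Real.pi * (mq c s / (1 - mq c s ^ 2))) ≤ 0 := by
      refine Real.log_nonpos (by have := Real.pi_pos; positivity) ?_
      have : c / Real.pi * (mq c s / (1 - mq c s ^ 2)) = κ / Real.pi := by rw [hκ]; ring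
      rw [this, div_le_one Real.pi_pos]
      linarith [Real.pi_gt_three]
    have h3 := mul_nonneg (neg_nonneg.2 h1) (sq_nonneg ‖y‖)
    have h4 := mul_nonneg (by positivity : (0 : ℝ) ≤ m / 2) (neg_nonneg.2 h2)
    linarith
  set z : Euc m → ℝ := fun x => κ * (2 * inner ℝ x y - mq c s * ‖x‖ ^ 2) with hz
  have hzb : ∀ x ∈ ball (0 : Euc m) R, |z x| ≤ η := fun x hx => by
    rw [mem_ball_zero_iff] at hx hy
    have h1 := abs_real_inner_le_norm x y
    have h2 : ‖x‖ * ‖y‖ ≤ R ^ 2 := by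
      rw [sq]; exact mul_le_mul hx.le hy.le (norm_nonneg _) ((norm_nonneg _).trans hx.le)
    have h3 : ‖x‖ ^ 2 ≤ R ^ 2 := pow_le_pow_left₀ (norm_nonneg _) hx.le 2
    have h4 : mq c s * ‖x‖ ^ 2 ≤ R ^ 2 := by nlinarith [sq_nonneg ‖x‖]
    have h5 : 0 ≤ mq c s * ‖x‖ ^ 2 := by positivity
    simp only [hz]
    rw [abs_mul, abs_of_pos hκ0]
    refine (mul_le_mul_of_nonneg_left ?_ hκ0.le).trans hR
    rw [abs_le] at h1 ⊢
    constructor <;> nlinarith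
  have hseg : ∀ k : Fin N, dil x0 (lnode θ N k) x ∈ ball (0 : Euc m) R := by
    intro k
    have hk : (((k : ℕ) : ℝ) + 1) ≤ N := by exact_mod_cast k.2
    have hn' : (0 : ℝ) < N := by exact_mod_cast (by omega : 0 < N)
    have h0 : 0 ≤ lnode θ N k := by unfold lnode; positivity
    have h1 : lnode θ N k ≤ 1 := by
      rw [lnode, div_le_one hn']; nlinarith
    exact (convex_ball (0 : Euc m) R).add_smul_sub_mem hx0 hx ⟨h0, h1⟩
  have hzt : ∀ t : ℝ, z (dil x0 t x) = z x0 + (κ * (2 * inner ℝ (x - x0) y -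
      mq c s * (2 * inner ℝ x0 (x - x0)))) * t + (-(κ * (mq c s * ‖x - x0‖ ^ 2))) * t ^ 2 :=
    fun t => by
      simp only [hz, dil]
      rw [norm_add_sq_real, inner_add_left, real_inner_smul_left, real_inner_smul_right, norm_smul,
        mul_pow, Real.norm_eq_abs, sq_abs]
      ring
  have hzx : z x = z x0 + (κ * (2 * inner ℝ (x - x0) y -
      mq c s * (2 * inner ℝ x0 (x - x0)))) + (-(κ * (mq c s * ‖x - x0‖ ^ 2))) := by
    have := hzt 1
    rw [show dil x0 1 x = x by simp [dil]] at this
    rw [this]; ring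
  have key := exp_quad_lagrange hθ hn hN hl hl' hη (hzx ▸ hzb x hx)
    (fun k => by rw [← hzt]; exact hzb _ (hseg k))
  rw [← hzx] at key
  simp only [← hzt] at key
  have e : mker c x s y - ∑ k : Fin N,
      l k * mker c (dil x0 (lnode θ N k) x) s y = P * (Real.exp (z x) -
        ∑ k : Fin N, l k * Real.exp (z (dil x0 (lnode θ N k) x))) := by
    rw [mul_sub, Finset.mul_sum, mker_factor c s x y hq0.ne']
    congr 1
    refine Finset.sum_congr rfl fun k _ => ?_
    rw [mker_factor c s _ y hq0.ne']
    simp only [hz]; ring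
  rw [e, abs_mul, abs_of_pos (Real.exp_pos _)]
  exact (mul_le_of_le_one_left (abs_nonneg _) hP1).trans key

end Extrapolation

section ExtrapolationL2

variable {m : ℕ}

theorem mapx_lagrange {R : ℝ} {χ : Euc m → ℝ} (hχ : Continuous χ) {X : ℝ}
    (hX : ∀ y ∈ ball (0 : Euc m) R, |χ y| ≤ X) {c s : ℝ} (hc : 0 < c) (hs : 0 < s) {θ : ℝ}
    (hθ : 0 < θ) (hθ1 : θ ≤ 1) {n N : ℕ} (hn : 0 < n) (hN : 2 * n ≤ N)
    {l : Fin N → ℝ} (hl : ∀ k, |l k| ≤ (N / θ) ^ N)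
    (hl' : ∀ p : Polynomial ℝ, p.degree < N → p.eval 1 = ∑ k, l k * p.eval (lnode θ N k))
    {η : ℝ} (hη : η ≤ 1) (hR : c * mq c s / (1 - mq c s ^ 2) * (3 * R ^ 2) ≤ η)
    (hpi : c * mq c s / (1 - mq c s ^ 2) ≤ 1) {x0 x : Euc m} (hx0 : x0 ∈ ball (0 : Euc m) R)
    (hx : x ∈ ball (0 : Euc m) R) {f : Euc m → ℝ} (hf : Good (ball (0 : Euc m) R) f) :
    (mapx χ c s f x - ∑ k : Fin N, l k * mapx χ c s f (dil x0 (lnode θ N k) x)) ^ 2 ≤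
      ((1 + N * (N / θ) ^ N) * (2 * η ^ n)) ^ 2 * X ^ 2 * volume.real (ball (0 : Euc m) R) *
        ∫ y, f y ^ 2 := by
  have hD : Bornology.IsBounded (ball (0 : Euc m) R) := isBounded_ball
  set ε := (1 + N * (N / θ) ^ N) * (2 * η ^ n) with hε
  set k : Euc m → ℝ := fun y => χ y * (mker c x s y -
    ∑ k : Fin N, l k * mker c (dil x0 (lnode θ N k) x) s y) with hk
  have hmc : ∀ x : Euc m, Continuous fun y : Euc m => mker c x s y := fun x => by
    simp only [mker, gker]; fun_prop
  have hkc : Continuous k :=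
    hχ.mul ((hmc x).sub (continuous_finsetSum _ fun i _ => (hmc _).const_mul _))
  have e : mapx χ c s f x - ∑ k : Fin N, l k * mapx χ c s f (dil x0 (lnode θ N k) x) =
      ∫ y, f y * k y := by
    have hi : ∀ x : Euc m, Integrable fun y : Euc m => f y * (χ y * mker c x s y) := fun x => by
      have := (hf.mul hD (hχ.mul (hmc x))).integrable hD
      simpa only [mul_comm, Pi.mul_apply] using this
    simp only [mapx, ← integral_const_mul]
    rw [← integral_finsetSum _ fun i _ => (hi _).const_mul _,
      ← integral_sub (hi x) (integrable_finsetSum _ fun i _ => (hi _).const_mul _)]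
    congr 1; funext y
    simp only [hk, mul_sub, Finset.mul_sum]
    congr 1
    refine Finset.sum_congr rfl fun i _ => by ring
  have hX0 : 0 ≤ X := (abs_nonneg _).trans (hX x hx)
  have hkb : ∀ y ∈ ball (0 : Euc m) R, |k y| ≤ X * ε := fun y hy => by
    simp only [hk]
    rw [abs_mul]
    exact mul_le_mul (hX y hy) (mker_lagrange hc hs hθ hθ1 hn hN hl hl' hη hR hpi hx0 hx hy)
      (abs_nonneg _) hX0
  set k' : Euc m → ℝ := (ball (0 : Euc m) R).indicator k with hk'
  have gk : Good (ball (0 : Euc m) R) k' := by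
    refine ⟨?_, fun y hy => indicator_of_notMem hy _⟩
    refine (memLp_indicator_const (μ := volume) 2 (measurableSet_ball (x := (0 : Euc m)) (ε := R)) (X * ε)
      (Or.inr measure_ball_lt_top.ne)).of_le (f := k')
      (hkc.aestronglyMeasurable.indicator measurableSet_ball) (Eventually.of_forall fun y => ?_)
    by_cases hy : y ∈ ball (0 : Euc m) R
    · rw [hk', indicator_of_mem hy, indicator_of_mem hy, Real.norm_eq_abs, Real.norm_eq_abs]
      exact (hkb y hy).trans (le_abs_self _)
    · rw [hk', indicator_of_notMem hy]; simp
  have e2 : ∫ y, f y * k y = ∫ y, f y * k' y := by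
    congr 1; funext y
    by_cases hy : y ∈ ball (0 : Euc m) R
    · rw [hk', indicator_of_mem hy]
    · rw [hf.zero y hy, zero_mul, zero_mul]
  rw [e, e2]
  have CS := abs_integral_inner_le gk.mem hf.mem
  simp only [RCLike.inner_apply, conj_trivial, Real.norm_eq_abs, sq_abs] at CS
  refine CS.trans ?_
  have h1 := gk.integral_sq_le (B := X * ε) (fun y hy => by rw [hk', indicator_of_mem hy]; exact hkb y hy)
  calc _ ≤ (X * ε) ^ 2 * volume.real (ball (0 : Euc m) R) * ∫ y, f y ^ 2 :=
        mul_le_mul_of_nonneg_right h1 (integral_nonneg fun _ => sq_nonneg _)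
    _ = _ := by ring

theorem setIntegral_dil_sq_le {F : Euc m → ℝ} (hF : Continuous F) {ρ r θ t : ℝ} {x0 : Euc m}
    (hx0 : x0 ∈ ball (0 : Euc m) ρ) (ht : 0 < t) (htθ : t ≤ θ) (hr : 2 * ρ * θ ≤ r) :
    ∫ x in ball 0 ρ, F (dil x0 t x) ^ 2 ≤ (t ^ m)⁻¹ * ∫ x in ball x0 r, F x ^ 2 := by
  have hFi : Integrable ((ball x0 r).indicator fun x => F x ^ 2) :=
    (integrable_indicator_iff measurableSet_ball).2
      (((hF.pow 2).continuousOn.integrableOn_compact (isCompact_closedBall x0 r)).mono_set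
        ball_subset_closedBall)
  have h1 := integral_dil ((ball x0 r).indicator fun x => F x ^ 2) x0 ht
  rw [integral_indicator measurableSet_ball, smul_eq_mul] at h1
  rw [← h1, ← integral_indicator measurableSet_ball]
  have hi : Integrable fun x => (ball x0 r).indicator (fun x => F x ^ 2) (dil x0 t x) := by
    have := (hFi.comp_smul ht.ne').comp_sub_right x0
    have h2 : Integrable ((ball x0 r).indicator fun x => F x ^ 2) := hFi
    have h3 : Integrable (fun x => (ball x0 r).indicator (fun x => F x ^ 2) (x0 + x)) :=
      hFi.comp_add_left x0
    exact (h3.comp_smul ht.ne').comp_sub_right x0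
  refine integral_mono_of_nonneg (Eventually.of_forall fun x =>
      indicator_nonneg (fun x _ => sq_nonneg _) x) hi (Eventually.of_forall fun x => ?_)
  by_cases hx : x ∈ ball (0 : Euc m) ρ
  · have hd : dil x0 t x ∈ ball x0 r := by
      rw [mem_ball, dist_eq_norm, dil, add_sub_cancel_left, norm_smul, Real.norm_of_nonneg ht.le]
      rw [mem_ball_zero_iff] at hx hx0
      have h2 : ‖x - x0‖ < 2 * ρ := lt_of_le_of_lt (norm_sub_le x x0) (by linarith)
      have h0 := norm_nonneg (x - x0)
      calc t * ‖x - x0‖ < t * (2 * ρ) := by gcongr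
        _ ≤ θ * (2 * ρ) := by gcongr; linarith
        _ ≤ r := by linarith
    simp only [indicator_of_mem hx, indicator_of_mem hd]; exact le_rfl
  · simp only [indicator_of_notMem hx]
    exact indicator_nonneg (fun x _ => sq_nonneg _) _

theorem mapx_sq_le {R : ℝ} {χ : Euc m → ℝ} (hχ : Continuous χ) :
    ∃ K, 1 ≤ K ∧ ∀ {c s : ℝ}, 0 < c → 0 < s → ∀ {θ : ℝ}, 0 < θ → θ ≤ 1 → ∀ {n N : ℕ}, 0 < n →
      2 * n ≤ N → ∀ {η : ℝ}, η ≤ 1 → c * mq c s / (1 - mq c s ^ 2) * (3 * R ^ 2) ≤ η →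
      c * mq c s / (1 - mq c s ^ 2) ≤ 1 → ∀ {x0 : Euc m} {ρ r : ℝ}, x0 ∈ ball (0 : Euc m) ρ →
      ρ ≤ R → 2 * ρ * θ ≤ r → ∀ {f : Euc m → ℝ}, Good (ball (0 : Euc m) R) f →
      ∫ x in ball 0 ρ, mapx χ c s f x ^ 2 ≤ K * (N / θ) ^ (2 * N + 2 + m) *
        ((∫ x in ball x0 r, mapx χ c s f x ^ 2) + η ^ (2 * n) * ∫ y, f y ^ 2) := by
  obtain ⟨X, hX0, hX⟩ := exists_bound_of_isBounded (isBounded_ball (x := (0 : Euc m)) (r := R)) hχ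
  set V := volume.real (ball (0 : Euc m) R) with hV
  have hV0 : 0 ≤ V := measureReal_nonneg
  refine ⟨2 + 32 * V ^ 2 * X ^ 2, by nlinarith [sq_nonneg (V * X)], ?_⟩
  intro c s hc hs θ hθ hθ1 n N hn hN η hη hR hpi x0 ρ r hx0 hρR hr f hf
  have hD : Bornology.IsBounded (ball (0 : Euc m) R) := isBounded_ball
  obtain ⟨l, hl, hl'⟩ := exists_lagrange hθ hθ1 (show 0 < N by omega)
  set F := mapx χ c s f with hF
  have hFc : Continuous F := continuous_mapx hχ hD hf c s
  set A : ℝ := N / θ with hA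
  have hN1 : (1 : ℝ) ≤ N := by exact_mod_cast (by omega : 1 ≤ N)
  have hNA : (N : ℝ) ≤ A := by rw [hA, le_div_iff₀ hθ]; nlinarith
  have hA1 : 1 ≤ A := hN1.trans hNA
  have hA0 : 0 ≤ A := by linarith
  set I := ∫ x in ball x0 r, F x ^ 2 with hI
  have hI0 : 0 ≤ I := integral_nonneg fun _ => sq_nonneg _
  set M := ∫ y, f y ^ 2 with hM
  have hM0 : 0 ≤ M := integral_nonneg fun _ => sq_nonneg _
  set ε := ((1 + N * A ^ N) * (2 * η ^ n)) ^ 2 * X ^ 2 * V * M with hε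
  have hη0 : 0 ≤ η ^ (2 * n) := by rw [mul_comm, pow_mul]; exact sq_nonneg _
  have hε0 : 0 ≤ ε := by positivity
  have hdc : ∀ t, Continuous fun x => F (dil x0 t x) := fun t => hFc.comp (continuous_dil x0 t)
  have hion : ∀ {u : Euc m → ℝ}, Continuous u → IntegrableOn u (ball 0 ρ) := fun hu =>
    (hu.continuousOn.integrableOn_compact (isCompact_closedBall 0 ρ)).mono_set
        ball_subset_closedBall
  have hp : ∀ x ∈ ball (0 : Euc m) ρ, F x ^ 2 ≤
      2 * (N * ∑ k : Fin N, A ^ (2 * N) * F (dil x0 (lnode θ N k) x) ^ 2) + 2 * ε := by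
    intro x hx
    have h1 := mapx_lagrange hχ hX hc hs hθ hθ1 hn hN hl hl' hη hR hpi
      (ball_subset_ball hρR hx0) (ball_subset_ball hρR hx) hf
    have h2 : (∑ k : Fin N, l k * F (dil x0 (lnode θ N k) x)) ^ 2 ≤
        N * ∑ k : Fin N, A ^ (2 * N) * F (dil x0 (lnode θ N k) x) ^ 2 := by
      refine (sq_sum_le_card_mul_sum_sq).trans ?_
      rw [Finset.card_univ, Fintype.card_fin]
      refine mul_le_mul_of_nonneg_left (Finset.sum_le_sum fun k _ => ?_) (by linarith)
      rw [mul_pow]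
      refine mul_le_mul_of_nonneg_right ?_ (sq_nonneg _)
      rw [← sq_abs, mul_comm 2 N, pow_mul]
      exact pow_le_pow_left₀ (abs_nonneg _) (hl k) 2
    have h3 := add_sq_le (a := F x - ∑ k : Fin N, l k * F (dil x0 (lnode θ N k) x))
      (b := ∑ k : Fin N, l k * F (dil x0 (lnode θ N k) x))
    rw [sub_add_cancel] at h3
    linarith
  have hint : ∫ x in ball (0 : Euc m) ρ, F x ^ 2 ≤
      2 * (N * ∑ k : Fin N, A ^ (2 * N) * ∫ x in ball (0 : Euc m) ρ,
        F (dil x0 (lnode θ N k) x) ^ 2) + 2 * ε * volume.real (ball (0 : Euc m) ρ) := by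
    refine (setIntegral_mono_on (hion (hFc.pow 2)) (hion ?_) measurableSet_ball hp).trans
      (le_of_eq ?_)
    · exact ((continuous_finsetSum _ fun k _ =>
        ((hdc _).pow 2).const_mul _).const_mul _ |>.const_mul _).add_const _
    · have hs1 : ∀ k ∈ (Finset.univ : Finset (Fin N)), IntegrableOn
          (fun x => A ^ (2 * N) * F (dil x0 (lnode θ N k) x) ^ 2) (ball 0 ρ) := fun k _ =>
        hion (((hdc _).pow 2).const_mul _)
      rw [integral_add (((integrable_finsetSum _ hs1).const_mul _).const_mul _)
        (hion continuous_const), integral_const_mul, integral_const_mul, integral_finsetSum _ hs1,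
        setIntegral_const, smul_eq_mul]
      simp only [integral_const_mul]
      ring
  have hVρ : volume.real (ball (0 : Euc m) ρ) ≤ V :=
    measureReal_mono (ball_subset_ball hρR) measure_ball_lt_top.ne
  have hS : ∑ k : Fin N, A ^ (2 * N) * ∫ x in ball (0 : Euc m) ρ,
        F (dil x0 (lnode θ N k) x) ^ 2 ≤ N * (A ^ (2 * N) * (A ^ m * I)) := by
    refine (Finset.sum_le_card_nsmul _ _ (A ^ (2 * N) * (A ^ m * I)) fun k _ => ?_).trans
      (le_of_eq ?_)
    · refine mul_le_mul_of_nonneg_left ?_ (by positivity)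
      have hk : (((k : ℕ) : ℝ) + 1) ≤ N := by exact_mod_cast k.2
      have ht0 : 0 < lnode θ N k := by unfold lnode; positivity
      have ht1 : lnode θ N k ≤ θ := by
        rw [lnode, div_le_iff₀ (by linarith)]; gcongr
      have ht2 : θ / N ≤ lnode θ N k := by
        rw [lnode]; gcongr; nlinarith [Nat.cast_nonneg (α := ℝ) (k : ℕ)]
      refine (setIntegral_dil_sq_le hFc hx0 ht0 ht1 hr).trans
        (mul_le_mul_of_nonneg_right ?_ hI0)
      rw [← inv_pow]
      refine pow_le_pow_left₀ (by positivity) ?_ m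
      rw [hA, ← inv_div]
      exact inv_anti₀ (by positivity) ht2
    · rw [Finset.card_univ, Fintype.card_fin, nsmul_eq_mul]
  have hAm : 1 ≤ A ^ m := one_le_pow₀ hA1
  have hb1 : (1 + N * A ^ N) ^ 2 ≤ 4 * A ^ (2 * N + 2 + m) := by
    have h1 : 1 + N * A ^ N ≤ 2 * (A * A ^ N) := by
      have : 1 ≤ A * A ^ N := one_le_mul_of_one_le_of_one_le hA1 (one_le_pow₀ hA1)
      have : N * A ^ N ≤ A * A ^ N := by gcongr
      linarith
    calc (1 + N * A ^ N) ^ 2 ≤ (2 * (A * A ^ N)) ^ 2 := pow_le_pow_left₀ (by positivity) h1 2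
      _ = 4 * A ^ (2 * N + 2) * 1 := by ring
      _ ≤ 4 * A ^ (2 * N + 2) * A ^ m := by gcongr
      _ = _ := by ring
  have hb2 : N * (N * (A ^ (2 * N) * (A ^ m * I))) ≤ A ^ (2 * N + 2 + m) * I := by
    calc _ ≤ A * (A * (A ^ (2 * N) * (A ^ m * I))) := by gcongr
      _ = _ := by ring
  have hb3 : ε ≤ 16 * A ^ (2 * N + 2 + m) * η ^ (2 * n) * (X ^ 2 * V * M) := by
    have e1 : ε = (1 + N * A ^ N) ^ 2 * (4 * η ^ (2 * n) * (X ^ 2 * V * M)) := by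
      rw [hε]; ring
    rw [e1]
    calc _ ≤ 4 * A ^ (2 * N + 2 + m) * (4 * η ^ (2 * n) * (X ^ 2 * V * M)) := by gcongr
      _ = _ := by ring
  set L := A ^ (2 * N + 2 + m) with hL
  have hL0 : 0 ≤ L := by positivity
  calc _ ≤ _ := hint
    _ ≤ 2 * (N * (N * (A ^ (2 * N) * (A ^ m * I)))) + 2 * ε * V := by gcongr
    _ ≤ 2 * (L * I) + 2 * (16 * L * η ^ (2 * n) * (X ^ 2 * V * M)) * V := by gcongr
    _ ≤ _ := by
      have h1 : 0 ≤ 32 * V ^ 2 * X ^ 2 * (L * I) := by positivity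
      have h2 : 0 ≤ 2 * (L * (η ^ (2 * n) * M)) := by positivity
      nlinarith

end ExtrapolationL2

section OneStep

variable {m : ℕ} {D : Set (Euc m)}

theorem Good.setIntegral_sq_le_two {w F : Euc m → ℝ} (hw : Good D w) (hF : Good D F)
    (S : Set (Euc m)) :
    ∫ x in S, w x ^ 2 ≤ 2 * (∫ x in S, F x ^ 2) + 2 * ∫ x in S, (w x - F x) ^ 2 := by
  have i1 := hw.int_sq.integrableOn (s := S)
  have i2 := hF.int_sq.integrableOn (s := S)
  have i3 : IntegrableOn (fun x => (w x - F x) ^ 2) S := (hw.sub hF).int_sq.integrableOn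
  rw [← integral_const_mul, ← integral_const_mul,
    ← integral_add (i2.const_mul 2) (i3.const_mul 2)]
  refine integral_mono i1 ((i2.const_mul 2).add (i3.const_mul 2)) fun x => ?_
  beta_reduce
  nlinarith [sq_nonneg (w x - 2 * F x)]

theorem Good.indicator_of_continuous {ψ : Euc m → ℝ} (hψ : Continuous ψ) (R : ℝ) :
    Good (ball (0 : Euc m) R) ((ball (0 : Euc m) R).indicator ψ) := by
  obtain ⟨C, hC0, hC⟩ := exists_bound_of_isBounded (isBounded_ball (x := (0 : Euc m)) (r := R)) hψ
  refine ⟨?_, fun y hy => indicator_of_notMem hy _⟩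
  refine (memLp_indicator_const (μ := volume) 2 (measurableSet_ball (x := (0 : Euc m)) (ε := R))
    C (Or.inr measure_ball_lt_top.ne)).of_le
    (hψ.aestronglyMeasurable.indicator measurableSet_ball) (Eventually.of_forall fun y => ?_)
  by_cases hy : y ∈ ball (0 : Euc m) R
  · rw [indicator_of_mem hy, indicator_of_mem hy]
    exact (hC y hy).trans (le_abs_self _)
  · rw [indicator_of_notMem hy]; simp

variable {c : ℝ} {v : ℝ → Euc m → ℝ} {g : ℝ → Euc m → Euc m} {h : ℝ → Euc m → ℝ}
  {gh : ℝ → Euc m → Euc m} {R : ℝ}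

theorem HeatFlow.mass_le_inner (F : HeatFlow (ball 0 R) c v g h gh) (hc : 0 < c) {R₁ ρ : ℝ}
    (hR₁ : 0 ≤ R₁) (hρ : R₁ ≤ ρ) {s t' t : ℝ} (hs : 0 < s) (hst : s ≤ t - t') :
    ∫ x, v t x ^ 2 ≤ (∫ x in ball 0 ρ, v t x ^ 2) +
      Real.exp (-c * R₁ ^ 2) * Real.exp (R ^ 2 / (2 * s)) * ∫ x, v t' x ^ 2 := by
  have hD : Bornology.IsBounded (ball (0 : Euc m) R) := isBounded_ball
  have key := F.gauss_exp hc hs hst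
  have i1 := (F.good t).int_sq
  have i2 : Integrable fun x => v t x ^ 2 * Real.exp (c * ‖x‖ ^ 2) :=
    (F.good t).int_sqw hD (b := fun x => Real.exp (c * ‖x‖ ^ 2)) (by fun_prop)
  have i3 := i1.indicator (measurableSet_ball (x := (0 : Euc m)) (ε := ρ))
  rw [← integral_indicator measurableSet_ball]
  have : ∫ x, v t x ^ 2 ≤ ∫ x, ((ball (0 : Euc m) ρ).indicator (fun x => v t x ^ 2) x +
      Real.exp (-c * R₁ ^ 2) * (v t x ^ 2 * Real.exp (c * ‖x‖ ^ 2))) := by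
    refine integral_mono i1 (i3.add (i2.const_mul _)) fun x => ?_
    by_cases hx : x ∈ ball (0 : Euc m) ρ
    · simp only [indicator_of_mem hx]
      have : 0 ≤ Real.exp (-c * R₁ ^ 2) * (v t x ^ 2 * Real.exp (c * ‖x‖ ^ 2)) := by positivity
      linarith
    · simp only [indicator_of_notMem hx, zero_add]
      have hx' : ρ ≤ ‖x‖ := by simpa using hx
      have h1 : 1 ≤ Real.exp (-c * R₁ ^ 2) * Real.exp (c * ‖x‖ ^ 2) := by
        rw [← Real.exp_add]
        refine Real.one_le_exp ?_
        have : R₁ ^ 2 ≤ ‖x‖ ^ 2 := pow_le_pow_left₀ hR₁ (hρ.trans hx') 2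
        nlinarith
      nlinarith [sq_nonneg (v t x), mul_le_mul_of_nonneg_left h1 (sq_nonneg (v t x))]
  rw [integral_add i3 (i2.const_mul _), integral_const_mul] at this
  refine this.trans ?_
  rw [mul_assoc]
  gcongr

theorem HeatFlow.inner_le (F : HeatFlow (ball 0 R) c v g h gh) (hc : 0 < c) {χ : Euc m → ℝ}
    (hχ : Continuous χ) {f : Euc m → ℝ} (hf : Good (ball 0 R) f) {s t ρ ρ₁ P E Z : ℝ} (hP : 0 ≤ P)
    (hρ : ρ ≤ ρ₁) (hρ₁ : ρ₁ ≤ R) {x0 : Euc m} {r : ℝ} (hB : ball x0 r ⊆ ball 0 ρ)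
    (hE : ∫ x in ball 0 ρ₁, (Real.exp (c / 2 * ‖x‖ ^ 2) * v t x - mapx χ c s f x) ^ 2 ≤ E)
    (hm : ∫ x in ball 0 ρ, mapx χ c s f x ^ 2 ≤
      P * ((∫ x in ball x0 r, mapx χ c s f x ^ 2) + Z)) :
    ∫ x in ball 0 ρ, v t x ^ 2 ≤
      4 * P * Real.exp (c * ρ ^ 2) * (∫ x in ball x0 r, v t x ^ 2) + (4 * P + 2) * E + 2 * P * Z := by
  have hD : Bornology.IsBounded (ball (0 : Euc m) R) := isBounded_ball
  set D' := ball (0 : Euc m) R with hD'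
  set Φ := D'.indicator (mapx χ c s f) with hΦ
  have gΦ : Good D' Φ := Good.indicator_of_continuous (continuous_mapx hχ hD hf c s) R
  set w : Euc m → ℝ := fun x => Real.exp (c / 2 * ‖x‖ ^ 2) * v t x with hw
  have gw : Good D' w :=
    (F.good t).mul hD (b := fun x => Real.exp (c / 2 * ‖x‖ ^ 2)) (by fun_prop)
  have w2 : ∀ x, w x ^ 2 = Real.exp (c * ‖x‖ ^ 2) * v t x ^ 2 := fun x => by
    simp only [hw, mul_pow, ← Real.exp_nat_mul]
    congr 2; push_cast; ring
  have sub1 : ball (0 : Euc m) ρ ⊆ ball 0 ρ₁ := ball_subset_ball hρ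
  have sub2 : ball (0 : Euc m) ρ₁ ⊆ D' := ball_subset_ball hρ₁
  have eΦ : ∀ x ∈ ball (0 : Euc m) ρ₁, Φ x = mapx χ c s f x := fun x hx =>
    indicator_of_mem (sub2 hx) _
  have dnn : ∀ S : Set (Euc m), IntegrableOn (fun x => (w x - Φ x) ^ 2) S := fun S =>
    (gw.sub gΦ).int_sq.integrableOn
  have hE1 : ∫ x in ball 0 ρ₁, (w x - Φ x) ^ 2 ≤ E := by
    refine le_trans (le_of_eq ?_) hE
    exact setIntegral_congr_fun measurableSet_ball fun x hx => by simp only [hw, eΦ x hx]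
  have hEm : ∀ S ⊆ ball (0 : Euc m) ρ₁, ∫ x in S, (w x - Φ x) ^ 2 ≤ E := fun S hS =>
    (setIntegral_mono_set (dnn _) (Eventually.of_forall fun x => sq_nonneg _)
      (Eventually.of_forall hS)).trans hE1
  have a1 := gw.setIntegral_sq_le_two gΦ (ball 0 ρ)
  have a2 := gΦ.setIntegral_sq_le_two gw (ball x0 r)
  have a3 : ∫ x in ball 0 ρ, v t x ^ 2 ≤ ∫ x in ball 0 ρ, w x ^ 2 := by
    refine integral_mono (F.good t).int_sq.integrableOn gw.int_sq.integrableOn fun x => ?_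
    simp only [w2]
    exact le_mul_of_one_le_left (sq_nonneg _) (Real.one_le_exp (by positivity))
  have a4 : ∫ x in ball x0 r, w x ^ 2 ≤ Real.exp (c * ρ ^ 2) * ∫ x in ball x0 r, v t x ^ 2 := by
    rw [← integral_const_mul]
    refine setIntegral_mono_on gw.int_sq.integrableOn
      ((F.good t).int_sq.integrableOn.const_mul _) measurableSet_ball fun x hx => ?_
    rw [w2]
    have hx' : ‖x‖ < ρ := by simpa using hB hx
    gcongr
  have e1 : ∫ x in ball 0 ρ, Φ x ^ 2 = ∫ x in ball 0 ρ, mapx χ c s f x ^ 2 :=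
    setIntegral_congr_fun measurableSet_ball fun x hx => by simp only [eΦ x (sub1 hx)]
  have e2 : ∫ x in ball x0 r, Φ x ^ 2 = ∫ x in ball x0 r, mapx χ c s f x ^ 2 :=
    setIntegral_congr_fun measurableSet_ball fun x hx => by simp only [eΦ x (sub1 (hB hx))]
  have e3 : ∫ x in ball x0 r, (Φ x - w x) ^ 2 = ∫ x in ball x0 r, (w x - Φ x) ^ 2 := by
    congr 1; funext x; ring
  have b1 := hEm _ sub1
  have b2 := hEm _ (hB.trans sub1)
  rw [← e1, ← e2] at hm
  rw [e3] at a2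
  have a5 : ∫ x in ball x0 r, Φ x ^ 2 ≤
      2 * (Real.exp (c * ρ ^ 2) * ∫ x in ball x0 r, v t x ^ 2) + 2 * E := by linarith
  have a6 := mul_le_mul_of_nonneg_left a5 hP
  linarith [mul_add P (∫ x in ball x0 r, Φ x ^ 2) Z]

end OneStep

section HighRegimeStep

variable {m : ℕ}

theorem mq_ratio_le {A R c s : ℝ} (hA : 48 * (3 * R ^ 2 + 1) ≤ A) (hs : 0 < s) (hs1 : s ≤ 1)
    (hc : A ≤ c * s ^ 2) :
    c * mq c s / (1 - mq c s ^ 2) * (3 * R ^ 2) ≤ Real.exp (-(c * s)) ∧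
      c * mq c s / (1 - mq c s ^ 2) ≤ 1 := by
  have hA1 : 48 ≤ A := by nlinarith [sq_nonneg R]
  have hs2 : s ^ 2 ≤ 1 := pow_le_one₀ hs.le hs1
  have hc0 : 0 < c := by
    by_contra hh
    push Not at hh
    nlinarith [sq_nonneg s]
  have hcA : A ≤ c := by nlinarith
  have hcs : A ≤ c * s := hc.trans (by nlinarith [mul_pos hc0 hs])
  set E := Real.exp (-(c * s)) with hE
  have hE0 : 0 < E := Real.exp_pos _
  have hq : mq c s = E * E := by rw [mq, hE, ← Real.exp_add]; congr 1; ring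
  have h4 := Real.pow_div_factorial_le_exp (c * s) (by positivity) 4
  have hEE : E * Real.exp (c * s) = 1 := by rw [hE, ← Real.exp_add]; simp
  have hb : c * E * (48 * (3 * R ^ 2 + 1)) ≤ 24 := by
    have h5 : c ^ 2 * A ^ 2 ≤ (c * s) ^ 4 := by
      have : (c * s) ^ 4 = c ^ 2 * (c * s ^ 2) ^ 2 := by ring
      rw [this]; gcongr
    have h6 : c ^ 2 * A ^ 2 ≤ 24 * Real.exp (c * s) := by
      have : ((4 : ℕ).factorial : ℝ) = 24 := by norm_num [Nat.factorial]
      rw [this, div_le_iff₀ (by norm_num)] at h4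
      linarith
    have h7 : c * A ≤ c ^ 2 * A ^ 2 := by
      have : 1 ≤ c * A := by nlinarith
      nlinarith
    calc c * E * (48 * (3 * R ^ 2 + 1)) ≤ c * E * A := by gcongr
      _ = (c * A) * E := by ring
      _ ≤ (24 * Real.exp (c * s)) * E := mul_le_mul_of_nonneg_right (h7.trans h6) hE0.le
      _ = 24 := by rw [mul_assoc, mul_comm _ E, hEE, mul_one]
  have hE1 : E ≤ 1 / 2 := by
    have := Real.add_one_le_exp (c * s)
    nlinarith
  have hden : 1 / 2 ≤ 1 - mq c s ^ 2 := by
    rw [hq]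
    have : (E * E) ^ 2 ≤ (1 / 2 * (1 / 2)) ^ 2 := by gcongr
    linarith
  have hk : c * mq c s / (1 - mq c s ^ 2) ≤ 2 * (c * mq c s) := by
    rw [div_le_iff₀ (by linarith)]
    have : 0 ≤ c * mq c s := mul_nonneg hc0.le (mq_pos _ _).le
    nlinarith
  rw [hq] at hk ⊢
  have hcE : 0 < c * E := by positivity
  constructor
  · calc _ ≤ 2 * (c * (E * E)) * (3 * R ^ 2) := by gcongr
      _ = (2 * (c * E * (3 * R ^ 2))) * E := by ring
      _ ≤ 1 * E := by gcongr; nlinarith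
      _ = E := one_mul _
  · refine hk.trans ?_
    nlinarith [mul_nonneg hcE.le (sq_nonneg R)]

theorem lagrange_const_le {κ s : ℝ} (hκ : 0 < κ) (hκ1 : κ ≤ 1) (hs : 0 < s) (hs1 : s ≤ 1)
    {n : ℕ} (hn : n = ⌈1 / s⌉₊) :
    (((2 * n : ℕ) : ℝ) / (κ * s)) ^ (2 * (2 * n) + 2 + m) ≤
      Real.exp (3 * (10 + m) / κ / s ^ 2) := by
  have hn2 : (n : ℝ) ≤ 2 / s := by
    have := (Nat.ceil_lt_add_one (show 0 ≤ 1 / s by positivity)).le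
    rw [← hn] at this
    have h1 : 1 ≤ 1 / s := by rw [le_div_iff₀ hs]; linarith
    calc (n : ℝ) ≤ 1 / s + 1 / s := by linarith
      _ = 2 / s := by ring
  have hb : ((2 * n : ℕ) : ℝ) / (κ * s) ≤ Real.exp (3 / (κ * s)) := by
    have h := Real.quadratic_le_exp_of_nonneg (show 0 ≤ 3 / (κ * s) by positivity)
    have h1 : ((2 * n : ℕ) : ℝ) / (κ * s) ≤ 4 / (κ * s ^ 2) := by
      push_cast
      rw [div_le_div_iff₀ (by positivity) (by positivity)]
      rw [le_div_iff₀ hs] at hn2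
      have := mul_le_mul_of_nonneg_left hn2 (show 0 ≤ 2 * (κ * s) by positivity)
      linarith
    have h2 : 4 / (κ * s ^ 2) ≤ (3 / (κ * s)) ^ 2 / 2 := by
      rw [div_pow, div_div, div_le_div_iff₀ (by positivity) (by positivity)]
      have : κ * (κ * s ^ 2) ≤ 1 * (κ * s ^ 2) := by gcongr
      have h0 : 0 ≤ κ * s ^ 2 := by positivity
      nlinarith
    have : 0 ≤ 3 / (κ * s) := by positivity
    linarith
  calc _ ≤ Real.exp (3 / (κ * s)) ^ (2 * (2 * n) + 2 + m) := by gcongr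
    _ = Real.exp ((2 * (2 * n) + 2 + m : ℕ) * (3 / (κ * s))) := (Real.exp_nat_mul _ _).symm
    _ ≤ _ := by
      refine Real.exp_le_exp.2 ?_
      have : ((2 * (2 * n) + 2 + m : ℕ) : ℝ) ≤ (10 + m) / s := by
        push_cast
        rw [le_div_iff₀ hs] at hn2 ⊢
        have : (m : ℝ) * s ≤ m := mul_le_of_le_one_right (by positivity) hs1
        nlinarith
      calc _ ≤ (10 + m) / s * (3 / (κ * s)) := by gcongr
        _ = _ := by field_simp

theorem le_exp_self_mul {a u : ℝ} (ha : 0 ≤ a) (hu : 1 ≤ u) : a ≤ Real.exp (a * u) := by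
  have := Real.add_one_le_exp (a * u)
  nlinarith

set_option maxHeartbeats 1000000 in
theorem HeatFlow.exists_one_step {R R₁ ρ₁ κ : ℝ} (hR₁ : 0 < R₁) (hρ₁ : R₁ < ρ₁) (hρR : ρ₁ < R)
    (hκ : 0 < κ) (hκ1 : κ ≤ 1) :
    ∃ A, 1 ≤ A ∧ ∃ γ, 0 < γ ∧ ∀ {c : ℝ} {v : ℝ → Euc m → ℝ} {g : ℝ → Euc m → Euc m}
      {h : ℝ → Euc m → ℝ} {gh : ℝ → Euc m → Euc m}, HeatFlow (ball 0 R) c v g h gh →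
      ∀ {s : ℝ}, 0 < s → s ≤ 1 → A ≤ c * s ^ 2 → ∀ {x0 : Euc m} {ρ r : ℝ},
        x0 ∈ ball 0 ρ → ball x0 r ⊆ ball 0 ρ → R₁ ≤ ρ → ρ ≤ ρ₁ → κ * s ≤ 1 → 2 * ρ * (κ * s) ≤ r →
        ∀ t, ∫ x, v t x ^ 2 ≤ Real.exp (A / s ^ 2 + c * ρ ^ 2) * (∫ x in ball x0 r, v t x ^ 2) +
          Real.exp (-γ * c) * ∫ x, v (t - 2 * s) x ^ 2 := by
  have hR : 0 < R := by linarith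
  set ε := (R - ρ₁) / 4 with hε
  have hε0 : 0 < ε := by rw [hε]; linarith
  let χ : ContDiffBump (0 : Euc m) := ⟨ρ₁ + 2 * ε, ρ₁ + 3 * ε, by linarith, by linarith⟩
  have hχ : IsTest (ball 0 R) χ := by
    refine ⟨χ.contDiff, χ.hasCompactSupport, ?_⟩
    rw [χ.tsupport_eq]
    exact closedBall_subset_ball (by change ρ₁ + 3 * ε < R; rw [hε]; linarith)
  have hχc : Continuous χ := χ.continuous
  obtain ⟨C, hC0, hC⟩ := mehler_close (hR₁.trans hρ₁) (show ρ₁ < ρ₁ + ε by linarith)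
    (show ρ₁ + ε < ρ₁ + 2 * ε by linarith) hχ fun y hy =>
      χ.one_of_mem_closedBall (by simpa using hy.le)
  obtain ⟨K, hK1, hK⟩ := mapx_sq_le (R := R) hχc
  set a0 := 3 * (10 + (m : ℝ)) / κ with ha0
  have ha0' : 0 < a0 := by rw [ha0]; positivity
  set a := 4 * K + 2 + a0 + C + R ^ 2 + 2 with ha
  set G := min (ε ^ 2) (min 2 (R₁ ^ 2)) with hG
  have hG0 : 0 < G := by rw [hG]; positivity
  have hG1 : G ≤ ε ^ 2 := min_le_left _ _
  have hG2 : G ≤ 2 := (min_le_right _ _).trans (min_le_left _ _)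
  have hG3 : G ≤ R₁ ^ 2 := (min_le_right _ _).trans (min_le_right _ _)
  have ha1 : 1 ≤ a := by rw [ha]; linarith [sq_nonneg R]
  set A := a + 48 * (3 * R ^ 2 + 1) + 2 * a / G with hA
  have hA2 : 0 < 2 * a / G := by positivity
  refine ⟨A, by rw [hA]; linarith [sq_nonneg R], G / 2, by positivity, ?_⟩
  intro c v g h gh F s hs hs1 hcs x0 ρ r hx0 hB hρ hρρ hks hr t
  have hs2 : s ^ 2 ≤ 1 := pow_le_one₀ hs.le hs1
  have hA1 : 1 ≤ A := by rw [hA]; linarith [sq_nonneg R]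
  have hc1 : 1 ≤ c := by
    by_contra hh
    push Not at hh
    linarith [mul_lt_mul_of_pos_right hh (pow_pos hs 2)]
  have hc : 0 < c := by linarith
  have hD : Bornology.IsBounded (ball (0 : Euc m) R) := isBounded_ball
  obtain ⟨n, hn⟩ : ∃ n, n = ⌈1 / s⌉₊ := ⟨_, rfl⟩
  have hn1 : 1 / s ≤ n := hn ▸ Nat.le_ceil _
  have hn0 : 0 < n := by
    have : 0 < 1 / s := by positivity
    exact_mod_cast this.trans_le hn1
  obtain ⟨hk1, hk2⟩ := mq_ratio_le (A := A) (R := R) (by rw [hA]; linarith) hs hs1 hcs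
  set u := 1 / s ^ 2 with hu
  have hu1 : 1 ≤ u := by rw [hu, le_div_iff₀ (by positivity)]; linarith
  have hAu : A * u ≤ c := by
    rw [hu, mul_one_div, div_le_iff₀ (by positivity)]; exact hcs
  have hP := lagrange_const_le (m := m) hκ hκ1 hs hs1 hn
  have hm := hK hc hs (mul_pos hκ hs) hks hn0 (le_refl (2 * n))
    (Real.exp_le_one_iff.2 (neg_nonpos.2 (mul_nonneg hc.le hs.le))) hk1 hk2 hx0 (hρρ.trans hρR.le) hr
    (F.good (t - s))
  set M1 := ∫ x, v (t - s) x ^ 2 with hM1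
  set M2 := ∫ x, v (t - 2 * s) x ^ 2 with hM2
  have hM12 : M1 ≤ M2 := F.mass_antitone hD (by linarith)
  have hM10 : 0 ≤ M1 := integral_nonneg fun x => sq_nonneg _
  have hM20 : 0 ≤ M2 := hM10.trans hM12
  have hη : Real.exp (-(c * s)) ^ (2 * n) ≤ Real.exp (-(2 * c)) := by
    rw [← Real.exp_nat_mul]
    refine Real.exp_le_exp.2 ?_
    rw [div_le_iff₀ hs] at hn1
    push_cast
    linarith [mul_le_mul_of_nonneg_right hn1 hc.le]
  have hPu : a0 * u = 3 * (10 + m) / κ / s ^ 2 := by rw [hu, mul_one_div]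
  rw [← hPu] at hP
  set P := K * Real.exp (a0 * u) with hPdef
  have hP0 : 0 ≤ P := by positivity
  have hI0 : 0 ≤ ∫ x in ball x0 r, mapx χ c s (v (t - s)) x ^ 2 :=
    integral_nonneg fun x => sq_nonneg _
  have hm' : ∫ x in ball 0 ρ, mapx χ c s (v (t - s)) x ^ 2 ≤
      P * ((∫ x in ball x0 r, mapx χ c s (v (t - s)) x ^ 2) + Real.exp (-(2 * c)) * M2) := by
    refine hm.trans ?_
    rw [hPdef]
    gcongr
  have hE := hC F hc1 hs hs hs1 (t := t)
  have hts : t - s - s = t - 2 * s := by ring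
  rw [hts, ← hM2] at hE
  have key := F.inner_le hc hχc (F.good (t - s)) hP0 hρρ hρR.le hB hE hm'
  have out := F.mass_le_inner hc hR₁.le hρ hs (t' := t - 2 * s) (t := t) (by linarith)
  rw [← hM2] at out
  have hsu : R ^ 2 / (2 * s) ≤ R ^ 2 * u := by
    rw [hu, mul_one_div]
    gcongr
    linarith [mul_le_of_le_one_right hs.le hs1, sq s]
  have hRs : Real.exp (R ^ 2 / (2 * s)) ≤ Real.exp (R ^ 2 * u) := Real.exp_le_exp.2 hsu
  have hKe := le_exp_self_mul (a := 4 * K + 2) (by linarith) hu1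
  have hCe := le_exp_self_mul hC0 hu1
  have he1 : 1 ≤ Real.exp (a0 * u) := Real.one_le_exp (by positivity)
  have h42 : 4 * P + 2 ≤ Real.exp ((4 * K + 2) * u) * Real.exp (a0 * u) := by
    calc 4 * P + 2 ≤ (4 * K + 2) * Real.exp (a0 * u) := by
          rw [hPdef]; linarith
      _ ≤ _ := by gcongr
  set X := ∫ x in ball x0 r, v t x ^ 2 with hX
  have hX0 : 0 ≤ X := integral_nonneg fun x => sq_nonneg _
  have hRu : 0 ≤ R ^ 2 * u := by positivity
  have hCu : 0 ≤ C * u := by positivity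
  have hKu : 0 ≤ K * u := by positivity
  have hau : 0 ≤ a0 * u := by positivity
  have t1 : 4 * P * Real.exp (c * ρ ^ 2) ≤ Real.exp (A / s ^ 2 + c * ρ ^ 2) := by
    have hle : (4 * K + 2) * u + a0 * u ≤ A / s ^ 2 := by
      have : A / s ^ 2 = A * u := by rw [hu, mul_one_div]
      rw [this, ← add_mul]
      gcongr
      rw [hA, ha]; linarith [sq_nonneg R]
    rw [Real.exp_add]
    gcongr
    calc 4 * P ≤ Real.exp ((4 * K + 2) * u) * Real.exp (a0 * u) := by linarith
      _ = Real.exp ((4 * K + 2) * u + a0 * u) := (Real.exp_add _ _).symm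
      _ ≤ _ := Real.exp_le_exp.2 hle
  set W := Real.exp ((a - 2) * u - G * c) with hW
  have t2 : (4 * P + 2) * (C * Real.exp (-c * (ρ₁ + 2 * ε - (ρ₁ + ε)) ^ 2) *
      Real.exp (R ^ 2 / (2 * s)) * M2) ≤ W * M2 := by
    rw [← mul_assoc]
    gcongr
    calc _ ≤ (Real.exp ((4 * K + 2) * u) * Real.exp (a0 * u)) * (Real.exp (C * u) *
          Real.exp (-c * (ρ₁ + 2 * ε - (ρ₁ + ε)) ^ 2) * Real.exp (R ^ 2 * u)) := by gcongr
      _ = Real.exp ((a - 2) * u - ε ^ 2 * c) := by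
        simp only [← Real.exp_add]; congr 1; rw [ha]; ring
      _ ≤ W := Real.exp_le_exp.2 (by linarith [mul_le_mul_of_nonneg_right hG1 hc.le])
  have t3 : 2 * P * (Real.exp (-(2 * c)) * M2) ≤ W * M2 := by
    rw [← mul_assoc]
    gcongr
    calc _ ≤ (Real.exp ((4 * K + 2) * u) * Real.exp (a0 * u)) * Real.exp (-(2 * c)) :=
          mul_le_mul_of_nonneg_right (by linarith) (Real.exp_pos _).le
      _ = Real.exp ((4 * K + 2 + a0) * u - 2 * c) := by
        simp only [← Real.exp_add]; congr 1; ring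
      _ ≤ W := Real.exp_le_exp.2 (by
        rw [ha]; linarith [mul_le_mul_of_nonneg_right hG2 hc.le])
  have t4 : Real.exp (-c * R₁ ^ 2) * Real.exp (R ^ 2 / (2 * s)) * M2 ≤ W * M2 := by
    gcongr
    calc _ ≤ Real.exp (-c * R₁ ^ 2) * Real.exp (R ^ 2 * u) := by gcongr
      _ = Real.exp (R ^ 2 * u - R₁ ^ 2 * c) := by
        simp only [← Real.exp_add]; congr 1; ring
      _ ≤ W := Real.exp_le_exp.2 (by
        rw [ha]; linarith [mul_le_mul_of_nonneg_right hG3 hc.le])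
  have t5 : 3 * W ≤ Real.exp (-(G / 2) * c) := by
    have h3 : (3 : ℝ) ≤ Real.exp (2 * u) := by
      have := Real.add_one_le_exp (2 * u); linarith
    calc 3 * W ≤ Real.exp (2 * u) * W := by gcongr
      _ = Real.exp (a * u - G * c) := by
        rw [hW, ← Real.exp_add]; congr 1; ring
      _ ≤ _ := by
        refine Real.exp_le_exp.2 ?_
        have h6 : 2 * a / G * u ≤ c := le_trans (by
          gcongr; rw [hA]; linarith [sq_nonneg R]) hAu
        have h7 : 2 * a / G * u * G = 2 * (a * u) := by field_simp
        linarith [mul_le_mul_of_nonneg_right h6 hG0.le]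
  have t6 := mul_le_mul_of_nonneg_right t5 hM20
  have t7 := mul_le_mul_of_nonneg_right t1 hX0
  linarith

end HighRegimeStep

section ModeObservability

theorem le_average_add {M f : ℝ → ℝ} (hM : Antitone M) (hf : Continuous f)
    {P Q h : ℝ} (hQ : 0 ≤ Q) (hh : 0 < h) (H : ∀ t, M t ≤ P * f t + Q * M (t - h)) (t : ℝ) :
    M t ≤ P / h * (∫ τ in (t - h)..t, f τ) + Q * M (t - 2 * h) := by
  have h1 : ∫ _ in (t - h)..t, M t ≤ ∫ τ in (t - h)..t, (P * f τ + Q * M (t - 2 * h)) := by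
    refine intervalIntegral.integral_mono_on (by linarith) (by simp)
      ((by fun_prop : Continuous fun τ => P * f τ + Q * M (t - 2 * h)).intervalIntegrable _ _)
      fun τ hτ => ?_
    refine (hM hτ.2).trans ((H τ).trans ?_)
    gcongr
    exact hM (by linarith [hτ.1])
  rw [intervalIntegral.integral_add ((hf.const_mul P).intervalIntegrable _ _) (by simp),
    intervalIntegral.integral_const_mul, intervalIntegral.integral_const,
    intervalIntegral.integral_const] at h1
  simp only [sub_sub_cancel, smul_eq_mul] at h1
  have h2 : P / h * (∫ τ in (t - h)..t, f τ) * h = P * ∫ τ in (t - h)..t, f τ := by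
    field_simp
  refine le_of_mul_le_mul_right (a := h) ?_ hh
  rw [add_mul, h2]
  linarith

theorem le_iterate_average_add {M f : ℝ → ℝ} (hM : Antitone M) (hf : Continuous f)
    (hf0 : ∀ t, 0 ≤ f t) {P Q h : ℝ} (hP : 0 ≤ P) (hQ : 0 ≤ Q) (hQ1 : Q ≤ 1) (hh : 0 < h)
    (H : ∀ t, M t ≤ P * f t + Q * M (t - h)) (t : ℝ) (k : ℕ) :
    M t ≤ P / h * (∫ τ in (t - 2 * k * h)..t, f τ) + Q ^ k * M (t - 2 * k * h) := by
  induction k with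
  | zero => simp
  | succ k ih =>
    have ii : ∀ a b, IntervalIntegrable f volume a b := fun a b => hf.intervalIntegrable a b
    have step := le_average_add hM hf hQ hh H (t - 2 * k * h)
    set a := t - 2 * k * h with ha
    have e1 : t - 2 * (k + 1 : ℕ) * h = a - 2 * h := by rw [ha]; push_cast; ring
    rw [e1]
    have hI : 0 ≤ ∫ τ in (a - h)..a, f τ :=
      intervalIntegral.integral_nonneg (by linarith) fun x _ => hf0 x
    have hI2 : 0 ≤ ∫ τ in (a - 2 * h)..(a - h), f τ :=
      intervalIntegral.integral_nonneg (by linarith) fun x _ => hf0 x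
    have split : ∫ τ in (a - 2 * h)..t, f τ =
        (∫ τ in (a - 2 * h)..(a - h), f τ) + (∫ τ in (a - h)..a, f τ) + ∫ τ in a..t, f τ := by
      rw [intervalIntegral.integral_add_adjacent_intervals (ii _ _) (ii _ _),
        intervalIntegral.integral_add_adjacent_intervals (ii _ _) (ii _ _)]
    have hQk : Q ^ k ≤ 1 := pow_le_one₀ hQ hQ1
    have hQk0 : 0 ≤ Q ^ k := pow_nonneg hQ k
    have hPh : 0 ≤ P / h := by positivity
    have s1 := mul_le_mul_of_nonneg_left step hQk0
    have s2 : Q ^ k * (P / h * ∫ τ in (a - h)..a, f τ) ≤ P / h * ∫ τ in (a - h)..a, f τ :=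
      mul_le_of_le_one_left (by positivity) hQk
    rw [split, pow_succ]
    have s3 : 0 ≤ P / h * ∫ τ in (a - 2 * h)..(a - h), f τ := by positivity
    linarith

variable {m : ℕ}

theorem HeatFlow.crude_observability_set {R : ℝ} (hR : 0 < R) {ω : Set (Euc m)}
    {x0 : Euc m} (hx0 : x0 ∈ ball (0 : Euc m) R) {r : ℝ} (hr : 0 < r)
    (hB : ball x0 r ⊆ ω) :
    ∃ B, 0 < B ∧ ∀ {c : ℝ} {v : ℝ → Euc m → ℝ} {g : ℝ → Euc m → Euc m}
      {h : ℝ → Euc m → ℝ} {gh : ℝ → Euc m → Euc m}, HeatFlow (ball 0 R) c v g h gh → 0 ≤ c →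
      ∀ {t : ℝ}, 0 < t → t ≤ 1 → ∫ x, v t x ^ 2 ≤
        Real.exp (B * (c + 1 / t)) * ∫ τ in (0 : ℝ)..t, ∫ x in ω, v τ x ^ 2 := by
  set C := R ^ 2 + 144 * R ^ 4 / r ^ 2 + 64 * R ^ 2 / r ^ 2 with hC
  have hC0 : 0 ≤ C := by positivity
  refine ⟨4 * (C + 2) * (2 * C + 1), by positivity, fun {c v g h gh} F hc {t} ht ht1 => ?_⟩
  have key := F.crude_observability hR (convex_ball 0 R) Subset.rfl hc hx0 hr hC 0 ht ht1
  simp only [zero_add] at key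
  refine key.trans ?_
  gcongr
  refine intervalIntegral.integral_mono_on ht.le ((F.cont_loc _).intervalIntegrable _ _)
    ((F.cont_loc _).intervalIntegrable _ _) fun τ _ => ?_
  exact setIntegral_mono_set (F.good τ).int_sq.integrableOn
    (Eventually.of_forall fun x => sq_nonneg _) (Eventually.of_forall hB)

set_option maxHeartbeats 1000000 in
/-- Uniform observability of all the Hermite modes at time `R₁² / (2m) + δ`, with `δ ≤ 1`. -/
theorem HeatFlow.mode_observability_short (hm : 1 ≤ m) {R R₁ R₂ : ℝ} (hR₁ : 0 < R₁)
    (hR₁₂ : R₁ < R₂) (hR₂ : R₂ < R) {ω : Set (Euc m)}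
    {θ : Euc m} (hθ : ‖θ‖ = 1) {κ₀ η₀ : ℝ} (hκ₀ : 0 < κ₀) (hκ₀1 : κ₀ ≤ 1) (hη₀ : 0 < η₀)
    (hη₀R : R₁ + 2 * η₀ ≤ R₂)
    (hball : ∀ η, 0 < η → η ≤ η₀ → ball ((R₁ + η) • θ) (κ₀ * η) ⊆ ω) :
    ∃ A, 0 < A ∧ ∀ {c : ℝ} {v : ℝ → Euc m → ℝ} {g : ℝ → Euc m → Euc m}
      {h : ℝ → Euc m → ℝ} {gh : ℝ → Euc m → Euc m}, HeatFlow (ball 0 R) c v g h gh → 0 ≤ c →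
      ∀ {δ : ℝ}, 0 < δ → δ ≤ 1 → ∫ x, v (R₁ ^ 2 / (2 * m) + δ) x ^ 2 ≤
        Real.exp (A / δ ^ 2) *
          ∫ τ in (0 : ℝ)..(R₁ ^ 2 / (2 * m) + δ), ∫ x in ω, v τ x ^ 2 := by
  have hR : 0 < R := by linarith
  have hm0 : (1 : ℝ) ≤ m := by exact_mod_cast hm
  have nθ : ∀ a, 0 ≤ a → ‖a • θ‖ = a := fun a ha => by
    rw [norm_smul, hθ, mul_one, Real.norm_of_nonneg ha]
  have hx00 : (R₁ + η₀) • θ ∈ ball (0 : Euc m) R := by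
    rw [mem_ball_zero_iff, nθ _ (by linarith)]; linarith
  obtain ⟨B, hB0, hB⟩ := HeatFlow.crude_observability_set hR hx00 (mul_pos hκ₀ hη₀)
    (hball η₀ hη₀ le_rfl)
  set k := min η₀ (1 / (8 * R)) with hk
  have hk0 : 0 < k := by rw [hk]; positivity
  have hkη : k ≤ η₀ := min_le_left _ _
  have hkR : k * (8 * R) ≤ 1 := by
    rw [← le_div_iff₀ (by positivity)]; exact min_le_right _ _
  set κ := min 1 (κ₀ * k / (2 * R)) with hκ
  have hκ0 : 0 < κ := by rw [hκ]; positivity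
  have hκ1 : κ ≤ 1 := min_le_left _ _
  have hκk : κ * (2 * R) ≤ κ₀ * k := by
    rw [← le_div_iff₀ (by positivity)]; exact min_le_right _ _
  obtain ⟨A, hA1, γ, hγ, H⟩ := HeatFlow.exists_one_step (m := m) hR₁ hR₁₂ hR₂ hκ0 hκ1
  obtain ⟨N, hN⟩ := exists_nat_ge (B / γ + 1)
  have hBγ : 0 < B / γ := by positivity
  have hN1 : (1 : ℝ) ≤ N := by linarith
  have hNB : B ≤ γ * N := by
    have : B / γ ≤ N := by linarith
    rw [div_le_iff₀ hγ] at this; linarith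
  set L := 16 * (N : ℝ) with hL
  have hL0 : 0 < L := by positivity
  have hL1 : 16 ≤ L := by rw [hL]; linarith
  refine ⟨(A * L ^ 2 + L + 4 * B + 1) + (B * (A * L ^ 2) + B), by positivity, ?_⟩
  intro c v g h gh F hc δ hδ hδ1
  set T := R₁ ^ 2 / (2 * m) with hT
  have hT0 : 0 ≤ T := by positivity
  have hTm : 2 * (m * T) = R₁ ^ 2 := by rw [hT]; field_simp
  set M : ℝ → ℝ := fun t => ∫ x, v t x ^ 2 with hM
  set f : ℝ → ℝ := fun t => ∫ x in ω, v t x ^ 2 with hf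
  have hfc : Continuous f := F.cont_loc ω
  have hf0 : ∀ t, 0 ≤ f t := fun t => integral_nonneg fun x => sq_nonneg _
  have hD : Bornology.IsBounded (ball (0 : Euc m) R) := isBounded_ball
  have hMa : Antitone M := fun s t hst => F.mass_antitone hD hst
  have ii : ∀ a b, IntervalIntegrable f volume a b := fun a b => hfc.intervalIntegrable a b
  have hI0 : ∀ a b, a ≤ b → 0 ≤ ∫ τ in a..b, f τ := fun a b hab =>
    intervalIntegral.integral_nonneg hab fun x _ => hf0 x
  have hImono : ∀ b, 0 ≤ b → b ≤ T + δ → ∫ τ in (0 : ℝ)..b, f τ ≤ ∫ τ in (0 : ℝ)..(T + δ), f τ := by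
    intro b hb hb'
    rw [← intervalIntegral.integral_add_adjacent_intervals (ii 0 b) (ii b (T + δ))]
    linarith [hI0 b (T + δ) hb']
  set u := 1 / δ ^ 2 with hu
  have hδ2 : δ ^ 2 ≤ δ := by nlinarith
  have hu1 : 1 ≤ u := by rw [hu, le_div_iff₀ (by positivity)]; linarith
  have hδu : 1 / δ ≤ u := by rw [hu]; gcongr
  rw [div_eq_mul_one_div _ (δ ^ 2), ← hu]
  change M (T + δ) ≤ _ * ∫ τ in (0 : ℝ)..(T + δ), f τ
  by_cases hlow : c ≤ A * L ^ 2 * u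
  · have h1 := hB F hc hδ hδ1
    refine (hMa (show δ ≤ T + δ by linarith)).trans (h1.trans ?_)
    refine mul_le_mul (Real.exp_le_exp.2 ?_) (hImono δ hδ.le (by linarith))
      (hI0 _ _ hδ.le) (Real.exp_pos _).le
    have h2 : B * (c + 1 / δ) ≤ B * (A * L ^ 2 * u + u) := by gcongr
    have h3 : 0 ≤ (A * L ^ 2 + L + 4 * B + 1) * u := by positivity
    linarith
  push Not at hlow
  set s := δ / L with hs
  have hs0 : 0 < s := by positivity
  have hsδ : s ≤ δ := div_le_self hδ.le (by linarith)
  have hs1 : s ≤ 1 := hsδ.trans hδ1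
  have hAs : A / s ^ 2 = A * L ^ 2 * u := by rw [hs, hu]; field_simp
  have hcs : A ≤ c * s ^ 2 := by
    rw [← div_le_iff₀ (by positivity), hAs]; exact hlow.le
  set η := k * δ with hη
  have hη0 : 0 < η := by positivity
  have hηk : η ≤ k := mul_le_of_le_one_right hk0.le hδ1
  have hηη : η ≤ η₀ := hηk.trans hkη
  set ρ := R₁ + η + κ₀ * η with hρ
  have hκη : κ₀ * η ≤ η := mul_le_of_le_one_left hη0.le hκ₀1
  have hκη0 : 0 < κ₀ * η := by positivity
  have hρ2 : ρ ≤ R₂ := by linarith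
  have hx0 : (R₁ + η) • θ ∈ ball (0 : Euc m) ρ := by
    rw [mem_ball_zero_iff, nθ _ (by linarith)]; linarith
  have hsub : ball ((R₁ + η) • θ) (κ₀ * η) ⊆ ball (0 : Euc m) ρ := by
    refine ball_subset_ball' ?_
    rw [dist_zero_right, nθ _ (by linarith)]; linarith
  have hκs : κ * s ≤ 1 := mul_le_one₀ hκ1 hs0.le hs1
  have hrr : 2 * ρ * (κ * s) ≤ κ₀ * η := by
    calc 2 * ρ * (κ * s) ≤ 2 * R * (κ * δ) := by gcongr; linarith
      _ = κ * (2 * R) * δ := by ring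
      _ ≤ κ₀ * k * δ := by gcongr
      _ = κ₀ * η := by rw [hη]; ring
  have step : ∀ t, M t ≤ Real.exp (A / s ^ 2 + c * ρ ^ 2) * f t +
      Real.exp (-γ * c) * M (t - 2 * s) := fun t => by
    refine (H F hs0 hs1 hcs hx0 hsub (by linarith) hρ2 hκs hrr t).trans ?_
    gcongr
    exact setIntegral_mono_set (F.good t).int_sq.integrableOn
      (Eventually.of_forall fun x => sq_nonneg _) (Eventually.of_forall (hball η hη0 hηη))
  have iter := le_iterate_average_add hMa hfc hf0 (Real.exp_pos _).le (Real.exp_pos _).le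
    (Real.exp_le_one_iff.2 (by linarith [mul_nonneg hγ.le hc])) (show 0 < 2 * s by positivity) step (δ / 2) N
  have e1 : δ / 2 - 2 * N * (2 * s) = δ / 4 := by rw [hs, hL]; field_simp; ring
  rw [e1] at iter
  have cr := hB F hc (show 0 < δ / 4 by positivity) (by linarith)
  change M (δ / 4) ≤ _ * ∫ τ in (0 : ℝ)..(δ / 4), f τ at cr
  have dec := F.decay_uncertainty hD (show δ / 2 ≤ T + δ by linarith)
  change M (T + δ) ≤ _ * M (δ / 2) at dec
  set I := ∫ τ in (0 : ℝ)..(T + δ), f τ with hI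
  have hII : 0 ≤ I := hI0 _ _ (by linarith)
  have j1 : ∫ τ in (δ / 4)..(δ / 2), f τ ≤ I := by
    have := hImono (δ / 2) (by linarith) (by linarith)
    rw [← intervalIntegral.integral_add_adjacent_intervals (ii 0 (δ / 4)) (ii (δ / 4) _)] at this
    linarith [hI0 0 (δ / 4) (by linarith)]
  have j2 : ∫ τ in (0 : ℝ)..(δ / 4), f τ ≤ I := hImono _ (by linarith) (by linarith)
  have hρsq : c * ρ ^ 2 ≤ c * R₁ ^ 2 + c * (m * δ) := by
    rw [← mul_add]
    refine mul_le_mul_of_nonneg_left ?_ hc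
    have h8 : ρ ^ 2 ≤ (R₁ + 2 * η) ^ 2 := by gcongr; linarith
    have h9 : η * (8 * R) ≤ δ := by
      calc η * (8 * R) = k * (8 * R) * δ := by rw [hη]; ring
        _ ≤ 1 * δ := by gcongr
        _ = δ := one_mul _
    have h10 : δ ≤ m * δ := le_mul_of_one_le_left hδ.le hm0
    have h11 : η * η ≤ η * R := by gcongr; linarith
    have h12 : η * R₁ ≤ η * R := by gcongr; linarith
    calc ρ ^ 2 ≤ (R₁ + 2 * η) ^ 2 := h8
      _ = R₁ ^ 2 + 4 * (η * R₁) + 4 * (η * η) := by ring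
      _ ≤ R₁ ^ 2 + m * δ := by linarith
  have p1 : Real.exp (A / s ^ 2 + c * ρ ^ 2) / (2 * s) ≤
      Real.exp ((A * L ^ 2 + L) * u + c * ρ ^ 2) := by
    rw [hAs, div_eq_mul_one_div, show (A * L ^ 2 + L) * u + c * ρ ^ 2 =
      (A * L ^ 2 * u + c * ρ ^ 2) + L * u by ring, Real.exp_add (A * L ^ 2 * u + c * ρ ^ 2)]
    gcongr
    calc 1 / (2 * s) = L / 2 * (1 / δ) := by rw [hs]; field_simp
      _ ≤ L * u := by gcongr; linarith
      _ ≤ Real.exp (L * u) := by linarith [Real.add_one_le_exp (L * u)]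
  have p2 : Real.exp (-γ * c) ^ N * Real.exp (B * (c + 1 / (δ / 4))) ≤ Real.exp (4 * B * u) := by
    rw [← Real.exp_nat_mul, ← Real.exp_add]
    refine Real.exp_le_exp.2 ?_
    have h1 : B * c ≤ γ * N * c := by gcongr
    have h2 : B * (1 / (δ / 4)) = 4 * B * (1 / δ) := by field_simp
    have h3 : 4 * B * (1 / δ) ≤ 4 * B * u := by gcongr
    linarith
  have q1 : M (δ / 2) ≤ Real.exp ((A * L ^ 2 + L + 4 * B + 1) * u + c * ρ ^ 2) * I := by
    have r1 : Real.exp (A / s ^ 2 + c * ρ ^ 2) / (2 * s) * ∫ τ in (δ / 4)..(δ / 2), f τ ≤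
        Real.exp ((A * L ^ 2 + L) * u + c * ρ ^ 2) * I := by
      refine mul_le_mul p1 j1 (hI0 _ _ (by linarith)) (Real.exp_pos _).le
    have r2 : Real.exp (-γ * c) ^ N * M (δ / 4) ≤ Real.exp (4 * B * u) * I := by
      calc _ ≤ Real.exp (-γ * c) ^ N * (Real.exp (B * (c + 1 / (δ / 4))) * I) := by
            gcongr
            exact cr.trans (by gcongr)
        _ = Real.exp (-γ * c) ^ N * Real.exp (B * (c + 1 / (δ / 4))) * I := by ring
        _ ≤ _ := by gcongr
    refine iter.trans ((add_le_add r1 r2).trans ?_)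
    rw [← add_mul]
    gcongr
    set X := (A * L ^ 2 + L + 4 * B) * u + c * ρ ^ 2 with hX
    have x1 : Real.exp ((A * L ^ 2 + L) * u + c * ρ ^ 2) ≤ Real.exp X :=
      Real.exp_le_exp.2 (by
        have : 0 ≤ 4 * B * u := by positivity
        rw [hX]; linarith)
    have x2 : Real.exp (4 * B * u) ≤ Real.exp X :=
      Real.exp_le_exp.2 (by
        have : 0 ≤ (A * L ^ 2 + L) * u + c * ρ ^ 2 := by positivity
        rw [hX]; linarith)
    have x3 : (2 : ℝ) ≤ Real.exp u := by linarith [Real.add_one_le_exp u]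
    calc _ ≤ 2 * Real.exp X := by linarith
      _ ≤ Real.exp u * Real.exp X := by gcongr
      _ = Real.exp ((A * L ^ 2 + L + 4 * B + 1) * u + c * ρ ^ 2) := by
        rw [← Real.exp_add]; congr 1; rw [hX]; ring
  refine dec.trans ((mul_le_mul_of_nonneg_left q1 (Real.exp_pos _).le).trans ?_)
  rw [← mul_assoc, ← Real.exp_add]
  gcongr
  have z1 : 2 * (m * c) * (T + δ - δ / 2) = c * R₁ ^ 2 + c * (m * δ) := by
    rw [← hTm]; ring
  have z2 : 0 ≤ (B * (A * L ^ 2) + B) * u := by positivity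
  rw [z1]
  linarith

end ModeObservability

section ModeObservabilityAllTimes

variable {m : ℕ}

theorem HeatFlow.mode_observability (hm : 1 ≤ m) {R R₁ R₂ : ℝ} (hR₁ : 0 < R₁)
    (hR₁₂ : R₁ < R₂) (hR₂ : R₂ < R) {ω : Set (Euc m)}
    {θ : Euc m} (hθ : ‖θ‖ = 1) {κ₀ η₀ : ℝ} (hκ₀ : 0 < κ₀) (hκ₀1 : κ₀ ≤ 1) (hη₀ : 0 < η₀)
    (hη₀R : R₁ + 2 * η₀ ≤ R₂)
    (hball : ∀ η, 0 < η → η ≤ η₀ → ball ((R₁ + η) • θ) (κ₀ * η) ⊆ ω) {β : ℝ} (hβ : 1 < β) :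
    ∃ A, 0 < A ∧ ∀ {c : ℝ} {v : ℝ → Euc m → ℝ} {g : ℝ → Euc m → Euc m}
      {h : ℝ → Euc m → ℝ} {gh : ℝ → Euc m → Euc m}, HeatFlow (ball 0 R) c v g h gh → 0 ≤ c →
      ∀ {T : ℝ}, R₁ ^ 2 / (2 * m) < T → ∫ x, v T x ^ 2 ≤
        Real.exp (2 * A / (T - R₁ ^ 2 / (2 * m)) ^ (2 * β)) *
          ∫ τ in (0 : ℝ)..T, ∫ x in ω, v τ x ^ 2 := by
  obtain ⟨A, hA, H⟩ := HeatFlow.mode_observability_short hm hR₁ hR₁₂ hR₂ hθ hκ₀ hκ₀1 hη₀ hη₀R hball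
  have hR : 0 < R := by linarith
  have hm0 : (1 : ℝ) ≤ m := by exact_mod_cast hm
  set l := 2 * ((m : ℝ) ^ 2 / (4 * R ^ 2)) with hl
  have hl0 : 0 < l := by positivity
  set δ₀ := 1 + A / l with hδ₀
  have hAl : 0 < A / l := by positivity
  have hδ₀1 : 1 ≤ δ₀ := by linarith
  have hb0 : (1 : ℝ) ≤ δ₀ ^ (2 * β) := Real.one_le_rpow hδ₀1 (by linarith)
  refine ⟨A * δ₀ ^ (2 * β), by positivity, fun {c v g h gh} F hc {T} hT => ?_⟩
  set T₀ := R₁ ^ 2 / (2 * (m : ℝ)) with hT₀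
  have hT₀0 : 0 ≤ T₀ := by positivity
  obtain ⟨δ, hδ⟩ : ∃ δ, δ = T - T₀ := ⟨_, rfl⟩
  obtain rfl : T = T₀ + δ := by linarith
  rw [← hδ]
  have hδ0 : 0 < δ := by linarith
  have hfc : Continuous fun t => ∫ x in ω, v t x ^ 2 := F.cont_loc ω
  have hI0 : ∀ a b, a ≤ b → 0 ≤ ∫ τ in a..b, ∫ x in ω, v τ x ^ 2 := fun a b hab =>
    intervalIntegral.integral_nonneg hab fun x _ => integral_nonneg fun x => sq_nonneg _
  have hp : 0 < δ ^ (2 * β) := Real.rpow_pos_of_pos hδ0 _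
  have hAb : A ≤ 2 * (A * δ₀ ^ (2 * β)) := by nlinarith
  by_cases h1 : δ ≤ 1
  · refine (H F hc hδ0 h1).trans ?_
    refine mul_le_mul_of_nonneg_right (Real.exp_le_exp.2 ?_) (hI0 _ _ (by linarith))
    have : δ ^ (2 * β) ≤ δ ^ 2 := by
      have := Real.rpow_le_rpow_of_exponent_ge hδ0 h1 (show (2 : ℝ) ≤ 2 * β by linarith)
      simpa using this
    gcongr
  · push Not at h1
    have k1 := H F hc one_pos le_rfl
    have k2 := F.decay_poincare hR Subset.rfl (show T₀ + 1 ≤ T₀ + δ by linarith)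
    rw [← hl] at k2
    have k3 : ∫ τ in (0 : ℝ)..(T₀ + 1), ∫ x in ω, v τ x ^ 2 ≤
        ∫ τ in (0 : ℝ)..(T₀ + δ), ∫ x in ω, v τ x ^ 2 := by
      rw [← intervalIntegral.integral_add_adjacent_intervals (b := T₀ + 1)
        (hfc.intervalIntegrable 0 _) (hfc.intervalIntegrable _ (T₀ + δ))]
      linarith [hI0 (T₀ + 1) (T₀ + δ) (by linarith)]
    refine k2.trans ((mul_le_mul_of_nonneg_left (k1.trans
      (mul_le_mul_of_nonneg_left k3 (Real.exp_pos _).le)) (Real.exp_pos _).le).trans ?_)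
    rw [← mul_assoc, ← Real.exp_add]
    refine mul_le_mul_of_nonneg_right (Real.exp_le_exp.2 ?_) (hI0 _ _ (by linarith))
    have e : -(l * (T₀ + δ - (T₀ + 1))) + A / 1 ^ 2 = A - l * (δ - 1) := by ring
    rw [e]
    by_cases h2 : δ₀ ≤ δ
    · have : A ≤ l * (δ - 1) := by
        have : A / l ≤ δ - 1 := by linarith
        rw [div_le_iff₀ hl0] at this; linarith
      have : 0 ≤ 2 * (A * δ₀ ^ (2 * β)) / δ ^ (2 * β) := by positivity
      linarith
    · push Not at h2
      have h3 : δ ^ (2 * β) ≤ δ₀ ^ (2 * β) := Real.rpow_le_rpow hδ0.le h2.le (by linarith)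
      have h4 : A ≤ 2 * (A * δ₀ ^ (2 * β)) / δ ^ (2 * β) := by
        rw [le_div_iff₀ hp]
        nlinarith
      have : 0 ≤ l * (δ - 1) := mul_nonneg hl0.le (by linarith)
      linarith

/-- A section of annulus contains balls shrinking linearly at its inner boundary. -/
theorem exists_ball_subset_section {R₁ R₂ : ℝ} (hR₁ : 0 < R₁) (hR₁₂ : R₁ < R₂)
    {Γ : Set (Euc m)} (hΓ : ∃ U : Set (Euc m), IsOpen U ∧ Γ = U ∩ sphere (0 : Euc m) 1)
    {θ : Euc m} (hθ : θ ∈ Γ) :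
    ∃ κ₀ η₀ : ℝ, 0 < κ₀ ∧ κ₀ ≤ 1 ∧ 0 < η₀ ∧ R₁ + 2 * η₀ ≤ R₂ ∧ ∀ η, 0 < η → η ≤ η₀ →
      ball ((R₁ + η) • θ) (κ₀ * η) ⊆ {x | ∃ r : ℝ, ∃ θ ∈ Γ, R₁ < r ∧ r < R₂ ∧ x = r • θ} := by
  obtain ⟨U, hU, rfl⟩ := hΓ
  obtain ⟨ε, hε, hεU⟩ := Metric.isOpen_iff.1 hU θ hθ.1
  have hθ1 : ‖θ‖ = 1 := by simpa using hθ.2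
  set η₀ := (R₂ - R₁) / 2 with hη₀
  have hη₀0 : 0 < η₀ := by rw [hη₀]; linarith
  set κ₀ := min 1 (ε * R₁ / (2 * η₀)) with hκ₀
  have hκ0 : 0 < κ₀ := by rw [hκ₀]; positivity
  have hκ1 : κ₀ ≤ 1 := min_le_left _ _
  have hκε : κ₀ * (2 * η₀) ≤ ε * R₁ := by
    rw [← le_div_iff₀ (by positivity)]; exact min_le_right _ _
  refine ⟨κ₀, η₀, hκ0, hκ1, hη₀0, by rw [hη₀]; linarith, fun η hη hηη x hx => ?_⟩
  set ρ := R₁ + η with hρ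
  have hρ0 : 0 < ρ := by linarith
  have hρn : ‖ρ • θ‖ = ρ := by rw [norm_smul, hθ1, mul_one, Real.norm_of_nonneg hρ0.le]
  have hd : ‖x - ρ • θ‖ < κ₀ * η := by simpa [dist_eq_norm] using hx
  have hκη : κ₀ * η ≤ η := mul_le_of_le_one_left hη.le hκ1
  have a1 : |‖x‖ - ρ| ≤ ‖x - ρ • θ‖ := by
    have := abs_norm_sub_norm_le x (ρ • θ)
    rwa [hρn] at this
  have a2 := abs_le.1 a1
  have x1 : R₁ < ‖x‖ := by linarith
  have x2 : ‖x‖ < R₂ := by linarith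
  have x0 : 0 < ‖x‖ := by linarith
  refine ⟨‖x‖, ‖x‖⁻¹ • x, ⟨hεU ?_, ?_⟩, x1, x2, ?_⟩
  · rw [mem_ball, dist_eq_norm]
    have e : ‖x‖⁻¹ • x - θ = ‖x‖⁻¹ • (x - ‖x‖ • θ) := by
      rw [smul_sub, smul_smul, inv_mul_cancel₀ x0.ne', one_smul]
    have b : ‖x - ‖x‖ • θ‖ ≤ ‖x - ρ • θ‖ + ‖x - ρ • θ‖ := by
      calc ‖x - ‖x‖ • θ‖ = ‖(x - ρ • θ) + (ρ - ‖x‖) • θ‖ := by congr 1; module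
        _ ≤ ‖x - ρ • θ‖ + ‖(ρ - ‖x‖) • θ‖ := norm_add_le _ _
        _ ≤ _ := by
          gcongr
          rw [norm_smul, hθ1, mul_one, Real.norm_eq_abs, abs_sub_comm]
          exact a1
    rw [e, norm_smul, norm_inv, norm_norm, inv_mul_lt_iff₀ x0]
    have c1 : κ₀ * η ≤ κ₀ * η₀ := by gcongr
    have c2 : ε * R₁ ≤ ε * ‖x‖ := by gcongr
    linarith
  · rw [mem_sphere_zero_iff_norm, norm_smul, norm_inv, norm_norm, inv_mul_cancel₀ x0.ne']
  · rw [smul_smul, mul_inv_cancel₀ x0.ne', one_smul]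

theorem isOpen_section {R₁ R₂ : ℝ} (hR₁ : 0 < R₁)
    {Γ : Set (Euc m)} (hΓ : ∃ U : Set (Euc m), IsOpen U ∧ Γ = U ∩ sphere (0 : Euc m) 1) :
    IsOpen {x : Euc m | ∃ r : ℝ, ∃ θ ∈ Γ, R₁ < r ∧ r < R₂ ∧ x = r • θ} := by
  obtain ⟨U, hU, rfl⟩ := hΓ
  have e : {x : Euc m | ∃ r : ℝ, ∃ θ ∈ U ∩ sphere (0 : Euc m) 1, R₁ < r ∧ r < R₂ ∧ x = r • θ} =
      {x | R₁ < ‖x‖ ∧ ‖x‖ < R₂} ∩ (fun x : Euc m => ‖x‖⁻¹ • x) ⁻¹' U := by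
    ext x
    constructor
    · rintro ⟨r, θ, ⟨hθU, hθ⟩, h1, h2, rfl⟩
      have hθ1 : ‖θ‖ = 1 := by simpa using hθ
      have hr : 0 < r := by linarith
      have hn : ‖r • θ‖ = r := by rw [norm_smul, hθ1, mul_one, Real.norm_of_nonneg hr.le]
      refine ⟨⟨by rw [hn]; exact h1, by rw [hn]; exact h2⟩, ?_⟩
      rw [mem_preimage, hn, smul_smul, inv_mul_cancel₀ hr.ne', one_smul]
      exact hθU
    · rintro ⟨⟨h1, h2⟩, h3⟩
      have x0 : 0 < ‖x‖ := by linarith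
      refine ⟨‖x‖, ‖x‖⁻¹ • x, ⟨h3, ?_⟩, h1, h2, ?_⟩
      · rw [mem_sphere_zero_iff_norm, norm_smul, norm_inv, norm_norm, inv_mul_cancel₀ x0.ne']
      · rw [smul_smul, mul_inv_cancel₀ x0.ne', one_smul]
  rw [e]
  have o : IsOpen {x : Euc m | R₁ < ‖x‖ ∧ ‖x‖ < R₂} :=
    (isOpen_lt continuous_const continuous_norm).inter (isOpen_lt continuous_norm continuous_const)
  refine ContinuousOn.isOpen_inter_preimage ?_ o hU
  refine ContinuousOn.smul (continuous_norm.continuousOn.inv₀ fun x hx => ?_) continuousOn_id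
  have : R₁ < ‖x‖ := hx.1
  linarith

end ModeObservabilityAllTimes

/-! ### Diagonalization of compact self-adjoint operators -/

theorem Orthonormal.countable_index {ι H : Type*} [NormedAddCommGroup H] [InnerProductSpace ℝ H]
    [TopologicalSpace.SeparableSpace H] {e : ι → H} (he : Orthonormal ℝ e) : Countable ι := by
  have hdist : ∀ i j, i ≠ j → 1 ≤ dist (e i) (e j) := by
    intro i j hij
    have h1 : ‖e i - e j‖ ^ 2 = 2 := by
      rw [norm_sub_sq_real, he.2 hij, he.1 i, he.1 j]; norm_num
    rw [dist_eq_norm]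
    nlinarith [norm_nonneg (e i - e j)]
  have hd : Pairwise (Function.onFun Disjoint fun i => ball (e i) (1 / 2 : ℝ)) := by
    intro i j hij
    refine ball_disjoint_ball ?_
    have := hdist i j hij
    linarith
  have := Set.PairwiseDisjoint.countable_of_isOpen (s := fun i => ball (e i) (1 / 2 : ℝ))
    (a := univ) (hd.set_pairwise _) (fun i _ => isOpen_ball)
    (fun i _ => ⟨e i, mem_ball_self (by norm_num)⟩)
  exact Set.countable_univ_iff.1 this

/-- A compact self-adjoint operator on a Hilbert space has a complete orthonormal family of
eigenvectors. -/
theorem exists_orthonormal_eigenvectors {H : Type} [NormedAddCommGroup H] [InnerProductSpace ℝ H]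
    [CompleteSpace H] {T : H →L[ℝ] H} (hT : IsCompactOperator T) (hT' : T.IsSymmetric) :
    ∃ (ι : Type) (e : ι → H) (κ : ι → ℝ), Orthonormal ℝ e ∧
      (Submodule.span ℝ (range e))ᗮ = ⊥ ∧ ∀ j, T (e j) = κ j • e j := by
  have hbot := ContinuousLinearMap.orthogonalComplement_iSup_eigenspaces_eq_bot hT hT'
  set E : ℝ → Submodule ℝ H := fun μ => Module.End.eigenspace (T : Module.End ℝ H) μ with hE
  have hcl : ∀ μ, IsClosed (E μ : Set H) := by
    intro μ
    have : (E μ : Set H) = {x | T x = μ • x} := by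
      ext x; simp [hE]
    rw [this]
    exact isClosed_eq T.continuous (continuous_const_smul μ)
  have hc : ∀ μ, CompleteSpace (E μ) := fun μ => (hcl μ).completeSpace_coe
  choose w b hb using fun μ => exists_hilbertBasis ℝ (E μ)
  have hof : OrthogonalFamily ℝ (fun μ => E μ) fun μ => (E μ).subtypeₗᵢ :=
    hT'.orthogonalFamily_eigenspaces
  have horth : Orthonormal ℝ fun a : Σ μ, w μ => ((b a.1 a.2 : E a.1) : H) :=
    hof.orthonormal_sigma_orthonormal fun μ => (b μ).orthonormal
  refine ⟨Σ μ, w μ, fun a => ((b a.1 a.2 : E a.1) : H), fun a => a.1, horth, ?_, ?_⟩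
  · rw [eq_bot_iff, ← hbot]
    intro x hx
    rw [Submodule.mem_orthogonal'] at hx
    have h0 : ∀ a : Σ μ, w μ, inner ℝ x ((b a.1 a.2 : E a.1) : H) = 0 := fun a =>
      hx _ (Submodule.subset_span ⟨a, rfl⟩)
    have hle : (⨆ μ, E μ) ≤ (ℝ ∙ x)ᗮ := by
      refine iSup_le fun μ v hv => ?_
      rw [Submodule.mem_orthogonal_singleton_iff_inner_right]
      have hs := ((b μ).hasSum_repr ⟨v, hv⟩).mapL ((innerSL ℝ x).comp (E μ).subtypeL)
      have hz : ∀ i : w μ, ((innerSL ℝ x).comp (E μ).subtypeL)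
          ((b μ).repr ⟨v, hv⟩ i • (b μ) i) = 0 := by
        intro i
        rw [map_smul]
        simp only [ContinuousLinearMap.comp_apply, Submodule.subtypeL_apply, innerSL_apply_apply]
        rw [h0 ⟨μ, i⟩, smul_zero]
      simp only [hz] at hs
      exact (hs.unique hasSum_zero)
    exact (Submodule.orthogonal_le hle) (Submodule.le_orthogonal_orthogonal _
      (Submodule.mem_span_singleton_self x))
  · intro a
    exact Module.End.mem_eigenspace_iff.1 (b a.1 a.2).2

/-! ### Finite rank approximation in `L²` -/

section FiniteRank

variable {m : ℕ} {D : Set (Euc m)}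

theorem exists_simpleFunc_close (hD : Bornology.IsBounded D) {ε : ℝ} (hε : 0 < ε) :
    ∃ p : SimpleFunc (Euc m) (Euc m), ∀ x ∈ D, dist x (p x) < ε := by
  set e := TopologicalSpace.denseSeq (Euc m) with he
  have hcov : closure D ⊆ ⋃ N : ℕ, ⋃ k ≤ N, ball (e k) ε := by
    intro x _
    obtain ⟨k, hk⟩ := (TopologicalSpace.denseRange_denseSeq (Euc m)).exists_dist_lt x hε
    exact mem_iUnion.2 ⟨k, mem_iUnion₂.2 ⟨k, le_rfl, hk⟩⟩
  obtain ⟨N, hN⟩ := hD.isCompact_closure.elim_directed_cover _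
    (fun N => isOpen_biUnion fun _ _ => isOpen_ball) hcov
    (directed_of_isDirected_le fun a b hab => biUnion_subset_biUnion_left fun k (hk : k ≤ a) =>
      hk.trans hab)
  refine ⟨SimpleFunc.nearestPt e N, fun x hx => ?_⟩
  obtain ⟨k, hk, hxk⟩ := mem_iUnion₂.1 (hN (subset_closure hx))
  have h := SimpleFunc.edist_nearestPt_le e x hk
  rw [edist_dist, edist_dist, ENNReal.ofReal_le_ofReal_iff dist_nonneg] at h
  rw [dist_comm]
  refine h.trans_lt ?_
  rw [dist_comm]; exact hxk

theorem sq_average_le {s : Set (Euc m)} {V : ℝ} (hV : 0 < V) (hs : volume s = ENNReal.ofReal V)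
    {f : Euc m → ℝ} (hf : MemLp f 2 (volume.restrict s)) :
    (V⁻¹ * ∫ w in s, f w) ^ 2 ≤ V⁻¹ * ∫ w in s, f w ^ 2 := by
  have hfin : IsFiniteMeasure (volume.restrict s) := ⟨by simp [hs]⟩
  have h := abs_integral_inner_le hf (memLp_const (1 : ℝ) (μ := volume.restrict s))
  simp only [RCLike.inner_apply, conj_trivial, Real.norm_eq_abs, sq_abs, one_mul, one_pow,
    integral_const, smul_eq_mul, mul_one] at h
  have hv : (volume.restrict s).real univ = V := by
    simp [Measure.real, hs, hV.le]
  rw [hv] at h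
  rw [mul_pow]
  have h3 : (V⁻¹) ^ 2 * (∫ w in s, f w) ^ 2 ≤ (V⁻¹) ^ 2 * ((∫ w in s, f w ^ 2) * V) :=
    mul_le_mul_of_nonneg_left h (by positivity)
  refine h3.trans (le_of_eq ?_)
  field_simp

/-- The averages of a test function over balls centred at the net points. -/
theorem IsTest.integral_sub_average_sq_le (hD : Bornology.IsBounded D)
    {φ : Euc m → ℝ} (h : IsTest D φ) {ε V V' : ℝ} (hV : 0 < V) (hV' : 0 ≤ V')
    (hVb : ∀ a : Euc m, volume (ball a ε) = ENNReal.ofReal V)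
    (hVb' : volume (closedBall (0 : Euc m) (2 * ε)) = ENNReal.ofReal V')
    {p : SimpleFunc (Euc m) (Euc m)} (hp : ∀ x ∈ D, dist x (p x) < ε) :
    ∫ x, (φ x - D.indicator (fun x => V⁻¹ * ∫ w in ball (p x) ε, φ w) x) ^ 2
      ≤ V⁻¹ * V' * (2 * ε) ^ 2 * ∫ x, ‖gradient φ x‖ ^ 2 := by
  have hc := h.contDiff.continuous
  obtain ⟨M, hM⟩ := hD.subset_closedBall (0 : Euc m)
  set B := closedBall (0 : Euc m) (2 * ε) with hB
  have hpt : ∀ x ∈ D, (φ x - V⁻¹ * ∫ w in ball (p x) ε, φ w) ^ 2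
      ≤ V⁻¹ * ∫ z in B, (φ (x + z) - φ x) ^ 2 := by
    intro x hx
    have hfin : IsFiniteMeasure (volume.restrict (ball (p x) ε)) := ⟨by simp [hVb]⟩
    have hm1 : MemLp (fun w => φ x - φ w) 2 (volume.restrict (ball (p x) ε)) :=
      (memLp_const _).sub (h.good.mem.restrict _)
    have hint : IntegrableOn φ (ball (p x) ε) :=
      (hc.integrable_of_hasCompactSupport h.compact).integrableOn
    have e1 : φ x - V⁻¹ * ∫ w in ball (p x) ε, φ w
        = V⁻¹ * ∫ w in ball (p x) ε, (φ x - φ w) := by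
      rw [integral_sub (integrable_const _) hint]
      have hv : (volume.restrict (ball (p x) ε)).real univ = V := by
        simp [Measure.real, hVb, hV.le]
      rw [integral_const, hv, smul_eq_mul]
      field_simp
    rw [e1]
    refine (sq_average_le hV (hVb _) hm1).trans ?_
    refine mul_le_mul_of_nonneg_left ?_ (by positivity)
    have e2 : ∫ z in B, (φ (x + z) - φ x) ^ 2 = ∫ w in closedBall x (2 * ε), (φ x - φ w) ^ 2 := by
      rw [← integral_indicator measurableSet_closedBall,
        ← integral_indicator measurableSet_closedBall,
        ← integral_add_left_eq_self (fun w => (closedBall x (2 * ε)).indicator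
          (fun w => (φ x - φ w) ^ 2) w) x]
      congr 1; funext z
      by_cases hz : z ∈ B
      · rw [indicator_of_mem hz, indicator_of_mem (by simpa [hB] using hz)]; ring
      · rw [indicator_of_notMem hz, indicator_of_notMem (by simpa [hB] using hz)]
    rw [e2]
    refine setIntegral_mono_set ?_ (Eventually.of_forall fun w => sq_nonneg _) ?_
    · exact (Continuous.continuousOn (by fun_prop)).integrableOn_compact (isCompact_closedBall _ _)
    · refine LE.le.eventuallyLE fun w hw => ?_
      rw [mem_closedBall]
      have h1 := hp x hx
      rw [mem_ball] at hw
      linarith [dist_triangle_right w x (p x)]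
  have hcont : Continuous fun q : Euc m × Euc m => (φ (q.1 + q.2) - φ q.1) ^ 2 := by fun_prop
  have hprod : Integrable (fun q : Euc m × Euc m => (φ (q.1 + q.2) - φ q.1) ^ 2)
      ((volume.restrict (closedBall (0 : Euc m) M)).prod (volume.restrict B)) := by
    rw [Measure.prod_restrict]
    exact hcont.continuousOn.integrableOn_compact
      ((isCompact_closedBall _ _).prod (isCompact_closedBall _ _))
  have hint2 : ∀ z, Integrable fun x => (φ (x + z) - φ x) ^ 2 := by
    intro z
    have h1 : MemLp (fun x => φ (x + z)) 2 volume :=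
      h.good.mem.comp_measurePreserving (measurePreserving_add_right volume z)
    exact (h1.sub h.good.mem).integrable_sq
  calc ∫ x, (φ x - D.indicator (fun x => V⁻¹ * ∫ w in ball (p x) ε, φ w) x) ^ 2
      = ∫ x in closedBall (0 : Euc m) M,
        (φ x - D.indicator (fun x => V⁻¹ * ∫ w in ball (p x) ε, φ w) x) ^ 2 := by
        symm
        refine setIntegral_eq_integral_of_forall_compl_eq_zero fun x hx => ?_
        have hxD : x ∉ D := fun h' => hx (hM h')
        rw [indicator_of_notMem hxD, h.good.zero x hxD]; norm_num
    _ ≤ ∫ x in closedBall (0 : Euc m) M, V⁻¹ * ∫ z in B, (φ (x + z) - φ x) ^ 2 := by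
        refine integral_mono_of_nonneg (Eventually.of_forall fun x => sq_nonneg _)
          (hprod.integral_prod_left.const_mul _) (Eventually.of_forall fun x => ?_)
        by_cases hx : x ∈ D
        · simp only [indicator_of_mem hx]; exact hpt x hx
        · simp only [indicator_of_notMem hx, h.good.zero x hx]
          have : 0 ≤ ∫ z in B, (φ (x + z) - 0) ^ 2 := integral_nonneg fun z => sq_nonneg _
          have h4 : (0 - 0 : ℝ) ^ 2 = 0 := by norm_num
          rw [h4]; positivity
    _ = V⁻¹ * ∫ z in B, ∫ x in closedBall (0 : Euc m) M, (φ (x + z) - φ x) ^ 2 := by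
        rw [integral_const_mul, integral_integral_swap hprod]
    _ ≤ V⁻¹ * ∫ z in B, (2 * ε) ^ 2 * ∫ x, ‖gradient φ x‖ ^ 2 := by
        refine mul_le_mul_of_nonneg_left ?_ (by positivity)
        refine setIntegral_mono_on hprod.integral_prod_right ?_ measurableSet_closedBall ?_
        · exact integrableOn_const (by simp [hVb']) enorm_ne_top
        · intro z hz
          refine (setIntegral_le_integral (hint2 z) (Eventually.of_forall fun x =>
            sq_nonneg _)).trans ((h.integral_translate_sq_le z).trans ?_)
          refine mul_le_mul_of_nonneg_right ?_ (integral_nonneg fun x => sq_nonneg _)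
          have : ‖z‖ ≤ 2 * ε := by simpa [hB] using hz
          exact pow_le_pow_left₀ (norm_nonneg _) this 2
    _ = V⁻¹ * V' * (2 * ε) ^ 2 * ∫ x, ‖gradient φ x‖ ^ 2 := by
        have hv : (volume.restrict B).real univ = V' := by
          simp [Measure.real, hVb', hV']
        rw [integral_const, hv, smul_eq_mul]; ring

theorem coeFn_finsetSum_Lp {ι α : Type*} [MeasurableSpace α] {μ : Measure α} (s : Finset ι)
    (f : ι → Lp ℝ 2 μ) : ⇑(∑ a ∈ s, f a) =ᵐ[μ] fun x => ∑ a ∈ s, f a x := by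
  classical
  induction s using Finset.induction_on with
  | empty => exact Lp.coeFn_zero ℝ 2 μ
  | insert a s ha ih =>
    rw [Finset.sum_insert ha]
    filter_upwards [Lp.coeFn_add (f a) (∑ a ∈ s, f a), ih] with x h1 h2
    rw [h1, Pi.add_apply, h2, Finset.sum_insert ha]

/-- On test functions of bounded energy the identity of `L²` is a limit of compact operators. -/
theorem exists_compact_approx (hD : Bornology.IsBounded D) (hDm : MeasurableSet D) {ε : ℝ}
    (hε : 0 < ε) : ∃ S : Lp ℝ 2 (volume : Measure (Euc m)) →L[ℝ] Lp ℝ 2 (volume : Measure (Euc m)),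
      IsCompactOperator S ∧ ∀ φ (h : IsTest D φ),
        ‖h.good.mem.toLp φ - S (h.good.mem.toLp φ)‖ ^ 2
          ≤ (2 ^ m * (2 * ε) ^ 2) * ∫ x, ‖gradient φ x‖ ^ 2 := by
  obtain ⟨p, hp⟩ := exists_simpleFunc_close hD hε
  set V := (volume (ball (0 : Euc m) ε)).toReal with hVdef
  have hVb : ∀ a : Euc m, volume (ball a ε) = ENNReal.ofReal V := by
    intro a
    rw [hVdef, ENNReal.ofReal_toReal measure_ball_lt_top.ne, Measure.addHaar_ball_center]
  have hV : 0 < V := ENNReal.toReal_pos (measure_ball_pos _ _ hε).ne' measure_ball_lt_top.ne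
  have hVb' : volume (closedBall (0 : Euc m) (2 * ε)) = ENNReal.ofReal (2 ^ m * V) := by
    have h1 := Measure.addHaar_closedBall (volume : Measure (Euc m)) 0 (r := 2 * ε) (by positivity)
    have h2 := Measure.addHaar_ball_of_pos (volume : Measure (Euc m)) 0 hε
    rw [finrank_euclideanSpace_fin] at h1 h2
    rw [h1, mul_pow, ENNReal.ofReal_mul (by positivity), mul_assoc, ← h2, hVb,
      ← ENNReal.ofReal_mul (by positivity)]
  have hI1 : ∀ a : Euc m, MemLp ((ball a ε).indicator fun _ => V⁻¹) 2 volume := fun a =>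
    memLp_indicator_const 2 measurableSet_ball _ (Or.inr measure_ball_lt_top.ne)
  have hI2 : ∀ a : Euc m, MemLp ((p ⁻¹' {a} ∩ D).indicator fun _ => (1 : ℝ)) 2 volume := fun a =>
    memLp_indicator_const 2 ((p.measurableSet_fiber a).inter hDm) _
      (Or.inr ((measure_mono inter_subset_right).trans_lt hD.measure_lt_top).ne)
  refine ⟨∑ a ∈ p.range, (innerSL ℝ ((hI1 a).toLp _)).smulRight ((hI2 a).toLp _), ?_, ?_⟩
  · have : ∀ s : Finset (Euc m), IsCompactOperator (∑ a ∈ s,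
        (innerSL ℝ ((hI1 a).toLp _)).smulRight ((hI2 a).toLp _) :
        Lp ℝ 2 (volume : Measure (Euc m)) →L[ℝ] Lp ℝ 2 (volume : Measure (Euc m))) := by
      intro s
      induction s using Finset.induction_on with
      | empty => simpa using isCompactOperator_zero
      | insert a s ha ih =>
        rw [Finset.sum_insert ha]
        refine IsCompactOperator.add ?_ ih
        have h1 : IsCompactOperator ((ContinuousLinearMap.id ℝ ℝ).smulRight ((hI2 a).toLp _)) :=
          isCompactOperator_of_locallyCompactSpace_rng
            ((ContinuousLinearMap.id ℝ ℝ).smulRight ((hI2 a).toLp _))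
        exact h1.comp_clm (innerSL ℝ ((hI1 a).toLp _))
    exact this _
  · intro φ h
    have hS : (∑ a ∈ p.range, (innerSL ℝ ((hI1 a).toLp _)).smulRight ((hI2 a).toLp _) :
        Lp ℝ 2 (volume : Measure (Euc m)) →L[ℝ] Lp ℝ 2 (volume : Measure (Euc m)))
        (h.good.mem.toLp φ) = ∑ a ∈ p.range, (V⁻¹ * ∫ w in ball a ε, φ w) • (hI2 a).toLp _ := by
      rw [_root_.sum_apply]
      refine Finset.sum_congr rfl fun a _ => ?_
      rw [ContinuousLinearMap.smulRight_apply, innerSL_apply_apply, inner_toLp]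
      congr 1
      rw [← integral_const_mul, ← integral_indicator measurableSet_ball]
      congr 1; funext w
      by_cases hw : w ∈ ball a ε
      · simp [indicator_of_mem hw, mul_comm]
      · simp [indicator_of_notMem hw]
    rw [hS]
    refine le_trans (le_of_eq ?_) ((h.integral_sub_average_sq_le hD hV (by positivity) hVb hVb'
      hp).trans (le_of_eq ?_))
    · rw [← real_inner_self_eq_norm_sq, L2.inner_def]
      refine integral_congr_ae ?_
      have hco : ∀ᵐ x : Euc m, ∀ a ∈ p.range, (hI2 a).toLp _ x
          = (p ⁻¹' {a} ∩ D).indicator (fun _ => (1 : ℝ)) x :=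
        (Finset.eventually_all _).2 fun a _ => (hI2 a).coeFn_toLp
      filter_upwards [h.good.mem.coeFn_toLp, hco, Lp.coeFn_sub (h.good.mem.toLp φ)
        (∑ a ∈ p.range, (V⁻¹ * ∫ w in ball a ε, φ w) • (hI2 a).toLp _),
        coeFn_finsetSum_Lp p.range
          (fun a => (V⁻¹ * ∫ w in ball a ε, φ w) • (hI2 a).toLp _),
        (Finset.eventually_all p.range).2 fun a _ => Lp.coeFn_smul
          (V⁻¹ * ∫ w in ball a ε, φ w) ((hI2 a).toLp _)] with x h1 h2 h3 h4 h5
      have e1 : ∑ a ∈ p.range, ((V⁻¹ * ∫ w in ball a ε, φ w) • (hI2 a).toLp _ :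
            Lp ℝ 2 (volume : Measure (Euc m))) x
          = D.indicator (fun x => V⁻¹ * ∫ w in ball (p x) ε, φ w) x := by
        rw [Finset.sum_congr rfl fun a ha => (h5 a ha).trans
          (congrArg (fun r : ℝ => (V⁻¹ * ∫ w in ball a ε, φ w) * r) (h2 a ha)),
          Finset.sum_eq_single (p x)]
        · by_cases hx : x ∈ D
          · simp [hx]
          · simp [hx]
        · intro a _ ha
          simp [indicator, ha.symm]
        · intro hx
          exact absurd (p.mem_range_self x) hx
      rw [real_inner_self_eq_norm_sq, Real.norm_eq_abs, sq_abs, h3, Pi.sub_apply, h1, h4, e1]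
    · field_simp

end FiniteRank

/-! ### The eigenbasis of `-Δ + c²‖x‖²` with Dirichlet conditions -/

section Eigenbasis

variable {m : ℕ} {D : Set (Euc m)}

/-- The ambient space of the energy space. -/
abbrev EnergyAmb (m : ℕ) := WithLp 2 (Lp ℝ 2 (volume : Measure (Euc m)) ×
  WithLp 2 (Lp (Euc m) 2 (volume : Measure (Euc m)) × Lp ℝ 2 (volume : Measure (Euc m))))

theorem continuous_potential (c : ℝ) : Continuous fun x : Euc m => c * ‖x‖ := by fun_prop

/-- The image of a test function in the energy space. -/
noncomputable def IsTest.energyVec (hD : Bornology.IsBounded D) (c : ℝ) {φ : Euc m → ℝ}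
    (h : IsTest D φ) : EnergyAmb m :=
  WithLp.toLp 2 (h.good.mem.toLp φ, WithLp.toLp 2 (h.good_gradient.mem.toLp (gradient φ),
    (h.good.mul hD (continuous_potential c)).mem.toLp (fun x => c * ‖x‖ * φ x)))

theorem IsTest.const_mul {φ : Euc m → ℝ} (h : IsTest D φ) (a : ℝ) : IsTest D (fun x => a * φ x) :=
  h.mul_left contDiff_const

theorem energyAmb_ext {v w : EnergyAmb m} (h1 : v.fst = w.fst) (h2 : v.snd.fst = w.snd.fst)
    (h3 : v.snd.snd = w.snd.snd) : v = w :=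
  WithLp.ofLp_injective 2 (Prod.ext h1 (WithLp.ofLp_injective 2 (Prod.ext h2 h3)))

theorem IsTest.energyVec_add (hD : Bornology.IsBounded D) (c : ℝ) {φ ψ : Euc m → ℝ}
    (h : IsTest D φ) (h' : IsTest D ψ) :
    (h.add h').energyVec hD c = h.energyVec hD c + h'.energyVec hD c := by
  refine energyAmb_ext ?_ ?_ ?_
  · exact MemLp.toLp_add h.good.mem h'.good.mem
  · refine (MemLp.toLp_congr (h.add h').good_gradient.mem (h.good_gradient.mem.add h'.good_gradient.mem)
      (ae_of_all _ fun x => ?_)).trans (MemLp.toLp_add h.good_gradient.mem h'.good_gradient.mem)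
    exact gradient_add (h.contDiff.differentiable (by simp) x)
      (h'.contDiff.differentiable (by simp) x)
  · refine (MemLp.toLp_congr
      ((h.add h').good.mul hD (continuous_potential c)).mem ((h.good.mul hD (continuous_potential c)).mem.add
      (h'.good.mul hD (continuous_potential c)).mem) (ae_of_all _ fun x => ?_)).trans
      (MemLp.toLp_add (h.good.mul hD (continuous_potential c)).mem
        (h'.good.mul hD (continuous_potential c)).mem)
    simp only [Pi.add_apply]; ring

theorem IsTest.energyVec_const_mul (hD : Bornology.IsBounded D) (c a : ℝ) {φ : Euc m → ℝ}
    (h : IsTest D φ) : (h.const_mul a).energyVec hD c = a • h.energyVec hD c := by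
  refine energyAmb_ext ?_ ?_ ?_
  · exact MemLp.toLp_const_smul a h.good.mem
  · refine (MemLp.toLp_congr (h.const_mul a).good_gradient.mem (h.good_gradient.mem.const_smul a)
      (ae_of_all _ fun x => ?_)).trans (MemLp.toLp_const_smul a h.good_gradient.mem)
    exact gradient_const_smul (h.contDiff.differentiable (by simp) x) a
  · refine (MemLp.toLp_congr
      ((h.const_mul a).good.mul hD (continuous_potential c)).mem ((h.good.mul hD (continuous_potential c)).mem.const_smul a)
      (ae_of_all _ fun x => ?_)).trans (MemLp.toLp_const_smul a
        (h.good.mul hD (continuous_potential c)).mem)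
    simp only [Pi.smul_apply, smul_eq_mul]; ring

/-- The images of the test functions in the energy space. -/
noncomputable def testEnergy (hD : Bornology.IsBounded D) (c : ℝ) : Submodule ℝ (EnergyAmb m) where
  carrier := {w | ∃ φ, ∃ h : IsTest D φ, h.energyVec hD c = w}
  zero_mem' := ⟨_, IsTest.zero.const_mul 0, by
    rw [IsTest.zero.energyVec_const_mul, zero_smul]⟩
  add_mem' := by
    rintro _ _ ⟨φ, h, rfl⟩ ⟨ψ, h', rfl⟩
    exact ⟨_, h.add h', h.energyVec_add hD c h'⟩
  smul_mem' := by
    rintro a _ ⟨φ, h, rfl⟩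
    exact ⟨_, h.const_mul a, h.energyVec_const_mul hD c a⟩

theorem L2Lim.indicator {F : Type*} [NormedAddCommGroup F] [InnerProductSpace ℝ F]
    (hDm : MeasurableSet D) {f : ℕ → Euc m → F} {g : Euc m → F}
    (h : L2Lim volume f g) (hf : ∀ k, ∀ x ∉ D, f k x = 0) : L2Lim volume f (D.indicator g) :=
  h.of_le h.mem (h.memLim.indicator hDm) 1 fun k x => by
    by_cases hx : x ∈ D
    · rw [indicator_of_mem hx, one_mul]
    · rw [indicator_of_notMem hx, hf k x hx]; simp

theorem L2Lim.toLp_eq {α F : Type*} [MeasurableSpace α] {μ : Measure α} [NormedAddCommGroup F]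
    [InnerProductSpace ℝ F] {f : ℕ → α → F} {g g' : α → F}
    (h : L2Lim μ f g) (h' : L2Lim μ f g') : h.memLim.toLp g = h'.memLim.toLp g' :=
  tendsto_nhds_unique h.tendsto_toLp h'.tendsto_toLp

theorem L2Lim.of_tendsto {α F : Type*} [MeasurableSpace α] {μ : Measure α} [NormedAddCommGroup F]
    [InnerProductSpace ℝ F] {f : ℕ → α → F} (hf : ∀ k, MemLp (f k) 2 μ) {G : Lp F 2 μ}
    (h : Tendsto (fun k => (hf k).toLp (f k)) atTop (nhds G)) : L2Lim μ f G := by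
  refine ⟨hf, Lp.memLp G, (Lp.tendsto_Lp_iff_tendsto_eLpNorm'' f hf G (Lp.memLp G)).1 ?_⟩
  rw [Lp.toLp_coeFn]; exact h

theorem exists_h10_of_mem_closure (hD : Bornology.IsBounded D) (hDm : MeasurableSet D) {c : ℝ}
    {w : EnergyAmb m} (hw : w ∈ (testEnergy (D := D) hD c).topologicalClosure) :
    ∃ (u : Euc m → ℝ) (g : Euc m → Euc m) (h : H10 D u g),
      w = WithLp.toLp 2 (h.good.mem.toLp u, WithLp.toLp 2 (h.good_grad.mem.toLp g,
        (h.good.mul hD (continuous_potential c)).mem.toLp (fun x => c * ‖x‖ * u x))) := by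
  have hw' : w ∈ closure (testEnergy (D := D) hD c : Set (EnergyAmb m)) := hw
  obtain ⟨v, hv, hlim⟩ := mem_closure_iff_seq_limit.1 hw'
  choose φ hφ hφv using hv
  have l1 : Tendsto (fun k => (hφ k).good.mem.toLp (φ k)) atTop (nhds w.fst) := by
    have := ((WithLp.fstL 2 ℝ (Lp ℝ 2 (volume : Measure (Euc m))) (WithLp 2
      (Lp (Euc m) 2 (volume : Measure (Euc m)) × Lp ℝ 2 (volume : Measure (Euc m))))).continuous.tendsto
      w).comp hlim
    refine this.congr fun k => ?_
    simp only [Function.comp_apply, ← hφv]; rfl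
  have l2 : Tendsto (fun k => (hφ k).good_gradient.mem.toLp (gradient (φ k))) atTop
      (nhds w.snd.fst) := by
    have := (((WithLp.fstL 2 ℝ _ _).comp (WithLp.sndL 2 ℝ (Lp ℝ 2 (volume : Measure (Euc m)))
      (WithLp 2 (Lp (Euc m) 2 (volume : Measure (Euc m)) ×
        Lp ℝ 2 (volume : Measure (Euc m)))))).continuous.tendsto w).comp hlim
    refine this.congr fun k => ?_
    simp only [Function.comp_apply, ← hφv]; rfl
  have l3 : Tendsto (fun k => ((hφ k).good.mul hD (continuous_potential c)).mem.toLp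
      (fun x => c * ‖x‖ * φ k x)) atTop (nhds w.snd.snd) := by
    have := (((WithLp.sndL 2 ℝ _ _).comp (WithLp.sndL 2 ℝ (Lp ℝ 2 (volume : Measure (Euc m)))
      (WithLp 2 (Lp (Euc m) 2 (volume : Measure (Euc m)) ×
        Lp ℝ 2 (volume : Measure (Euc m)))))).continuous.tendsto w).comp hlim
    refine this.congr fun k => ?_
    simp only [Function.comp_apply, ← hφv]; rfl
  have L1 := L2Lim.of_tendsto _ l1
  have L2' := L2Lim.of_tendsto _ l2
  have L3 := L2Lim.of_tendsto _ l3
  have M1 := L1.indicator hDm fun k => (hφ k).good.zero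
  have M2 := L2'.indicator hDm fun k => (hφ k).good_gradient.zero
  have H : H10 D (D.indicator w.fst) (D.indicator w.snd.fst) :=
    ⟨fun x hx => indicator_of_notMem hx _, fun x hx => indicator_of_notMem hx _, φ, hφ, M1, M2⟩
  have M3 := M1.smul_cont hD (fun k => (hφ k).good.zero) H.good.zero (continuous_potential c)
  refine ⟨_, _, H, ?_⟩
  have e1 := M1.toLp_eq L1
  have e2 := M2.toLp_eq L2'
  have e3 := L2Lim.toLp_eq M3 L3
  rw [Lp.toLp_coeFn] at e1 e2 e3
  refine energyAmb_ext ?_ ?_ ?_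
  · exact e1.symm
  · exact e2.symm
  · exact e3.symm

end Eigenbasis

section Eigenbasis

variable {m : ℕ} {D : Set (Euc m)}

/-- The energy space. -/
noncomputable abbrev energySpace (hD : Bornology.IsBounded D) (c : ℝ) : Submodule ℝ (EnergyAmb m) :=
  (testEnergy hD c).topologicalClosure

instance (hD : Bornology.IsBounded D) (c : ℝ) : CompleteSpace (energySpace hD c) :=
  (testEnergy hD c).isClosed_topologicalClosure.completeSpace_coe

/-- The inclusion of the energy space into `L²`. -/
noncomputable def energyIncl (hD : Bornology.IsBounded D) (c : ℝ) :
    energySpace hD c →L[ℝ] Lp ℝ 2 (volume : Measure (Euc m)) :=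
  (WithLp.fstL 2 ℝ (Lp ℝ 2 (volume : Measure (Euc m))) (WithLp 2
      (Lp (Euc m) 2 (volume : Measure (Euc m)) × Lp ℝ 2 (volume : Measure (Euc m))))).comp
    (energySpace hD c).subtypeL

theorem norm_sq_energyVec (hD : Bornology.IsBounded D) (c : ℝ) {φ : Euc m → ℝ} (h : IsTest D φ) :
    ∫ x, ‖gradient φ x‖ ^ 2 ≤ ‖h.energyVec hD c‖ ^ 2 := by
  have h1 : ‖h.good_gradient.mem.toLp (gradient φ)‖ ^ 2 = ∫ x, ‖gradient φ x‖ ^ 2 := by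
    rw [← real_inner_self_eq_norm_sq, inner_toLp]
    simp only [real_inner_self_eq_norm_sq]
  rw [WithLp.prod_norm_sq_eq_of_L2, WithLp.prod_norm_sq_eq_of_L2, ← h1]
  have : (h.energyVec hD c).snd.fst = h.good_gradient.mem.toLp (gradient φ) := rfl
  rw [this]
  nlinarith [sq_nonneg ‖(h.energyVec hD c).fst‖, sq_nonneg ‖(h.energyVec hD c).snd.snd‖]

/-- An operator which is a limit of compact perturbations of itself is compact. -/
theorem isCompactOperator_of_norm_sub_comp_le {K H : Type} [NormedAddCommGroup K]
    [NormedSpace ℝ K] [NormedAddCommGroup H] [NormedSpace ℝ H] [CompleteSpace H] (J : K →L[ℝ] H)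
    {S : ℕ → H →L[ℝ] H} (hS : ∀ n, IsCompactOperator (S n)) {b : ℕ → ℝ} (hb : ∀ n, 0 ≤ b n)
    (hlim : Tendsto b atTop (nhds 0)) (h : ∀ n w, ‖J w - S n (J w)‖ ≤ b n * ‖w‖) :
    IsCompactOperator J := by
  refine isCompactOperator_of_tendsto (F := fun n => (S n).comp J) (l := atTop) ?_
    (Eventually.of_forall fun n => (hS n).comp_clm _)
  rw [tendsto_iff_norm_sub_tendsto_zero]
  refine squeeze_zero (fun n => norm_nonneg _) (fun n => ?_) hlim
  rw [norm_sub_rev]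
  exact ContinuousLinearMap.opNorm_le_bound _ (hb n) (h n)

theorem isCompactOperator_energyIncl (hD : Bornology.IsBounded D) (hDm : MeasurableSet D) (c : ℝ) :
    IsCompactOperator (energyIncl hD c) := by
  have hpos : ∀ n : ℕ, (0 : ℝ) < 1 / (n + 1) := fun n => Nat.one_div_pos_of_nat
  choose S hSc hS using fun n : ℕ => exists_compact_approx hD hDm (hpos n)
  have hlim : Tendsto (fun n : ℕ => Real.sqrt (2 ^ m) * (2 * (1 / ((n : ℝ) + 1)))) atTop
      (nhds 0) := by
    have := (tendsto_one_div_add_atTop_nhds_zero_nat (𝕜 := ℝ)).const_mul (Real.sqrt (2 ^ m) * 2)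
    simpa [mul_assoc] using this
  have hb : ∀ n, ∀ w : energySpace hD c, ‖energyIncl hD c w - S n (energyIncl hD c w)‖
      ≤ Real.sqrt (2 ^ m) * (2 * (1 / ((n : ℝ) + 1))) * ‖w‖ := by
    intro n
    rintro ⟨w, hw⟩
    have hcl : IsClosed {w : EnergyAmb m | ‖w.fst - S n w.fst‖
        ≤ Real.sqrt (2 ^ m) * (2 * (1 / ((n : ℝ) + 1))) * ‖w‖} := by
      have hf : Continuous fun w : EnergyAmb m => w.fst :=
        (WithLp.fstL 2 ℝ (Lp ℝ 2 (volume : Measure (Euc m))) (WithLp 2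
      (Lp (Euc m) 2 (volume : Measure (Euc m)) × Lp ℝ 2 (volume : Measure (Euc m))))).continuous
      exact isClosed_le ((hf.sub ((S n).continuous.comp hf)).norm) (by fun_prop)
    have hsub : (testEnergy hD c : Set (EnergyAmb m)) ⊆ {w : EnergyAmb m | ‖w.fst - S n w.fst‖
        ≤ Real.sqrt (2 ^ m) * (2 * (1 / ((n : ℝ) + 1))) * ‖w‖} := by
      rintro _ ⟨φ, h, rfl⟩
      have h1 := (hS n φ h).trans (mul_le_mul_of_nonneg_left (norm_sq_energyVec hD c h)
        (by positivity))
      refine (sq_le_sq₀ (norm_nonneg _) (by positivity)).1 ?_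
      refine h1.trans (le_of_eq ?_)
      rw [mul_pow _ ‖_‖, mul_pow (Real.sqrt _), Real.sq_sqrt (by positivity)]
    exact closure_minimal hsub hcl hw
  exact isCompactOperator_of_norm_sub_comp_le _ hSc (fun n => by positivity) hlim hb

/-- Eigenvectors of `J ∘ J*` for a compact operator `J`. -/
theorem exists_eigenvectors_comp_adjoint {K H : Type} [NormedAddCommGroup K]
    [InnerProductSpace ℝ K] [CompleteSpace K] [NormedAddCommGroup H] [InnerProductSpace ℝ H]
    [CompleteSpace H] (J : K →L[ℝ] H) (hJ : IsCompactOperator J) :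
    ∃ (A : H → K) (ι : Type) (b : ι → H) (κ : ι → ℝ),
      (∀ x y, inner ℝ (A x) y = inner ℝ x (J y)) ∧ Orthonormal ℝ b ∧
      (Submodule.span ℝ (Set.range b))ᗮ = ⊥ ∧ ∀ j, J (A (b j)) = κ j • b j := by
  have hTc : IsCompactOperator (J.comp (ContinuousLinearMap.adjoint J)) := hJ.comp_clm _
  have hTs : (J.comp (ContinuousLinearMap.adjoint J)).IsSymmetric := by
    intro x y
    change inner ℝ (J (ContinuousLinearMap.adjoint J x)) y
      = inner ℝ x (J (ContinuousLinearMap.adjoint J y))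
    rw [← ContinuousLinearMap.adjoint_inner_right, ContinuousLinearMap.adjoint_inner_left]
  obtain ⟨ι, b, κ, hb, hbot, hbe⟩ := exists_orthonormal_eigenvectors hTc hTs
  exact ⟨ContinuousLinearMap.adjoint J, ι, b, κ,
    fun x y => ContinuousLinearMap.adjoint_inner_left J y x, hb, hbot, hbe⟩

set_option maxHeartbeats 1000000 in
theorem exists_eigenbasis (hD : Bornology.IsBounded D) (ho : IsOpen D) (c : ℝ) :
    ∃ (ι : Type) (_ : Countable ι) (e : ι → Euc m → ℝ) (g : ι → Euc m → Euc m) (l : ι → ℝ),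
      (∀ j, 0 ≤ l j) ∧ (∀ j, IsWeak D c (e j) (g j) (fun x => l j * e j x)) ∧
      (∀ i j, i ≠ j → ∫ x, e i x * e j x = 0) ∧ (∀ j, ∫ x, e j x ^ 2 = 1) ∧
      ∀ f, Good D f → HasSum (fun j => (∫ x, f x * e j x) ^ 2) (∫ x, f x ^ 2) := by
  have hDm := ho.measurableSet
  set J := energyIncl hD c with hJ
  obtain ⟨A, ι, b, κ, hadj, hb, hbot, hbe'⟩ :=
    exists_eigenvectors_comp_adjoint (K := energySpace hD c)
      (H := Lp ℝ 2 (volume : Measure (Euc m))) J (isCompactOperator_energyIncl hD hDm c)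
  have hfact : Fact ((2 : ENNReal) ≠ ⊤) := ⟨by norm_num⟩
  have hct : Countable ι := hb.countable_index
  have hvec : ∀ φ (h : IsTest D φ), ∃ w : energySpace hD c, (w : EnergyAmb m) = h.energyVec hD c :=
    fun φ h => ⟨⟨_, subset_closure ⟨φ, h, rfl⟩⟩, rfl⟩
  have hpair : ∀ φ (h : IsTest D φ) (w : energySpace hD c), (w : EnergyAmb m) = h.energyVec hD c →
      ∀ j, inner ℝ (A (b j)) w = inner ℝ (b j) (h.good.mem.toLp φ) := by
    intro φ h w hw j
    rw [hadj]
    congr 1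
    change (w : EnergyAmb m).fst = _
    rw [hw]; rfl
  have hzero : ∀ j, κ j = 0 → ∀ f (hf : Good D f), inner ℝ (hf.mem.toLp f) (b j) = 0 := by
    intro j hj f hf
    have hAz : A (b j) = 0 := by
      have h1 : inner ℝ (A (b j)) (A (b j)) = (0 : ℝ) := by
        rw [hadj, hbe', hj, zero_smul, inner_zero_right]
      exact inner_self_eq_zero.1 h1
    have hloc : LocallyIntegrableOn (b j) D volume :=
      ((Lp.memLp (b j)).locallyIntegrable (by norm_num)).locallyIntegrableOn D
    have hae := ho.ae_eq_zero_of_integral_contDiff_smul_eq_zero hloc fun φ h1 h2 h3 => by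
      have hφ : IsTest D φ := ⟨h1, h2, h3⟩
      obtain ⟨w, hw⟩ := hvec φ hφ
      have h4 := hpair φ hφ w hw j
      rw [hAz, inner_zero_left, L2.inner_def] at h4
      rw [h4]
      refine integral_congr_ae ?_
      filter_upwards [hφ.good.mem.coeFn_toLp] with x hx
      rw [hx]; simp
    rw [L2.inner_def]
    refine integral_eq_zero_of_ae ?_
    filter_upwards [hf.mem.coeFn_toLp, hae] with x hx hx2
    rw [hx]
    by_cases hxD : x ∈ D
    · rw [hx2 hxD]; simp
    · rw [hf.zero x hxD]; simp
  have hex : ∀ j : {j // κ j ≠ 0}, ∃ (u : Euc m → ℝ) (g : Euc m → Euc m) (l : ℝ) (hg : Good D u),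
      0 ≤ l ∧ IsWeak D c u g (fun x => l * u x) ∧ hg.mem.toLp u = b j := by
    rintro ⟨j, hj⟩
    obtain ⟨u, g, H, hw⟩ := exists_h10_of_mem_closure hD hDm (A (b j)).2
    have hu : H.good.mem.toLp u = κ j • b j := by
      rw [← hbe' j]
      change _ = (A (b j) : EnergyAmb m).fst
      rw [hw]; rfl
    have H' := H.const_mul (κ j)⁻¹
    have hu' : H'.good.mem.toLp (fun x => (κ j)⁻¹ * u x) = b j := by
      have : H'.good.mem.toLp (fun x => (κ j)⁻¹ * u x) = (κ j)⁻¹ • H.good.mem.toLp u := rfl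
      rw [this, hu, smul_smul, inv_mul_cancel₀ hj, one_smul]
    have hW : IsWeak D c (fun x => (κ j)⁻¹ * u x) (fun x => (κ j)⁻¹ • g x)
        (fun x => ((κ j)⁻¹ - 1) * ((κ j)⁻¹ * u x)) := by
      refine ⟨H', by simpa using H'.good.const_smul ((κ j)⁻¹ - 1), fun φ hφ => ?_⟩
      obtain ⟨w, hw2⟩ := hvec φ hφ
      have h4 := hpair φ hφ w hw2 j
      rw [Submodule.coe_inner, hw, hw2, WithLp.prod_inner_apply, WithLp.prod_inner_apply,
        ← hu', inner_toLp] at h4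
      simp only [IsTest.energyVec, inner_toLp, RCLike.inner_apply, conj_trivial] at h4
      have e1 : ∫ x, inner ℝ ((κ j)⁻¹ • g x) (gradient φ x)
          = (κ j)⁻¹ * ∫ x, inner ℝ (g x) (gradient φ x) := by
        rw [← integral_const_mul]
        exact integral_congr_ae (ae_of_all _ fun x => real_inner_smul_left _ _ _)
      have e2 : ∫ x, (κ j)⁻¹ * u x * φ x * (c ^ 2 * ‖x‖ ^ 2)
          = (κ j)⁻¹ * ∫ x, c * ‖x‖ * φ x * (c * ‖x‖ * u x) := by
        rw [← integral_const_mul]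
        exact integral_congr_ae (ae_of_all _ fun x => by ring)
      have e3 : ∫ x, ((κ j)⁻¹ - 1) * ((κ j)⁻¹ * u x) * φ x
          = ((κ j)⁻¹ - 1) * (κ j)⁻¹ * ∫ x, φ x * u x := by
        rw [← integral_const_mul]
        exact integral_congr_ae (ae_of_all _ fun x => by ring)
      have e4 : ∫ x, φ x * ((κ j)⁻¹ * u x) = (κ j)⁻¹ * ∫ x, φ x * u x := by
        rw [← integral_const_mul]
        exact integral_congr_ae (ae_of_all _ fun x => by ring)
      rw [e4] at h4
      rw [e1, e2, e3]
      linear_combination (κ j)⁻¹ * h4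
    refine ⟨_, _, _, H'.good, ?_, hW, hu'⟩
    have := hW.energy hD
    have hn : ∫ x, ((κ j)⁻¹ * u x) ^ 2 = 1 := by
      have h1 := real_inner_self_eq_norm_sq (b j)
      rw [hb.1, ← hu', inner_toLp] at h1
      simpa only [RCLike.inner_apply, conj_trivial, sq, one_mul, mul_one] using h1
    have e1 : ∫ x, ((κ j)⁻¹ - 1) * ((κ j)⁻¹ * u x) * ((κ j)⁻¹ * u x) = (κ j)⁻¹ - 1 := by
      have : ((κ j)⁻¹ - 1) * ∫ x, ((κ j)⁻¹ * u x) ^ 2 = (κ j)⁻¹ - 1 := by rw [hn, mul_one]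
      refine Eq.trans ?_ this
      rw [← integral_const_mul]
      exact integral_congr_ae (ae_of_all _ fun x => by ring)
    rw [e1] at this
    rw [this]
    have h1 : 0 ≤ ∫ x, ‖(κ j)⁻¹ • g x‖ ^ 2 := integral_nonneg fun x => by positivity
    have h2 : 0 ≤ ∫ x, ((κ j)⁻¹ * u x) ^ 2 * ‖x‖ ^ 2 := integral_nonneg fun x => by positivity
    positivity
  choose u g l hg hl hW hu using hex
  refine ⟨{j // κ j ≠ 0}, inferInstance, u, g, l, hl, hW, ?_, ?_, ?_⟩
  · intro i j hij
    have : inner ℝ (b i) (b j) = (0 : ℝ) := hb.2 (fun h => hij (Subtype.ext h) : (i : ι) ≠ j)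
    rw [← hu, ← hu, inner_toLp] at this
    simpa [mul_comm] using this
  · intro j
    have := real_inner_self_eq_norm_sq (b j)
    rw [hb.1, ← hu, inner_toLp] at this
    simpa [sq] using this
  · intro f hf
    set B := HilbertBasis.mkOfOrthogonalEqBot hb hbot with hB
    have hs := B.hasSum_inner_mul_inner (hf.mem.toLp f) (hf.mem.toLp f)
    rw [inner_toLp] at hs
    have hs' : HasSum (fun i => (inner ℝ (hf.mem.toLp f) (b i)) ^ 2) (∫ x, f x ^ 2) := by
      have e1 : ∀ i, inner ℝ (hf.mem.toLp f) (B i) * inner ℝ (B i) (hf.mem.toLp f)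
          = (inner ℝ (hf.mem.toLp f) (b i)) ^ 2 := by
        intro i
        rw [hB, HilbertBasis.coe_mkOfOrthogonalEqBot, real_inner_comm (hf.mem.toLp f), sq]
      simp only [e1] at hs
      simpa [sq] using hs
    have hs2 := (hasSum_subtype_iff_of_support_subset (s := {j | κ j ≠ 0}) (f := fun i =>
      (inner ℝ (hf.mem.toLp f) (b i)) ^ 2) (by
        intro i hi
        rw [Function.mem_support] at hi
        intro h0
        exact hi (by rw [hzero i h0 f hf]; norm_num))).2 hs'
    have e2 : (fun j : {j // κ j ≠ 0} => (∫ x, f x * u j x) ^ 2)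
        = fun j : {j // κ j ≠ 0} => (inner ℝ (hf.mem.toLp f) (b j)) ^ 2 := by
      funext j
      rw [← hu j, inner_toLp]
      simp [mul_comm]
    rw [e2]
    exact hs2

end Eigenbasis

section PartialDerivatives

variable {m : ℕ} {F : Type*} [NormedAddCommGroup F] [NormedSpace ℝ F]

/-- The gradient of `W` along the range of `A`. -/
noncomputable def pgrad (A : Euc m →L[ℝ] F) (W : F → ℝ) (q : F) : Euc m :=
  (InnerProductSpace.toDual ℝ (Euc m)).symm ((fderiv ℝ W q).comp A)

/-- The Laplacian of `W` along the range of `A`. -/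
noncomputable def plap (A : Euc m →L[ℝ] F) (W : F → ℝ) (q : F) : ℝ :=
  ∑ i, fderiv ℝ (fun r => fderiv ℝ W r (A (EuclideanSpace.single i 1))) q
    (A (EuclideanSpace.single i 1))

variable {A : Euc m →L[ℝ] F} {W : F → ℝ}

theorem hasFDerivAt_section {G : F → ℝ} {q : F} {x : Euc m} (hG : DifferentiableAt ℝ G (q + A x)) :
    HasFDerivAt (fun x => G (q + A x)) ((fderiv ℝ G (q + A x)).comp A) x :=
  HasFDerivAt.comp x hG.hasFDerivAt (A.hasFDerivAt.const_add q)

theorem gradient_section (hW : Differentiable ℝ W) (q : F) (x : Euc m) :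
    gradient (fun x => W (q + A x)) x = pgrad A W (q + A x) := by
  rw [gradient, (hasFDerivAt_section (hW _)).fderiv]; rfl

theorem contDiff_directional (hW : ContDiff ℝ (⊤ : ℕ∞) W) (v : F) :
    ContDiff ℝ (⊤ : ℕ∞) (fun z => fderiv ℝ W z v) :=
  (hW.fderiv_right (m := ((⊤ : ℕ∞) : WithTop ℕ∞)) (by simp)).clm_apply contDiff_const

theorem lapl_section (hW : ContDiff ℝ (⊤ : ℕ∞) W) (q : F) (x : Euc m) :
    lapl (fun x => W (q + A x)) x = plap A W (q + A x) := by
  unfold lapl plap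
  refine Finset.sum_congr rfl fun i _ => ?_
  have h1 : (fun z => fderiv ℝ (fun x => W (q + A x)) z (EuclideanSpace.single i 1))
      = fun z => (fun r => fderiv ℝ W r (A (EuclideanSpace.single i 1))) (q + A z) := by
    funext z
    rw [(hasFDerivAt_section ((hW.differentiable (by simp)) _)).fderiv]; rfl
  rw [h1, (hasFDerivAt_section (((contDiff_directional hW _).differentiable (by simp)) _)).fderiv]
  rfl

theorem continuous_pgrad (hW : ContDiff ℝ (⊤ : ℕ∞) W) : Continuous (pgrad A W) :=
  (InnerProductSpace.toDual ℝ (Euc m)).symm.continuous.comp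
    ((hW.continuous_fderiv (by simp)).clm_comp continuous_const)

theorem continuous_plap (hW : ContDiff ℝ (⊤ : ℕ∞) W) : Continuous (plap A W) :=
  continuous_finsetSum _ fun _ _ =>
    (contDiff_directional (contDiff_directional hW _) _).continuous

theorem pgrad_eq_zero {q : F} (hq : q ∉ tsupport W) : pgrad A W q = 0 := by
  have : fderiv ℝ W q = 0 := by
    by_contra h
    exact hq (support_fderiv_subset ℝ h)
  simp [pgrad, this]

theorem pgrad_comp {θ : ℝ → ℝ} (hθ : Differentiable ℝ θ) (hW : Differentiable ℝ W) (q : F) :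
    pgrad A (fun q => θ (W q)) q = deriv θ (W q) • pgrad A W q := by
  have : fderiv ℝ (fun q => θ (W q)) q = deriv θ (W q) • fderiv ℝ W q :=
    ((hθ _).hasDerivAt.comp_hasFDerivAt q (hW q).hasFDerivAt).fderiv
  simp [pgrad, this]

theorem isClosedEmbedding_section (hA : Function.Injective A) (q : F) :
    Topology.IsClosedEmbedding fun x => q + A x :=
  (Homeomorph.addLeft q).isClosedEmbedding.comp
    (LinearMap.isClosedEmbedding_of_injective (f := A.toLinearMap) (LinearMap.ker_eq_bot.2 hA))

theorem isTest_section (hA : Function.Injective A) (hW : ContDiff ℝ (⊤ : ℕ∞) W)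
    (hc : HasCompactSupport W) (q : F) {D : Set (Euc m)}
    (hD : ∀ x, q + A x ∈ tsupport W → x ∈ D) : IsTest D fun x => W (q + A x) := by
  refine ⟨hW.comp (contDiff_const.add A.contDiff), hc.comp_isClosedEmbedding
    (isClosedEmbedding_section hA q), fun x hx => hD x ?_⟩
  exact tsupport_comp_subset_preimage W (f := fun x => q + A x) (by fun_prop) hx

end PartialDerivatives

section TimeSlices

variable {P : Type*} [NormedAddCommGroup P] [NormedSpace ℝ P]

theorem isClosedEmbedding_slice (t : ℝ) : Topology.IsClosedEmbedding fun p : P => (t, p) :=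
  ⟨isEmbedding_prodMkRight t, by
    have : range (fun p : P => (t, p)) = {t} ×ˢ univ := by
      ext ⟨a, b⟩; simp [eq_comm]
    rw [this]
    exact isClosed_singleton.prod isClosed_univ⟩

theorem hasCompactSupport_slice {G : Type*} [Zero G] {W : ℝ × P → G} (h : HasCompactSupport W)
    (t : ℝ) : HasCompactSupport fun p => W (t, p) :=
  h.comp_isClosedEmbedding (isClosedEmbedding_slice t)

variable [MeasurableSpace P] [BorelSpace P] {μ : Measure P}

/-- Weighted integrals of time slices of a continuous compactly supported function are
continuous. -/
theorem continuous_integral_slice [SecondCountableTopology P]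
    {G : Type*} [NormedAddCommGroup G] [NormedSpace ℝ G]
    {W : ℝ × P → ℝ} (hW : Continuous W) (hc : HasCompactSupport W) {f : P → G}
    (hf : Integrable f μ) : Continuous fun t => ∫ p, W (t, p) • f p ∂μ := by
  obtain ⟨C, hC⟩ := hc.exists_bound_of_continuous hW
  refine continuous_of_dominated (bound := fun p => C * ‖f p‖) (fun t => ?_)
    (fun t => ae_of_all _ fun p => ?_) (hf.norm.const_mul C) (ae_of_all _ fun p => ?_)
  · exact (hW.comp (by fun_prop)).aestronglyMeasurable.smul hf.1
  · rw [norm_smul]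
    exact mul_le_mul_of_nonneg_right (hC _) (norm_nonneg _)
  · exact (hW.comp (by fun_prop)).smul continuous_const

theorem continuous_integral_slice' [SecondCountableTopology P] [IsFiniteMeasureOnCompacts μ]
    {W : ℝ × P → ℝ} (hW : Continuous W) (hc : HasCompactSupport W) :
    Continuous fun t => ∫ p, W (t, p) ∂μ := by
  have hK : IsCompact (Prod.snd '' tsupport W) := hc.isCompact.image continuous_snd
  have h1 := continuous_integral_slice (μ := μ.restrict (Prod.snd '' tsupport W)) hW hc
    (f := fun _ => (1 : ℝ)) (by
      have : IsFiniteMeasure (μ.restrict (Prod.snd '' tsupport W)) :=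
        ⟨by simpa using hK.measure_lt_top⟩
      exact integrable_const _)
  refine h1.congr fun t => ?_
  simp only [smul_eq_mul, mul_one]
  refine setIntegral_eq_integral_of_forall_compl_eq_zero fun p hp => ?_
  by_contra h
  exact hp ⟨(t, p), subset_tsupport _ h, rfl⟩

/-- The fundamental theorem of calculus for integrals of time slices. -/
theorem integral_slice_sub [SecondCountableTopology P] [IsFiniteMeasureOnCompacts μ] [SFinite μ]
    {G : ℝ × P → ℝ} (hG : ContDiff ℝ 1 G) (hc : HasCompactSupport G) (a b : ℝ) :
    ∫ p, G (b, p) ∂μ - ∫ p, G (a, p) ∂μ = ∫ t in a..b, ∫ p, fderiv ℝ G (t, p) (1, 0) ∂μ := by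
  have hcont : Continuous fun q => fderiv ℝ G q (1, 0) :=
    (hG.continuous_fderiv one_ne_zero).clm_apply continuous_const
  have hcs : HasCompactSupport fun q => fderiv ℝ G q (1, 0) := hc.fderiv_apply ℝ (1, 0)
  rw [intervalIntegral_integral_swap, ← integral_sub]
  · refine integral_congr_ae (ae_of_all _ fun p => ?_)
    have hd : ∀ t ∈ uIcc a b, HasDerivAt (fun t => G (t, p)) (fderiv ℝ G (t, p) (1, 0)) t := by
      intro t _
      exact ((hG.differentiable one_ne_zero) (t, p)).hasFDerivAt.comp_hasDerivAt t
        ((hasDerivAt_id t).prodMk (hasDerivAt_const t p))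
    exact (intervalIntegral.integral_eq_sub_of_hasDerivAt hd
      (hcont.comp (by fun_prop)).continuousOn.intervalIntegrable).symm
  · exact (hG.continuous.comp (by fun_prop)).integrable_of_hasCompactSupport
      (hasCompactSupport_slice hc b)
  · exact (hG.continuous.comp (by fun_prop)).integrable_of_hasCompactSupport
      (hasCompactSupport_slice hc a)
  · have : Integrable (fun q => fderiv ℝ G q (1, 0)) ((volume : Measure ℝ).prod μ) :=
      hcont.integrable_of_hasCompactSupport hcs
    refine this.mono_measure ?_
    exact Measure.prod_mono Measure.restrict_le_self le_rfl

end TimeSlices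

section Truncation

theorem contDiff_primitive {k : ℝ → ℝ} (hk : ContDiff ℝ (⊤ : ℕ∞) k) :
    ContDiff ℝ (⊤ : ℕ∞) (fun r => ∫ s in (0 : ℝ)..r, k s) ∧
      deriv (fun r => ∫ s in (0 : ℝ)..r, k s) = k := by
  have hd : ∀ r, HasDerivAt (fun r => ∫ s in (0 : ℝ)..r, k s) (k r) r := fun r =>
    intervalIntegral.integral_hasDerivAt_right (hk.continuous.intervalIntegrable _ _)
      hk.continuous.stronglyMeasurable.stronglyMeasurableAtFilter hk.continuous.continuousAt
  have he : deriv (fun r => ∫ s in (0 : ℝ)..r, k s) = k := funext fun r => (hd r).deriv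
  refine ⟨?_, he⟩
  rw [contDiff_infty_iff_deriv, he]
  exact ⟨fun r => (hd r).differentiableAt, hk⟩

/-- Bounds for primitives of functions between the graphs of `0` and `s ↦ a s`. -/
theorem primitive_bounds {k h : ℝ → ℝ} (hk : Continuous k) (hh : Continuous h)
    (h0 : ∀ s, 0 ≤ s → 0 ≤ k s ∧ k s ≤ h s) (r : ℝ) (hr : 0 ≤ r) :
    0 ≤ ∫ s in (0 : ℝ)..r, k s ∧ ∫ s in (0 : ℝ)..r, k s ≤ ∫ s in (0 : ℝ)..r, h s :=
  ⟨intervalIntegral.integral_nonneg hr fun s hs => (h0 s hs.1).1,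
    intervalIntegral.integral_mono_on hr (hk.intervalIntegrable _ _) (hh.intervalIntegrable _ _)
      fun s hs => (h0 s hs.1).2⟩

/-- A smooth truncation of the identity near `0`, together with its primitive. -/
theorem exists_truncation {ε : ℝ} (hε : 0 < ε) : ∃ θ Θ : ℝ → ℝ, ContDiff ℝ (⊤ : ℕ∞) θ ∧
    ContDiff ℝ (⊤ : ℕ∞) Θ ∧ deriv Θ = θ ∧ (∀ r, |r| ≤ ε → θ r = 0) ∧
    (∀ r, |θ r - r| ≤ 4 * ε) ∧ (∀ r, 0 ≤ deriv θ r ∧ deriv θ r ≤ 1) ∧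
    ∀ r, 0 ≤ Θ r ∧ Θ r ≤ r ^ 2 / 2 := by
  let b : ContDiffBump (0 : ℝ) := ⟨ε, 2 * ε, hε, by linarith⟩
  set k : ℝ → ℝ := fun s => 1 - b s with hk
  have hks : ContDiff ℝ (⊤ : ℕ∞) k := contDiff_const.sub b.contDiff
  have hk01 : ∀ s, 0 ≤ k s ∧ k s ≤ 1 := fun s =>
    ⟨sub_nonneg.2 b.le_one, sub_le_self _ b.nonneg⟩
  obtain ⟨h1, h2⟩ := contDiff_primitive hks
  set θ : ℝ → ℝ := fun r => ∫ s in (0 : ℝ)..r, k s with hθ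
  obtain ⟨h3, h4⟩ := contDiff_primitive h1
  have hpos : ∀ r, 0 ≤ r → 0 ≤ θ r ∧ θ r ≤ r := by
    intro r hr
    have := primitive_bounds hks.continuous continuous_const (h := fun _ => 1)
      (fun s _ => hk01 s) r hr
    simpa using this
  have heven : ∀ s, k (-s) = k s := fun s => by
    simp only [hk, b.neg]
  have hodd : ∀ r, θ (-r) = - θ r := by
    intro r
    have := intervalIntegral.integral_comp_neg (a := 0) (b := r) (fun s => k s)
    simp only [heven, neg_zero] at this
    simp only [hθ]
    rw [this, intervalIntegral.integral_symm]
  refine ⟨θ, fun r => ∫ s in (0 : ℝ)..r, θ s, h1, h3, h4, ?_, ?_, ?_, ?_⟩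
  · intro r hr
    have : ∀ s ∈ uIcc 0 r, k s = 0 := by
      intro s hs
      have hs' : s ∈ closedBall (0 : ℝ) ε := by
        rw [mem_closedBall, dist_zero_right, Real.norm_eq_abs]
        have := abs_sub_left_of_mem_uIcc hs
        simp only [sub_zero] at this
        exact this.trans hr
      simp only [hk]
      rw [b.one_of_mem_closedBall hs', sub_self]
    simp only [hθ]
    rw [intervalIntegral.integral_congr (g := fun _ => 0) this]
    simp
  · intro r
    have e1 : θ r - r = - ∫ s in (0 : ℝ)..r, b s := by
      have : (∫ s in (0 : ℝ)..r, k s) + ∫ s in (0 : ℝ)..r, b s = r := by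
        rw [← intervalIntegral.integral_add (hks.continuous.intervalIntegrable _ _)
          (b.continuous.intervalIntegrable _ _)]
        simp [hk]
      simp only [hθ]; linarith
    rw [e1, abs_neg, ← Real.norm_eq_abs]
    refine intervalIntegral.norm_integral_le_integral_norm_uIoc.trans ?_
    have hbi : Integrable (fun s => ‖b s‖) := b.integrable.norm
    refine (setIntegral_le_integral hbi (ae_of_all _ fun s => norm_nonneg _)).trans ?_
    have hind : ∀ s, ‖b s‖ ≤ (ball (0 : ℝ) (2 * ε)).indicator (fun _ => (1 : ℝ)) s := by
      intro s
      by_cases hs : s ∈ ball (0 : ℝ) (2 * ε)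
      · rw [indicator_of_mem hs, Real.norm_of_nonneg b.nonneg]; exact b.le_one
      · rw [indicator_of_notMem hs, b.zero_of_le_dist (by simpa using hs)]; simp
    refine (integral_mono hbi ((integrable_indicator_iff measurableSet_ball).2
      (integrableOn_const measure_ball_lt_top.ne)) hind).trans (le_of_eq ?_)
    rw [integral_indicator measurableSet_ball]
    simp [Real.volume_ball, Measure.real, hε.le]
    ring
  · intro r
    rw [h2]; exact hk01 r
  · have hP : ∀ r, 0 ≤ r → 0 ≤ ∫ s in (0 : ℝ)..r, θ s ∧ ∫ s in (0 : ℝ)..r, θ s ≤ r ^ 2 / 2 := by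
      intro r hr
      have := primitive_bounds h1.continuous continuous_id (h := fun s => s) hpos r hr
      simpa using this
    intro r
    rcases le_total 0 r with hr | hr
    · exact hP r hr
    · have := intervalIntegral.integral_comp_neg (a := 0) (b := -r) (fun s => θ s)
      simp only [hodd, neg_zero, neg_neg] at this
      have e : ∫ s in (0 : ℝ)..r, θ s = ∫ s in (0 : ℝ)..(-r), θ s := by
        rw [intervalIntegral.integral_symm, ← this]; simp
      beta_reduce
      rw [e]
      simpa using hP (-r) (by linarith)

end Truncation

section Tensor

variable {α β : Type*} [MeasurableSpace α] [MeasurableSpace β] {μ : Measure α} {ν : Measure β}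
  [SFinite μ] [SFinite ν]
  {F G H : Type*} [NormedAddCommGroup F] [InnerProductSpace ℝ F] [NormedAddCommGroup G]
  [InnerProductSpace ℝ G] [NormedAddCommGroup H] [InnerProductSpace ℝ H]

theorem memLp_tensor {f : α → F} {g : β → G} {h : α × β → H} (hf : MemLp f 2 μ)
    (hg : MemLp g 2 ν) (hm : AEStronglyMeasurable h (μ.prod ν))
    (hle : ∀ p, ‖h p‖ ≤ ‖f p.1‖ * ‖g p.2‖) : MemLp h 2 (μ.prod ν) := by
  rw [memLp_two_iff_integrable_sq_norm hm]
  refine ((memLp_two_integrable_norm_sq hf).mul_prod (memLp_two_integrable_norm_sq hg)).mono'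
    (hm.norm.pow 2) (ae_of_all _ fun p => ?_)
  rw [norm_pow, norm_norm, ← mul_pow]
  exact pow_le_pow_left₀ (norm_nonneg _) (hle p) 2

theorem L2Lim.tendsto_norm_sub_sq {f : ℕ → α → F} {f' : α → F} (hf : L2Lim μ f f') :
    Tendsto (fun k => ∫ x, ‖f k x - f' x‖ ^ 2 ∂μ) atTop (nhds 0) := by
  have := (hf.add ((L2Lim.const hf.memLim).const_smul (-1))).tendsto_norm_sq
  simpa [sub_eq_add_neg] using this

theorem tendsto_tensor {f : ℕ → α → F} {f' : α → F} {g : ℕ → β → G} {g' : β → G}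
    (hf : L2Lim μ f f') (hg : L2Lim ν g g') {h : ℕ → α × β → H}
    (hle : ∀ k p, ‖h k p‖ ≤ ‖f k p.1 - f' p.1‖ * ‖g k p.2‖ + ‖f' p.1‖ * ‖g k p.2 - g' p.2‖) :
    Tendsto (fun k => ∫ p, ‖h k p‖ ^ 2 ∂(μ.prod ν)) atTop (nhds 0) := by
  have hlim : Tendsto (fun k => 2 * ((∫ x, ‖f k x - f' x‖ ^ 2 ∂μ) * ∫ z, ‖g k z‖ ^ 2 ∂ν)
      + 2 * ((∫ x, ‖f' x‖ ^ 2 ∂μ) * ∫ z, ‖g k z - g' z‖ ^ 2 ∂ν)) atTop (nhds 0) := by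
    have := ((hf.tendsto_norm_sub_sq.mul hg.tendsto_norm_sq).const_mul 2).add
      ((hg.tendsto_norm_sub_sq.const_mul (∫ x, ‖f' x‖ ^ 2 ∂μ)).const_mul 2)
    simpa using this
  refine squeeze_zero (fun k => integral_nonneg fun p => by positivity) (fun k => ?_) hlim
  rw [← integral_prod_mul, ← integral_prod_mul, ← integral_const_mul, ← integral_const_mul,
    ← integral_add]
  · refine integral_mono_of_nonneg (ae_of_all _ fun p => by positivity) ?_
      (ae_of_all _ fun p => ?_)
    · exact (((memLp_two_integrable_norm_sq ((hf.mem k).sub hf.memLim)).mul_prod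
        (memLp_two_integrable_norm_sq (hg.mem k))).const_mul 2).add
        (((memLp_two_integrable_norm_sq hf.memLim).mul_prod
        (memLp_two_integrable_norm_sq ((hg.mem k).sub hg.memLim))).const_mul 2)
    · have h1 := pow_le_pow_left₀ (norm_nonneg _) (hle k p) 2
      refine h1.trans ?_
      simp only
      nlinarith [sq_nonneg (‖f k p.1 - f' p.1‖ * ‖g k p.2‖ - ‖f' p.1‖ * ‖g k p.2 - g' p.2‖)]
  · exact ((memLp_two_integrable_norm_sq ((hf.mem k).sub hf.memLim)).mul_prod
        (memLp_two_integrable_norm_sq (hg.mem k))).const_mul 2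
  · exact ((memLp_two_integrable_norm_sq hf.memLim).mul_prod
        (memLp_two_integrable_norm_sq ((hg.mem k).sub hg.memLim))).const_mul 2

end Tensor

section GrushinForm

theorem memLp_tensor_smul {α β G : Type*} [MeasurableSpace α] [MeasurableSpace β]
    [NormedAddCommGroup G] [InnerProductSpace ℝ G] {μ : Measure α} {ν : Measure β} [SFinite μ]
    [SFinite ν] {f : α → ℝ} {g : β → G} (hf : MemLp f 2 μ) (hg : MemLp g 2 ν) :
    MemLp (fun p : α × β => f p.1 • g p.2) 2 (μ.prod ν) :=
  memLp_tensor hf hg (hf.1.comp_fst.smul hg.1.comp_snd) fun _ => (norm_smul _ _).le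

variable {m k : ℕ} {B : Set (Euc m)} {Ω : Set (Euc k)}

/-- Test functions on the product domain. -/
structure IsTestProd (B : Set (Euc m)) (Ω : Set (Euc k)) (w : Euc m × Euc k → ℝ) : Prop where
  contDiff : ContDiff ℝ (⊤ : ℕ∞) w
  compact : HasCompactSupport w
  sub : tsupport w ⊆ B ×ˢ Ω

/-- The gradient in the first variable. -/
noncomputable abbrev gradx (w : Euc m × Euc k → ℝ) : Euc m × Euc k → Euc m :=
  pgrad (ContinuousLinearMap.inl ℝ (Euc m) (Euc k)) w

/-- The gradient in the second variable. -/
noncomputable abbrev gradz (w : Euc m × Euc k → ℝ) : Euc m × Euc k → Euc k :=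
  pgrad (ContinuousLinearMap.inr ℝ (Euc m) (Euc k)) w

/-- The density of the Grushin bilinear form. -/
noncomputable def hform (w V : Euc m × Euc k → ℝ) (p : Euc m × Euc k) : ℝ :=
  inner ℝ (gradx w p) (gradx V p) + ‖p.1‖ ^ 2 * inner ℝ (gradz w p) (gradz V p)

/-- The Grushin operator. -/
noncomputable def hop (V : Euc m × Euc k → ℝ) (p : Euc m × Euc k) : ℝ :=
  plap (ContinuousLinearMap.inl ℝ (Euc m) (Euc k)) V p
    + ‖p.1‖ ^ 2 * plap (ContinuousLinearMap.inr ℝ (Euc m) (Euc k)) V p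

theorem inl_add_section (x : Euc m) (z : Euc k) :
    (0, z) + ContinuousLinearMap.inl ℝ (Euc m) (Euc k) x = (x, z) := by simp

theorem inr_add_section (x : Euc m) (z : Euc k) :
    (x, 0) + ContinuousLinearMap.inr ℝ (Euc m) (Euc k) z = (x, z) := by simp

theorem gradient_fst {w : Euc m × Euc k → ℝ} (hw : Differentiable ℝ w) (x : Euc m) (z : Euc k) :
    gradient (fun x => w (x, z)) x = gradx w (x, z) := by
  simpa only [inl_add_section] using
    gradient_section (A := ContinuousLinearMap.inl ℝ (Euc m) (Euc k)) hw (0, z) x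

theorem gradient_snd {w : Euc m × Euc k → ℝ} (hw : Differentiable ℝ w) (x : Euc m) (z : Euc k) :
    gradient (fun z => w (x, z)) z = gradz w (x, z) := by
  simpa only [inr_add_section] using
    gradient_section (A := ContinuousLinearMap.inr ℝ (Euc m) (Euc k)) hw (x, 0) z

theorem lapl_fst {w : Euc m × Euc k → ℝ} (hw : ContDiff ℝ (⊤ : ℕ∞) w) (x : Euc m) (z : Euc k) :
    lapl (fun x => w (x, z)) x = plap (ContinuousLinearMap.inl ℝ (Euc m) (Euc k)) w (x, z) := by
  simpa only [inl_add_section] using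
    lapl_section (A := ContinuousLinearMap.inl ℝ (Euc m) (Euc k)) hw (0, z) x

theorem lapl_snd {w : Euc m × Euc k → ℝ} (hw : ContDiff ℝ (⊤ : ℕ∞) w) (x : Euc m) (z : Euc k) :
    lapl (fun z => w (x, z)) z = plap (ContinuousLinearMap.inr ℝ (Euc m) (Euc k)) w (x, z) := by
  simpa only [inr_add_section] using
    lapl_section (A := ContinuousLinearMap.inr ℝ (Euc m) (Euc k)) hw (x, 0) z

theorem IsTestProd.fst {w : Euc m × Euc k → ℝ} (h : IsTestProd B Ω w) (z : Euc k) :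
    IsTest B fun x => w (x, z) := by
  simpa only [inl_add_section] using
    isTest_section (A := ContinuousLinearMap.inl ℝ (Euc m) (Euc k))
      LinearMap.inl_injective h.contDiff h.compact (0, z) (D := B) fun x hx => by
        rw [inl_add_section] at hx; exact (h.sub hx).1

theorem IsTestProd.snd {w : Euc m × Euc k → ℝ} (h : IsTestProd B Ω w) (x : Euc m) :
    IsTest Ω fun z => w (x, z) := by
  simpa only [inr_add_section] using
    isTest_section (A := ContinuousLinearMap.inr ℝ (Euc m) (Euc k))
      LinearMap.inr_injective h.contDiff h.compact (x, 0) (D := Ω) fun z hz => by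
        rw [inr_add_section] at hz; exact (h.sub hz).2

theorem IsTestProd.differentiable {w : Euc m × Euc k → ℝ} (h : IsTestProd B Ω w) :
    Differentiable ℝ w := h.contDiff.differentiable (by simp)

theorem IsTestProd.integrable_mul {w : Euc m × Euc k → ℝ} (h : IsTestProd B Ω w)
    {f : Euc m × Euc k → ℝ} (hf : Continuous f) : Integrable fun p => w p * f p :=
  (h.contDiff.continuous.mul hf).integrable_of_hasCompactSupport h.compact.mul_right

theorem IsTestProd.integrable_hform {w : Euc m × Euc k → ℝ} (h : IsTestProd B Ω w)
    {V : Euc m × Euc k → ℝ} (hV : ContDiff ℝ (⊤ : ℕ∞) V) : Integrable (hform w V) := by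
  refine Continuous.integrable_of_hasCompactSupport ?_ (HasCompactSupport.intro h.compact ?_)
  · exact ((continuous_pgrad h.contDiff).inner (continuous_pgrad hV)).add
      ((continuous_fst.norm.pow 2).mul
        ((continuous_pgrad h.contDiff).inner (continuous_pgrad hV)))
  · intro p hp
    simp only [hform, gradx, gradz, pgrad_eq_zero hp, inner_zero_left, mul_zero, add_zero]

theorem continuous_hop {V : Euc m × Euc k → ℝ} (hV : ContDiff ℝ (⊤ : ℕ∞) V) :
    Continuous (hop V) :=
  (continuous_plap hV).add ((continuous_fst.norm.pow 2).mul (continuous_plap hV))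

theorem hform_comm (w V : Euc m × Euc k → ℝ) : hform w V = hform V w := by
  funext p
  simp only [hform, real_inner_comm]

theorem IsTestProd.integrable_of_eq_zero {w : Euc m × Euc k → ℝ} (h : IsTestProd B Ω w)
    {f : Euc m × Euc k → ℝ} (hf : Continuous f) (h0 : ∀ p ∉ tsupport w, f p = 0) :
    Integrable f :=
  hf.integrable_of_hasCompactSupport (HasCompactSupport.intro h.compact h0)

theorem image_eq_zero_off {w : Euc m × Euc k → ℝ} {p : Euc m × Euc k} (hp : p ∉ tsupport w) :
    w p = 0 := image_eq_zero_of_notMem_tsupport hp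

/-- Green's formula for the Grushin operator. -/
theorem IsTestProd.green {w : Euc m × Euc k → ℝ} (h : IsTestProd B Ω w)
    {V : Euc m × Euc k → ℝ} (hV : ContDiff ℝ (⊤ : ℕ∞) V) :
    ∫ p, w p * hop V p = - ∫ p, hform w V p := by
  have hdV : Differentiable ℝ V := hV.differentiable (by simp)
  set fx : Euc m × Euc k → ℝ := fun p => inner ℝ (gradx w p) (gradx V p)
    + w p * plap (ContinuousLinearMap.inl ℝ (Euc m) (Euc k)) V p with hfx
  set fz : Euc m × Euc k → ℝ := fun p => ‖p.1‖ ^ 2 * (inner ℝ (gradz w p) (gradz V p)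
    + w p * plap (ContinuousLinearMap.inr ℝ (Euc m) (Euc k)) V p) with hfz
  have hix : Integrable fx := h.integrable_of_eq_zero
    (((continuous_pgrad h.contDiff).inner (continuous_pgrad hV)).add
      (h.contDiff.continuous.mul (continuous_plap hV))) fun p hp => by
        simp only [hfx, gradx, pgrad_eq_zero hp, image_eq_zero_off hp, inner_zero_left, zero_mul,
          add_zero]
  have hiz : Integrable fz := h.integrable_of_eq_zero
    ((continuous_fst.norm.pow 2).mul
      (((continuous_pgrad h.contDiff).inner (continuous_pgrad hV)).add
      (h.contDiff.continuous.mul (continuous_plap hV)))) fun p hp => by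
        simp only [hfz, gradz, pgrad_eq_zero hp, image_eq_zero_off hp, inner_zero_left, zero_mul,
          add_zero, mul_zero]
  have hx : ∫ p, fx p = 0 := by
    rw [Measure.volume_eq_prod, integral_prod_symm _ hix]
    refine integral_eq_zero_of_ae (ae_of_all _ fun z => ?_)
    have := (h.fst z).integral_green (ζ := fun x => V (x, z))
      (hV.comp (contDiff_id.prodMk contDiff_const))
    simp only [gradient_fst h.differentiable, gradient_fst hdV, lapl_fst hV] at this
    exact this
  have hz : ∫ p, fz p = 0 := by
    rw [Measure.volume_eq_prod, integral_prod _ hiz]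
    refine integral_eq_zero_of_ae (ae_of_all _ fun x => ?_)
    have := (h.snd x).integral_green (ζ := fun z => V (x, z))
      (hV.comp (contDiff_const.prodMk contDiff_id))
    simp only [gradient_snd h.differentiable, gradient_snd hdV, lapl_snd hV] at this
    simp only [hfz, integral_const_mul, this, mul_zero]; rfl
  have hsum : ∫ p, (w p * hop V p + hform w V p) = 0 := by
    rw [← add_zero (0 : ℝ)]
    nth_rewrite 1 [← hx]
    rw [← hz, ← integral_add hix hiz]
    refine integral_congr_ae (ae_of_all _ fun p => ?_)
    simp only [hop, hform, hfx, hfz]; ring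
  rw [integral_add (h.integrable_mul (continuous_hop hV)) (h.integrable_hform hV)] at hsum
  linarith

/-- The weak equation for a tensor product of eigenfunctions. -/
theorem IsTestProd.weak_tensor (hB : Bornology.IsBounded B) {w : Euc m × Euc k → ℝ} (h : IsTestProd B Ω w) {c l : ℝ} {e : Euc m → ℝ}
    {g : Euc m → Euc m} (he : IsWeak B c e g fun x => l * e x) {φ : Euc k → ℝ} {γ : Euc k → Euc k}
    (hφ : IsWeak Ω 0 φ γ fun z => c ^ 2 * φ z) :
    ∫ p : Euc m × Euc k, (inner ℝ (φ p.2 • g p.1) (gradx w p)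
        + ‖p.1‖ ^ 2 * inner ℝ (e p.1 • γ p.2) (gradz w p))
      = l * ∫ p : Euc m × Euc k, w p * (e p.1 * φ p.2) := by
  have hE := he.h10.good
  have hG := he.h10.good_grad
  have hΦ := hφ.h10.good
  have hΓ := hφ.h10.good_grad
  have hwm : MemLp w 2 (volume.prod volume) :=
    h.contDiff.continuous.memLp_of_hasCompactSupport h.compact
  have hgx : MemLp (gradx w) 2 (volume.prod volume) :=
    (continuous_pgrad h.contDiff).memLp_of_hasCompactSupport
      (HasCompactSupport.intro h.compact fun p hp => pgrad_eq_zero hp)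
  have hgz : MemLp (gradz w) 2 (volume.prod volume) :=
    (continuous_pgrad h.contDiff).memLp_of_hasCompactSupport
      (HasCompactSupport.intro h.compact fun p hp => pgrad_eq_zero hp)
  have m1 : MemLp (fun p : Euc m × Euc k => φ p.2 • g p.1) 2 (volume.prod volume) :=
    memLp_tensor hG.mem hΦ.mem (hΦ.mem.1.comp_snd.smul hG.mem.1.comp_fst) fun p => by
      rw [norm_smul, mul_comm]
  have hE2 := hE.mul hB (b := fun x : Euc m => ‖x‖ ^ 2) (by fun_prop)
  have m2 : MemLp (fun p : Euc m × Euc k => (‖p.1‖ ^ 2 * e p.1) • γ p.2) 2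
      (volume.prod volume) := memLp_tensor_smul hE2.mem hΓ.mem
  have m3 : MemLp (fun p : Euc m × Euc k => (‖p.1‖ ^ 2 * e p.1) * φ p.2) 2
      (volume.prod volume) := memLp_tensor_smul hE2.mem hΦ.mem
  have m4 : MemLp (fun p : Euc m × Euc k => e p.1 * φ p.2) 2 (volume.prod volume) :=
    memLp_tensor_smul hE.mem hΦ.mem
  have i1 := memLp_two_integrable_inner m1 hgx
  have i2 := memLp_two_integrable_inner m2 hgz
  have i3 := memLp_two_integrable_mul hwm m3
  have i4 := memLp_two_integrable_mul hwm m4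
  have e1 : ∫ p : Euc m × Euc k, inner ℝ (φ p.2 • g p.1) (gradx w p)
      = l * (∫ p : Euc m × Euc k, w p * (e p.1 * φ p.2))
        - c ^ 2 * ∫ p : Euc m × Euc k, w p * (‖p.1‖ ^ 2 * e p.1 * φ p.2) := by
    rw [Measure.volume_eq_prod, integral_prod_symm _ i1, integral_prod_symm _ i3,
      integral_prod_symm _ i4, ← integral_const_mul, ← integral_const_mul, ← integral_sub]
    · refine integral_congr_ae (ae_of_all _ fun z => ?_)
      have hw := he.weak _ (h.fst z)
      simp only [gradient_fst h.differentiable] at hw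
      have a1 : ∫ x, inner ℝ (φ z • g x) (gradx w (x, z))
          = φ z * ∫ x, inner ℝ (g x) (gradx w (x, z)) := by
        rw [← integral_const_mul]
        exact integral_congr_ae (ae_of_all _ fun x => real_inner_smul_left _ _ _)
      have a2 : ∫ x, w (x, z) * (e x * φ z) = φ z * ∫ x, e x * w (x, z) := by
        rw [← integral_const_mul]
        exact integral_congr_ae (ae_of_all _ fun x => by ring)
      have a3 : c ^ 2 * ∫ x, w (x, z) * (‖x‖ ^ 2 * e x * φ z)
          = φ z * ∫ x, e x * w (x, z) * (c ^ 2 * ‖x‖ ^ 2) := by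
        rw [← integral_const_mul, ← integral_const_mul]
        exact integral_congr_ae (ae_of_all _ fun x => by ring)
      have a4 : ∫ x, l * e x * w (x, z) = l * ∫ x, e x * w (x, z) := by
        rw [← integral_const_mul]
        exact integral_congr_ae (ae_of_all _ fun x => by ring)
      rw [a4] at hw
      simp only
      rw [a1, a2, a3]
      linear_combination φ z * hw
    · exact i4.integral_prod_right.const_mul _
    · exact i3.integral_prod_right.const_mul _
  have e2 : ∫ p : Euc m × Euc k, inner ℝ ((‖p.1‖ ^ 2 * e p.1) • γ p.2) (gradz w p)
      = c ^ 2 * ∫ p : Euc m × Euc k, w p * (‖p.1‖ ^ 2 * e p.1 * φ p.2) := by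
    rw [Measure.volume_eq_prod, integral_prod _ i2, integral_prod _ i3, ← integral_const_mul]
    refine integral_congr_ae (ae_of_all _ fun x => ?_)
    have hw := hφ.weak _ (h.snd x)
    simp only [gradient_snd h.differentiable] at hw
    have a1 : ∫ z, inner ℝ ((‖x‖ ^ 2 * e x) • γ z) (gradz w (x, z))
        = (‖x‖ ^ 2 * e x) * ∫ z, inner ℝ (γ z) (gradz w (x, z)) := by
      rw [← integral_const_mul]
      exact integral_congr_ae (ae_of_all _ fun z => real_inner_smul_left _ _ _)
    have a2 : c ^ 2 * ∫ z, w (x, z) * (‖x‖ ^ 2 * e x * φ z)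
        = (‖x‖ ^ 2 * e x) * ∫ z, c ^ 2 * φ z * w (x, z) := by
      rw [← integral_const_mul, ← integral_const_mul]
      exact integral_congr_ae (ae_of_all _ fun z => by ring)
    simp only
    rw [a1, a2, ← hw]
    simp
  have e3 : ∀ p : Euc m × Euc k, ‖p.1‖ ^ 2 * inner ℝ (e p.1 • γ p.2) (gradz w p)
      = inner ℝ ((‖p.1‖ ^ 2 * e p.1) • γ p.2) (gradz w p) := fun p => by
    rw [real_inner_smul_left, real_inner_smul_left, mul_assoc]
  simp only [e3]
  rw [Measure.volume_eq_prod] at e1 e2 ⊢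
  rw [integral_add i1 i2, e1, e2]
  ring

end GrushinForm

section GrushinDuality

variable {m k : ℕ} {B : Set (Euc m)} {Ω : Set (Euc k)}

/-- The squared energy distance between `e ⊗ φ` and `V`. -/
noncomputable def tensorDist (e : Euc m → ℝ) (g : Euc m → Euc m) (φ : Euc k → ℝ)
    (γ : Euc k → Euc k) (V : Euc m × Euc k → ℝ) : ℝ :=
  (∫ p : Euc m × Euc k, ‖φ p.2 • g p.1 - gradx V p‖ ^ 2)
    + ∫ p : Euc m × Euc k, ‖(‖p.1‖ * e p.1) • γ p.2 - ‖p.1‖ • gradz V p‖ ^ 2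

theorem IsTestProd.memLp_pgrad {n : ℕ} {A : Euc n →L[ℝ] Euc m × Euc k} {V : Euc m × Euc k → ℝ}
    (h : IsTestProd B Ω V) {b : Euc m × Euc k → ℝ} (hb : Continuous b) :
    MemLp (fun p => b p • pgrad A V p) 2 (volume.prod volume) :=
  (hb.smul (continuous_pgrad h.contDiff)).memLp_of_hasCompactSupport
    (HasCompactSupport.intro h.compact fun p hp => by
      change b p • pgrad A V p = 0
      rw [pgrad_eq_zero hp, smul_zero])

theorem abs_inner_le_half {E : Type*} [NormedAddCommGroup E] [InnerProductSpace ℝ E] {κ : ℝ}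
    (hκ : 0 < κ) (a b : E) :
    |inner ℝ a b| ≤ (2 * κ)⁻¹ * ‖a‖ ^ 2 + κ / 2 * ‖b‖ ^ 2 := by
  have h1 := abs_real_inner_le_norm a b
  have h2 : (2 * κ)⁻¹ * ‖a‖ ^ 2 + κ / 2 * ‖b‖ ^ 2 - ‖a‖ * ‖b‖
      = (2 * κ)⁻¹ * (‖a‖ - κ * ‖b‖) ^ 2 := by
    field_simp; ring
  have h3 : 0 ≤ (2 * κ)⁻¹ * (‖a‖ - κ * ‖b‖) ^ 2 := by positivity
  linarith

theorem IsTestProd.abs_pairing_le (hB : Bornology.IsBounded B) {w V : Euc m × Euc k → ℝ}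
    (h : IsTestProd B Ω w) (hV : IsTestProd B Ω V) {c l : ℝ} {e : Euc m → ℝ}
    {g : Euc m → Euc m} (he : IsWeak B c e g fun x => l * e x) {φ : Euc k → ℝ} {γ : Euc k → Euc k}
    (hφ : IsWeak Ω 0 φ γ fun z => c ^ 2 * φ z) {κ : ℝ} (hκ : 0 < κ) :
    |(∫ p, w p * hop V p) + l * ∫ p : Euc m × Euc k, w p * (e p.1 * φ p.2)|
      ≤ (2 * κ)⁻¹ * tensorDist e g φ γ V + κ / 2 * ∫ p, hform w w p := by
  have hG := he.h10.good_grad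
  have hΦ := hφ.h10.good
  have m1 : MemLp (fun p : Euc m × Euc k => φ p.2 • g p.1) 2 (volume.prod volume) :=
    memLp_tensor hG.mem hΦ.mem (hΦ.mem.1.comp_snd.smul hG.mem.1.comp_fst) fun p => by
      rw [norm_smul, mul_comm]
  have m2 : MemLp (fun p : Euc m × Euc k => (‖p.1‖ * e p.1) • γ p.2) 2 (volume.prod volume) :=
    memLp_tensor_smul (he.h10.good.mul hB (b := fun x : Euc m => ‖x‖) (by fun_prop)).mem
      hφ.h10.good_grad.mem
  have hn : Continuous fun p : Euc m × Euc k => ‖p.1‖ := by fun_prop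
  have w1 : MemLp (gradx w) 2 (volume.prod volume) := by
    simpa using h.memLp_pgrad (b := fun _ => 1) continuous_const
  have v1 : MemLp (gradx V) 2 (volume.prod volume) := by
    simpa using hV.memLp_pgrad (b := fun _ => 1) continuous_const
  have w2 := h.memLp_pgrad (A := ContinuousLinearMap.inr ℝ (Euc m) (Euc k)) hn
  have v2 := hV.memLp_pgrad (A := ContinuousLinearMap.inr ℝ (Euc m) (Euc k)) hn
  have hww : ∀ p, hform w w p = ‖gradx w p‖ ^ 2 + ‖‖p.1‖ • gradz w p‖ ^ 2 := fun p => by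
    rw [hform, real_inner_self_eq_norm_sq, real_inner_self_eq_norm_sq, norm_smul, norm_norm,
      mul_pow]
  have n1 := memLp_two_integrable_norm_sq (m1.sub v1)
  have n2 := memLp_two_integrable_norm_sq (m2.sub v2)
  simp only [Pi.sub_apply] at n1 n2
  have hI : Integrable (hform w w) (volume.prod volume) := h.integrable_hform h.contDiff
  have e1 : (∫ p, w p * hop V p) + l * ∫ p : Euc m × Euc k, w p * (e p.1 * φ p.2)
      = ∫ p : Euc m × Euc k, (inner ℝ (φ p.2 • g p.1 - gradx V p) (gradx w p)
        + inner ℝ ((‖p.1‖ * e p.1) • γ p.2 - ‖p.1‖ • gradz V p) (‖p.1‖ • gradz w p)) := by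
    rw [h.green hV.contDiff, ← h.weak_tensor hB he hφ, ← integral_neg, ← integral_add]
    · refine integral_congr_ae (ae_of_all _ fun p => ?_)
      simp only [hform, inner_sub_left, real_inner_smul_left, real_inner_smul_right,
        real_inner_comm (gradx w p) (gradx V p), real_inner_comm (gradz w p) (gradz V p)]
      ring
    · exact (h.integrable_hform hV.contDiff).neg
    · refine ((memLp_two_integrable_inner m1 w1).add (memLp_two_integrable_inner m2 w2)).congr
        (ae_of_all _ fun p => ?_)
      simp only [Pi.add_apply, real_inner_smul_left, real_inner_smul_right]
      ring
  have hb : Integrable (fun p : Euc m × Euc k => (2 * κ)⁻¹ * (‖φ p.2 • g p.1 - gradx V p‖ ^ 2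
      + ‖(‖p.1‖ * e p.1) • γ p.2 - ‖p.1‖ • gradz V p‖ ^ 2) + κ / 2 * hform w w p)
      (volume.prod volume) := ((n1.add n2).const_mul _).add (hI.const_mul _)
  rw [e1, ← Real.norm_eq_abs]
  refine (norm_integral_le_of_norm_le hb (ae_of_all _ fun p => ?_)).trans_eq ?_
  · refine (abs_add_le _ _).trans ?_
    have h1 := abs_inner_le_half hκ (φ p.2 • g p.1 - gradx V p) (gradx w p)
    have h2 := abs_inner_le_half hκ ((‖p.1‖ * e p.1) • γ p.2 - ‖p.1‖ • gradz V p)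
      (‖p.1‖ • gradz w p)
    rw [hww]
    linarith
  · rw [tensorDist, Measure.volume_eq_prod, ← integral_add n1 n2, ← integral_const_mul,
      ← integral_const_mul]
    exact integral_add ((n1.add n2).const_mul _) (hI.const_mul _)

/-- Truncations of smooth functions are controlled by the Grushin form. -/
theorem IsTestProd.integral_hform_comp_le {u : Euc m × Euc k → ℝ} (hu : ContDiff ℝ (⊤ : ℕ∞) u)
    {θ : ℝ → ℝ} (hθ : ContDiff ℝ (⊤ : ℕ∞) θ) (hθ' : ∀ r, 0 ≤ deriv θ r ∧ deriv θ r ≤ 1)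
    (h : IsTestProd B Ω fun p => θ (u p)) :
    ∫ p, hform (fun p => θ (u p)) (fun p => θ (u p)) p ≤ - ∫ p, θ (u p) * hop u p := by
  rw [h.green hu, neg_neg]
  refine integral_mono (h.integrable_hform h.contDiff) (h.integrable_hform hu) fun p => ?_
  have hd := hθ.differentiable (by simp)
  have hd' := hu.differentiable (by simp)
  simp only [hform, gradx, gradz, pgrad_comp hd hd', real_inner_smul_left,
    real_inner_self_eq_norm_sq, norm_smul, mul_pow, Real.norm_eq_abs, sq_abs]
  obtain ⟨h0, h1⟩ := hθ' (u p)
  set s := deriv θ (u p)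
  have h2 : s * s ≤ s := by nlinarith
  have h3 := mul_le_mul_of_nonneg_right h2 (sq_nonneg ‖pgrad (ContinuousLinearMap.inl ℝ (Euc m) (Euc k)) u p‖)
  have h4 := mul_le_mul_of_nonneg_right h2 (mul_nonneg (sq_nonneg ‖p.1‖)
    (sq_nonneg ‖pgrad (ContinuousLinearMap.inr ℝ (Euc m) (Euc k)) u p‖))
  linarith

end GrushinDuality

section GrushinSlices

variable {m k : ℕ} {B : Set (Euc m)} {Ω : Set (Euc k)}

theorem plap_eq_zero {n : ℕ} {F : Type*} [NormedAddCommGroup F] [NormedSpace ℝ F]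
    {A : Euc n →L[ℝ] F} {W : F → ℝ} {q : F} (hq : q ∉ tsupport W) : plap A W q = 0 := by
  refine Finset.sum_eq_zero fun i _ => ?_
  have : fderiv ℝ (fun r => fderiv ℝ W r (A (EuclideanSpace.single i 1))) q = 0 := by
    by_contra h
    exact hq (tsupport_fderiv_apply_subset ℝ _ (support_fderiv_subset ℝ h))
  rw [this, zero_apply]

theorem IsTestProd.integrable_hop {V : Euc m × Euc k → ℝ} (h : IsTestProd B Ω V) :
    Integrable (hop V) :=
  h.integrable_of_eq_zero (continuous_hop h.contDiff) fun p hp => by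
    simp only [hop, plap_eq_zero hp, mul_zero, add_zero]

theorem isTestProd_slice {W : ℝ × (Euc m × Euc k) → ℝ} (hW : ContDiff ℝ (⊤ : ℕ∞) W)
    (hc : HasCompactSupport W) (hsub : ∀ q ∈ tsupport W, q.2 ∈ B ×ˢ Ω) {θ : ℝ → ℝ}
    (hθ : ContDiff ℝ (⊤ : ℕ∞) θ) (h0 : θ 0 = 0) (t : ℝ) :
    IsTestProd B Ω fun p => θ (W (t, p)) :=
  ⟨hθ.comp (hW.comp (contDiff_const.prodMk contDiff_id)),
    (hasCompactSupport_slice hc t).comp_left h0, fun p hp => hsub (t, p)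
      (tsupport_comp_subset_preimage W (f := fun p : Euc m × Euc k => (t, p)) (by fun_prop)
        (tsupport_comp_subset h0 (fun p : Euc m × Euc k => W (t, p)) hp))⟩

/-- The weak formulation for truncated solutions, tested against smooth approximations of
tensor products of eigenfunctions. -/
theorem abs_slice_pairing_le (hB : Bornology.IsBounded B) {W : ℝ × (Euc m × Euc k) → ℝ}
    (hW : ContDiff ℝ (⊤ : ℕ∞) W) (hc : HasCompactSupport W)
    (hsub : ∀ q ∈ tsupport W, q.2 ∈ B ×ˢ Ω) {V : Euc m × Euc k → ℝ} (hV : IsTestProd B Ω V)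
    {c l : ℝ} {e : Euc m → ℝ} {g : Euc m → Euc m} (he : IsWeak B c e g fun x => l * e x)
    {φ : Euc k → ℝ} {γ : Euc k → Euc k} (hφ : IsWeak Ω 0 φ γ fun z => c ^ 2 * φ z)
    (hi : Integrable fun p : Euc m × Euc k => e p.1 * φ p.2) {κ ε : ℝ} (hκ : 0 < κ)
    {θ Θ : ℝ → ℝ} (hθ : ContDiff ℝ (⊤ : ℕ∞) θ) (hΘ : ContDiff ℝ (⊤ : ℕ∞) Θ) (hd : deriv Θ = θ)
    (hθε : ∀ r, |r| ≤ ε → θ r = 0) (hθr : ∀ r, |θ r - r| ≤ 4 * ε) (hε : 0 < ε)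
    (hθ' : ∀ r, 0 ≤ deriv θ r ∧ deriv θ r ≤ 1) (hΘ2 : ∀ r, 0 ≤ Θ r ∧ Θ r ≤ r ^ 2 / 2)
    {t₁ t₂ : ℝ} (ht : t₁ ≤ t₂)
    (heq : ∀ t ∈ Icc t₁ t₂, ∀ p, p ∈ tsupport V ∨ ε ≤ |W (t, p)| →
      fderiv ℝ W (t, p) (1, 0) = hop (fun p => W (t, p)) p) :
    |(∫ p, W (t₂, p) * V p) - (∫ p, W (t₁, p) * V p)
        + l * ∫ t in t₁..t₂, ∫ p : Euc m × Euc k, θ (W (t, p)) * (e p.1 * φ p.2)|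
      ≤ (t₂ - t₁) * (4 * ε * (∫ p, |hop V p|) + (2 * κ)⁻¹ * tensorDist e g φ γ V)
        + κ / 4 * ∫ p, W (t₁, p) ^ 2 := by
  have h0 : θ 0 = 0 := hθε 0 (by simpa using hε.le)
  have hΘ0 : Θ 0 = 0 := by have := hΘ2 0; linarith
  have hWs : ∀ t, ContDiff ℝ (⊤ : ℕ∞) fun p => W (t, p) := fun t =>
    hW.comp (contDiff_const.prodMk contDiff_id)
  have hWd := hW.differentiable (by simp)
  set G₁ : ℝ × (Euc m × Euc k) → ℝ := fun q => W q * V q.2 with hG₁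
  set G₂ : ℝ × (Euc m × Euc k) → ℝ := fun q => Θ (W q) with hG₂
  have hG₁s : ContDiff ℝ 1 G₁ := (hW.mul (hV.contDiff.comp contDiff_snd)).of_le (by simp)
  have hG₂s : ContDiff ℝ 1 G₂ := (hΘ.comp hW).of_le (by simp)
  have hG₁c : HasCompactSupport G₁ := hc.mul_right
  have hG₂c : HasCompactSupport G₂ := hc.comp_left hΘ0
  have d₁ : ∀ t p, fderiv ℝ G₁ (t, p) (1, 0) = fderiv ℝ W (t, p) (1, 0) * V p := fun t p => by
    have h2 : HasFDerivAt (fun q : ℝ × (Euc m × Euc k) => V q.2)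
        ((fderiv ℝ V p).comp (ContinuousLinearMap.snd ℝ ℝ _)) (t, p) :=
      HasFDerivAt.comp (t, p) (hV.differentiable p).hasFDerivAt hasFDerivAt_snd
    have := ((hWd (t, p)).hasFDerivAt.mul h2).fderiv
    change fderiv ℝ G₁ (t, p) = _ at this
    rw [this]
    simp [mul_comm]
  have d₂ : ∀ t p, fderiv ℝ G₂ (t, p) (1, 0) = θ (W (t, p)) * fderiv ℝ W (t, p) (1, 0) :=
    fun t p => by
    have := ((hΘ.differentiable (by simp) _).hasDerivAt.comp_hasFDerivAt (t, p)
      (hWd (t, p)).hasFDerivAt).fderiv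
    change fderiv ℝ G₂ (t, p) = _ at this
    rw [this, hd]
    simp
  have c₁ : Continuous fun t => ∫ p, fderiv ℝ G₁ (t, p) (1, 0) :=
    continuous_integral_slice' ((hG₁s.continuous_fderiv one_ne_zero).clm_apply continuous_const)
      (hG₁c.fderiv_apply ℝ (1, 0))
  have c₂ : Continuous fun t => ∫ p, fderiv ℝ G₂ (t, p) (1, 0) :=
    continuous_integral_slice' ((hG₂s.continuous_fderiv one_ne_zero).clm_apply continuous_const)
      (hG₂c.fderiv_apply ℝ (1, 0))
  have c₃ : Continuous fun t => ∫ p : Euc m × Euc k, θ (W (t, p)) * (e p.1 * φ p.2) :=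
    continuous_integral_slice (hθ.continuous.comp hW.continuous) (hc.comp_left h0) hi
  have f₁ := integral_slice_sub (μ := volume) hG₁s hG₁c t₁ t₂
  have f₂ := integral_slice_sub (μ := volume) hG₂s hG₂c t₁ t₂
  set C := 4 * ε * (∫ p, |hop V p|) + (2 * κ)⁻¹ * tensorDist e g φ γ V with hC
  have hpt : ∀ t ∈ Icc t₁ t₂, |(∫ p, fderiv ℝ G₁ (t, p) (1, 0))
      + l * ∫ p : Euc m × Euc k, θ (W (t, p)) * (e p.1 * φ p.2)|
      ≤ C - κ / 2 * ∫ p, fderiv ℝ G₂ (t, p) (1, 0) := by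
    intro t ht
    have hw := isTestProd_slice hW hc hsub hθ h0 t
    have hu := isTestProd_slice hW hc hsub contDiff_id rfl t
    simp only [id] at hu
    have g₁ : ∫ p, fderiv ℝ G₁ (t, p) (1, 0) = ∫ p, W (t, p) * hop V p := by
      rw [hu.green hV.contDiff, hform_comm, ← hV.green (hWs t)]
      refine integral_congr_ae (ae_of_all _ fun p => ?_)
      simp only [d₁]
      by_cases hp : p ∈ tsupport V
      · rw [heq t ht p (Or.inl hp), mul_comm]
      · rw [image_eq_zero_off hp, mul_zero, zero_mul]
    have g₂ : ∫ p, fderiv ℝ G₂ (t, p) (1, 0)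
        = ∫ p, θ (W (t, p)) * hop (fun p => W (t, p)) p := by
      refine integral_congr_ae (ae_of_all _ fun p => ?_)
      simp only [d₂]
      rcases le_total |W (t, p)| ε with hp | hp
      · rw [hθε _ hp, zero_mul, zero_mul]
      · rw [heq t ht p (Or.inr hp)]
    have s₁ := hw.abs_pairing_le hB hV he hφ hκ
    have s₂ := IsTestProd.integral_hform_comp_le (hWs t) hθ hθ' hw
    have i₁ := hu.integrable_mul (continuous_hop hV.contDiff)
    have i₂ := hw.integrable_mul (continuous_hop hV.contDiff)
    have s₃ : |(∫ p, W (t, p) * hop V p) - ∫ p, θ (W (t, p)) * hop V p|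
        ≤ 4 * ε * ∫ p, |hop V p| := by
      rw [← integral_sub i₁ i₂, ← integral_const_mul, ← Real.norm_eq_abs]
      refine norm_integral_le_of_norm_le (hV.integrable_hop.abs.const_mul _)
        (ae_of_all _ fun p => ?_)
      rw [← sub_mul, norm_mul, Real.norm_eq_abs, abs_sub_comm]
      exact mul_le_mul_of_nonneg_right (hθr _) (abs_nonneg _)
    have s₄ := mul_le_mul_of_nonneg_left s₂ (half_pos hκ).le
    rw [g₁, g₂]
    rw [abs_le] at s₁ s₃ ⊢
    constructor <;> linarith [s₁.1, s₁.2, s₃.1, s₃.2]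
  have hmain : (∫ p, W (t₂, p) * V p) - (∫ p, W (t₁, p) * V p)
        + l * (∫ t in t₁..t₂, ∫ p : Euc m × Euc k, θ (W (t, p)) * (e p.1 * φ p.2))
      = ∫ t in t₁..t₂, ((∫ p, fderiv ℝ G₁ (t, p) (1, 0))
        + l * ∫ p : Euc m × Euc k, θ (W (t, p)) * (e p.1 * φ p.2)) := by
    rw [intervalIntegral.integral_add (c₁.intervalIntegrable _ _)
      ((c₃.const_mul l).intervalIntegrable _ _), intervalIntegral.integral_const_mul, ← f₁]
  have hb : IntervalIntegrable (fun t => C - κ / 2 * ∫ p, fderiv ℝ G₂ (t, p) (1, 0)) volume t₁ t₂ :=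
    (continuous_const.sub (c₂.const_mul _)).intervalIntegrable t₁ t₂
  have hint := intervalIntegral.norm_integral_le_of_norm_le ht
    (ae_of_all _ fun t h => (Real.norm_eq_abs _).trans_le (hpt t ⟨h.1.le, h.2⟩)) hb
  rw [hmain]
  refine hint.trans ?_
  rw [intervalIntegral.integral_sub (continuous_const.intervalIntegrable _ _)
    ((c₂.const_mul _).intervalIntegrable _ _), intervalIntegral.integral_const_mul, ← f₂,
    intervalIntegral.integral_const, smul_eq_mul]
  have b₁ : ∫ p, G₂ (t₁, p) ≤ 1 / 2 * ∫ p, W (t₁, p) ^ 2 := by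
    rw [← integral_const_mul]
    refine integral_mono_of_nonneg (ae_of_all _ fun p => (hΘ2 _).1) ?_
      (ae_of_all _ fun p => (hΘ2 _).2.trans_eq (by ring))
    have := (isTestProd_slice hW hc hsub contDiff_id rfl t₁).integrable_mul (hWs t₁).continuous
    simp only [id, ← sq] at this
    exact this.const_mul _
  have b₂ : 0 ≤ ∫ p, G₂ (t₂, p) := integral_nonneg fun p => (hΘ2 _).1
  have b₃ := mul_le_mul_of_nonneg_left b₁ (half_pos hκ).le
  have b₄ := mul_nonneg (half_pos hκ).le b₂
  linarith

end GrushinSlices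

section Localization

open scoped Manifold ContDiff

theorem lapl_congr {n : ℕ} {f g : Euc n → ℝ} {x : Euc n} (h : f =ᶠ[nhds x] g) :
    lapl f x = lapl g x :=
  Finset.sum_congr rfl fun i _ => by
    have : (fun z => fderiv ℝ f z (EuclideanSpace.single i 1))
        =ᶠ[nhds x] fun z => fderiv ℝ g z (EuclideanSpace.single i 1) := by
      filter_upwards [h.fderiv (𝕜 := ℝ)] with z hz
      rw [hz]
    rw [this.fderiv_eq]

variable {d dt : ℕ} {R T : ℝ} {Ω : Set (Euc dt)} {y : ℝ → Euc d → Euc dt → ℝ}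

/-- Cutting off a solution away from its small values and from the boundary. -/
theorem IsGrushinSolution.exists_localization (hy : IsGrushinSolution d dt R T Ω y)
    (hΩo : IsOpen Ω) (hΩb : Bornology.IsBounded Ω) {K : Set (Euc d × Euc dt)} (hK : IsCompact K)
    (hKQ : K ⊆ ball (0 : Euc d) R ×ˢ Ω) {t₁ t₂ ε : ℝ} (ht₁ : 0 < t₁) (ht₂ : t₂ < T) (hε : 0 < ε) :
    ∃ W : ℝ × (Euc d × Euc dt) → ℝ, ContDiff ℝ (⊤ : ℕ∞) W ∧ HasCompactSupport W ∧
      (∀ q ∈ tsupport W, q.2 ∈ ball (0 : Euc d) R ×ˢ Ω) ∧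
      (∀ q, |W q| ≤ |y q.1 q.2.1 q.2.2|) ∧
      ∀ t ∈ Icc t₁ t₂, ∀ p ∈ ball (0 : Euc d) R ×ˢ Ω, p ∈ K ∨ ε ≤ |y t p.1 p.2| →
        W (t, p) = y t p.1 p.2 ∧ fderiv ℝ W (t, p) (1, 0) = hop (fun p => W (t, p)) p := by
  set Q := ball (0 : Euc d) R ×ˢ Ω with hQ
  have hQo : IsOpen Q := isOpen_ball.prod hΩo
  set Y : ℝ × (Euc d × Euc dt) → ℝ := fun q => y q.1 q.2.1 q.2.2 with hY
  set U : Set (ℝ × (Euc d × Euc dt)) := Ioo 0 T ×ˢ Q with hU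
  have hUo : IsOpen U := isOpen_Ioo.prod hQo
  have hSc : IsCompact (Icc t₁ t₂ ×ˢ closure Q) :=
    isCompact_Icc.prod (isBounded_ball.prod hΩb).isCompact_closure
  have hYc : ContinuousOn (fun q => |Y q|) (Icc t₁ t₂ ×ˢ closure Q) :=
    (hy.continuousOn.mono (prod_mono (Icc_subset_Icc ht₁.le ht₂.le) subset_rfl)).abs
  have hLc : IsCompact ((Icc t₁ t₂ ×ˢ closure Q) ∩ (fun q => |Y q|) ⁻¹' Ici ε) :=
    hSc.of_isClosed_subset (hYc.preimage_isClosed_of_isClosed hSc.isClosed isClosed_Ici)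
      inter_subset_left
  set L := ((Icc t₁ t₂ ×ˢ closure Q) ∩ (fun q => |Y q|) ⁻¹' Ici ε) ∪ Icc t₁ t₂ ×ˢ K with hL
  have hLc' : IsCompact L := hLc.union (isCompact_Icc.prod hK)
  have hLU : L ⊆ U := by
    rintro ⟨t, p⟩ (⟨⟨h1, h2⟩, h3⟩ | ⟨h1, h2⟩)
    · refine ⟨⟨ht₁.trans_le h1.1, h1.2.trans_lt ht₂⟩, ?_⟩
      by_contra hp
      have := hy.boundary t ⟨ht₁.trans_le h1.1, h1.2.trans_lt ht₂⟩ p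
        (hQo.frontier_eq ▸ ⟨h2, hp⟩)
      simp only [mem_preimage, mem_Ici, hY, this, abs_zero] at h3
      linarith
    · exact ⟨⟨ht₁.trans_le h1.1, h1.2.trans_lt ht₂⟩, hKQ h2⟩
  obtain ⟨L', hL'c, hLL', hL'U⟩ := exists_compact_between hLc' hUo hLU
  obtain ⟨Ξ, h1, h0, h01⟩ := exists_contMDiffMap_one_nhds_of_subset_interior
    𝓘(ℝ, ℝ × (Euc d × Euc dt)) (n := (⊤ : ℕ∞)) hLc'.isClosed hLL'
  have hΞ : ContDiff ℝ (⊤ : ℕ∞) Ξ := Ξ.contMDiff.contDiff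
  have hW0 : ∀ q ∉ L', Ξ q * Y q = 0 := fun q hq => by rw [h0 q hq, zero_mul]
  have hsupp : tsupport (fun q => Ξ q * Y q) ⊆ L' :=
    closure_minimal (fun q hq => by_contra fun h => hq (hW0 q h)) hL'c.isClosed
  have hW : ContDiff ℝ (⊤ : ℕ∞) fun q => Ξ q * Y q := contDiff_iff_contDiffAt.2 fun q => by
    by_cases hq : q ∈ U
    · exact hΞ.contDiffAt.mul (hy.smoothOn.contDiffAt (hUo.mem_nhds hq))
    · refine (contDiffAt_const (c := (0 : ℝ))).congr_of_eventuallyEq ?_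
      filter_upwards [hL'c.isClosed.isOpen_compl.mem_nhds fun h => hq (hL'U h)] with r hr
      exact hW0 r hr
  refine ⟨fun q => Ξ q * Y q, hW, HasCompactSupport.intro hL'c hW0,
    fun q hq => (hL'U (hsupp hq)).2, fun q => ?_, fun t ht p hp h => ?_⟩
  · rw [abs_mul, abs_of_nonneg (h01 q).1]
    exact mul_le_of_le_one_left (abs_nonneg _) (h01 q).2
  have hmem : (t, p) ∈ L := h.elim (fun h => Or.inr ⟨ht, h⟩)
    fun h => Or.inl ⟨⟨ht, subset_closure hp⟩, h⟩
  have hev : (fun q => Ξ q * Y q) =ᶠ[nhds (t, p)] Y := by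
    filter_upwards [h1.filter_mono (nhds_le_nhdsSet hmem)] with q hq
    rw [hq, one_mul]
  refine ⟨hev.self_of_nhds, ?_⟩
  obtain ⟨x, z⟩ := p
  have htd : HasDerivAt (fun s : ℝ => (s, (x, z))) (1, 0) t :=
    (hasDerivAt_id t).prodMk (hasDerivAt_const t (x, z))
  have e1 := ((hW.differentiable (by simp) (t, (x, z))).hasFDerivAt.comp_hasDerivAt t htd).deriv
  have e2 := (hev.comp_tendsto htd.continuousAt).deriv_eq
  have k3 : Tendsto (fun x' : Euc d => (t, (x', z))) (nhds x) (nhds (t, (x, z))) :=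
    Continuous.tendsto' (by fun_prop) _ _ rfl
  have k4 : Tendsto (fun z' : Euc dt => (t, (x, z'))) (nhds z) (nhds (t, (x, z))) :=
    Continuous.tendsto' (by fun_prop) _ _ rfl
  have e3 := lapl_congr (hev.comp_tendsto k3)
  have e4 := lapl_congr (hev.comp_tendsto k4)
  have hs : ContDiff ℝ (⊤ : ℕ∞) fun p => Ξ (t, p) * Y (t, p) :=
    hW.comp (contDiff_const.prodMk contDiff_id)
  have e5 := hy.eqn t (hLU hmem).1 x hp.1 z hp.2
  rw [← e1, hop, ← lapl_fst hs, ← lapl_snd hs]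
  refine e2.trans ?_
  change _ = lapl ((fun q => Ξ q * Y q) ∘ fun x' : Euc d => (t, (x', z))) x
    + ‖x‖ ^ 2 * lapl ((fun q => Ξ q * Y q) ∘ fun z' : Euc dt => (t, (x, z'))) z
  rw [e3, e4]
  simp only [Function.comp_def, hY]
  linarith

end Localization

section TensorApproximation

theorem norm_smul_sub_smul_le {E : Type*} [NormedAddCommGroup E] [InnerProductSpace ℝ E]
    (r r' : ℝ) (v v' : E) : ‖r' • v' - r • v‖ ≤ ‖r - r'‖ * ‖v‖ + ‖r'‖ * ‖v - v'‖ := by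
  rw [← norm_smul, ← norm_smul, show r' • v' - r • v = -((r - r') • v + r' • (v - v')) by module,
    norm_neg]
  exact norm_add_le _ _

theorem norm_smul_sub_smul_le' {E : Type*} [NormedAddCommGroup E] [InnerProductSpace ℝ E]
    (r r' : ℝ) (v v' : E) : ‖r' • v' - r • v‖ ≤ ‖v - v'‖ * ‖r‖ + ‖v'‖ * ‖r - r'‖ := by
  rw [mul_comm, mul_comm ‖v'‖, ← norm_smul, ← norm_smul,
    show r' • v' - r • v = -(r • (v - v') + (r - r') • v') by module, norm_neg]
  exact norm_add_le _ _

variable {m k : ℕ} {B : Set (Euc m)} {Ω : Set (Euc k)}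

theorem IsTest.tensor {u : Euc m → ℝ} {v : Euc k → ℝ} (hu : IsTest B u) (hv : IsTest Ω v) :
    IsTestProd B Ω fun p => u p.1 * v p.2 := by
  have h0 : ∀ p ∉ tsupport u ×ˢ tsupport v, u p.1 * v p.2 = 0 := fun p hp => by
    by_contra h
    exact hp ⟨subset_tsupport _ (left_ne_zero_of_mul h), subset_tsupport _ (right_ne_zero_of_mul h)⟩
  have hs : Function.support (fun p : Euc m × Euc k => u p.1 * v p.2) ⊆ tsupport u ×ˢ tsupport v :=
    fun p hp => by_contra fun h => hp (h0 p h)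
  have hc := hu.compact.isCompact.prod hv.compact.isCompact
  exact ⟨(hu.contDiff.comp contDiff_fst).mul (hv.contDiff.comp contDiff_snd),
    HasCompactSupport.intro hc h0, (closure_minimal hs hc.isClosed).trans (prod_mono hu.sub hv.sub)⟩

theorem H10.exists_tensor_approx (hB : Bornology.IsBounded B) {e : Euc m → ℝ} {g : Euc m → Euc m}
    (he : H10 B e g) {φ : Euc k → ℝ} {γ : Euc k → Euc k} (hφ : H10 Ω φ γ) {δ : ℝ} (hδ : 0 < δ) :
    ∃ V, IsTestProd B Ω V ∧ tensorDist e g φ γ V < δ ∧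
      ∫ p : Euc m × Euc k, ‖e p.1 * φ p.2 - V p‖ ^ 2 < δ := by
  obtain ⟨u, hu, hue, hug⟩ := he.approx
  obtain ⟨v, hv, hvφ, hvγ⟩ := hφ.approx
  have hT := fun n => (hu n).tensor (hv n)
  have gx : ∀ n p, gradx (fun p => u n p.1 * v n p.2) p = v n p.2 • gradient (u n) p.1 :=
    fun n p => by
      rw [← gradient_fst (hT n).differentiable p.1 p.2]
      simp only [mul_comm (u n _)]
      exact gradient_const_smul ((hu n).contDiff.differentiable (by simp) _) _
  have gz : ∀ n p, gradz (fun p => u n p.1 * v n p.2) p = u n p.1 • gradient (v n) p.2 :=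
    fun n p => by
      rw [← gradient_snd (hT n).differentiable p.1 p.2]
      change gradient (fun z => u n p.1 * v n z) p.2 = _
      exact gradient_const_smul ((hv n).contDiff.differentiable (by simp) _) _
  have hx : L2Lim volume (fun n x => ‖x‖ • u n x) fun x => ‖x‖ • e x :=
    hue.smul_cont hB (fun n x hx => image_eq_zero_of_notMem_tsupport fun h => hx ((hu n).sub h))
      he.zu (b := fun x : Euc m => ‖x‖) (by fun_prop)
  have l₁ := tendsto_tensor hug hvφ (h := fun n p => φ p.2 • g p.1
    - gradx (fun p => u n p.1 * v n p.2) p) fun n p => by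
      rw [gx]; exact norm_smul_sub_smul_le' _ _ _ _
  have l₂ := tendsto_tensor hx hvγ (h := fun n p => (‖p.1‖ * e p.1) • γ p.2
    - ‖p.1‖ • gradz (fun p => u n p.1 * v n p.2) p) fun n p => by
      rw [gz, smul_smul]; exact norm_smul_sub_smul_le _ _ _ _
  have l₃ := tendsto_tensor hue hvφ (h := fun n p => e p.1 * φ p.2 - u n p.1 * v n p.2)
    fun n p => norm_smul_sub_smul_le _ _ _ _
  have l₄ := l₁.add l₂
  rw [add_zero] at l₄
  obtain ⟨n, h1, h2⟩ := ((l₄.eventually_lt_const hδ).and (l₃.eventually_lt_const hδ)).exists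
  exact ⟨_, hT n, h1, h2⟩

end TensorApproximation

section CoefficientEvolution

theorem le_of_forall_pos_le_add_mul {X A B : ℝ} (h : ∀ ε > 0, X ≤ A + ε * B) : X ≤ A := by
  have : Tendsto (fun ε : ℝ => A + ε * B) (nhdsWithin 0 (Ioi 0)) (nhds (A + 0 * B)) :=
    ((by fun_prop : Continuous fun ε : ℝ => A + ε * B).tendsto 0).mono_left nhdsWithin_le_nhds
  simpa using ge_of_tendsto this (eventually_nhdsWithin_of_forall h)

theorem continuousOn_setIntegral_mul {X A : Type*} [TopologicalSpace X] [FirstCountableTopology X]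
    [TopologicalSpace A] [SecondCountableTopology A] [MeasurableSpace A] [OpensMeasurableSpace A]
    {μ : Measure A} {K : Set X} {D : Set A} (hD : MeasurableSet D) {F : X → A → ℝ}
    (hF : ContinuousOn (fun q : X × A => F q.1 q.2) (K ×ˢ D)) {M : ℝ}
    (hM : ∀ s ∈ K, ∀ a ∈ D, |F s a| ≤ M) {ψ : A → ℝ} (hψ : IntegrableOn ψ D μ) :
    ContinuousOn (fun s => ∫ a in D, F s a * ψ a ∂μ) K := by
  refine continuousOn_of_dominated (bound := fun a => M * ‖ψ a‖) (fun s hs => ?_) (fun s hs => ?_)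
    (hψ.norm.const_mul M) ?_
  · exact ((hF.comp (by fun_prop : Continuous fun a => (s, a)).continuousOn
      fun a ha => ⟨hs, ha⟩).aestronglyMeasurable hD).mul hψ.1
  · filter_upwards [ae_restrict_mem hD] with a ha
    rw [norm_mul]
    exact mul_le_mul_of_nonneg_right (hM s hs a ha) (norm_nonneg _)
  · filter_upwards [ae_restrict_mem hD] with a ha
    exact (hF.comp (by fun_prop : Continuous fun s => (s, a)).continuousOn
      fun s hs => ⟨hs, ha⟩).mul continuousOn_const

theorem eq_exp_mul_of_integral_eq {a : ℝ → ℝ} {l T : ℝ} (hc : ContinuousOn a (Icc 0 T))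
    (h : ∀ t₁ t₂, 0 < t₁ → t₁ ≤ t₂ → t₂ < T → a t₂ - a t₁ + l * ∫ t in t₁..t₂, a t = 0)
    {t : ℝ} (ht : t ∈ Icc 0 T) : a t = Real.exp (-l * t) * a 0 := by
  have hd : ∀ s ∈ Ioo 0 T, HasDerivAt a (-l * a s) s := fun s hs => by
    have hs2 : s / 2 < s := by linarith [hs.1]
    have hca : ContinuousAt a s := hc.continuousAt (Icc_mem_nhds hs.1 hs.2)
    have := ((intervalIntegral.integral_hasDerivAt_right (a := s / 2) (b := s) (f := a)
      ((hc.mono (by rw [uIcc_of_le hs2.le]; exact Icc_subset_Icc (by linarith [hs.1]) hs.2.le)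
        ).intervalIntegrable)
      ((hc.mono Ioo_subset_Icc_self).stronglyMeasurableAtFilter isOpen_Ioo s hs) hca).const_mul
        (-l)).const_add (a (s / 2))
    refine this.congr_of_eventuallyEq ?_
    filter_upwards [Ioo_mem_nhds hs2 hs.2] with r hr
    linarith [h (s / 2) r (by linarith [hs.1]) hr.1.le hr.2]
  rcases ht.1.eq_or_lt with rfl | h0
  · simp
  obtain ⟨s, hs, h1⟩ := exists_hasDerivAt_eq_slope (fun t => Real.exp (l * t) * a t)
    (fun s => Real.exp (l * s) * (l * 1) * a s + Real.exp (l * s) * (-l * a s)) h0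
    (ContinuousOn.mul (by fun_prop) (hc.mono (Icc_subset_Icc_right ht.2))) fun s hs =>
      ((hasDerivAt_id s).const_mul l).exp.fun_mul (hd s ⟨hs.1, hs.2.trans_le ht.2⟩)
  rw [eq_div_iff (by linarith)] at h1
  have h2 : Real.exp (l * t) * a t = a 0 := by
    rw [mul_zero, Real.exp_zero, one_mul] at h1
    linear_combination -h1
  rw [← h2, ← mul_assoc, ← Real.exp_add]
  simp

variable {d dt : ℕ} {R T M : ℝ} {Ω : Set (Euc dt)} {y : ℝ → Euc d → Euc dt → ℝ}
  {c l : ℝ} {e : Euc d → ℝ} {g : Euc d → Euc d} {φ : Euc dt → ℝ} {γ : Euc dt → Euc dt}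

theorem IsGrushinSolution.continuousOn_coeff (hy : IsGrushinSolution d dt R T Ω y)
    (hΩo : IsOpen Ω)
    (hM : ∀ t ∈ Icc 0 T, ∀ p ∈ ball (0 : Euc d) R ×ˢ Ω, |y t p.1 p.2| ≤ M)
    {ψ : Euc d × Euc dt → ℝ} (hψ : Integrable ψ) :
    ContinuousOn (fun t => ∫ p in ball (0 : Euc d) R ×ˢ Ω, y t p.1 p.2 * ψ p) (Icc 0 T) :=
  continuousOn_setIntegral_mul (isOpen_ball.prod hΩo).measurableSet
    (hy.continuousOn.mono (prod_mono_right subset_closure)) hM hψ.integrableOn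

theorem IsGrushinSolution.integrableOn_mul (hy : IsGrushinSolution d dt R T Ω y)
    (hΩo : IsOpen Ω)
    (hM : ∀ t ∈ Icc 0 T, ∀ p ∈ ball (0 : Euc d) R ×ˢ Ω, |y t p.1 p.2| ≤ M)
    {ψ : Euc d × Euc dt → ℝ} (hψ : Integrable ψ) {t : ℝ} (ht : t ∈ Icc 0 T) :
    IntegrableOn (fun p => y t p.1 p.2 * ψ p) (ball (0 : Euc d) R ×ˢ Ω) :=
  have hQm := (isOpen_ball.prod hΩo).measurableSet
  hψ.integrableOn.bdd_mul (c := M) ((hy.continuousOn.comp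
    (by fun_prop : Continuous fun p : Euc d × Euc dt => (t, p)).continuousOn
    fun p hp => ⟨ht, subset_closure hp⟩).aestronglyMeasurable hQm)
    (ae_restrict_of_forall_mem hQm (hM t ht))

set_option maxHeartbeats 1000000 in
theorem IsGrushinSolution.abs_coeff_test_le (hy : IsGrushinSolution d dt R T Ω y)
    (hΩo : IsOpen Ω) (hΩb : Bornology.IsBounded Ω)
    (hM : ∀ t ∈ Icc 0 T, ∀ p ∈ ball (0 : Euc d) R ×ˢ Ω, |y t p.1 p.2| ≤ M)
    {V : Euc d × Euc dt → ℝ} (hV : IsTestProd (ball 0 R) Ω V)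
    (he : IsWeak (ball 0 R) c e g fun x => l * e x) (hφ : IsWeak Ω 0 φ γ fun z => c ^ 2 * φ z)
    (hi : Integrable fun p : Euc d × Euc dt => e p.1 * φ p.2) {κ : ℝ} (hκ : 0 < κ)
    {t₁ t₂ : ℝ} (h1 : 0 < t₁) (h12 : t₁ ≤ t₂) (h2 : t₂ < T) :
    |(∫ p in ball (0 : Euc d) R ×ˢ Ω, y t₂ p.1 p.2 * V p)
        - (∫ p in ball (0 : Euc d) R ×ˢ Ω, y t₁ p.1 p.2 * V p)
        + l * ∫ t in t₁..t₂, ∫ p in ball (0 : Euc d) R ×ˢ Ω, y t p.1 p.2 * (e p.1 * φ p.2)|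
      ≤ (t₂ - t₁) * ((2 * κ)⁻¹ * tensorDist e g φ γ V)
        + κ / 4 * (M ^ 2 * volume.real (ball (0 : Euc d) R ×ˢ Ω)) := by
  set Q := ball (0 : Euc d) R ×ˢ Ω with hQ
  have hQm : MeasurableSet Q := (isOpen_ball.prod hΩo).measurableSet
  have hQf : volume Q < ⊤ := (isBounded_ball.prod hΩb).measure_lt_top
  refine le_of_forall_pos_le_add_mul (B := (t₂ - t₁) * (4 * ∫ p, |hop V p|)
    + |l| * (4 * (∫ p in Q, |e p.1 * φ p.2|) * (t₂ - t₁))) fun ε hε => ?_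
  obtain ⟨θ, Θ, hθ, hΘ, hd, hθε, hθr, hθ', hΘ2⟩ := exists_truncation hε
  obtain ⟨W, hW, hWc, hWs, hWy, hWe⟩ := hy.exists_localization hΩo hΩb
    hV.compact.isCompact hV.sub h1 h2 hε
  have hmem : ∀ t ∈ Icc t₁ t₂, t ∈ Icc 0 T := fun t ht => ⟨h1.le.trans ht.1, ht.2.trans h2.le⟩
  have hW0 : ∀ t, ∀ p ∉ Q, W (t, p) = 0 := fun t p hp =>
    image_eq_zero_of_notMem_tsupport fun h => hp (hWs (t, p) h)
  have key := abs_slice_pairing_le isBounded_ball hW hWc hWs hV he hφ hi hκ hθ hΘ hd hθε hθr hε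
    hθ' hΘ2 h12 fun t ht p hp => by
      rcases hp with hp | hp
      · exact (hWe t ht p (hV.sub hp) (.inl hp)).2
      · exact (hWe t ht p (by_contra fun h => by simp [hW0 t p h] at hp; linarith)
          (.inr (hp.trans (hWy _)))).2
  have hWV : ∀ t ∈ Icc t₁ t₂, ∫ p, W (t, p) * V p = ∫ p in Q, y t p.1 p.2 * V p := fun t ht => by
    rw [← setIntegral_eq_integral_of_forall_compl_eq_zero (s := Q)
      fun p hp => by rw [hW0 t p hp, zero_mul]]
    refine setIntegral_congr_fun hQm fun p hp => ?_
    by_cases h : p ∈ tsupport V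
    · simp only [(hWe t ht p hp (.inl h)).1]
    · simp only [image_eq_zero_of_notMem_tsupport h, mul_zero]
  have hθW : ∀ t ∈ Icc t₁ t₂, ∀ p ∈ Q, |θ (W (t, p)) - y t p.1 p.2| ≤ 4 * ε :=
    fun t ht p hp => by
      by_cases h : ε ≤ |y t p.1 p.2|
      · rw [← (hWe t ht p hp (.inr h)).1]; exact hθr _
      · rw [hθε _ ((hWy (t, p)).trans (le_of_not_ge h)), zero_sub, abs_neg]; linarith
  have hθM : ∀ t ∈ Icc t₁ t₂, ∀ p ∈ Q, |θ (W (t, p))| ≤ 4 * ε + M := fun t ht p hp => by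
    have := abs_add_le (θ (W (t, p)) - y t p.1 p.2) (y t p.1 p.2)
    rw [sub_add_cancel] at this
    exact this.trans (add_le_add (hθW t ht p hp) (hM t (hmem t ht) p hp))
  have hcθ : ContinuousOn (fun t => ∫ p in Q, θ (W (t, p)) * (e p.1 * φ p.2)) (Icc t₁ t₂) :=
    continuousOn_setIntegral_mul hQm (hθ.continuous.comp hW.continuous).continuousOn
      (M := 4 * ε + M) hθM hi.integrableOn
  have hcy := (hy.continuousOn_coeff hΩo hM hi).mono hmem
  have hdiff : |(∫ t in t₁..t₂, ∫ p : Euc d × Euc dt, θ (W (t, p)) * (e p.1 * φ p.2))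
      - ∫ t in t₁..t₂, ∫ p in Q, y t p.1 p.2 * (e p.1 * φ p.2)|
        ≤ 4 * ε * (∫ p in Q, |e p.1 * φ p.2|) * (t₂ - t₁) := by
    have h0 : ∀ t, (∫ p : Euc d × Euc dt, θ (W (t, p)) * (e p.1 * φ p.2))
        = ∫ p in Q, θ (W (t, p)) * (e p.1 * φ p.2) := fun t =>
      (setIntegral_eq_integral_of_forall_compl_eq_zero fun p hp => by
        rw [hW0 t p hp, hθε 0 (by simpa using hε.le), zero_mul]).symm
    simp only [h0]
    rw [← intervalIntegral.integral_sub (hcθ.intervalIntegrable_of_Icc h12)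
      (hcy.intervalIntegrable_of_Icc h12), ← abs_of_nonneg (sub_nonneg.2 h12)]
    refine (Real.norm_eq_abs _).symm.trans_le
      (intervalIntegral.norm_integral_le_of_norm_le_const fun t ht => ?_)
    rw [uIoc_of_le h12] at ht
    have ht' := Ioc_subset_Icc_self ht
    rw [← integral_const_mul, ← integral_sub]
    · have hb : IntegrableOn (fun p : Euc d × Euc dt => 4 * ε * |e p.1 * φ p.2|) Q :=
        (hi.abs.const_mul _).integrableOn
      refine norm_integral_le_of_norm_le hb ?_
      filter_upwards [ae_restrict_mem hQm] with p hp
      rw [← sub_mul, norm_mul]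
      exact mul_le_mul_of_nonneg_right (hθW t ht' p hp) (norm_nonneg _)
    · exact hi.integrableOn.bdd_mul (c := 4 * ε + M)
        (hθ.continuous.comp (hW.continuous.comp (by fun_prop))).aestronglyMeasurable
        (ae_restrict_of_forall_mem hQm (hθM t ht'))
    · exact hy.integrableOn_mul hΩo hM hi (hmem t ht')
  have hsq : ∫ p, W (t₁, p) ^ 2 ≤ M ^ 2 * volume.real Q := by
    rw [← setIntegral_eq_integral_of_forall_compl_eq_zero (s := Q) fun p hp => by
      rw [hW0 _ p hp, zero_pow two_ne_zero]]
    refine (Real.le_norm_self _).trans (norm_setIntegral_le_of_norm_le_const hQf fun p hp => ?_)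
    rw [Real.norm_eq_abs, abs_pow]
    exact pow_le_pow_left₀ (abs_nonneg _)
      ((hWy _).trans (hM t₁ (hmem t₁ ⟨le_rfl, h12⟩) p hp)) 2
  rw [hWV t₁ ⟨le_rfl, h12⟩, hWV t₂ ⟨h12, le_rfl⟩] at key
  have h3 := mul_le_mul_of_nonneg_left hdiff (abs_nonneg l)
  rw [← abs_mul] at h3
  have h4 := mul_le_mul_of_nonneg_left hsq (by positivity : 0 ≤ κ / 4)
  rw [abs_le] at key h3 ⊢
  constructor <;> linarith [key.1, key.2, h3.1, h3.2]

theorem IsGrushinSolution.coeff_eq (hy : IsGrushinSolution d dt R T Ω y)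
    (hΩo : IsOpen Ω) (hΩb : Bornology.IsBounded Ω)
    (hM : ∀ t ∈ Icc 0 T, ∀ p ∈ ball (0 : Euc d) R ×ˢ Ω, |y t p.1 p.2| ≤ M)
    (he : IsWeak (ball 0 R) c e g fun x => l * e x) (hφ : IsWeak Ω 0 φ γ fun z => c ^ 2 * φ z)
    {t : ℝ} (ht : t ∈ Icc 0 T) :
    ∫ p in ball (0 : Euc d) R ×ˢ Ω, y t p.1 p.2 * (e p.1 * φ p.2)
      = Real.exp (-l * t) * ∫ p in ball (0 : Euc d) R ×ˢ Ω, y 0 p.1 p.2 * (e p.1 * φ p.2) := by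
  have hi : Integrable fun p : Euc d × Euc dt => e p.1 * φ p.2 :=
    (he.h10.good.integrable isBounded_ball).mul_prod (hφ.h10.good.integrable hΩb)
  have hi2 : MemLp (fun p : Euc d × Euc dt => e p.1 * φ p.2) 2 :=
    memLp_tensor_smul he.h10.good.mem hφ.h10.good.mem
  set Q := ball (0 : Euc d) R ×ˢ Ω with hQ
  have hQm : MeasurableSet Q := (isOpen_ball.prod hΩo).measurableSet
  have hQf : volume Q < ⊤ := (isBounded_ball.prod hΩb).measure_lt_top
  refine eq_exp_mul_of_integral_eq
    (a := fun t => ∫ p in Q, y t p.1 p.2 * (e p.1 * φ p.2))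
    (hy.continuousOn_coeff hΩo hM hi) (fun t₁ t₂ h1 h12 h2 => ?_) ht
  refine abs_nonpos_iff.1 (le_of_forall_pos_le_add_mul
    (B := 2 * (M ^ 2 * volume.real Q)) fun κ hκ => ?_)
  rw [zero_add]
  refine le_of_forall_pos_le_add_mul (B := (2 * κ)⁻¹ * (t₂ - t₁ + 2)) fun δ hδ => ?_
  obtain ⟨V, hV, hV1, hV2⟩ := he.h10.exists_tensor_approx isBounded_ball hφ.h10 hδ
  have key := hy.abs_coeff_test_le hΩo hΩb hM hV he hφ hi hκ h1 h12 h2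
  have hVi : MemLp V 2 := hV.contDiff.continuous.memLp_of_hasCompactSupport hV.compact
  have hVd : ∀ t ∈ Icc 0 T, |(∫ p in Q, y t p.1 p.2 * (e p.1 * φ p.2))
      - ∫ p in Q, y t p.1 p.2 * V p| ≤ (2 * κ)⁻¹ * δ + κ / 2 * (M ^ 2 * volume.real Q) := by
    intro t ht
    have hw : Integrable fun p : Euc d × Euc dt => ‖e p.1 * φ p.2 - V p‖ ^ 2 :=
      memLp_two_integrable_norm_sq (hi2.sub hVi)
    have hb : IntegrableOn (fun p : Euc d × Euc dt => (2 * κ)⁻¹ * ‖e p.1 * φ p.2 - V p‖ ^ 2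
        + κ / 2 * M ^ 2) Q :=
      (hw.integrableOn.const_mul _).add (integrableOn_const hQf.ne)
    rw [← integral_sub (hy.integrableOn_mul hΩo hM hi ht) (hy.integrableOn_mul hΩo hM
      (hV.contDiff.continuous.integrable_of_hasCompactSupport hV.compact) ht)]
    refine (Real.norm_eq_abs _).symm.trans_le ((norm_integral_le_of_norm_le hb ?_).trans ?_)
    · filter_upwards [ae_restrict_mem hQm] with p hp
      have h1 := mul_le_mul_of_nonneg_right (hM t ht p hp) (abs_nonneg (e p.1 * φ p.2 - V p))
      have h2 : 0 ≤ (2 * κ)⁻¹ * (|e p.1 * φ p.2 - V p| - κ * M) ^ 2 := by positivity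
      have h3 : (2 * κ)⁻¹ * (|e p.1 * φ p.2 - V p| - κ * M) ^ 2 = (2 * κ)⁻¹
        * |e p.1 * φ p.2 - V p| ^ 2 - M * |e p.1 * φ p.2 - V p| + κ / 2 * M ^ 2 := by
        field_simp; ring
      rw [← mul_sub, norm_mul, Real.norm_eq_abs, Real.norm_eq_abs]
      linarith
    · rw [integral_add (hw.integrableOn.const_mul _) (integrableOn_const hQf.ne),
        integral_const_mul, setIntegral_const, smul_eq_mul]
      have := mul_le_mul_of_nonneg_left ((setIntegral_le_integral (s := Q) hw
        (ae_of_all _ fun _ => sq_nonneg _)).trans hV2.le) (by positivity : 0 ≤ (2 * κ)⁻¹)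
      linarith
  have h3 := hVd t₁ ⟨h1.le, h12.trans h2.le⟩
  have h4 := hVd t₂ ⟨h1.le.trans h12, h2.le⟩
  have h5 := mul_le_mul_of_nonneg_left (mul_le_mul_of_nonneg_left hV1.le
    (by positivity : 0 ≤ (2 * κ)⁻¹)) (sub_nonneg.2 h12)
  have h6 : 0 ≤ κ * (M ^ 2 * volume.real Q) := by positivity
  rw [abs_le] at key h3 h4 ⊢
  constructor <;> linarith [key.1, key.2, h3.1, h3.2, h4.1, h4.2]

end CoefficientEvolution

section ModeApproximation

variable {m : ℕ} {D : Set (Euc m)} {ι : Type} {e : ι → Euc m → ℝ}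

theorem Good.tendsto_setIntegral_sq {κ : Type*} {u : Filter κ} {f : κ → Euc m → ℝ}
    {f' : Euc m → ℝ} (hf : ∀ k, Good D (f k)) (hf' : Good D f')
    (h : Tendsto (fun k => ∫ x, (f k x - f' x) ^ 2) u (nhds 0)) (S : Set (Euc m)) :
    Tendsto (fun k => ∫ x in S, f k x ^ 2) u (nhds (∫ x in S, f' x ^ 2)) := by
  rw [tendsto_iff_norm_sub_tendsto_zero]
  have hb : Tendsto (fun k => (∫ x, (f k x - f' x) ^ 2)
      + 2 * √((∫ x, (f k x - f' x) ^ 2) * ∫ x, f' x ^ 2)) u (nhds 0) := by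
    have := h.add (((h.mul_const (∫ x, f' x ^ 2)).sqrt).const_mul 2)
    simpa using this
  refine squeeze_zero (fun k => norm_nonneg _) (fun k => ?_) hb
  have hd := (hf k).sub hf'
  have e1 : ∫ x in S, f k x ^ 2 = (∫ x in S, (f k x - f' x) ^ 2)
      + 2 * (∫ x in S, (f k x - f' x) * f' x) + ∫ x in S, f' x ^ 2 := by
    rw [← integral_const_mul, ← integral_add hd.int_sq.integrableOn
      ((hd.int_mul hf').const_mul 2).integrableOn, ← integral_add (hd.int_sq.fun_add
      ((hd.int_mul hf').const_mul 2)).integrableOn hf'.int_sq.integrableOn]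
    congr 1 with x; ring
  have e2 := abs_integral_inner_le (hd.mem.restrict S) (hf'.mem.restrict S)
  simp only [RCLike.inner_apply, conj_trivial, Real.norm_eq_abs, sq_abs, mul_comm (f' _)] at e2
  have i1 : ∫ x in S, (f k x - f' x) ^ 2 ≤ ∫ x, (f k x - f' x) ^ 2 :=
    setIntegral_le_integral hd.int_sq (ae_of_all _ fun _ => sq_nonneg _)
  have i2 : ∫ x in S, f' x ^ 2 ≤ ∫ x, f' x ^ 2 :=
    setIntegral_le_integral hf'.int_sq (ae_of_all _ fun _ => sq_nonneg _)
  have i3 : 0 ≤ ∫ x in S, (f k x - f' x) ^ 2 := integral_nonneg fun _ => sq_nonneg _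
  have i4 : 0 ≤ ∫ x in S, f' x ^ 2 := integral_nonneg fun _ => sq_nonneg _
  have e3 := Real.abs_le_sqrt (e2.trans (mul_le_mul i1 i2 i4 (i3.trans i1)))
  rw [e1, add_sub_cancel_right, Real.norm_eq_abs]
  refine (abs_add_le _ _).trans (add_le_add ((abs_of_nonneg i3).trans_le i1) ?_)
  rw [abs_mul, abs_two]
  exact mul_le_mul_of_nonneg_left e3 zero_le_two

theorem Good.integral_sum_mul (he : ∀ j, Good D (e j)) (s : Finset ι) (a : ι → ℝ)
    {f : Euc m → ℝ} (hf : Good D f) :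
    ∫ x, (∑ j ∈ s, a j * e j x) * f x = ∑ j ∈ s, a j * ∫ x, f x * e j x := by
  simp_rw [Finset.sum_mul, mul_assoc, mul_comm (e _ _)]
  rw [integral_finsetSum _ fun j _ => (hf.int_mul (he j)).const_mul _]
  simp_rw [integral_const_mul]

theorem Good.integral_sum_sq (he : ∀ j, Good D (e j))
    (ho : ∀ i j, i ≠ j → ∫ x, e i x * e j x = 0) (hn : ∀ j, ∫ x, e j x ^ 2 = 1) (s : Finset ι)
    (a : ι → ℝ) : ∫ x, (∑ j ∈ s, a j * e j x) ^ 2 = ∑ j ∈ s, a j ^ 2 := by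
  have hs : Good D fun x => ∑ j ∈ s, a j * e j x := Good.sum s fun j _ => (he j).const_smul (a j)
  simp_rw [sq (∑ j ∈ s, _)]
  rw [Good.integral_sum_mul he s a hs]
  refine Finset.sum_congr rfl fun i hi => ?_
  rw [Good.integral_sum_mul he s a (he i), Finset.sum_eq_single i
    (fun j _ hj => by rw [ho i j hj.symm, mul_zero]) fun h => absurd hi h]
  simp_rw [← sq, hn]; ring

theorem Good.integral_sub_sum_sq (he : ∀ j, Good D (e j))
    (ho : ∀ i j, i ≠ j → ∫ x, e i x * e j x = 0) (hn : ∀ j, ∫ x, e j x ^ 2 = 1) (s : Finset ι)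
    {f : Euc m → ℝ} (hf : Good D f) {a : ι → ℝ} (ha : ∀ j, ∫ x, f x * e j x = a j) :
    ∫ x, ((∑ j ∈ s, a j * e j x) - f x) ^ 2 = (∫ x, f x ^ 2) - ∑ j ∈ s, a j ^ 2 := by
  have hs : Good D fun x => ∑ j ∈ s, a j * e j x := Good.sum s fun j _ => (he j).const_smul (a j)
  have h1 := Good.integral_sum_mul he s a hf
  simp_rw [ha, ← sq] at h1
  have h2 := Good.integral_sum_sq he ho hn s a
  have h3 : ∫ x, ((∑ j ∈ s, a j * e j x) - f x) ^ 2 = ((∫ x, (∑ j ∈ s, a j * e j x) ^ 2)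
      + ∫ x, f x ^ 2) - 2 * ∫ x, (∑ j ∈ s, a j * e j x) * f x := by
    rw [← integral_const_mul, ← integral_add hs.int_sq hf.int_sq,
      ← integral_sub (hs.int_sq.fun_add hf.int_sq) ((hs.int_mul hf).const_mul 2)]
    congr 1 with x; ring
  rw [h3, h1, h2]; ring

/-- An observability inequality passes from heat flows to functions whose coefficients in the
eigenbasis decay like those of a heat flow. -/
theorem observability_of_coeff (hD : Bornology.IsBounded D) {c : ℝ} [Countable ι]
    {g : ι → Euc m → Euc m} {l : ι → ℝ} (hl : ∀ j, 0 ≤ l j)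
    (hw : ∀ j, IsWeak D c (e j) (g j) fun x => l j * e j x)
    (ho : ∀ i j, i ≠ j → ∫ x, e i x * e j x = 0) (hn : ∀ j, ∫ x, e j x ^ 2 = 1)
    (hp : ∀ f, Good D f → HasSum (fun j => (∫ x, f x * e j x) ^ 2) (∫ x, f x ^ 2))
    {ω : Set (Euc m)} {K T : ℝ} (hT : 0 ≤ T)
    (hK : ∀ {v g h gh}, HeatFlow D c v g h gh →
      ∫ x, v T x ^ 2 ≤ K * ∫ t in (0 : ℝ)..T, ∫ x in ω, v t x ^ 2)
    {v : ℝ → Euc m → ℝ} (hv : ∀ t ∈ Icc 0 T, Good D (v t))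
    (hc : ∀ j, ∀ t ∈ Icc 0 T, ∫ x, v t x * e j x = Real.exp (-(l j) * t) * ∫ x, v 0 x * e j x) :
    ∫ x, v T x ^ 2 ≤ K * ∫ t in (0 : ℝ)..T, ∫ x in ω, v t x ^ 2 := by
  have he : ∀ j, Good D (e j) := fun j => (hw j).h10.good
  set a : ι → ℝ := fun j => ∫ x, v 0 x * e j x with ha
  set w : Finset ι → ℝ → Euc m → ℝ := fun J t x =>
    ∑ j ∈ J, (a j * Real.exp (-(l j) * t)) * e j x with hwJ
  have hF := fun J : Finset ι => flow_comb hD (fun j : J => hw j) fun j => a j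
  have hFw : ∀ J : Finset ι, comb (fun j : J => a j) (fun j => l j) (fun j => e j) = w J :=
    fun J => funext fun t => funext fun x =>
      Finset.sum_coe_sort J fun j => (a j * Real.exp (-(l j) * t)) * e j x
  simp only [hFw] at hF
  have h0 : (0 : ℝ) ∈ Icc 0 T := ⟨le_rfl, hT⟩
  have hlim : ∀ t ∈ Icc 0 T, ∀ S : Set (Euc m),
      Tendsto (fun J => ∫ x in S, w J t x ^ 2) atTop (nhds (∫ x in S, v t x ^ 2)) := by
    intro t ht S
    refine Good.tendsto_setIntegral_sq (fun J => ((hF J).weak t).h10.good) (hv t ht) ?_ S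
    have hca : ∀ j, ∫ x, v t x * e j x = a j * Real.exp (-(l j) * t) := fun j => by
      rw [hc j t ht, mul_comm]
    simp only [hwJ, fun J => Good.integral_sub_sum_sq he ho hn J (hv t ht) hca]
    have := hp _ (hv t ht)
    simp only [hca] at this
    rw [← sub_self (∫ x, v t x ^ 2)]
    exact tendsto_const_nhds.sub this
  have hbd : ∀ J, ∀ t ∈ Icc 0 T, ‖∫ x in ω, w J t x ^ 2‖ ≤ ∫ x, v 0 x ^ 2 := by
    intro J t ht
    rw [Real.norm_of_nonneg (integral_nonneg fun _ => sq_nonneg _)]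
    refine (setIntegral_le_integral ((hF J).weak t).h10.good.int_sq
      (ae_of_all _ fun _ => sq_nonneg _)).trans ?_
    rw [Good.integral_sum_sq he ho hn]
    refine le_trans (Finset.sum_le_sum fun j _ => ?_)
      (sum_le_hasSum J (fun _ _ => sq_nonneg _) (hp _ (hv 0 h0)))
    rw [mul_pow]
    exact mul_le_of_le_one_right (sq_nonneg _) (pow_le_one₀ (Real.exp_pos _).le
      (Real.exp_le_one_iff.2 (by nlinarith [hl j, ht.1])))
  have h1 : Tendsto (fun J => ∫ x, w J T x ^ 2) atTop (nhds (∫ x, v T x ^ 2)) := by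
    simpa using hlim T ⟨hT, le_rfl⟩ univ
  have h2 : Tendsto (fun J => ∫ t in (0 : ℝ)..T, ∫ x in ω, w J t x ^ 2) atTop
      (nhds (∫ t in (0 : ℝ)..T, ∫ x in ω, v t x ^ 2)) := by
    refine intervalIntegral.tendsto_integral_filter_of_dominated_convergence
      (fun _ => ∫ x, v 0 x ^ 2) (.of_forall fun J => ((hF J).cont_loc ω).aestronglyMeasurable)
      (.of_forall fun J => ae_of_all _ fun t ht => hbd J t ?_) intervalIntegrable_const
      (ae_of_all _ fun t ht => hlim t ?_ ω) <;>
    exact Ioc_subset_Icc_self (by rwa [uIoc_of_le hT] at ht)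
  exact le_of_tendsto_of_tendsto' h1 (h2.const_mul K) fun J => hK (hF J)

end ModeApproximation

section ModeDecomposition

theorem Good.indicator_of_continuousOn {n : ℕ} {D : Set (Euc n)} (hD : Bornology.IsBounded D)
    (hDm : MeasurableSet D) {ψ : Euc n → ℝ} (hψ : ContinuousOn ψ D) {C : ℝ}
    (hC : ∀ x ∈ D, |ψ x| ≤ C) : Good D (D.indicator ψ) := by
  refine ⟨(memLp_indicator_iff_restrict hDm).2 ?_, fun x hx => indicator_of_notMem hx _⟩
  have : IsFiniteMeasure (volume.restrict D) := ⟨by simpa using hD.measure_lt_top⟩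
  exact MemLp.of_bound (hψ.aestronglyMeasurable hDm) C (ae_restrict_of_forall_mem hDm hC)

variable {d dt : ℕ} {R T : ℝ} {Ω : Set (Euc dt)} {y : ℝ → Euc d → Euc dt → ℝ}

set_option maxHeartbeats 1000000 in
theorem IsGrushinSolution.observability_of_modes (hy : IsGrushinSolution d dt R T Ω y)
    (hΩo : IsOpen Ω) (hΩb : Bornology.IsBounded Ω) (hT : 0 ≤ T) {ω : Set (Euc d)}
    (hωm : MeasurableSet ω) (hωB : ω ⊆ ball 0 R) {K : ℝ} (hK0 : 0 ≤ K)
    (hK : ∀ {c : ℝ} {v g h gh}, HeatFlow (ball (0 : Euc d) R) c v g h gh → 0 ≤ c →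
      ∫ x, v T x ^ 2 ≤ K * ∫ t in (0 : ℝ)..T, ∫ x in ω, v t x ^ 2) :
    ∫ x in ball (0 : Euc d) R, ∫ z in Ω, y T x z ^ 2
      ≤ K * ∫ t in (0 : ℝ)..T, ∫ x in ω, ∫ z in Ω, y t x z ^ 2 := by
  set B := ball (0 : Euc d) R with hB
  have hBm : MeasurableSet B := measurableSet_ball
  have hBb : Bornology.IsBounded B := isBounded_ball
  obtain ⟨M, hM⟩ : ∃ M, ∀ t ∈ Icc 0 T, ∀ p ∈ B ×ˢ Ω, |y t p.1 p.2| ≤ M := by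
    obtain ⟨M, hM⟩ := (isCompact_Icc.prod
      (hBb.prod hΩb).isCompact_closure).exists_bound_of_continuousOn hy.continuousOn
    exact ⟨M, fun t ht p hp => hM (t, p) ⟨ht, subset_closure hp⟩⟩
  obtain ⟨ι, _, φ, γ, ν, hν, hφw, hφo, hφn, hφp⟩ := exists_eigenbasis hΩb hΩo 0
  set P := Icc 0 T ×ˢ B with hP
  have hcy : ContinuousOn (fun q : (ℝ × Euc d) × Euc dt => y q.1.1 q.1.2 q.2) (P ×ˢ Ω) :=
    hy.continuousOn.comp (f := fun q : (ℝ × Euc d) × Euc dt => (q.1.1, (q.1.2, q.2)))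
      (by fun_prop) fun q hq => ⟨hq.1.1, subset_closure ⟨hq.1.2, hq.2⟩⟩
  have hMy : ∀ s ∈ P, ∀ z ∈ Ω, |y s.1 s.2 z| ≤ M := fun s hs z hz => hM s.1 hs.1 (s.2, z) ⟨hs.2, hz⟩
  set u : ι → ℝ → Euc d → ℝ := fun n t x => ∫ z in Ω, y t x z * φ n z with hu
  set G : ℝ → Euc d → ℝ := fun t x => ∫ z in Ω, y t x z ^ 2 with hG
  set C := M ^ 2 * volume.real Ω with hC
  have hcu : ∀ n, ContinuousOn (fun s : ℝ × Euc d => u n s.1 s.2) P := fun n =>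
    continuousOn_setIntegral_mul hΩo.measurableSet hcy hMy
      ((hφw n).h10.good.integrable hΩb).integrableOn
  have hM2 : ∀ s ∈ P, ∀ z ∈ Ω, |y s.1 s.2 z ^ 2| ≤ M ^ 2 := fun s hs z hz => by
    rw [abs_pow]; exact pow_le_pow_left₀ (abs_nonneg _) (hMy s hs z hz) 2
  have hcG : ContinuousOn (fun s : ℝ × Euc d => G s.1 s.2) P := by
    have := continuousOn_setIntegral_mul (μ := volume) (ψ := fun _ => 1) hΩo.measurableSet (hcy.pow 2) hM2
      (integrableOn_const hΩb.measure_lt_top.ne)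
    simpa only [mul_one] using this
  have hGC : ∀ s ∈ P, |G s.1 s.2| ≤ C := fun s hs =>
    (Real.norm_eq_abs _).symm.trans_le <|
      norm_setIntegral_le_of_norm_le_const hΩb.measure_lt_top (hM2 s hs)
  have hsum : ∀ s ∈ P, HasSum (fun n => u n s.1 s.2 ^ 2) (G s.1 s.2) := fun s hs => by
    have := hφp _ (Good.indicator_of_continuousOn hΩb hΩo.measurableSet
      (ψ := y s.1 s.2) (hcy.comp (f := fun z => (s, z)) (by fun_prop) fun z hz => ⟨hs, hz⟩)
      (hMy s hs))
    have e1 : ∀ z, Ω.indicator (y s.1 s.2) z ^ 2 = Ω.indicator (fun z => y s.1 s.2 z ^ 2) z :=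
      fun z => by by_cases hz : z ∈ Ω <;> simp [hz]
    simpa only [← indicator_mul_left, e1, integral_indicator hΩo.measurableSet] using this
  have huC : ∀ n, ∀ s ∈ P, |u n s.1 s.2 ^ 2| ≤ C := fun n s hs => by
    rw [abs_of_nonneg (sq_nonneg _)]
    exact (le_hasSum (hsum s hs) n fun _ _ => sq_nonneg _).trans ((le_abs_self _).trans (hGC s hs))
  have hI : ∀ {f : ℝ → Euc d → ℝ}, ContinuousOn (fun s : ℝ × Euc d => f s.1 s.2) P →
      (∀ s ∈ P, |f s.1 s.2| ≤ C) → (∀ t ∈ Icc 0 T, IntegrableOn (f t) B) ∧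
      IntervalIntegrable (fun t => ∫ x in ω, f t x) volume 0 T := fun {f} h1 h2 => by
    refine ⟨fun t ht => ?_, ContinuousOn.intervalIntegrable_of_Icc hT ?_⟩
    · have : IsFiniteMeasure (volume.restrict B) := ⟨by simpa using hBb.measure_lt_top⟩
      exact Integrable.of_bound ((h1.comp (f := fun x => (t, x)) (by fun_prop)
        fun x hx => ⟨ht, hx⟩).aestronglyMeasurable hBm) C
        (ae_restrict_of_forall_mem hBm fun x hx => h2 (t, x) ⟨ht, hx⟩)
    · have := continuousOn_setIntegral_mul (μ := volume) (ψ := fun _ => 1) hωm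
        (h1.mono (prod_mono_right hωB)) (fun t ht x hx => h2 (t, x) ⟨ht, hωB hx⟩)
        (integrableOn_const (hBb.subset hωB).measure_lt_top.ne)
      simpa only [mul_one] using this
  have hIG := hI hcG hGC
  have hIu := fun n => hI (f := fun t x => u n t x ^ 2) ((hcu n).pow 2) (huC n)
  have hobs : ∀ n, ∫ x in B, u n T x ^ 2 ≤ K * ∫ t in (0 : ℝ)..T, ∫ x in ω, u n t x ^ 2 := by
    intro n
    obtain ⟨κ, _, e, g, l, hl, hew, heo, hen, hep⟩ :=
      exists_eigenbasis hBb isOpen_ball (√(ν n))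
    have hφ' : IsWeak Ω 0 (φ n) (γ n) fun z => √(ν n) ^ 2 * φ n z := by
      simpa only [Real.sq_sqrt (hν n)] using hφw n
    have key := observability_of_coeff hBb hl hew heo hen hep (ω := ω) (K := K) hT
      (fun H => hK H (Real.sqrt_nonneg _)) (v := fun t => B.indicator (u n t))
      (fun t ht => Good.indicator_of_continuousOn hBb hBm
        ((hcu n).comp (f := fun x => (t, x)) (by fun_prop) fun x hx => ⟨ht, hx⟩) fun x hx =>
        Real.abs_le_sqrt ((le_abs_self _).trans (huC n (t, x) ⟨ht, hx⟩))) fun j t ht => by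
      have e2 : ∀ t ∈ Icc 0 T, ∫ x, B.indicator (u n t) x * e j x
          = ∫ p in B ×ˢ Ω, y t p.1 p.2 * (e j p.1 * φ n p.2) := fun t ht => by
        simp only [← indicator_mul_left, integral_indicator hBm]
        have hi := hy.integrableOn_mul hΩo hM (((hew j).h10.good.integrable hBb).mul_prod
          ((hφw n).h10.good.integrable hΩb)) ht
        refine Eq.trans ?_ (setIntegral_prod _ hi).symm
        simp only [hu, ← integral_mul_const]
        congr! 4; ring
      rw [e2 t ht, e2 0 ⟨le_rfl, hT⟩]
      exact hy.coeff_eq hΩo hΩb hM (hew j) hφ' ht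
    have e3 : ∀ t x, B.indicator (u n t) x ^ 2 = B.indicator (fun x => u n t x ^ 2) x :=
      fun t x => by by_cases hx : x ∈ B <;> simp [hx]
    simp only [e3, integral_indicator hBm, Measure.restrict_restrict hBm,
      inter_eq_self_of_subset_right hωB] at key
    exact key
  have hlim : Tendsto (fun J : Finset ι => ∑ n ∈ J, ∫ x in B, u n T x ^ 2) atTop
      (nhds (∫ x in B, G T x)) := by
    have hTT : T ∈ Icc 0 T := ⟨hT, le_rfl⟩
    simp only [fun J : Finset ι =>
      (integral_finsetSum J fun n _ => (hIu n).1 T hTT).symm]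
    refine tendsto_integral_filter_of_dominated_convergence (fun _ => C)
      (.of_forall fun J => (integrable_finsetSum J fun n _ => (hIu n).1 T hTT).1)
      (.of_forall fun J => ae_restrict_of_forall_mem hBm fun x hx => ?_)
      (integrableOn_const hBb.measure_lt_top.ne)
      (ae_restrict_of_forall_mem hBm fun x hx => hsum (T, x) ⟨hTT, hx⟩)
    rw [Real.norm_of_nonneg (Finset.sum_nonneg fun _ _ => sq_nonneg _)]
    exact (sum_le_hasSum J (fun _ _ => sq_nonneg _) (hsum (T, x) ⟨hTT, hx⟩)).trans
      ((le_abs_self _).trans (hGC (T, x) ⟨hTT, hx⟩))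
  refine le_of_tendsto' hlim fun J => (Finset.sum_le_sum fun n _ => hobs n).trans ?_
  rw [← Finset.mul_sum, ← intervalIntegral.integral_finsetSum fun n _ => (hIu n).2]
  refine mul_le_mul_of_nonneg_left (intervalIntegral.integral_mono_on hT
    (by simpa only [Finset.sum_fn] using IntervalIntegrable.sum J fun n _ => (hIu n).2) hIG.2 fun t ht => ?_) hK0
  rw [← integral_finsetSum J fun n _ => ((hIu n).1 t ht).mono_set hωB]
  exact setIntegral_mono_on (integrable_finsetSum J fun n _ => ((hIu n).1 t ht).mono_set hωB)
    ((hIG.1 t ht).mono_set hωB) hωm fun x hx =>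
    sum_le_hasSum J (fun _ _ => sq_nonneg _) (hsum (t, x) ⟨ht, hωB hx⟩)

end ModeDecomposition

/-- Observability of the Baouendi–Grushin equation from a section of annulus
`ω = {rθ : R₁ < r < R₂, θ ∈ Γ}`, with minimal time `T* = R₁²/(2d)` and cost estimate
`K_T ≤ exp(c_β/(T−T*)^{2β})`. -/
theorem statement1
    (d dt : ℕ) (hd : 2 ≤ d) (hdt : 1 ≤ dt) (R R₁ R₂ : ℝ)
    (hR₁ : 0 < R₁) (hR₁₂ : R₁ < R₂) (hR₂ : R₂ < R)
    (Ωt : Set (EuclideanSpace ℝ (Fin dt))) (hΩo : IsOpen Ωt)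
    (hΩb : Bornology.IsBounded Ωt) (hΩne : Ωt.Nonempty)
    (Γ : Set (EuclideanSpace ℝ (Fin d)))
    (hΓsub : Γ ⊆ sphere (0 : EuclideanSpace ℝ (Fin d)) 1)
    (hΓopen : ∃ U : Set (EuclideanSpace ℝ (Fin d)), IsOpen U ∧
      Γ = U ∩ sphere (0 : EuclideanSpace ℝ (Fin d)) 1)
    (hΓne : Γ.Nonempty)
    (ω : Set (EuclideanSpace ℝ (Fin d)))
    (hω : ω = {x | ∃ r : ℝ, ∃ θ ∈ Γ, R₁ < r ∧ r < R₂ ∧ x = r • θ})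
    (β : ℝ) (hβ : 1 < β) :
    ∃ cβ : ℝ, 0 < cβ ∧
      ∀ T : ℝ, R₁ ^ 2 / (2 * d) < T →
      ∀ y : ℝ → EuclideanSpace ℝ (Fin d) → EuclideanSpace ℝ (Fin dt) → ℝ,
        IsGrushinSolution d dt R T Ωt y →
        (∫ x in ball (0 : EuclideanSpace ℝ (Fin d)) R, ∫ z in Ωt, (y T x z) ^ 2) ≤
          Real.exp (2 * cβ / (T - R₁ ^ 2 / (2 * d)) ^ (2 * β)) *
            ∫ t in Ioc (0:ℝ) T, ∫ x in ω, ∫ z in Ωt, (y t x z) ^ 2 := by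
  obtain ⟨θ, hθ⟩ := hΓne
  obtain ⟨κ₀, η₀, hκ₀, hκ₀1, hη₀, hη₀R, hball⟩ := exists_ball_subset_section hR₁ hR₁₂ hΓopen hθ
  rw [← hω] at hball
  obtain ⟨A, hA, H⟩ := HeatFlow.mode_observability (by omega : 1 ≤ d) hR₁ hR₁₂ hR₂
    (mem_sphere_zero_iff_norm.1 (hΓsub hθ)) hκ₀ hκ₀1 hη₀ hη₀R hball hβ
  refine ⟨A, hA, fun T hT y hy => ?_⟩
  have hT0 : 0 ≤ T := le_trans (by positivity) hT.le
  rw [← intervalIntegral.integral_of_le hT0]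
  refine hy.observability_of_modes hΩo hΩb hT0 (hω ▸ (isOpen_section hR₁ hΓopen).measurableSet) ?_
    (Real.exp_pos _).le fun F hc => H F hc hT
  rw [hω]
  rintro _ ⟨r, θ, hθ, h1, h2, rfl⟩
  rw [mem_ball_zero_iff, norm_smul, mem_sphere_zero_iff_norm.1 (hΓsub hθ), mul_one,
    Real.norm_of_nonneg (by linarith)]
  linarith
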